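/- If â ∈ ℝⁿ is a blow-up point of u, then there exists a sign ε ∈ {1, -1} such that w_{â,T}(·,s) → ε κ as s → ∞, both in the weighted space L²_ρ and uniformly on every compact subset of ℝⁿ; that is, ∫_{ℝⁿ} (w_{â,T}(y,s) - εκ)² ρ(y) dy → 0 and, for every compact K ⊆ ℝⁿ, sup_{y ∈ K} |(T-t)^{1/(p-1)} u(â + y√(T-t), t) - εκ| → 0 as t → T⁻. -/

import Mathlib

open MeasureTheory Real Filter Topology

noncomputable def hfun (p a μ : ℝ) (z : ℝ) : ℝ :=
  μ * |z| ^ (p - 1) * z / (Real.log (2 + z ^ 2)) ^ a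

noncomputable def rho (n : ℕ) (y : EuclideanSpace ℝ (Fin n)) : ℝ :=
  (4 * Real.pi) ^ (-(n : ℝ) / 2) * Real.exp (-‖y‖ ^ 2 / 4)

noncomputable def lap (n : ℕ) (f : EuclideanSpace ℝ (Fin n) → ℝ)
    (y : EuclideanSpace ℝ (Fin n)) : ℝ :=
  ∑ i : Fin n, fderiv ℝ (fun z => fderiv ℝ f z (EuclideanSpace.single i 1)) y
      (EuclideanSpace.single i 1)

/-- `u` is a classical solution of `u_t = Δu + |u|^{p-1}u + h(u)` on `ℝⁿ × [0,T)`,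
bounded on `ℝⁿ × [0,t]` for every `t < T`, blowing up at time `T`. -/
def SolvesU (n : ℕ) (p a μ T : ℝ) (u : EuclideanSpace ℝ (Fin n) → ℝ → ℝ) : Prop :=
  (∀ t ∈ Set.Ico (0:ℝ) T, ContDiff ℝ 2 (fun x => u x t)) ∧
  (∀ x, ∀ t ∈ Set.Ico (0:ℝ) T, DifferentiableAt ℝ (fun t' => u x t') t) ∧
  (∀ x, ∀ t ∈ Set.Ico (0:ℝ) T,
    deriv (fun t' => u x t') t =
      lap n (fun z => u z t) x + |u x t| ^ (p - 1) * u x t + hfun p a μ (u x t)) ∧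
  (∀ t ∈ Set.Ico (0:ℝ) T, ∃ M : ℝ, ∀ x, ∀ t' ∈ Set.Icc (0:ℝ) t, |u x t'| ≤ M) ∧
  (∀ M : ℝ, ∃ t₁ ∈ Set.Ico (0:ℝ) T, ∀ t ∈ Set.Ico t₁ T, ∃ x, M ≤ |u x t|)

/-- The similarity-variables rescaled solution
`w_{b,T}(y,s) = (T-t)^{1/(p-1)} u(b + y√(T-t), t)` with `t = T - e^{-s}`. -/
noncomputable def wSelf (n : ℕ) (p T : ℝ) (u : EuclideanSpace ℝ (Fin n) → ℝ → ℝ)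
    (b y : EuclideanSpace ℝ (Fin n)) (s : ℝ) : ℝ :=
  Real.exp (-s / (p - 1)) * u (b + Real.exp (-s / 2) • y) (T - Real.exp (-s))

/-- `b` is a blow-up point of `u`: there exist `(xₖ, tₖ) → (b, T)` with `|u(xₖ,tₖ)| → ∞`. -/
def BlowupPt (n : ℕ) (T : ℝ) (u : EuclideanSpace ℝ (Fin n) → ℝ → ℝ)
    (b : EuclideanSpace ℝ (Fin n)) : Prop :=
  ∃ x : ℕ → EuclideanSpace ℝ (Fin n), ∃ t : ℕ → ℝ,
    (∀ k, t k ∈ Set.Ico (0:ℝ) T) ∧ Tendsto x atTop (nhds b) ∧ Tendsto t atTop (nhds T) ∧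
    Tendsto (fun k => |u (x k) (t k)|) atTop atTop

namespace GK
open scoped ContDiff

section

abbrev E (n : ℕ) := EuclideanSpace ℝ (Fin n)

noncomputable abbrev bv {n : ℕ} (i : Fin n) : E n := EuclideanSpace.single i (1 : ℝ)

noncomputable def pd {n : ℕ} (i : Fin n) (φ : E n → ℝ) : E n → ℝ :=
  fun x => fderiv ℝ φ x (bv i)

lemma lap_eq_sum_pd {n : ℕ} (φ : E n → ℝ) (x : E n) : lap n φ x = ∑ i, pd i (pd i φ) x := rfl

/-- Smooth compactly supported functions. -/
def Tst {n : ℕ} (φ : E n → ℝ) : Prop := ContDiff ℝ ∞ φ ∧ HasCompactSupport φ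

namespace Tst
variable {n : ℕ} {φ ψ : E n → ℝ}

lemma continuous (h : Tst φ) : Continuous φ := h.1.continuous

lemma integrable (h : Tst φ) : Integrable φ volume :=
  h.continuous.integrable_of_hasCompactSupport h.2

lemma pd (h : Tst φ) (i : Fin n) : Tst (GK.pd i φ) := by
  refine ⟨?_, ?_⟩
  · exact (h.1.fderiv_right (m := ∞) (by simp)).clm_apply contDiff_const
  · exact (h.2.fderiv ℝ).comp_left (g := fun L : E n →L[ℝ] ℝ => L (bv i)) (by simp)

lemma zero : Tst (fun _ : E n => (0 : ℝ)) := ⟨contDiff_const, HasCompactSupport.zero⟩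

lemma add (h : Tst φ) (h' : Tst ψ) : Tst (fun x => φ x + ψ x) := ⟨h.1.add h'.1, h.2.add h'.2⟩

lemma sum {ι : Type*} (s : Finset ι) {f : ι → E n → ℝ} (h : ∀ i ∈ s, Tst (f i)) :
    Tst (fun x => ∑ i ∈ s, f i x) := by
  classical
  induction s using Finset.induction_on with
  | empty => simpa using zero
  | insert a s ha ih =>
    simp only [Finset.sum_insert ha]
    exact (h a (by simp)).add (ih fun i hi => h i (by simp [hi]))

lemma lap (h : Tst φ) : Tst (lap n φ) := by
  have : Tst (fun x => ∑ i, GK.pd i (GK.pd i φ) x) := sum _ fun i _ => (h.pd i).pd i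
  exact this

lemma differentiable (h : Tst φ) : Differentiable ℝ φ := h.1.differentiable (by simp)

lemma c2 (h : Tst φ) : ContDiff ℝ 2 φ := contDiff_infty.1 h.1 2

lemma comp_sub (h : Tst φ) (x : E n) : Tst (fun y => φ (x - y)) := by
  refine ⟨h.1.comp (contDiff_const.sub contDiff_id), ?_⟩
  exact h.2.comp_homeomorph (Homeomorph.subLeft x)

end Tst

lemma pd_comp_sub {n : ℕ} {φ : E n → ℝ} (h : Differentiable ℝ φ) (i : Fin n) (x y : E n) :
    pd i (fun y => φ (x - y)) y = - pd i φ (x - y) := by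
  have h1 : HasFDerivAt (fun y : E n => x - y) (-(ContinuousLinearMap.id ℝ (E n))) y := by
    simpa using (hasFDerivAt_id (𝕜 := ℝ) y).const_sub x
  have h2 := ((h (x - y)).hasFDerivAt.comp y h1).fderiv
  simp only [pd]
  change fderiv ℝ (φ ∘ fun y => x - y) y (bv i) = _
  rw [h2]; simp

lemma pd_comp_add {n : ℕ} (φ : E n → ℝ) (i : Fin n) (x y : E n) :
    pd i (fun y => φ (x + y)) y = pd i φ (x + y) := by
  simp only [pd]
  rw [fderiv_comp_add_left]

lemma pd_neg {n : ℕ} (φ : E n → ℝ) (i : Fin n) (y : E n) :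
    pd i (fun y => - φ y) y = - pd i φ y := by
  simp only [pd]
  rw [fderiv_fun_neg]; simp

lemma differentiable_pd {n : ℕ} {φ : E n → ℝ} (hφ : ContDiff ℝ 2 φ) (i : Fin n) :
    Differentiable ℝ (pd i φ) := by
  have : ContDiff ℝ 1 (pd i φ) :=
    (hφ.fderiv_right (m := 1) (by norm_num)).clm_apply contDiff_const
  exact this.differentiable (by norm_num)

lemma pd_add {n : ℕ} {f g : E n → ℝ} (hf : Differentiable ℝ f) (hg : Differentiable ℝ g)
    (i : Fin n) (y : E n) : pd i (fun y => f y + g y) y = pd i f y + pd i g y := by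
  simp only [pd]
  rw [fderiv_fun_add (hf y) (hg y)]; simp

lemma pd_const_mul {n : ℕ} {f : E n → ℝ} (hf : Differentiable ℝ f) (c : ℝ)
    (i : Fin n) (y : E n) : pd i (fun y => c * f y) y = c * pd i f y := by
  simp only [pd]
  rw [fderiv_const_mul (hf y)]; simp

lemma lap_add {n : ℕ} {f g : E n → ℝ} (hf : ContDiff ℝ 2 f) (hg : ContDiff ℝ 2 g) (y : E n) :
    lap n (fun y => f y + g y) y = lap n f y + lap n g y := by
  simp only [lap_eq_sum_pd, ← Finset.sum_add_distrib]
  refine Finset.sum_congr rfl fun i _ => ?_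
  rw [show pd i (fun y => f y + g y) = fun y => pd i f y + pd i g y from funext fun y =>
    pd_add (hf.differentiable (by norm_num)) (hg.differentiable (by norm_num)) i y]
  exact pd_add (differentiable_pd hf i) (differentiable_pd hg i) i y

lemma lap_const_mul {n : ℕ} {f : E n → ℝ} (hf : ContDiff ℝ 2 f) (c : ℝ) (y : E n) :
    lap n (fun y => c * f y) y = c * lap n f y := by
  simp only [lap_eq_sum_pd, Finset.mul_sum]
  refine Finset.sum_congr rfl fun i _ => ?_
  rw [show pd i (fun y => c * f y) = fun y => c * pd i f y from funext fun y =>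
    pd_const_mul (hf.differentiable (by norm_num)) c i y]
  exact pd_const_mul (differentiable_pd hf i) c i y

lemma lap_comp_sub {n : ℕ} {φ : E n → ℝ} (h : ContDiff ℝ 2 φ) (x y : E n) :
    lap n (fun y => φ (x - y)) y = lap n φ (x - y) := by
  simp only [lap_eq_sum_pd]
  refine Finset.sum_congr rfl fun i _ => ?_
  have : pd i (fun y => φ (x - y)) = fun y => - pd i φ (x - y) := by
    ext y; exact pd_comp_sub (h.differentiable (by norm_num)) i x y
  rw [this, pd_neg (fun y => pd i φ (x - y)), pd_comp_sub (differentiable_pd h i), neg_neg]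

lemma lap_comp_add {n : ℕ} (φ : E n → ℝ) (x y : E n) :
    lap n (fun y => φ (x + y)) y = lap n φ (x + y) := by
  simp only [lap_eq_sum_pd]
  refine Finset.sum_congr rfl fun i _ => ?_
  have : pd i (fun y => φ (x + y)) = fun y => pd i φ (x + y) := by
    ext y; exact pd_comp_add φ i x y
  rw [this, pd_comp_add]

end

section

lemma deriv_deriv_nonpos_of_isLocalMax {f : ℝ → ℝ} {x : ℝ} (hc : ContinuousAt f x)
    (h : IsLocalMax f x) : deriv (deriv f) x ≤ 0 := by
  by_contra! hpos
  have hmin := isLocalMin_of_deriv_deriv_pos hpos h.deriv_eq_zero hc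
  have hev : f =ᶠ[𝓝 x] fun _ => f x := by
    filter_upwards [h, hmin] with y h1 h2 using le_antisymm h1 h2
  have := hev.deriv.deriv_eq
  simp at this
  linarith

lemma hasDerivAt_line {n : ℕ} {φ : E n → ℝ} (hφ : Differentiable ℝ φ) (i : Fin n) (h : E n) (τ : ℝ) :
    HasDerivAt (fun τ : ℝ => φ (h + τ • bv i)) (pd i φ (h + τ • bv i)) τ := by
  have h1 : HasDerivAt (fun τ : ℝ => h + τ • bv i) ((1 : ℝ) • bv i) τ :=
    ((hasDerivAt_id τ).smul_const (bv i)).const_add h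
  have := (hφ (h + τ • bv i)).hasFDerivAt.comp_hasDerivAt τ h1
  simpa [pd, Function.comp_def] using this

lemma continuous_pd_pd {n : ℕ} {φ : E n → ℝ} (hφ : ContDiff ℝ 2 φ) (i j : Fin n) :
    Continuous (pd i (pd j φ)) := by
  have : ContDiff ℝ 1 (pd j φ) :=
    (hφ.fderiv_right (m := 1) (by norm_num)).clm_apply contDiff_const
  exact (this.continuous_fderiv (by norm_num)).clm_apply continuous_const

lemma norm_add_smul_bv_sq {n : ℕ} (h : E n) (i : Fin n) (τ : ℝ) :
    ‖h + τ • bv i‖ ^ 2 = ‖h‖ ^ 2 + 2 * τ * h i + τ ^ 2 := by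
  rw [norm_add_sq_real, inner_smul_right, norm_smul]
  simp [bv, EuclideanSpace.inner_single_right]
  ring

lemma pd_pd_le_of_isLocalMax {n : ℕ} {φ : E n → ℝ} (hφ : ContDiff ℝ 2 φ) {K : ℝ} {h : E n}
    (hm : IsLocalMax (fun x => φ x - K * ‖x‖ ^ 2) h) (i : Fin n) : pd i (pd i φ) h ≤ 2 * K := by
  have hd : Differentiable ℝ φ := hφ.differentiable (by norm_num)
  let f : ℝ → ℝ := fun τ => φ (h + τ • bv i) - K * ‖h + τ • bv i‖ ^ 2
  have hf : f = fun τ => φ (h + τ • bv i) - K * (‖h‖ ^ 2 + 2 * τ * h i + τ ^ 2) := by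
    ext τ; simp only [f]; rw [norm_add_smul_bv_sq]
  have hd1 : ∀ τ, HasDerivAt f (pd i φ (h + τ • bv i) - K * (2 * h i + 2 * τ)) τ := by
    intro τ
    rw [hf]
    refine (hasDerivAt_line hd i h τ).sub (HasDerivAt.const_mul K ?_)
    have h1 : HasDerivAt (fun τ : ℝ => 2 * τ * h i) (2 * 1 * h i) τ :=
      ((hasDerivAt_id τ).const_mul 2).mul_const (h i)
    have := (h1.const_add (‖h‖ ^ 2)).fun_add (hasDerivAt_pow 2 τ)
    simpa using this
  have hdf : deriv f = fun τ => pd i φ (h + τ • bv i) - K * (2 * h i + 2 * τ) :=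
    funext fun τ => (hd1 τ).deriv
  have hd2 : HasDerivAt (deriv f) (pd i (pd i φ) (h + (0 : ℝ) • bv i) - K * (2 * 1)) 0 := by
    rw [hdf]
    refine (hasDerivAt_line (differentiable_pd hφ i) i h 0).sub (HasDerivAt.const_mul K ?_)
    exact (((hasDerivAt_id (0 : ℝ)).const_mul 2).const_add _)
  have hlm : IsLocalMax f 0 := by
    have hcont : ContinuousAt (fun τ : ℝ => h + τ • bv i) 0 := by fun_prop
    have ht : Tendsto (fun τ : ℝ => h + τ • bv i) (𝓝 0) (𝓝 h) := by
      simpa using hcont.tendsto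
    have := ht.eventually hm
    simpa [IsLocalMax, IsMaxFilter, f] using this
  have := deriv_deriv_nonpos_of_isLocalMax (hd1 0).continuousAt hlm
  rw [hd2.deriv] at this
  simp at this
  linarith

lemma deriv_nonneg_of_max_left {f : ℝ → ℝ} {f' t1 t : ℝ} (ht : t1 < t) (hf : HasDerivAt f f' t)
    (hmax : ∀ s ∈ Set.Icc t1 t, f s ≤ f t) : 0 ≤ f' := by
  by_contra! hneg
  have h1 := hf.tendsto_slope
  have h2 : ∀ᶠ s in 𝓝[<] t, slope f t s < 0 :=
    (h1.mono_left (nhdsWithin_mono _ (fun s hs => ne_of_lt hs))).eventually (gt_mem_nhds hneg)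
  have h3 : ∀ᶠ s in 𝓝[<] t, s ∈ Set.Ioo t1 t := Ioo_mem_nhdsLT ht
  obtain ⟨s, hs1, hs2⟩ := (h2.and h3).exists
  have := hmax s ⟨hs2.1.le, hs2.2.le⟩
  rw [slope_def_field] at hs1
  have h4 : 0 ≤ (f s - f t) / (s - t) := div_nonneg_of_nonpos (by linarith) (by linarith [hs2.2])
  linarith

/-- Comparison with a quadratic barrier for subsolutions of the heat equation. -/
lemma quadratic_barrier {n : ℕ} {W Wt : E n → ℝ → ℝ} {ρ A K M t1 t2 : ℝ} (hρ : 0 < ρ)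
    (ht : t1 < t2)
    (hc : ContinuousOn (Function.uncurry W) (Metric.closedBall 0 ρ ×ˢ Set.Icc t1 t2))
    (hx : ∀ t ∈ Set.Ioc t1 t2, ContDiff ℝ 2 (fun x => W x t))
    (hd : ∀ h ∈ Metric.ball (0 : E n) ρ, ∀ t ∈ Set.Ioc t1 t2, HasDerivAt (W h) (Wt h t) t)
    (hpde : ∀ h ∈ Metric.ball (0 : E n) ρ, ∀ t ∈ Set.Ioc t1 t2,
      Wt h t ≤ lap n (fun x => W x t) h + M)
    (h0 : ∀ h ∈ Metric.closedBall (0 : E n) ρ, W h t1 ≤ A + K * ‖h‖ ^ 2)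
    (hb : ∀ h : E n, ‖h‖ = ρ → ∀ t ∈ Set.Icc t1 t2, W h t ≤ A + K * ρ ^ 2)
    (hKM : 0 ≤ 2 * n * K + M) :
    W 0 t2 ≤ A + (2 * n * K + M) * (t2 - t1) := by
  refine le_of_forall_pos_le_add fun ε hε => ?_
  set c := 2 * n * K + M + ε / (t2 - t1) with hcdef
  have hε' : 0 < ε / (t2 - t1) := div_pos hε (by linarith)
  have hcpos : 0 < c := by linarith
  let Z : E n × ℝ → ℝ := fun q => W q.1 q.2 - K * ‖q.1‖ ^ 2 - c * (q.2 - t1)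
  have hcomp : IsCompact (Metric.closedBall (0 : E n) ρ ×ˢ Set.Icc t1 t2) :=
    (isCompact_closedBall _ _).prod isCompact_Icc
  have hne : ((0 : E n), t2) ∈ Metric.closedBall (0 : E n) ρ ×ˢ Set.Icc t1 t2 :=
    ⟨by simp [hρ.le], by simp [ht.le]⟩
  have hZ : ContinuousOn Z (Metric.closedBall (0 : E n) ρ ×ˢ Set.Icc t1 t2) := by
    refine (ContinuousOn.sub ?_ ?_).sub ?_
    · exact hc
    · fun_prop
    · fun_prop
  obtain ⟨⟨h, t⟩, ⟨hh, htt⟩, hmax⟩ := hcomp.exists_isMaxOn ⟨_, hne⟩ hZ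
  simp only at hh htt
  have key : Z (h, t) ≤ A := by
    by_contra! hA
    have htt1 : t1 < t := by
      rcases htt.1.lt_or_eq with h1 | h1
      · exact h1
      · exfalso
        have := h0 h hh
        simp only [Z, ← h1] at hA
        linarith
    have hhρ : h ∈ Metric.ball (0 : E n) ρ := by
      rw [mem_ball_zero_iff]
      rw [mem_closedBall_zero_iff] at hh
      rcases hh.lt_or_eq with h1 | h1
      · exact h1
      · exfalso
        have := hb h h1 t htt
        simp only [Z, h1] at hA
        nlinarith
    have hto : t ∈ Set.Ioc t1 t2 := ⟨htt1, htt.2⟩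
    have hder : HasDerivAt (fun s => Z (h, s)) (Wt h t - c * 1) t := by
      have e1 : HasDerivAt (fun s : ℝ => c * (s - t1)) (c * 1) t :=
        ((hasDerivAt_id t).sub_const t1).const_mul c
      exact ((hd h hhρ t hto).sub_const (K * ‖h‖ ^ 2)).fun_sub e1
    have h1 := deriv_nonneg_of_max_left htt1 hder fun s hs =>
      hmax (show (h, s) ∈ _ from ⟨hh, hs.1, hs.2.trans htt.2⟩)
    have hlm : IsLocalMax (fun x => W x t - K * ‖x‖ ^ 2) h := by
      filter_upwards [Metric.isOpen_ball.mem_nhds hhρ] with x hx'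
      have := hmax (show (x, t) ∈ _ from ⟨Metric.ball_subset_closedBall hx', htt⟩)
      simp only [Z, Set.mem_ofPred_eq] at this
      linarith
    have h2 : lap n (fun x => W x t) h ≤ ∑ _i : Fin n, 2 * K :=
      Finset.sum_le_sum fun i _ => pd_pd_le_of_isLocalMax (hx t hto) hlm i
    have h3 := hpde h hhρ t hto
    simp at h2
    linarith
  have h1 := hmax hne
  simp only [Set.mem_ofPred_eq] at h1
  have h2 := h1.trans key
  simp only [Z] at h2
  have h3 : c * (t2 - t1) = (2 * n * K + M) * (t2 - t1) + ε := by
    rw [hcdef, add_mul, div_mul_cancel₀]; linarith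
  simp at h2
  linarith

end

section

lemma abs_integral_le {α : Type*} [MeasurableSpace α] {m : Measure α} {f g : α → ℝ}
    (hg : Integrable g m) (h : ∀ x, |f x| ≤ g x) : |∫ x, f x ∂m| ≤ ∫ x, g x ∂m := by
  rw [← Real.norm_eq_abs]
  exact norm_integral_le_of_norm_le hg (ae_of_all _ h)

/-- Convolution of a test function with `v`. -/
noncomputable def V {n : ℕ} (φ v : E n → ℝ) (x : E n) : ℝ := ∫ z, φ z * v (x - z)

lemma V_eq_conv {n : ℕ} (φ v : E n → ℝ) :
    V φ v = MeasureTheory.convolution φ v (ContinuousLinearMap.mul ℝ ℝ) volume := by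
  ext x; simp [V, MeasureTheory.convolution]

lemma V_eq {n : ℕ} (φ v : E n → ℝ) (x : E n) : V φ v x = ∫ y, φ (x - y) * v y := by
  unfold V
  rw [← integral_sub_left_eq_self (fun y => φ (x - y) * v y) volume x]
  simp

lemma V_integrable {n : ℕ} {φ v : E n → ℝ} (hφ : Tst φ) (hv : Continuous v) (x : E n) :
    Integrable (fun z => φ z * v (x - z)) volume :=
  (hφ.continuous.mul (hv.comp (continuous_const.sub continuous_id))).integrable_of_hasCompactSupport
    hφ.2.mul_right

lemma V_contDiff {n : ℕ} {φ v : E n → ℝ} (hφ : Tst φ) (hv : Continuous v) : ContDiff ℝ ∞ (V φ v) := by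
  rw [V_eq_conv]
  exact hφ.2.contDiff_convolution_left _ hφ.1 hv.locallyIntegrable

lemma pd_V {n : ℕ} {φ v : E n → ℝ} (hφ : Tst φ) (hv : Continuous v) (i : Fin n) :
    pd i (V φ v) = V (pd i φ) v := by
  ext x
  have h := hφ.2.hasFDerivAt_convolution_left (ContinuousLinearMap.mul ℝ ℝ) (hφ.1.of_le (by simp))
    (μ := volume) hv.locallyIntegrable x
  unfold pd
  rw [V_eq_conv, h.fderiv]
  have h1 : ConvolutionExistsAt (fderiv ℝ φ) v x ((ContinuousLinearMap.mul ℝ ℝ).precompL (E n)) volume :=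
    (hφ.2.fderiv ℝ).convolutionExists_left _ (hφ.1.continuous_fderiv (by simp))
      hv.locallyIntegrable x
  have h2 := ContinuousLinearMap.integral_apply h1 (bv i)
  rw [MeasureTheory.convolution]
  refine h2.trans ?_
  simp [V]

lemma lap_V {n : ℕ} {φ v : E n → ℝ} (hφ : Tst φ) (hv : Continuous v) (x : E n) :
    lap n (V φ v) x = V (lap n φ) v x := by
  rw [lap_eq_sum_pd]
  simp only [pd_V hφ hv, pd_V (hφ.pd _) hv]
  unfold V
  rw [← integral_finsetSum _ fun i _ => V_integrable ((hφ.pd i).pd i) hv x]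
  congr 1; ext z
  rw [lap_eq_sum_pd, Finset.sum_mul]

lemma V_abs_le {n : ℕ} {φ v : E n → ℝ} (hφ : Tst φ) {M : ℝ}
    (hM : ∀ x, |v x| ≤ M) (x : E n) : |V φ v x| ≤ M * ∫ z, |φ z| := by
  unfold V
  rw [← integral_const_mul]
  refine abs_integral_le (hφ.integrable.abs.const_mul M) fun z => ?_
  rw [abs_mul, mul_comm]
  exact mul_le_mul_of_nonneg_right (hM _) (abs_nonneg _)

/-- Mollifier: nonnegative test function of integral one supported in a ball of radius `δ`. -/
structure Mol {n : ℕ} (δ : ℝ) (φ : E n → ℝ) : Prop where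
  tst : Tst φ
  nonneg : ∀ x, 0 ≤ φ x
  int : ∫ x, φ x = 1
  supp : ∀ x, δ ≤ ‖x‖ → φ x = 0

lemma exists_mol (n : ℕ) {δ : ℝ} (hδ : 0 < δ) : ∃ φ : E n → ℝ, Mol δ φ := by
  let f : ContDiffBump (0 : E n) := ⟨δ / 2, δ, by linarith, by linarith⟩
  refine ⟨f.normed volume, ⟨f.contDiff_normed, f.hasCompactSupport_normed⟩, f.nonneg_normed,
    f.integral_normed, fun x hx => ?_⟩
  have : x ∉ Function.support (f.normed volume) := by
    rw [f.support_normed_eq]; simpa [f] using hx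
  simpa using this

lemma Mol.tsupport_sub {n : ℕ} {δ : ℝ} {φ : E n → ℝ} (h : Mol δ φ) (x : E n) :
    tsupport (fun y => φ (x - y)) ⊆ Metric.closedBall x δ := by
  refine closure_minimal (fun y hy => ?_) Metric.isClosed_closedBall
  by_contra hc
  apply hy
  apply h.supp
  rw [Metric.mem_closedBall, dist_comm, dist_eq_norm] at hc
  linarith

lemma Mol.V_sub_le {n : ℕ} {δ : ℝ} {φ : E n → ℝ} (h : Mol δ φ) {v : E n → ℝ} (hv : Continuous v)
    {x : E n} {η c : ℝ} (hη : ∀ z : E n, ‖z‖ ≤ δ → |v (x - z) - c| ≤ η) : |V φ v x - c| ≤ η := by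
  have h1 : V φ v x - c = ∫ z, φ z * (v (x - z) - c) := by
    simp only [mul_sub]
    rw [integral_sub (V_integrable h.tst hv x) (h.tst.integrable.mul_const c), integral_mul_const,
      h.int, one_mul, V]
  rw [h1]
  calc |∫ z, φ z * (v (x - z) - c)| ≤ ∫ z, φ z * η := by
        refine abs_integral_le (h.tst.integrable.mul_const η) fun z => ?_
        rw [abs_mul, abs_of_nonneg (h.nonneg z)]
        rcases le_or_gt ‖z‖ δ with hz | hz
        · exact mul_le_mul_of_nonneg_left (hη z hz) (h.nonneg z)
        · simp [h.supp z hz.le]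
    _ = η := by rw [integral_mul_const, h.int, one_mul]

lemma Mol.abs_V_le {n : ℕ} {δ : ℝ} {φ : E n → ℝ} (h : Mol δ φ) {v : E n → ℝ}
    {M : ℝ} (hM : ∀ x, |v x| ≤ M) (x : E n) : |V φ v x| ≤ M := by
  have := V_abs_le h.tst hM x
  simpa [abs_of_nonneg (h.nonneg _), h.int] using this

end

section

/-- Separately continuous and bounded on `E n × I`. -/
structure SC {n : ℕ} (I : Set ℝ) (M : ℝ) (v : E n → ℝ → ℝ) : Prop where
  cx : ∀ t ∈ I, Continuous (fun x => v x t)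
  ct : ∀ x, ContinuousOn (v x) I
  bd : ∀ x, ∀ t ∈ I, |v x t| ≤ M

lemma SC.int_ct {n : ℕ} {I : Set ℝ} {M : ℝ} {v : E n → ℝ → ℝ} (h : SC I M v) {φ : E n → ℝ}
    (hφ : Integrable φ volume) : ContinuousOn (fun t => ∫ y, φ y * v y t) I := by
  refine continuousOn_of_dominated (bound := fun y => |φ y| * M) ?_ ?_ ?_ ?_
  · intro t ht
    exact hφ.aestronglyMeasurable.mul (h.cx t ht).aestronglyMeasurable
  · intro t ht
    refine ae_of_all _ fun y => ?_
    rw [norm_mul]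
    exact mul_le_mul_of_nonneg_left (h.bd y t ht) (abs_nonneg _)
  · exact hφ.abs.mul_const M
  · exact ae_of_all _ fun y => (h.ct y).const_smul (φ y)

lemma SC.V_ct {n : ℕ} {I : Set ℝ} {M : ℝ} {v : E n → ℝ → ℝ} (h : SC I M v) {φ : E n → ℝ}
    (hφ : Tst φ) (x : E n) : ContinuousOn (fun t => V φ (fun y => v y t) x) I := by
  simp only [V_eq]
  exact h.int_ct (hφ.comp_sub x).integrable

lemma norm_le_sum_apply {n : ℕ} (L : E n →L[ℝ] ℝ) : ‖L‖ ≤ ∑ i, |L (bv i)| := by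
  refine L.opNorm_le_bound (Finset.sum_nonneg fun _ _ => abs_nonneg _) fun x => ?_
  have hx : x = ∑ i, x i • bv i := by
    conv_lhs => rw [← (EuclideanSpace.basisFun (Fin n) ℝ).sum_repr x]
    simp
  have h1 : L x = ∑ i, x i * L (bv i) := by
    conv_lhs => rw [hx]
    simp [map_sum]
  rw [h1, Finset.sum_mul]
  refine (norm_sum_le _ _).trans (Finset.sum_le_sum fun i _ => ?_)
  rw [norm_mul, mul_comm]
  exact mul_le_mul_of_nonneg_left (PiLp.norm_apply_le x i) (abs_nonneg _)

lemma lipschitz_of_pd_bdd {n : ℕ} {f : E n → ℝ} (hf : Differentiable ℝ f) {C : Fin n → ℝ}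
    (hC : ∀ i x, |pd i f x| ≤ C i) (x y : E n) : |f x - f y| ≤ (∑ i, C i) * ‖x - y‖ := by
  have := (convex_univ : Convex ℝ (Set.univ : Set (E n))).norm_image_sub_le_of_norm_fderiv_le
    (f := f) (C := ∑ i, C i) (𝕜 := ℝ) (x := y) (y := x) (fun z _ => hf z)
    (fun z _ => (norm_le_sum_apply _).trans (Finset.sum_le_sum fun i _ => hC i z))
    trivial trivial
  simpa using this

lemma continuousOn_uncurry_of_lipschitz {n : ℕ} {f : E n → ℝ → ℝ} {I : Set ℝ} {L : ℝ}
    (hL : ∀ t ∈ I, ∀ x y, |f x t - f y t| ≤ L * ‖x - y‖) (hc : ∀ x, ContinuousOn (f x) I) :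
    ContinuousOn (Function.uncurry f) (Set.univ ×ˢ I) := by
  rintro ⟨x0, t0⟩ ⟨-, ht0⟩
  have h1 : Tendsto (fun q : E n × ℝ => f x0 q.2) (𝓝[Set.univ ×ˢ I] (x0, t0)) (𝓝 (f x0 t0)) := by
    refine (hc x0 t0 ht0).tendsto.comp ?_
    refine tendsto_nhdsWithin_of_tendsto_nhds_of_eventually_within _ ?_ ?_
    · exact (continuous_snd.tendsto (x0, t0)).mono_left nhdsWithin_le_nhds
    · filter_upwards [self_mem_nhdsWithin] with q hq using hq.2
  have h2 : Tendsto (fun q : E n × ℝ => L * ‖q.1 - x0‖) (𝓝[Set.univ ×ˢ I] (x0, t0)) (𝓝 0) := by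
    have : Continuous fun q : E n × ℝ => L * ‖q.1 - x0‖ := by fun_prop
    simpa using (this.tendsto (x0, t0)).mono_left nhdsWithin_le_nhds
  have h3 : Tendsto (fun q : E n × ℝ => f q.1 q.2 - f x0 q.2) (𝓝[Set.univ ×ˢ I] (x0, t0)) (𝓝 0) := by
    refine squeeze_zero_norm' ?_ h2
    filter_upwards [self_mem_nhdsWithin] with q hq using hL q.2 hq.2 _ _
  simpa [ContinuousWithinAt, Function.uncurry_def] using h3.add h1

lemma SC.V_lip {n : ℕ} {I : Set ℝ} {M : ℝ} {v : E n → ℝ → ℝ} (h : SC I M v) {φ : E n → ℝ}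
    (hφ : Tst φ) : ∀ t ∈ I, ∀ x y, |V φ (fun z => v z t) x - V φ (fun z => v z t) y| ≤
      (∑ i, M * ∫ z, |pd i φ z|) * ‖x - y‖ := by
  intro t ht
  refine lipschitz_of_pd_bdd ((V_contDiff hφ (h.cx t ht)).differentiable (by simp)) fun i x => ?_
  rw [pd_V hφ (h.cx t ht)]
  exact V_abs_le (hφ.pd i) (fun y => h.bd y t ht) x

lemma SC.V_cont {n : ℕ} {I : Set ℝ} {M : ℝ} {v : E n → ℝ → ℝ} (h : SC I M v) {φ : E n → ℝ}
    (hφ : Tst φ) : ContinuousOn (fun q : E n × ℝ => V φ (fun z => v z q.2) q.1) (Set.univ ×ˢ I) :=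
  continuousOn_uncurry_of_lipschitz (f := fun x t => V φ (fun z => v z t) x)
    (h.V_lip hφ) fun x => h.V_ct hφ x

/-- Classical bounded solution of `u_t = Δu + g` with separately continuous right-hand side. -/
structure Cl {n : ℕ} (I : Set ℝ) (M : ℝ) (u g : E n → ℝ → ℝ) : Prop where
  c2 : ∀ t ∈ I, ContDiff ℝ 2 (fun x => u x t)
  dt : ∀ x, ∀ t ∈ I, HasDerivAt (u x) (lap n (fun z => u z t) x + g x t) t
  ub : ∀ x, ∀ t ∈ I, |u x t| ≤ M
  gsc : SC I M g

lemma Cl.usc {n : ℕ} {I : Set ℝ} {M : ℝ} {u g : E n → ℝ → ℝ} (h : Cl I M u g) : SC I M u where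
  cx t ht := (h.c2 t ht).continuous
  ct x t ht := (h.dt x t ht).continuousAt.continuousWithinAt
  bd := h.ub

lemma Cl.neg {n : ℕ} {I : Set ℝ} {M : ℝ} {u g : E n → ℝ → ℝ} (h : Cl I M u g) :
    Cl I M (fun x t => - u x t) (fun x t => - g x t) where
  c2 t ht := (h.c2 t ht).neg
  dt x t ht := by
    have h1 := (h.dt x t ht).fun_neg
    have h2 := lap_const_mul (h.c2 t ht) (-1) x
    simp only [neg_mul, one_mul] at h2
    rw [h2]
    exact h1.congr_deriv (by ring)
  ub x t ht := by simpa using h.ub x t ht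
  gsc := ⟨fun t ht => (h.gsc.cx t ht).neg, fun x => (h.gsc.ct x).neg,
    fun x t ht => by simpa using h.gsc.bd x t ht⟩

/-- Weak form of `u_t = Δu + g` at time `t` for test functions supported in `ball 0 R`. -/
def Wk {n : ℕ} (u g : E n → ℝ → ℝ) (R t : ℝ) : Prop :=
  ∀ φ : E n → ℝ, Tst φ → tsupport φ ⊆ Metric.ball 0 R →
    HasDerivAt (fun s => ∫ y, φ y * u y s) (∫ y, (lap n φ y * u y t + φ y * g y t)) t

lemma Wk.neg {n : ℕ} {u g : E n → ℝ → ℝ} {R t : ℝ} (h : Wk u g R t) :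
    Wk (fun x t => - u x t) (fun x t => - g x t) R t := by
  intro φ h1 h2
  have := (h φ h1 h2).fun_neg
  simp only [← integral_neg, mul_neg] at this ⊢
  refine this.congr_deriv ?_
  congr 1; ext y; ring

lemma Wk.hasDerivAt_V {n : ℕ} {I : Set ℝ} {M : ℝ} {u g : E n → ℝ → ℝ} (h : Cl I M u g) {R t : ℝ}
    (hk : Wk u g R t) (ht : t ∈ I) {φ : E n → ℝ} (hφ : Tst φ) {x : E n}
    (hs : tsupport (fun y => φ (x - y)) ⊆ Metric.ball 0 R) :
    HasDerivAt (fun s => V φ (fun z => u z s) x)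
      (lap n (V φ (fun z => u z t)) x + V φ (fun z => g z t) x) t := by
  have h1 := hk _ (hφ.comp_sub x) hs
  rw [lap_V hφ (h.usc.cx t ht)]
  simp only [V_eq]
  rw [← integral_add]
  · refine h1.congr_deriv ?_
    congr 1; ext y
    rw [lap_comp_sub hφ.c2]
  · exact ((hφ.lap.comp_sub x).continuous.mul (h.usc.cx t ht)).integrable_of_hasCompactSupport
      (hφ.lap.comp_sub x).2.mul_right
  · exact ((hφ.comp_sub x).continuous.mul (h.gsc.cx t ht)).integrable_of_hasCompactSupport
      (hφ.comp_sub x).2.mul_right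

end

section

lemma lap_symm {n : ℕ} {f : E n → ℝ} (hf : ContDiff ℝ 2 f) (x h : E n) :
    lap n (fun y => (1 / 2) * (f (x + y) + f (x - y))) h = (1 / 2) * (lap n f (x + h) + lap n f (x - h)) := by
  have h1 : ContDiff ℝ 2 (fun y => f (x + y)) := hf.comp (contDiff_const.add contDiff_id)
  have h2 : ContDiff ℝ 2 (fun y => f (x - y)) := hf.comp (contDiff_const.sub contDiff_id)
  rw [lap_const_mul (h1.add h2), lap_add h1 h2, lap_comp_add, lap_comp_sub hf]

lemma gap_upper {n : ℕ} {I : Set ℝ} {M : ℝ} {u g : E n → ℝ → ℝ} (h : Cl I M u g)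
    {R ρ N t1 t2 : ℝ} {x : E n} (ht : t1 < t2) (hI : Set.Icc t1 t2 ⊆ I) (hρ : 0 < ρ) (hρ1 : ρ ≤ 1)
    (hx : ‖x‖ + 2 * ρ < R) (hk : ∀ t ∈ Set.Ioc t1 t2, Wk u g R t) (hN0 : 0 ≤ N)
    (hN : ∀ y : E n, ‖y‖ < R → ∀ k : E n, ‖k‖ ≤ 1 →
      |u (y + k) t1 + u (y - k) t1 - 2 * u y t1| ≤ N * ‖k‖ ^ 2) :
    u x t2 - u x t1 ≤ (2 * n * (N + 2 * M / ρ ^ 2) + M) * (t2 - t1) := by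
  have ht1 : t1 ∈ I := hI ⟨le_rfl, ht.le⟩
  have ht2 : t2 ∈ I := hI ⟨ht.le, le_rfl⟩
  have hM : 0 ≤ M := (abs_nonneg _).trans (h.ub x t1 ht1)
  refine le_of_forall_pos_le_add fun η hη => ?_
  obtain ⟨δ, hδ, hδρ, hδu⟩ : ∃ δ > 0, δ < ρ ∧ ∀ z : E n, ‖z‖ ≤ δ →
      |u (x - z) t1 - u x t1| ≤ η / 2 ∧ |u (x - z) t2 - u x t2| ≤ η / 2 := by
    have key : ∀ t ∈ I, ∀ᶠ z in 𝓝 (0 : E n), |u (x - z) t - u x t| < η / 2 := by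
      intro t ht
      have : Continuous fun z => |u (x - z) t - u x t| :=
        (((h.usc.cx t ht).comp (continuous_const.sub continuous_id)).sub continuous_const).abs
      have h2 := this.tendsto 0
      simp only [sub_zero, sub_self, abs_zero] at h2
      exact h2.eventually (gt_mem_nhds (by linarith))
    obtain ⟨δ, hδ, hb⟩ := Metric.eventually_nhds_iff.1 ((key t1 ht1).and (key t2 ht2))
    refine ⟨min (δ / 2) (ρ / 2), by positivity, by
      have := min_le_right (δ / 2) (ρ / 2); linarith, fun z hz => ?_⟩
    have := hb (y := z) (by
      rw [dist_zero_right]; have := min_le_left (δ / 2) (ρ / 2); linarith)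
    exact ⟨this.1.le, this.2.le⟩
  obtain ⟨φ, hφ⟩ := exists_mol n hδ
  set Vu : E n → ℝ → ℝ := fun y t => V φ (fun z => u z t) y with hVu
  set Vg : E n → ℝ → ℝ := fun y t => V φ (fun z => g z t) y with hVg
  have hVub : ∀ y, ∀ t ∈ I, |Vu y t| ≤ M := fun y t ht => hφ.abs_V_le (fun z => h.ub z t ht) y
  have hVgb : ∀ y, ∀ t ∈ I, |Vg y t| ≤ M := fun y t ht => hφ.abs_V_le (fun z => h.gsc.bd z t ht) y
  have hC2 : ∀ t ∈ I, ContDiff ℝ 2 (fun y => Vu y t) := fun t ht =>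
    contDiff_infty.1 (V_contDiff hφ.tst (h.usc.cx t ht)) 2
  set K := N + 2 * M / ρ ^ 2 with hK
  have hK0 : 0 ≤ K := by positivity
  have hKρ : 2 * M ≤ K * ρ ^ 2 := by
    rw [hK, add_mul, div_mul_cancel₀ _ (by positivity)]
    have : 0 ≤ N * ρ ^ 2 := by positivity
    linarith
  have hsupp : ∀ y : E n, ‖y‖ ≤ ‖x‖ + ρ → tsupport (fun z => φ (y - z)) ⊆ Metric.ball 0 R := by
    intro y hy
    refine (hφ.tsupport_sub y).trans fun z hz => ?_
    rw [Metric.mem_closedBall, dist_eq_norm] at hz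
    rw [mem_ball_zero_iff]
    have : ‖z‖ ≤ ‖y‖ + ‖z - y‖ := by
      simpa using norm_add_le y (z - y)
    linarith
  have hq := quadratic_barrier (n := n)
    (W := fun k t => (1 / 2) * (Vu (x + k) t + Vu (x - k) t))
    (Wt := fun k t => (1 / 2) * ((lap n (fun y => Vu y t) (x + k) + Vg (x + k) t) +
      (lap n (fun y => Vu y t) (x - k) + Vg (x - k) t)))
    (ρ := ρ) (A := Vu x t1) (K := K) (M := M) (t1 := t1) (t2 := t2) hρ ht ?_ ?_ ?_ ?_ ?_ ?_ ?_
  · have e1 := (abs_le.1 (hφ.V_sub_le (h.usc.cx t1 ht1) (x := x) fun z hz => (hδu z hz).1)).2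
    have e2 := (abs_le.1 (hφ.V_sub_le (h.usc.cx t2 ht2) (x := x) fun z hz => (hδu z hz).2)).1
    simp only [add_zero, sub_zero] at hq
    simp only [hVu] at hq
    linarith
  · have h1 := h.usc.V_cont hφ.tst
    have h2 : ContinuousOn (fun q : E n × ℝ => Vu (x + q.1) q.2)
        (Metric.closedBall 0 ρ ×ˢ Set.Icc t1 t2) :=
      h1.comp (g := fun q : E n × ℝ => Vu q.1 q.2) (f := fun q : E n × ℝ => (x + q.1, q.2))
        (by fun_prop) fun q hq => ⟨trivial, hI hq.2⟩
    have h3 : ContinuousOn (fun q : E n × ℝ => Vu (x - q.1) q.2)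
        (Metric.closedBall 0 ρ ×ˢ Set.Icc t1 t2) :=
      h1.comp (g := fun q : E n × ℝ => Vu q.1 q.2) (f := fun q : E n × ℝ => (x - q.1, q.2))
        (by fun_prop) fun q hq => ⟨trivial, hI hq.2⟩
    exact continuousOn_const.mul (h2.add h3)
  · intro t ht
    have := hC2 t (hI ⟨ht.1.le, ht.2⟩)
    exact contDiff_const.mul ((this.comp (contDiff_const.add contDiff_id)).add
      (this.comp (contDiff_const.sub contDiff_id)))
  · intro k hk' t ht
    rw [mem_ball_zero_iff] at hk'
    have htI := hI ⟨ht.1.le, ht.2⟩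
    have h1 := (hk t ht).hasDerivAt_V h htI hφ.tst (hsupp (x + k) ((norm_add_le _ _).trans (by linarith)))
    have h2 := (hk t ht).hasDerivAt_V h htI hφ.tst (hsupp (x - k) ((norm_sub_le _ _).trans (by linarith)))
    exact (h1.fun_add h2).const_mul (1 / 2)
  · intro k hk' t ht
    have htI := hI ⟨ht.1.le, ht.2⟩
    rw [lap_symm (hC2 t htI)]
    have e1 := (abs_le.1 (hVgb (x + k) t htI)).2
    have e2 := (abs_le.1 (hVgb (x - k) t htI)).2
    linarith
  · intro k hk'
    rw [mem_closedBall_zero_iff] at hk'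
    have e : (1 / 2) * (Vu (x + k) t1 + Vu (x - k) t1) - Vu x t1 =
        ∫ z, φ z * ((1 / 2) * (u (x - z + k) t1 + u (x - z - k) t1 - 2 * u (x - z) t1)) := by
      have i1 := V_integrable hφ.tst (h.usc.cx t1 ht1) (x + k)
      have i2 := V_integrable hφ.tst (h.usc.cx t1 ht1) (x - k)
      have i3 := V_integrable hφ.tst (h.usc.cx t1 ht1) x
      simp only [hVu, V]
      rw [← integral_add i1 i2, ← integral_const_mul]
      have i12 : Integrable (fun z => (1 / 2) * (φ z * u (x + k - z) t1 + φ z * u (x - k - z) t1)) volume :=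
        (i1.add i2).const_mul _
      rw [← integral_sub i12 i3]
      congr 1; ext z
      rw [show x + k - z = x - z + k by abel, show x - k - z = x - z - k by abel]
      ring
    have e2 : |∫ z, φ z * ((1 / 2) * (u (x - z + k) t1 + u (x - z - k) t1 - 2 * u (x - z) t1))| ≤
        ∫ z, φ z * (K * ‖k‖ ^ 2) := by
      refine abs_integral_le (hφ.tst.integrable.mul_const _) fun z => ?_
      rw [abs_mul, abs_of_nonneg (hφ.nonneg z)]
      rcases le_or_gt δ ‖z‖ with hz | hz
      · simp [hφ.supp z hz]
      refine mul_le_mul_of_nonneg_left ?_ (hφ.nonneg z)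
      have e3 := hN (x - z) ((norm_sub_le _ _).trans_lt (by linarith)) k (by linarith)
      rw [abs_mul, abs_of_pos (by norm_num : (0 : ℝ) < 1 / 2)]
      have e4 : N * ‖k‖ ^ 2 ≤ K * ‖k‖ ^ 2 := by
        refine mul_le_mul_of_nonneg_right ?_ (by positivity)
        rw [hK]
        have : 0 ≤ 2 * M / ρ ^ 2 := by positivity
        linarith
      have e5 : 0 ≤ N * ‖k‖ ^ 2 := by positivity
      linarith
    rw [integral_mul_const, hφ.int, one_mul] at e2
    have := (abs_le.1 e2).2
    linarith
  · intro k hk' t ht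
    have e1 := (abs_le.1 (hVub (x + k) t (hI ht))).2
    have e2 := (abs_le.1 (hVub (x - k) t (hI ht))).2
    have e3 := (abs_le.1 (hVub x t1 ht1)).1
    linarith
  · positivity

lemma gap_bound {n : ℕ} {I : Set ℝ} {M : ℝ} {u g : E n → ℝ → ℝ} (h : Cl I M u g)
    {R ρ N t1 t2 : ℝ} {x : E n} (ht : t1 < t2) (hI : Set.Icc t1 t2 ⊆ I) (hρ : 0 < ρ) (hρ1 : ρ ≤ 1)
    (hx : ‖x‖ + 2 * ρ < R) (hk : ∀ t ∈ Set.Ioc t1 t2, Wk u g R t) (hN0 : 0 ≤ N)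
    (hN : ∀ y : E n, ‖y‖ < R → ∀ k : E n, ‖k‖ ≤ 1 →
      |u (y + k) t1 + u (y - k) t1 - 2 * u y t1| ≤ N * ‖k‖ ^ 2) :
    |u x t2 - u x t1| ≤ (2 * n * (N + 2 * M / ρ ^ 2) + M) * (t2 - t1) := by
  have h1 := gap_upper h ht hI hρ hρ1 hx hk hN0 hN
  have h2 := gap_upper h.neg ht hI hρ hρ1 hx (fun t ht => (hk t ht).neg) hN0 (fun y hy k hk => by
    have := hN y hy k hk
    rw [← abs_neg] at this
    convert this using 2; ring)
  rw [abs_le]; constructor <;> linarith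

/-- Second differences of a `C²` function are quadratically bounded on balls. -/
lemma exists_second_diff {n : ℕ} {f : E n → ℝ} (hf : ContDiff ℝ 2 f) (R : ℝ) :
    ∃ N : ℕ, ∀ y : E n, ‖y‖ < R → ∀ k : E n, ‖k‖ ≤ 1 →
      |f (y + k) + f (y - k) - 2 * f y| ≤ N * ‖k‖ ^ 2 := by
  have hfd : ContDiff ℝ 1 (fderiv ℝ f) := hf.fderiv_right (by norm_num)
  obtain ⟨C, hC⟩ := (isCompact_closedBall (0 : E n) (R + 1)).exists_bound_of_continuousOn
    (hfd.continuous_fderiv (by norm_num)).continuousOn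
  have hlip : ∀ a b : E n, ‖a‖ ≤ R + 1 → ‖b‖ ≤ R + 1 →
      ‖fderiv ℝ f a - fderiv ℝ f b‖ ≤ C * ‖a - b‖ := by
    intro a b ha hb
    exact (convex_closedBall (0 : E n) (R + 1)).norm_image_sub_le_of_norm_fderiv_le (𝕜 := ℝ)
      (fun z _ => hfd.differentiable (by norm_num) z) hC (by simpa using hb) (by simpa using ha)
  obtain ⟨N, hN⟩ := exists_nat_ge (2 * C)
  refine ⟨N, fun y hy k hk => ?_⟩
  have hd : Differentiable ℝ f := hf.differentiable (by norm_num)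
  have hder : ∀ τ : ℝ, HasDerivAt (fun τ : ℝ => f (y + τ • k) + f (y - τ • k))
      ((fderiv ℝ f (y + τ • k) - fderiv ℝ f (y - τ • k)) k) τ := by
    intro τ
    have h1 : HasDerivAt (fun τ : ℝ => y + τ • k) ((1 : ℝ) • k) τ :=
      ((hasDerivAt_id τ).smul_const k).const_add y
    have h2 : HasDerivAt (fun τ : ℝ => y - τ • k) (-((1 : ℝ) • k)) τ :=
      ((hasDerivAt_id τ).smul_const k).const_sub y
    have h3 := (hd (y + τ • k)).hasFDerivAt.comp_hasDerivAt τ h1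
    have h4 := (hd (y - τ • k)).hasFDerivAt.comp_hasDerivAt τ h2
    refine (h3.fun_add h4).congr_deriv ?_
    simp [sub_eq_add_neg]
  have hn : ∀ τ ∈ Set.Icc (0 : ℝ) 1, ‖(fderiv ℝ f (y + τ • k) - fderiv ℝ f (y - τ • k)) k‖ ≤
      2 * C * ‖k‖ ^ 2 := by
    intro τ hτ
    have hτk : ‖τ • k‖ ≤ 1 := by
      rw [norm_smul, Real.norm_eq_abs, abs_of_nonneg hτ.1]
      exact mul_le_one₀ hτ.2 (norm_nonneg _) hk
    have h1 := hlip (y + τ • k) (y - τ • k) ((norm_add_le _ _).trans (by linarith))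
      ((norm_sub_le _ _).trans (by linarith))
    have h2 : y + τ • k - (y - τ • k) = (2 * τ) • k := by rw [mul_smul, two_smul]; abel
    rw [h2, norm_smul, Real.norm_eq_abs, abs_of_nonneg (by linarith [hτ.1])] at h1
    have hC0 : 0 ≤ C := (norm_nonneg _).trans (hC y (by simp; linarith))
    calc _ ≤ C * (2 * τ * ‖k‖) * ‖k‖ := (ContinuousLinearMap.le_opNorm _ _).trans
          (mul_le_mul_of_nonneg_right h1 (norm_nonneg _))
      _ = τ * (2 * C * ‖k‖ ^ 2) := by ring
      _ ≤ 1 * (2 * C * ‖k‖ ^ 2) := mul_le_mul_of_nonneg_right hτ.2 (by positivity)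
      _ = _ := by ring
  have := (convex_Icc (0 : ℝ) 1).norm_image_sub_le_of_norm_hasDerivWithin_le
    (fun τ _ => (hder τ).hasDerivWithinAt) hn (x := 0) (y := 1) (by simp) (by simp)
  simp only [one_smul, zero_smul, add_zero, sub_zero, Real.norm_eq_abs, abs_one, mul_one] at this
  rw [show f (y + k) + f (y - k) - 2 * f y = f (y + k) + f (y - k) - (f y + f y) by ring]
  exact this.trans (mul_le_mul_of_nonneg_right hN (by positivity))

lemma pd_pd_le_of_second_diff {n : ℕ} {f : E n → ℝ} (hf : ContDiff ℝ 2 f) {N : ℝ} {y : E n}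
    (hN : ∀ k : E n, ‖k‖ ≤ 1 → f (y + k) + f (y - k) - 2 * f y ≤ N * ‖k‖ ^ 2) (i : Fin n) :
    pd i (pd i f) y ≤ N := by
  have hg : ContDiff ℝ 2 (fun k => (1 / 2) * (f (y + k) + f (y - k))) :=
    contDiff_const.mul ((hf.comp (contDiff_const.add contDiff_id)).add
      (hf.comp (contDiff_const.sub contDiff_id)))
  have hm : IsLocalMax (fun k => (1 / 2) * (f (y + k) + f (y - k)) - N / 2 * ‖k‖ ^ 2) (0 : E n) := by
    filter_upwards [Metric.closedBall_mem_nhds (0 : E n) one_pos] with k hk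
    have := hN k (by simpa using hk)
    simp
    linarith
  have h1 := pd_pd_le_of_isLocalMax hg hm i
  have hd := hf.differentiable (by norm_num)
  have h2 : pd i (fun k => (1 / 2) * (f (y + k) + f (y - k))) =
      fun k => (1 / 2) * (pd i f (y + k) + (- pd i f (y - k))) := by
    ext k
    rw [pd_const_mul (by fun_prop), pd_add (by fun_prop) (by fun_prop), pd_comp_add, pd_comp_sub hd]
  have hd2 := differentiable_pd hf i
  rw [h2, pd_const_mul (by fun_prop), pd_add (by fun_prop) (by fun_prop), pd_comp_add, pd_neg (fun k => pd i f (y - k)),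
    pd_comp_sub hd2] at h1
  simp at h1
  linarith

end

section

lemma real_induction {P : ℝ → Prop} {a b : ℝ}
    (hcl : ∀ x ∈ Set.Icc a b, (∀ s ∈ Set.Ico a x, P s) → P x)
    (hstep : ∀ x ∈ Set.Ico a b, (∀ s ∈ Set.Icc a x, P s) → ∃ z > x, ∀ s ∈ Set.Ioc x z, s ≤ b → P s) :
    ∀ s ∈ Set.Icc a b, P s := by
  by_contra! hbad
  obtain ⟨s0, hs0, hP0⟩ := hbad
  set A := {s | s ∈ Set.Icc a b ∧ ¬ P s} with hA
  have hne : A.Nonempty := ⟨s0, hs0, hP0⟩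
  have hbdd : BddBelow A := ⟨a, fun s hs => hs.1.1⟩
  set t := sInf A with ht
  have hat : a ≤ t := le_csInf hne fun s hs => hs.1.1
  have hts0 : t ≤ s0 := csInf_le hbdd ⟨hs0, hP0⟩
  have htb : t ≤ b := hts0.trans hs0.2
  have hgood : ∀ s ∈ Set.Ico a t, P s := by
    intro s hs
    by_contra hPs
    have : t ≤ s := csInf_le hbdd ⟨⟨hs.1, hs.2.le.trans htb⟩, hPs⟩
    linarith [hs.2]
  have hPt : P t := hcl t ⟨hat, htb⟩ hgood
  have hlt : t < s0 := lt_of_le_of_ne hts0 fun h => hP0 (h ▸ hPt)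
  obtain ⟨z, hz, hz2⟩ := hstep t ⟨hat, hlt.trans_le hs0.2⟩ fun s hs => by
    rcases hs.2.lt_or_eq with h | h
    · exact hgood s ⟨hs.1, h⟩
    · rwa [h]
  obtain ⟨s, hs, hsz⟩ := exists_lt_of_csInf_lt hne hz
  have hts : t ≤ s := csInf_le hbdd hs
  have hts' : t < s := lt_of_le_of_ne hts fun h => hs.2 (h ▸ hPt)
  exact hs.2 (hz2 s ⟨hts', hsz.le⟩ hs.1.2)

lemma hasDerivAt_of_hasDerivWithinAt_right {F H : ℝ → ℝ} {J : Set ℝ} (hJ : IsOpen J)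
    (hF : ContinuousOn F J) (hH : ContinuousOn H J)
    (hr : ∀ t ∈ J, HasDerivWithinAt F (H t) (Set.Ioi t) t) : ∀ t ∈ J, HasDerivAt F (H t) t := by
  intro t ht
  obtain ⟨r, hr0, hrJ⟩ := Metric.isOpen_iff.1 hJ t ht
  rw [Real.ball_eq_Ioo] at hrJ
  set c := t - r / 2 with hc
  have hsub : ∀ d, d < t + r → Set.Icc c d ⊆ J := fun d hd s hs => hrJ ⟨by linarith [hs.1], by linarith [hs.2]⟩
  have hInt : ∀ d, c ≤ d → d < t + r → IntervalIntegrable H volume c d := fun d hcd hd =>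
    ContinuousOn.intervalIntegrable (by rw [Set.uIcc_of_le hcd]; exact hH.mono (hsub d hd))
  have heq : ∀ d, c ≤ d → d < t + r → ∫ y in c..d, H y = F d - F c := fun d hcd hd =>
    intervalIntegral.integral_eq_sub_of_hasDeriv_right_of_le hcd (hF.mono (hsub d hd))
      (fun x hx => hr x (hsub d hd ⟨hx.1.le, hx.2.le⟩)) (hInt d hcd hd)
  have h1 : HasDerivAt (fun d => F c + ∫ y in c..d, H y) (H t) t := by
    refine HasDerivAt.const_add (F c) ?_
    exact intervalIntegral.integral_hasDerivAt_right (hInt t (by linarith) (by linarith))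
      (hH.stronglyMeasurableAtFilter hJ t ht) (hH.continuousAt (hJ.mem_nhds ht))
  refine h1.congr_of_eventuallyEq ?_
  filter_upwards [Ioo_mem_nhds (show c < t by linarith) (show t < t + r by linarith)] with d hd
  rw [heq d hd.1.le hd.2]; ring

lemma integral_mul_pd {n : ℕ} {φ v : E n → ℝ} (hφ : Tst φ) (hv : Differentiable ℝ v)
    (hv' : ∀ i, Continuous (pd i v)) (i : Fin n) : ∫ y, φ y * pd i v y = - ∫ y, pd i φ y * v y := by
  refine integral_mul_fderiv_eq_neg_fderiv_mul_of_integrable ?_ ?_ ?_ (fun x _ => hφ.differentiable x)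
    (fun x _ => hv x)
  · exact ((hφ.pd i).continuous.mul hv.continuous).integrable_of_hasCompactSupport (hφ.pd i).2.mul_right
  · exact (hφ.continuous.mul (hv' i)).integrable_of_hasCompactSupport hφ.2.mul_right
  · exact (hφ.continuous.mul hv.continuous).integrable_of_hasCompactSupport hφ.2.mul_right

lemma integral_mul_lap {n : ℕ} {φ v : E n → ℝ} (hφ : Tst φ) (hv : ContDiff ℝ 2 v) :
    ∫ y, φ y * lap n v y = ∫ y, lap n φ y * v y := by
  have hvd := hv.differentiable (by norm_num)
  have h1 : ∀ i, ∫ y, φ y * pd i (pd i v) y = ∫ y, pd i (pd i φ) y * v y := by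
    intro i
    rw [integral_mul_pd hφ (differentiable_pd hv i) (fun j => continuous_pd_pd hv j i),
      integral_mul_pd (hφ.pd i) hvd (fun j => (differentiable_pd hv j).continuous), neg_neg]
  simp only [lap_eq_sum_pd, Finset.mul_sum, Finset.sum_mul]
  rw [integral_finsetSum _ fun i _ => ?_, integral_finsetSum _ fun i _ => ?_]
  · exact Finset.sum_congr rfl fun i _ => h1 i
  · exact (((hφ.pd i).pd i).continuous.mul hvd.continuous).integrable_of_hasCompactSupport
      ((hφ.pd i).pd i).2.mul_right
  · exact (hφ.continuous.mul (continuous_pd_pd hv i i)).integrable_of_hasCompactSupport hφ.2.mul_right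

/-- One-sided Lipschitz bound from a closed set of times, propagated through the gaps. -/
lemma lipschitz_from_closed {v : ℝ → ℝ} {S : Set ℝ} {C t1 t2 : ℝ} (hS : IsClosed (S ∩ Set.Icc t1 t2))
    (ht1 : t1 ∈ S) (hv : ContinuousOn v (Set.Icc t1 t2))
    (hd : ∀ s ∈ S ∩ Set.Icc t1 t2, ∃ v', HasDerivAt v v' s ∧ |v'| ≤ C)
    (hgap : ∀ s ∈ S ∩ Set.Icc t1 t2, ∀ t ∈ Set.Icc t1 t2, s < t → (∀ r ∈ Set.Ioc s t, r ∉ S) →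
      |v t - v s| ≤ C * (t - s)) : ∀ t ∈ Set.Icc t1 t2, |v t - v t1| ≤ C * (t - t1) := by
  intro t ht
  refine le_of_forall_pos_le_add fun η hη => ?_
  have ht0 : 0 ≤ t - t1 := by linarith [ht.1]
  set ε := η / (t - t1 + 1) with hε
  have hε0 : 0 < ε := by positivity
  have hεη : ε * (t - t1) ≤ η := by
    rw [hε, div_mul_eq_mul_div, div_le_iff₀ (by linarith)]
    nlinarith
  have key : ∀ s ∈ Set.Icc t1 t2, |v s - v t1| ≤ (C + ε) * (s - t1) := by
    apply real_induction
    · intro x hx hgood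
      rcases hx.1.eq_or_lt with h | h
      · simp [← h]
      have hc : ContinuousWithinAt (fun s => (C + ε) * (s - t1) - |v s - v t1|) (Set.Ico t1 x) x := by
        have h1 : ContinuousWithinAt v (Set.Ico t1 x) x :=
          (hv x hx).mono fun s hs => ⟨hs.1, hs.2.le.trans hx.2⟩
        exact ContinuousWithinAt.sub (by fun_prop) (h1.sub continuousWithinAt_const).abs
      have : 0 ≤ (C + ε) * (x - t1) - |v x - v t1| := by
        have : (𝓝[Set.Ico t1 x] x).NeBot := by
          rw [← mem_closure_iff_nhdsWithin_neBot, closure_Ico h.ne]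
          exact ⟨h.le, le_rfl⟩
        refine ge_of_tendsto hc ?_
        filter_upwards [self_mem_nhdsWithin] with s hs
        linarith [hgood s hs]
      linarith
    · intro x hx hgood
      by_cases hxS : x ∈ S
      · obtain ⟨v', hv', hC⟩ := hd x ⟨hxS, hx.1, hx.2.le⟩
        have h1 := hv'.tendsto_slope
        have h2 : ∀ᶠ s in 𝓝[>] x, |slope v x s| < C + ε := by
          refine ((h1.mono_left (nhdsWithin_mono _ fun s hs => ne_of_gt hs)).abs).eventually
            (gt_mem_nhds (by linarith))
        obtain ⟨z, hz, hz2⟩ := (mem_nhdsGT_iff_exists_Ioc_subset).1 h2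
        refine ⟨z, hz, fun s hs hsb => ?_⟩
        have h3 : |slope v x s| < C + ε := hz2 hs
        have hsx : 0 < s - x := by linarith [hs.1]
        rw [slope_def_field, abs_div, abs_of_pos hsx, div_lt_iff₀ hsx] at h3
        have h4 := hgood x ⟨hx.1, le_rfl⟩
        have h5 : |v s - v t1| ≤ |v s - v x| + |v x - v t1| := abs_sub_le _ _ _
        nlinarith
      · have hcl : IsClosed (S ∩ Set.Icc t1 x) := by
          have : S ∩ Set.Icc t1 x = (S ∩ Set.Icc t1 t2) ∩ Set.Iic x := by
            ext s; simp only [Set.mem_inter_iff, Set.mem_Icc, Set.mem_Iic]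
            constructor
            · rintro ⟨h1, h2, h3⟩; exact ⟨⟨h1, h2, h3.trans hx.2.le⟩, h3⟩
            · rintro ⟨⟨h1, h2, h3⟩, h4⟩; exact ⟨h1, h2, h4⟩
          rw [this]; exact hS.inter isClosed_Iic
        have hne : (S ∩ Set.Icc t1 x).Nonempty := ⟨t1, ht1, le_rfl, hx.1⟩
        have hbdd : BddAbove (S ∩ Set.Icc t1 x) := ⟨x, fun s hs => hs.2.2⟩
        set σ := sSup (S ∩ Set.Icc t1 x) with hσ
        have hσm : σ ∈ S ∩ Set.Icc t1 x := hcl.csSup_mem hne hbdd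
        have hσx : σ < x := lt_of_le_of_ne hσm.2.2 fun h => hxS (h ▸ hσm.1)
        have hnear : ∃ z > x, ∀ s ∈ Set.Ioc x z, s ≤ t2 → s ∉ S := by
          have h1 : (S ∩ Set.Icc t1 t2)ᶜ ∈ 𝓝[>] x :=
            nhdsWithin_le_nhds (hS.isOpen_compl.mem_nhds fun h => hxS h.1)
          obtain ⟨z, hz, hz2⟩ := (mem_nhdsGT_iff_exists_Ioc_subset).1 h1
          exact ⟨z, hz, fun s hs hs2 hsS => hz2 hs ⟨hsS, hx.1.trans hs.1.le, hs2⟩⟩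
        obtain ⟨z, hz, hz2⟩ := hnear
        refine ⟨z, hz, fun s hs hsb => ?_⟩
        have h6 := hgap σ ⟨hσm.1, hσm.2.1, hσm.2.2.trans hx.2.le⟩ s ⟨hx.1.trans hs.1.le, hsb⟩
          (hσx.trans hs.1) fun r hr hrS => by
            rcases le_or_gt r x with h | h
            · have : r ≤ σ := le_csSup hbdd ⟨hrS, hσm.2.1.trans hr.1.le, h⟩
              linarith [hr.1]
            · exact hz2 r ⟨h, hr.2.trans hs.2⟩ (hr.2.trans hsb) hrS
        have h7 := hgood σ ⟨hσm.2.1, hσm.2.2⟩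
        have h5 : |v s - v t1| ≤ |v s - v σ| + |v σ - v t1| := abs_sub_le _ _ _
        have : 0 < s - σ := by linarith [hs.1]
        nlinarith
  have := key t ht
  linarith

end

section

def SDB {n : ℕ} (f : E n → ℝ) (R N : ℝ) : Prop :=
  ∀ y : E n, ‖y‖ < R → ∀ k : E n, ‖k‖ ≤ 1 → |f (y + k) + f (y - k) - 2 * f y| ≤ N * ‖k‖ ^ 2

lemma SDB.abs_lap_le {n : ℕ} {f : E n → ℝ} {R N : ℝ} (h : SDB f R N) (hf : ContDiff ℝ 2 f)
    {y : E n} (hy : ‖y‖ < R) : |lap n f y| ≤ n * N := by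
  have h1 : ∀ i, |pd i (pd i f) y| ≤ N := by
    intro i
    rw [abs_le]
    constructor
    · have h2 := pd_pd_le_of_second_diff (N := N) (y := y) hf.neg (fun k hk => by
        have := (abs_le.1 (h y hy k hk)).1
        show -f (y + k) + -f (y - k) - 2 * -f y ≤ _
        linarith) i
      have h3 : pd i (fun z => - f z) = fun z => - pd i f z := by
        funext z; exact pd_neg _ _ _
      rw [h3, pd_neg] at h2
      linarith
    · exact pd_pd_le_of_second_diff hf (fun k hk => (abs_le.1 (h y hy k hk)).2) i
  rw [lap_eq_sum_pd]
  refine (Finset.abs_sum_le_sum_abs _ _).trans ((Finset.sum_le_sum fun i _ => h1 i).trans ?_)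
  simp

/-- If off a relatively closed set `B` the weak form holds and on `B` second differences are
uniformly bounded, then the weak form holds. -/
lemma Wk_of_SDB {n : ℕ} {I J B : Set ℝ} {M R N a b : ℝ} {u g : E n → ℝ → ℝ} (h : Cl I M u g)
    (hJ : J = Set.Ioo a b) (hJI : J ⊆ I) (hN0 : 0 ≤ N)
    (hB : ∀ t1 ∈ J, ∀ t2 ∈ J, IsClosed (B ∩ Set.Icc t1 t2))
    (hBk : ∀ t ∈ J, t ∉ B → Wk u g R t)
    (hBN : ∀ t ∈ J, t ∈ B → SDB (fun x => u x t) R N) : ∀ t ∈ J, Wk u g R t := by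
  intro t ht φ hφ hs
  obtain ⟨R', hR', hsR'⟩ := exists_lt_subset_ball (isClosed_tsupport φ) hs
  have hM : 0 ≤ M := (abs_nonneg _).trans (h.ub 0 t (hJI ht))
  set ρ := min 1 ((R - R') / 4) with hρd
  have hρ : 0 < ρ := lt_min one_pos (by linarith)
  have hρ1 : ρ ≤ 1 := min_le_left _ _
  have hρ2 : ρ ≤ (R - R') / 4 := min_le_right _ _
  set C := 2 * n * (N + 2 * M / ρ ^ 2) + M with hC
  have hsub : ∀ t1 ∈ J, ∀ t2 ∈ J, Set.Icc t1 t2 ⊆ J := by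
    intro t1 h1 t2 h2 s hs
    rw [hJ] at *
    exact ⟨h1.1.trans_le hs.1, hs.2.trans_lt h2.2⟩
  have hlip : ∀ x : E n, ‖x‖ < R' → ∀ t1 ∈ J, t1 ∈ B → ∀ t2 ∈ J, t1 ≤ t2 →
      |u x t2 - u x t1| ≤ C * (t2 - t1) := by
    intro x hx t1 h1 h1B t2 h2 h12
    have hI := (hsub t1 h1 t2 h2)
    refine lipschitz_from_closed (v := u x) (hB t1 h1 t2 h2) h1B (fun s hs =>
      (h.dt x s (hJI (hI hs))).continuousAt.continuousWithinAt) ?_ ?_ t2 ⟨h12, le_rfl⟩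
    · intro s hs
      refine ⟨_, h.dt x s (hJI (hI hs.2)), ?_⟩
      have e1 := (hBN s (hI hs.2) hs.1).abs_lap_le (h.c2 s (hJI (hI hs.2))) (y := x) (by linarith)
      have e2 := h.gsc.bd x s (hJI (hI hs.2))
      have e3 : 0 ≤ 2 * M / ρ ^ 2 := by positivity
      have e4 : (0:ℝ) ≤ n := Nat.cast_nonneg n
      refine (abs_add_le _ _).trans ?_
      rw [hC]
      nlinarith [mul_nonneg e4 hN0, mul_nonneg e4 e3]
    · intro s hs s' hs' hss' hgap
      refine gap_bound h hss' (fun r hr => hJI (hI ⟨hs.2.1.trans hr.1, hr.2.trans hs'.2⟩)) hρ hρ1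
        (R := R) (by linarith) (fun r hr => hBk r (hI ⟨hs.2.1.trans hr.1.le, hr.2.trans hs'.2⟩)
          (hgap r hr)) hN0 (hBN s (hI hs.2) hs.1)
  have hJo : IsOpen J := hJ ▸ isOpen_Ioo
  have hint1 : ∀ (t : ℝ), t ∈ J → Integrable (fun y => lap n φ y * u y t) := fun t ht =>
    (hφ.lap.continuous.mul (h.usc.cx t (hJI ht))).integrable_of_hasCompactSupport hφ.lap.2.mul_right
  have hint2 : ∀ (t : ℝ), t ∈ J → Integrable (fun y => φ y * g y t) := fun t ht =>
    (hφ.continuous.mul (h.gsc.cx t (hJI ht))).integrable_of_hasCompactSupport hφ.2.mul_right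
  have hint3 : ∀ (t : ℝ), t ∈ J → Integrable (fun y => φ y * u y t) := fun t ht =>
    (hφ.continuous.mul (h.usc.cx t (hJI ht))).integrable_of_hasCompactSupport hφ.2.mul_right
  refine hasDerivAt_of_hasDerivWithinAt_right hJo (F := fun s => ∫ y, φ y * u y s)
    (H := fun s => ∫ y, (lap n φ y * u y s + φ y * g y s))
    ((h.usc.int_ct hφ.integrable).mono hJI) ?_ ?_ t ht
  · refine ContinuousOn.congr (((h.usc.int_ct hφ.lap.integrable).mono hJI).add
      ((h.gsc.int_ct hφ.integrable).mono hJI)) fun s hs => ?_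
    exact integral_add (hint1 s hs) (hint2 s hs)
  · intro t ht
    by_cases htB : t ∈ B
    swap
    · exact (hBk t ht htB φ hφ hs).hasDerivWithinAt
    rw [hasDerivWithinAt_iff_tendsto_slope' (by simp)]
    have hlim : ∫ y, (lap n φ y * u y t + φ y * g y t) =
        ∫ y, φ y * (lap n (fun z => u z t) y + g y t) := by
      rw [integral_add (hint1 t ht) (hint2 t ht), ← integral_mul_lap hφ (h.c2 t (hJI ht)),
        ← integral_add ?_ (hint2 t ht)]
      · congr 1; ext y; ring
      · simp only [lap_eq_sum_pd, Finset.mul_sum]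
        exact integrable_finsetSum _ fun i _ => (hφ.continuous.mul
          (continuous_pd_pd (h.c2 t (hJI ht)) i i)).integrable_of_hasCompactSupport hφ.2.mul_right
    rw [hlim]
    have hev : ∀ᶠ s in 𝓝[>] t, s ∈ J ∧ t < s := by
      filter_upwards [nhdsWithin_le_nhds (hJo.mem_nhds ht), self_mem_nhdsWithin] with s h1 h2
        using ⟨h1, h2⟩
    have hsl : ∀ᶠ s in 𝓝[>] t, slope (fun s => ∫ y, φ y * u y s) t s =
        ∫ y, φ y * slope (u y) t s := by
      filter_upwards [hev] with s hs
      simp only [slope_def_field]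
      rw [← integral_sub (hint3 s hs.1) (hint3 t ht), ← integral_div]
      congr 1; ext y; ring
    refine Tendsto.congr' (hsl.mono fun s hs => hs.symm) ?_
    refine tendsto_integral_filter_of_dominated_convergence (fun y => |φ y| * C) ?_ ?_ ?_ ?_
    · filter_upwards [hev] with s hs
      have := ((h.usc.cx s (hJI hs.1)).sub (h.usc.cx t (hJI ht))).div_const (s - t)
      simp only [slope_def_field]
      exact (hφ.continuous.mul this).aestronglyMeasurable
    · filter_upwards [hev] with s hs
      refine ae_of_all _ fun y => ?_
      rw [norm_mul]
      by_cases hy : φ y = 0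
      · simp [hy]
      refine mul_le_mul_of_nonneg_left ?_ (abs_nonneg _)
      have hy' : ‖y‖ < R' := by simpa using hsR' (subset_tsupport φ hy)
      have hst : 0 < s - t := sub_pos.2 hs.2
      rw [Real.norm_eq_abs, slope_def_field, abs_div, abs_of_pos hst, div_le_iff₀ hst]
      exact hlip y hy' t ht htB s hs.1 hs.2.le
    · exact hφ.integrable.abs.mul_const C
    · refine ae_of_all _ fun y => Tendsto.const_mul _ ?_
      exact (h.dt y t (hJI ht)).tendsto_slope.mono_left (nhdsWithin_mono _ fun s hs => ne_of_gt hs)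

theorem Cl.wk {n : ℕ} {I : Set ℝ} {M : ℝ} {u g : E n → ℝ → ℝ} (h : Cl I M u g) (hI : IsOpen I)
    (R : ℝ) : ∀ t ∈ I, Wk u g R t := by
  set G := interior {t | Wk u g R t} with hG
  set B := I ∩ Gᶜ with hBd
  suffices hB : ¬ B.Nonempty by
    intro t ht
    by_contra hc
    exact hB ⟨t, ht, fun h' => hc (interior_subset h')⟩
  intro hne
  have hlc : IsLocallyClosed B := hI.isLocallyClosed.inter isOpen_interior.isClosed_compl.isLocallyClosed
  have : LocallyCompactSpace B := hlc.locallyCompactSpace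
  have : Nonempty B := hne.to_subtype
  obtain ⟨N, x, hx⟩ := nonempty_interior_of_iUnion_of_closed
    (f := fun N : ℕ => {t : B | SDB (fun x => u x t) R N}) (by
      intro N
      simp only [SDB, Set.ofPred_forall]
      refine isClosed_iInter fun y => isClosed_iInter fun _ => isClosed_iInter fun k =>
        isClosed_iInter fun _ => ?_
      have hc : ∀ y, Continuous fun t : B => u y t := fun y =>
        continuousOn_iff_continuous_domRestrict.1 ((h.usc.ct y).mono Set.inter_subset_left)
      exact isClosed_le (((hc _).add (hc _)).sub (continuous_const.mul (hc _))).abs continuous_const)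
    (by
      rw [Set.eq_univ_iff_forall]
      intro t
      obtain ⟨N, hN⟩ := exists_second_diff (h.c2 t t.2.1) R
      exact Set.mem_iUnion.2 ⟨N, hN⟩)
  rw [mem_interior_iff_mem_nhds, Metric.mem_nhds_iff] at hx
  obtain ⟨r, hr, hball⟩ := hx
  obtain ⟨r', hr', hball'⟩ := Metric.isOpen_iff.1 hI x x.2.1
  set r2 := min r r' with hr2
  have hr20 : 0 < r2 := lt_min hr hr'
  have hJ : ∀ t ∈ Metric.ball (x : ℝ) r2, Wk u g R t := by
    have hJI : Metric.ball (x : ℝ) r2 ⊆ I := (Metric.ball_subset_ball (min_le_right _ _)).trans hball'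
    refine Wk_of_SDB h (B := B) (Real.ball_eq_Ioo _ _) hJI (N := N) (Nat.cast_nonneg N) ?_ ?_ ?_
    · intro t1 h1 t2 h2
      have : B ∩ Set.Icc t1 t2 = Gᶜ ∩ Set.Icc t1 t2 := by
        ext s
        simp only [hBd, Set.mem_inter_iff]
        constructor
        · rintro ⟨⟨_, h⟩, h'⟩; exact ⟨h, h'⟩
        · rintro ⟨h, h'⟩
          refine ⟨⟨hJI ?_, h⟩, h'⟩
          rw [Real.ball_eq_Ioo] at *
          exact ⟨h1.1.trans_le h'.1, h'.2.trans_lt h2.2⟩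
      rw [this]
      exact isOpen_interior.isClosed_compl.inter isClosed_Icc
    · intro t ht htB
      have : t ∈ G := by
        by_contra hc; exact htB ⟨hJI ht, hc⟩
      exact interior_subset this
    · intro t ht htB
      exact hball (show (⟨t, htB⟩ : B) ∈ Metric.ball x r from
        Metric.ball_subset_ball (min_le_left _ _) ht)
  exact x.2.2 (mem_interior.2 ⟨_, hJ, Metric.isOpen_ball, Metric.mem_ball_self hr20⟩)

theorem Cl.hasDerivAt_V {n : ℕ} {I : Set ℝ} {M : ℝ} {u g : E n → ℝ → ℝ} (h : Cl I M u g)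
    (hI : IsOpen I) {φ : E n → ℝ} (hφ : Tst φ) (x : E n) {t : ℝ} (ht : t ∈ I) :
    HasDerivAt (fun s => V φ (fun z => u z s) x)
      (V (lap n φ) (fun z => u z t) x + V φ (fun z => g z t) x) t := by
  obtain ⟨R, hR⟩ := ((hφ.comp_sub x).2.isCompact.isBounded).subset_ball (0 : E n)
  rw [← lap_V hφ (h.usc.cx t ht)]
  exact Wk.hasDerivAt_V h (h.wk hI R t ht) ht hφ hR

end

section

lemma apply_eq_sum_bv {n : ℕ} (L : E n →L[ℝ] ℝ) (v : E n) : L v = ∑ i, v i * L (bv i) := by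
  have hx : v = ∑ i, v i • bv i := by
    conv_lhs => rw [← (EuclideanSpace.basisFun (Fin n) ℝ).sum_repr v]
    simp
  conv_lhs => rw [hx]
  simp [map_sum]

lemma fderiv_apply_eq_sum {n : ℕ} (f : E n → ℝ) (x v : E n) :
    fderiv ℝ f x v = ∑ i, v i * pd i f x := apply_eq_sum_bv _ _

lemma fderiv_eq_sum {n : ℕ} (f : E n → ℝ) (x : E n) :
    fderiv ℝ f x = ∑ i, pd i f x • EuclideanSpace.proj (𝕜 := ℝ) i := by
  ext v
  rw [fderiv_apply_eq_sum]
  simp [mul_comm]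

lemma Cl.hasDerivAt_V_curve {n : ℕ} {I : Set ℝ} {M : ℝ} {u g : E n → ℝ → ℝ} (h : Cl I M u g)
    (hI : IsOpen I) {φ : E n → ℝ} (hφ : Tst φ) {x : ℝ → E n} {τ : ℝ → ℝ} {x' : E n} {τ' s : ℝ}
    (hx : HasDerivAt x x' s) (hτ : HasDerivAt τ τ' s) (hs : τ s ∈ I) :
    HasDerivAt (fun s => V φ (fun z => u z (τ s)) (x s))
      ((∑ i, x' i * V (pd i φ) (fun z => u z (τ s)) (x s)) +
        τ' * (V (lap n φ) (fun z => u z (τ s)) (x s) + V φ (fun z => g z (τ s)) (x s))) s := by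
  have hop : (Set.univ : Set (E n)) ×ˢ I ∈ 𝓝 (x s, τ s) :=
    (isOpen_univ.prod hI).mem_nhds ⟨trivial, hs⟩
  have hcu : ∀ {ψ : E n → ℝ}, Tst ψ → ContinuousAt
      (fun q : E n × ℝ => V ψ (fun z => u z q.2) q.1) (x s, τ s) := fun hψ =>
    (h.usc.V_cont hψ).continuousAt hop
  have hcg : ContinuousAt (fun q : E n × ℝ => V φ (fun z => g z q.2) q.1) (x s, τ s) :=
    (h.gsc.V_cont hφ).continuousAt hop
  have key := hasStrictFDerivAt_uncurry_coprod (𝕜 := ℝ) (u := (x s, τ s))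
    (f := fun x t => V φ (fun z => u z t) x)
    (f₁ := fun x t => ∑ i, V (pd i φ) (fun z => u z t) x • EuclideanSpace.proj (𝕜 := ℝ) i)
    (f₂ := fun x t => ContinuousLinearMap.toSpanSingleton ℝ
      (V (lap n φ) (fun z => u z t) x + V φ (fun z => g z t) x)) ?_ ?_ ?_ ?_
  · have h1 := key.hasFDerivAt.comp_hasDerivAt s (hx.prodMk hτ)
    refine h1.congr_deriv ?_
    simp [Function.HasUncurry.uncurry, mul_comm]
  · filter_upwards [hop] with q hq
    have hc := h.usc.cx q.2 hq.2
    have := ((V_contDiff hφ hc).differentiable (by simp)) q.1 |>.hasFDerivAt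
    rw [fderiv_eq_sum] at this
    simp only [pd_V hφ hc] at this
    exact this
  · filter_upwards [hop] with q hq
    exact (h.hasDerivAt_V hI hφ q.1 hq.2).hasFDerivAt
  · have : ContinuousAt (fun q : E n × ℝ => ∑ i, V (pd i φ) (fun z => u z q.2) q.1 •
        (EuclideanSpace.proj i : E n →L[ℝ] ℝ)) (x s, τ s) :=
      tendsto_finsetSum _ fun i _ => (hcu (hφ.pd i)).smul continuousAt_const
    exact this
  · have : ContinuousAt (fun q : E n × ℝ => V (lap n φ) (fun z => u z q.2) q.1 +
      V φ (fun z => g z q.2) q.1) (x s, τ s) := (hcu hφ.lap).add hcg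
    exact (ContinuousLinearMap.toSpanSingletonCLE (𝕜 := ℝ) (E := ℝ)).continuous.continuousAt.comp this

end

section

lemma rho_pos {n : ℕ} (y : E n) : 0 < rho n y := by
  unfold rho; positivity

lemma rho_continuous (n : ℕ) : Continuous (rho n) := by
  unfold rho; fun_prop

/-- The Gaussian probability measure with density `rho`. -/
noncomputable def gm (n : ℕ) : Measure (E n) := volume.withDensity fun y => ENNReal.ofReal (rho n y)

lemma integral_gm {n : ℕ} (f : E n → ℝ) : ∫ y, f y ∂(gm n) = ∫ y, f y * rho n y := by
  unfold gm
  have : (fun y => ENNReal.ofReal (rho n y)) = fun y => ((rho n y).toNNReal : ENNReal) := rfl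
  rw [this, integral_withDensity_eq_integral_smul (rho_continuous n).measurable.real_toNNReal]
  congr 1; ext y
  rw [NNReal.smul_def, Real.coe_toNNReal _ (rho_pos y).le, smul_eq_mul, mul_comm]

lemma integrable_gm {n : ℕ} {f : E n → ℝ} :
    Integrable f (gm n) ↔ Integrable (fun y => f y * rho n y) := by
  unfold gm
  have : (fun y => ENNReal.ofReal (rho n y)) = fun y => ((rho n y).toNNReal : ENNReal) := rfl
  rw [this, integrable_withDensity_iff_integrable_smul (rho_continuous n).measurable.real_toNNReal]
  apply iff_of_eq; congr 1; ext y
  rw [NNReal.smul_def, Real.coe_toNNReal _ (rho_pos y).le, smul_eq_mul, mul_comm]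

lemma integrable_exp_sq {n : ℕ} {c : ℝ} (hc : 0 < c) :
    Integrable (fun y : E n => Real.exp (-c * ‖y‖ ^ 2)) := by
  have h := GaussianFourier.integrable_cexp_neg_mul_sq_norm_add (V := E n) (b := c) (by simpa using hc) 0 0
  have h2 := h.norm
  refine h2.congr (ae_of_all _ fun y => ?_)
  simp only [Complex.norm_exp]
  congr 1
  simp
  exact Or.inl (by norm_cast)

lemma integral_rho (n : ℕ) : ∫ y, rho n y = 1 := by
  unfold rho
  rw [integral_const_mul]
  have h := GaussianFourier.integral_rexp_neg_mul_sq_norm (V := E n) (b := 1 / 4) (by norm_num)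
  have h2 : ∀ y : E n, Real.exp (-‖y‖ ^ 2 / 4) = Real.exp (-(1 / 4) * ‖y‖ ^ 2) := fun y => by
    congr 1; ring
  simp only [h2, h]
  rw [show π / (1 / 4) = 4 * π by ring, finrank_euclideanSpace_fin, ← Real.rpow_add (by positivity)]
  rw [show -(n : ℝ) / 2 + n / 2 = 0 by ring, Real.rpow_zero]

instance gm_prob (n : ℕ) : IsProbabilityMeasure (gm n) := by
  constructor
  unfold gm
  rw [withDensity_apply _ MeasurableSet.univ, Measure.restrict_univ,
    ← ofReal_integral_eq_lintegral_ofReal, integral_rho, ENNReal.ofReal_one]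
  · by_contra hc
    have := integral_undef hc
    rw [integral_rho] at this
    norm_num at this
  · exact ae_of_all _ fun y => (rho_pos y).le

lemma integrable_pow_exp {n : ℕ} (k : ℕ) {c : ℝ} (hc : 0 < c) :
    Integrable (fun y : E n => (1 + ‖y‖) ^ k * Real.exp (-c * ‖y‖ ^ 2)) := by
  obtain ⟨C, hC⟩ : ∃ C : ℝ, ∀ r : ℝ, 0 ≤ r → (1 + r) ^ k * Real.exp (-c * r ^ 2) ≤
      C * Real.exp (-(c / 2) * r ^ 2) := by
    refine ⟨k.factorial * Real.exp (1 + 1 / (2 * c)), fun r hr => ?_⟩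
    have h1 : (1 + r) ^ k ≤ k.factorial * Real.exp (1 + r) := by
      have := Real.pow_div_factorial_le_exp (1 + r) (by linarith) k
      rwa [div_le_iff₀ (by positivity), mul_comm] at this
    have h2 : Real.exp (1 + r) * Real.exp (-c * r ^ 2) ≤
        Real.exp (1 + 1 / (2 * c)) * Real.exp (-(c / 2) * r ^ 2) := by
      rw [← Real.exp_add, ← Real.exp_add]
      apply Real.exp_le_exp.2
      have : r ≤ 1 / (2 * c) + c / 2 * r ^ 2 := by
        have := sq_nonneg (c * r - 1)
        rw [← sub_nonneg]
        have h3 : 1 / (2 * c) + c / 2 * r ^ 2 - r = (c * r - 1) ^ 2 / (2 * c) := by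
          field_simp; ring
        rw [h3]; positivity
      nlinarith
    calc _ ≤ k.factorial * Real.exp (1 + r) * Real.exp (-c * r ^ 2) := by gcongr
      _ ≤ _ := by
        rw [mul_assoc, mul_assoc]; gcongr
  refine ((integrable_exp_sq (n := n) (half_pos hc)).const_mul C).mono' ?_ (ae_of_all _ fun y => ?_)
  · exact Continuous.aestronglyMeasurable (by fun_prop)
  · rw [Real.norm_eq_abs, abs_of_nonneg (by positivity)]
    exact hC _ (norm_nonneg y)

lemma integrable_pow_gm {n : ℕ} (k : ℕ) : Integrable (fun y : E n => (1 + ‖y‖) ^ k) (gm n) := by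
  rw [integrable_gm]
  refine ((integrable_pow_exp (n := n) k (c := 1 / 4) (by norm_num)).const_mul
    ((4 * π) ^ (-(n : ℝ) / 2))).congr (ae_of_all _ fun y => ?_)
  simp only [rho]
  rw [show -‖y‖ ^ 2 / 4 = -(1 / 4) * ‖y‖ ^ 2 by ring]; ring

/-- Continuous in `y`, continuous in `s ∈ J`, with uniform polynomial growth in `y`. -/
structure Nice {n : ℕ} (J : Set ℝ) (v : E n → ℝ → ℝ) : Prop where
  cy : ∀ s ∈ J, Continuous fun y => v y s
  cs : ∀ y, ContinuousOn (v y) J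
  gr : ∃ k : ℕ, ∃ C : ℝ, 0 ≤ C ∧ ∀ y, ∀ s ∈ J, |v y s| ≤ C * (1 + ‖y‖) ^ k

namespace Nice
variable {n : ℕ} {J : Set ℝ} {v v' : E n → ℝ → ℝ}

lemma mono {J' : Set ℝ} (h : Nice J v) (hJ : J' ⊆ J) : Nice J' v where
  cy s hs := h.cy s (hJ hs)
  cs y := (h.cs y).mono hJ
  gr := by
    obtain ⟨k, C, hC, hb⟩ := h.gr
    exact ⟨k, C, hC, fun y s hs => hb y s (hJ hs)⟩

lemma congr (h : Nice J v) (he : ∀ y, ∀ s ∈ J, v' y s = v y s) : Nice J v' where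
  cy s hs := by simpa only [he _ s hs] using h.cy s hs
  cs y := (h.cs y).congr fun s hs => he y s hs
  gr := by
    obtain ⟨k, C, hC, hb⟩ := h.gr
    exact ⟨k, C, hC, fun y s hs => by rw [he y s hs]; exact hb y s hs⟩

lemma add (h : Nice J v) (h' : Nice J v') : Nice J fun y s => v y s + v' y s where
  cy s hs := (h.cy s hs).add (h'.cy s hs)
  cs y := (h.cs y).add (h'.cs y)
  gr := by
    obtain ⟨k, C, hC, hb⟩ := h.gr
    obtain ⟨k', C', hC', hb'⟩ := h'.gr
    refine ⟨k + k', C + C', by positivity, fun y s hs => ?_⟩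
    have h1 : (1:ℝ) ≤ 1 + ‖y‖ := by linarith [norm_nonneg y]
    calc _ ≤ |v y s| + |v' y s| := abs_add_le _ _
      _ ≤ C * (1 + ‖y‖) ^ k + C' * (1 + ‖y‖) ^ k' := add_le_add (hb y s hs) (hb' y s hs)
      _ ≤ C * (1 + ‖y‖) ^ (k + k') + C' * (1 + ‖y‖) ^ (k + k') := by
        gcongr <;> first | exact h1 | omega
      _ = _ := by ring

lemma mul (h : Nice J v) (h' : Nice J v') : Nice J fun y s => v y s * v' y s where
  cy s hs := (h.cy s hs).mul (h'.cy s hs)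
  cs y := (h.cs y).mul (h'.cs y)
  gr := by
    obtain ⟨k, C, hC, hb⟩ := h.gr
    obtain ⟨k', C', hC', hb'⟩ := h'.gr
    refine ⟨k + k', C * C', by positivity, fun y s hs => ?_⟩
    calc _ = |v y s| * |v' y s| := abs_mul _ _
      _ ≤ (C * (1 + ‖y‖) ^ k) * (C' * (1 + ‖y‖) ^ k') := by
        gcongr
        · exact hb y s hs
        · exact hb' y s hs
      _ = _ := by ring

lemma const (c : ℝ) : Nice J fun (_ : E n) _ => c where
  cy s hs := continuous_const
  cs y := continuousOn_const
  gr := ⟨0, |c|, abs_nonneg _, fun y s _ => by simp⟩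

lemma const_mul (h : Nice J v) (c : ℝ) : Nice J fun y s => c * v y s := (const c).mul h

lemma neg (h : Nice J v) : Nice J fun y s => - v y s := by
  simpa using h.const_mul (-1)

lemma sub (h : Nice J v) (h' : Nice J v') : Nice J fun y s => v y s - v' y s := by
  simpa [sub_eq_add_neg] using h.add h'.neg

lemma sq (h : Nice J v) : Nice J fun y s => v y s ^ 2 := by
  simpa [pow_two] using h.mul h

lemma sum {ι : Type*} (t : Finset ι) {f : ι → E n → ℝ → ℝ} (h : ∀ i, Nice J (f i)) :
    Nice J fun y s => ∑ i ∈ t, f i y s := by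
  classical
  induction t using Finset.induction_on with
  | empty => simpa using const 0
  | insert a t ha ih => simpa [Finset.sum_insert ha] using (h a).add ih

lemma coord (i : Fin n) : Nice J fun (y : E n) _ => y i where
  cy s hs := by fun_prop
  cs y := continuousOn_const
  gr := ⟨1, 1, zero_le_one, fun y s _ => by
    have := PiLp.norm_apply_le y i
    rw [Real.norm_eq_abs] at this
    linarith⟩

lemma norm : Nice J fun (y : E n) _ => ‖y‖ where
  cy s hs := continuous_norm
  cs y := continuousOn_const
  gr := ⟨1, 1, zero_le_one, fun y s _ => by simp⟩

lemma integrable (h : Nice J v) {s : ℝ} (hs : s ∈ J) : Integrable (fun y => v y s) (gm n) := by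
  obtain ⟨k, C, hC, hb⟩ := h.gr
  exact ((integrable_pow_gm k).const_mul C).mono' (h.cy s hs).aestronglyMeasurable
    (ae_of_all _ fun y => hb y s hs)

lemma integral_cont (h : Nice J v) : ContinuousOn (fun s => ∫ y, v y s ∂(gm n)) J := by
  obtain ⟨k, C, hC, hb⟩ := h.gr
  exact continuousOn_of_dominated (bound := fun y => C * (1 + ‖y‖) ^ k)
    (fun s hs => (h.cy s hs).aestronglyMeasurable) (fun s hs => ae_of_all _ fun y => hb y s hs)
    ((integrable_pow_gm k).const_mul C) (ae_of_all _ h.cs)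

lemma hasDerivAt (h : Nice J v) (h' : Nice J v') (hJ : IsOpen J)
    (hd : ∀ y, ∀ s ∈ J, HasDerivAt (v y) (v' y s) s) {s : ℝ} (hs : s ∈ J) :
    HasDerivAt (fun s => ∫ y, v y s ∂(gm n)) (∫ y, v' y s ∂(gm n)) s := by
  obtain ⟨k, C, hC, hb⟩ := h'.gr
  refine (hasDerivAt_integral_of_dominated_loc_of_deriv_le (F := fun s y => v y s)
    (F' := fun s y => v' y s) (bound := fun y => C * (1 + ‖y‖) ^ k) (hJ.mem_nhds hs) ?_
    (h.integrable hs) (h'.cy s hs).aestronglyMeasurable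
    (ae_of_all _ fun y s hs => hb y s hs) ((integrable_pow_gm k).const_mul C)
    (ae_of_all _ fun y s hs => hd y s hs)).2
  filter_upwards [hJ.mem_nhds hs] with s hs using (h.cy s hs).aestronglyMeasurable

end Nice

end

section

lemma hasFDerivAt_rho {n : ℕ} (y : E n) (i : Fin n) :
    pd i (rho n) y = - (1 / 2) * y i * rho n y ∧ DifferentiableAt ℝ (rho n) y := by
  have h1 : HasFDerivAt (fun y : E n => ‖y‖ ^ 2) (2 • (innerSL ℝ y)) y := by
    simpa using (hasStrictFDerivAt_norm_sq y).hasFDerivAt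
  have h2 : HasFDerivAt (fun y : E n => -‖y‖ ^ 2 / 4) ((-(1 / 4) : ℝ) • (2 • (innerSL ℝ y))) y := by
    have := h1.const_mul (-(1 / 4) : ℝ)
    refine this.congr_of_eventuallyEq (Eventually.of_forall fun z => ?_)
    simp only; ring
  have h3 := (h2.exp).const_mul ((4 * π) ^ (-(n : ℝ) / 2))
  refine ⟨?_, h3.differentiableAt⟩
  unfold pd rho
  rw [h3.fderiv]
  simp [PiLp.inner_apply]
  ring

lemma integral_pd_gm {n : ℕ} {f : E n → ℝ} (hf : Differentiable ℝ f) (i : Fin n)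
    (h1 : Integrable f (gm n)) (h2 : Integrable (pd i f) (gm n))
    (h3 : Integrable (fun y => y i * f y) (gm n)) :
    ∫ y, pd i f y ∂(gm n) = 1 / 2 * ∫ y, y i * f y ∂(gm n) := by
  rw [integrable_gm] at *
  have e : ∀ y, f y * fderiv ℝ (rho n) y (bv i) = -(1 / 2) * (y i * f y * rho n y) := fun y => by
    have := (hasFDerivAt_rho y i).1
    unfold pd at this
    rw [this]; ring
  have key := integral_mul_fderiv_eq_neg_fderiv_mul_of_integrable (μ := volume) (𝕜 := ℝ) (f := f)
    (g := rho n) (v := bv i) h2 (by simp only [e]; exact h3.const_mul _) h1 (fun x _ => hf x)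
    (fun x _ => (hasFDerivAt_rho x i).2)
  simp only [e, integral_const_mul] at key
  rw [integral_gm, integral_gm]
  unfold pd
  linarith

/-- Integration by parts against the Gaussian weight. -/
lemma integral_mul_pd_gm {n : ℕ} {f g : E n → ℝ} (hf : Differentiable ℝ f) (hg : Differentiable ℝ g)
    (i : Fin n) (h1 : Integrable (fun y => f y * g y) (gm n))
    (h2 : Integrable (fun y => f y * pd i g y) (gm n))
    (h2' : Integrable (fun y => pd i f y * g y) (gm n))
    (h3 : Integrable (fun y => y i * (f y * g y)) (gm n)) :
    ∫ y, f y * pd i g y ∂(gm n) =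
      - ∫ y, pd i f y * g y ∂(gm n) + 1 / 2 * ∫ y, y i * (f y * g y) ∂(gm n) := by
  have e : pd i (fun y => f y * g y) = fun y => f y * pd i g y + pd i f y * g y := by
    funext y
    unfold pd
    rw [fderiv_fun_mul (hf y) (hg y)]
    simp [mul_comm]
  have := integral_pd_gm (f := fun y => f y * g y) (hf.mul hg) i h1 (by rw [e]; exact h2.add h2') h3
  rw [e, integral_add h2 h2'] at this
  linarith

/-- The right-hand side of the equation in similarity variables. -/
noncomputable def wt {n : ℕ} (β : ℝ) (w q : E n → ℝ → ℝ) (y : E n) (s : ℝ) : ℝ :=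
  lap n (fun z => w z s) y - 1 / 2 * ∑ i, y i * pd i (fun z => w z s) y - β * w y s + q y s

/-- Smooth solution of the similarity-variable equation with forcing `q`. -/
structure Sim {n : ℕ} (J : Set ℝ) (β : ℝ) (w q : E n → ℝ → ℝ) : Prop where
  op : IsOpen J
  sm : ∀ s ∈ J, ContDiff ℝ ∞ (fun y => w y s)
  ssm : ∀ s ∈ J, ContDiff ℝ ∞ (fun y => wt β w q y s)
  dw : ∀ y, ∀ s ∈ J, HasDerivAt (w y) (wt β w q y s) s
  dwi : ∀ i y, ∀ s ∈ J, HasDerivAt (fun s => pd i (fun z => w z s) y)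
    (pd i (fun z => wt β w q z s) y) s
  nw : Nice J w
  nwi : ∀ i, Nice J (fun y s => pd i (fun z => w z s) y)
  nwij : ∀ i j, Nice J (fun y s => pd j (pd i (fun z => w z s)) y)
  nwt : Nice J (wt β w q)
  nwti : ∀ i, Nice J (fun y s => pd i (fun z => wt β w q z s) y)
  nq : Nice J q

/-- Self-similar rescaling of `v` about `(b, T)` with weight `exp (-k s)`. -/
noncomputable def W {n : ℕ} (k T : ℝ) (b : E n) (v : E n → ℝ → ℝ) (y : E n) (s : ℝ) : ℝ :=
  Real.exp (-k * s) * v (b + Real.exp (-s / 2) • y) (T - Real.exp (-s))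

lemma W_nice {n : ℕ} {I J : Set ℝ} {C k T sa : ℝ} {b : E n} {v : E n → ℝ → ℝ}
    (hc : ContinuousOn (fun q : E n × ℝ => v q.1 q.2) (Set.univ ×ˢ I))
    (hb : ∀ x, ∀ t ∈ I, |v x t| ≤ C)
    (hJ : ∀ s ∈ J, T - Real.exp (-s) ∈ I) (hsa : ∀ s ∈ J, sa ≤ s) (hk : 0 ≤ k) :
    Nice J (W k T b v) where
  cy s hs := by
    refine continuous_const.mul ?_
    have h1 : Continuous fun y : E n => ((b + Real.exp (-s / 2) • y, T - Real.exp (-s)) : E n × ℝ) := by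
      fun_prop
    exact hc.comp_continuous h1 fun y => ⟨trivial, hJ s hs⟩
  cs y := by
    refine ContinuousOn.mul (by fun_prop) ?_
    have h1 : ContinuousOn (fun s : ℝ => ((b + Real.exp (-s / 2) • y, T - Real.exp (-s)) : E n × ℝ)) J := by
      fun_prop
    exact hc.comp h1 fun s hs => ⟨trivial, hJ s hs⟩
  gr := by
    refine ⟨0, Real.exp (-k * sa) * |C|, by positivity, fun y s hs => ?_⟩
    rw [pow_zero, mul_one, W, abs_mul, abs_of_pos (Real.exp_pos _)]
    refine mul_le_mul ?_ ((hb _ _ (hJ s hs)).trans (le_abs_self C)) (abs_nonneg _) (Real.exp_pos _).le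
    apply Real.exp_le_exp.2
    nlinarith [hsa s hs]

lemma pd_W {n : ℕ} {k T s : ℝ} {b : E n} {v : E n → ℝ → ℝ} (i : Fin n)
    (hv : Differentiable ℝ fun z => v z (T - Real.exp (-s))) :
    pd i (fun y => W k T b v y s) =
      fun y => W (k + 1 / 2) T b (fun x t => pd i (fun z => v z t) x) y s := by
  funext y
  unfold pd W
  have h1 : HasFDerivAt (fun y : E n => b + Real.exp (-s / 2) • y)
      (Real.exp (-s / 2) • ContinuousLinearMap.id ℝ (E n)) y :=
    ((hasFDerivAt_id y).fun_const_smul (Real.exp (-s / 2))).const_add b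
  have h2 := ((hv (b + Real.exp (-s / 2) • y)).hasFDerivAt.comp y h1).const_mul (Real.exp (-k * s))
  have h3 := h2.fderiv
  simp only [Function.comp_def] at h3
  rw [h3]
  simp
  rw [← mul_assoc, ← Real.exp_add]
  ring_nf

lemma pd_comm {n : ℕ} {f : E n → ℝ} (hf : ContDiff ℝ 2 f) (i j : Fin n) :
    pd i (pd j f) = pd j (pd i f) := by
  funext y
  have h := hf.contDiffAt.isSymmSndFDerivAt (x := y) (by simp)
  have hd : Differentiable ℝ (fderiv ℝ f) := (hf.fderiv_right (by norm_num)).differentiable (n := 1) (by norm_num)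
  have e : ∀ i j : Fin n, pd i (pd j f) y = fderiv ℝ (fderiv ℝ f) y (bv i) (bv j) := by
    intro i j
    unfold pd
    have := ((hd y).hasFDerivAt.clm_apply (hasFDerivAt_const (bv j) y)).fderiv
    rw [this]; simp
  rw [e, e]
  exact h _ _

end

section

lemma pd_lap {n : ℕ} {φ : E n → ℝ} (hφ : Tst φ) (i : Fin n) : pd i (lap n φ) = lap n (pd i φ) := by
  have e : ∀ x, lap n (pd i φ) x = ∑ j, pd i (pd j (pd j φ)) x := fun x => by
    rw [lap_eq_sum_pd]
    refine Finset.sum_congr rfl fun j _ => ?_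
    rw [pd_comm (hφ.pd j).c2 i j, pd_comm hφ.c2 i j]
  funext x
  rw [e]
  have : lap n φ = fun x => ∑ j, pd j (pd j φ) x := rfl
  rw [this]
  change fderiv ℝ (fun x => ∑ j, pd j (pd j φ) x) x (bv i) = _
  rw [fderiv_fun_sum (A := fun j => pd j (pd j φ)) fun j _ => (((hφ.pd j).pd j).differentiable x)]
  simp only [sum_apply]
  rfl

lemma pd_coord {n : ℕ} (i j : Fin n) (y : E n) : pd i (fun z : E n => z j) y = if i = j then 1 else 0 := by
  unfold pd
  have : (fun z : E n => z j) = (EuclideanSpace.proj j : E n →L[ℝ] ℝ) := rfl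
  rw [this, ContinuousLinearMap.fderiv]
  simp [PiLp.single_apply, eq_comm]

section
variable {n : ℕ} {I J : Set ℝ} {M T sa : ℝ} {b : E n} {u g : E n → ℝ → ℝ}

/-- Mollified solution in similarity variables. -/
noncomputable def WV (k T : ℝ) (b : E n) (ψ : E n → ℝ) (v : E n → ℝ → ℝ) : E n → ℝ → ℝ :=
  W k T b fun x t => V ψ (fun z => v z t) x

lemma WV_nice (h : SC I M u) {ψ : E n → ℝ} (hψ : Tst ψ) (hJ : ∀ s ∈ J, T - Real.exp (-s) ∈ I)
    (hsa : ∀ s ∈ J, sa ≤ s) {k : ℝ} (hk : 0 ≤ k) : Nice J (WV k T b ψ u) :=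
  W_nice (h.V_cont hψ) (fun x t ht => V_abs_le hψ (fun y => h.bd y t ht) x) hJ hsa hk

lemma WV_contDiff (h : SC I M u) {ψ : E n → ℝ} (hψ : Tst ψ) {s : ℝ} (hs : T - Real.exp (-s) ∈ I)
    {k : ℝ} : ContDiff ℝ ∞ fun y => WV k T b ψ u y s := by
  unfold WV W
  exact contDiff_const.mul ((V_contDiff hψ (h.cx _ hs)).comp
    (contDiff_const.add (contDiff_id.const_smul _)))

lemma pd_WV (h : SC I M u) {ψ : E n → ℝ} (hψ : Tst ψ) {s : ℝ} (hs : T - Real.exp (-s) ∈ I)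
    {k : ℝ} (i : Fin n) :
    pd i (fun y => WV k T b ψ u y s) = fun y => WV (k + 1 / 2) T b (pd i ψ) u y s := by
  have hc := h.cx _ hs
  unfold WV
  rw [pd_W i ((V_contDiff hψ hc).differentiable (by simp))]
  funext y
  unfold W
  have := congrFun (pd_V hψ hc i) (b + Real.exp (-s / 2) • y)
  simp only
  congr 1

lemma lap_WV (h : SC I M u) {ψ : E n → ℝ} (hψ : Tst ψ) {s : ℝ} (hs : T - Real.exp (-s) ∈ I)
    {k : ℝ} (y : E n) :
    lap n (fun y => WV k T b ψ u y s) y = WV (k + 1) T b (lap n ψ) u y s := by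
  rw [lap_eq_sum_pd]
  simp only [pd_WV h hψ hs, pd_WV h (hψ.pd _) hs]
  unfold WV W
  rw [← Finset.mul_sum]
  have hc := h.cx _ hs
  have h1 := lap_V hψ hc (b + Real.exp (-s / 2) • y)
  rw [lap_eq_sum_pd] at h1
  simp only [pd_V hψ hc, pd_V (hψ.pd _) hc] at h1
  simp only
  rw [h1]
  ring_nf

lemma hasDerivAt_WV (h : Cl I M u g) (hI : IsOpen I) {ψ : E n → ℝ} (hψ : Tst ψ) {s : ℝ}
    (hs : T - Real.exp (-s) ∈ I) {k : ℝ} (y : E n) :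
    HasDerivAt (WV k T b ψ u y) (WV (k + 1) T b (lap n ψ) u y s
      - 1 / 2 * ∑ i, y i * WV (k + 1 / 2) T b (pd i ψ) u y s - k * WV k T b ψ u y s
      + WV (k + 1) T b ψ g y s) s := by
  have hx : HasDerivAt (fun s : ℝ => b + Real.exp (-s / 2) • y)
      ((Real.exp (-s / 2) * (-1 / 2)) • y) s := by
    have h1 : HasDerivAt (fun s : ℝ => Real.exp (-s / 2)) (Real.exp (-s / 2) * (-1 / 2)) s :=
      ((hasDerivAt_id s).fun_neg.div_const 2).exp
    exact (h1.smul_const y).const_add b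
  have hτ : HasDerivAt (fun s : ℝ => T - Real.exp (-s)) (Real.exp (-s)) s := by
    have h1 : HasDerivAt (fun s : ℝ => Real.exp (-s)) (Real.exp (-s) * (-1)) s :=
      (hasDerivAt_id s).fun_neg.exp
    exact (h1.const_sub T).congr_deriv (by ring)
  have he : HasDerivAt (fun s : ℝ => Real.exp (-k * s)) (Real.exp (-k * s) * (-k)) s := by
    have := ((hasDerivAt_id s).const_mul (-k)).exp
    simpa using this
  have key := he.mul (h.hasDerivAt_V_curve hI hψ hx hτ hs)
  refine key.congr_deriv ?_
  unfold WV W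
  have e1 : Real.exp (-(k + 1) * s) = Real.exp (-k * s) * Real.exp (-s) := by
    rw [← Real.exp_add]; ring_nf
  have e2 : Real.exp (-(k + 1 / 2) * s) = Real.exp (-k * s) * Real.exp (-s / 2) := by
    rw [← Real.exp_add]; ring_nf
  rw [e1, e2, Finset.mul_sum]
  simp only [PiLp.smul_apply, smul_eq_mul]
  have : ∑ i, Real.exp (-s / 2) * (-1 / 2) * y i *
      V (pd i ψ) (fun z => u z (T - Real.exp (-s))) (b + Real.exp (-s / 2) • y) =
      - ∑ i, 1 / 2 * (y i * (Real.exp (-s / 2) *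
        V (pd i ψ) (fun z => u z (T - Real.exp (-s))) (b + Real.exp (-s / 2) • y))) := by
    rw [← Finset.sum_neg_distrib]
    exact Finset.sum_congr rfl fun i _ => by ring
  rw [this]
  have h3 : ∑ i, 1 / 2 * (y i * (Real.exp (-k * s) * Real.exp (-s / 2) *
        V (pd i ψ) (fun z => u z (T - Real.exp (-s))) (b + Real.exp (-s / 2) • y))) =
      Real.exp (-k * s) * ∑ i, 1 / 2 * (y i * (Real.exp (-s / 2) *
        V (pd i ψ) (fun z => u z (T - Real.exp (-s))) (b + Real.exp (-s / 2) • y))) := by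
    rw [Finset.mul_sum]
    exact Finset.sum_congr rfl fun i _ => by ring
  rw [h3]
  ring

theorem Cl.sim (h : Cl I M u g) (hI : IsOpen I) {φ : E n → ℝ} (hφ : Tst φ) (hJo : IsOpen J)
    (hJ : ∀ s ∈ J, T - Real.exp (-s) ∈ I) (hsa : ∀ s ∈ J, sa ≤ s) {β : ℝ} (hβ : 0 ≤ β) :
    Sim J β (WV β T b φ u) (WV (β + 1) T b φ g) := by
  have hwt : ∀ s ∈ J, ∀ y, wt β (WV β T b φ u) (WV (β + 1) T b φ g) y s =
      WV (β + 1) T b (lap n φ) u y s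
      - 1 / 2 * ∑ i, y i * WV (β + 1 / 2) T b (pd i φ) u y s - β * WV β T b φ u y s
      + WV (β + 1) T b φ g y s := by
    intro s hs y
    unfold wt
    rw [lap_WV h.usc hφ (hJ s hs)]
    simp only [pd_WV h.usc hφ (hJ s hs)]
  have hwti : ∀ i, ∀ s ∈ J, ∀ y, pd i (fun z => wt β (WV β T b φ u) (WV (β + 1) T b φ g) z s) y =
      WV (β + 1 / 2 + 1) T b (lap n (pd i φ)) u y s
      - 1 / 2 * ∑ j, y j * WV (β + 1 / 2 + 1 / 2) T b (pd j (pd i φ)) u y s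
      - (β + 1 / 2) * WV (β + 1 / 2) T b (pd i φ) u y s
      + WV (β + 1 / 2 + 1) T b (pd i φ) g y s := by
    intro i s hs y
    have e : (fun z => wt β (WV β T b φ u) (WV (β + 1) T b φ g) z s) = fun y =>
      WV (β + 1) T b (lap n φ) u y s
      - 1 / 2 * ∑ i, y i * WV (β + 1 / 2) T b (pd i φ) u y s - β * WV β T b φ u y s
      + WV (β + 1) T b φ g y s := funext fun y => hwt s hs y
    have hd : ∀ {v : E n → ℝ → ℝ} {ψ : E n → ℝ} {k : ℝ}, SC I M v → Tst ψ → HasFDerivAt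
        (fun y => WV k T b ψ v y s) (fderiv ℝ (fun y => WV k T b ψ v y s) y) y := fun hv hψ =>
      ((WV_contDiff hv hψ (hJ s hs)).differentiable (by simp) y).hasFDerivAt
    have hp : ∀ {v : E n → ℝ → ℝ} {ψ : E n → ℝ} {k : ℝ}, SC I M v → Tst ψ →
        fderiv ℝ (fun y => WV k T b ψ v y s) y (bv i) = WV (k + 1 / 2) T b (pd i ψ) v y s :=
      fun hv hψ => congrFun (pd_WV hv hψ (hJ s hs) i) y
    have hy : ∀ j, HasFDerivAt (fun z : E n => z j) (EuclideanSpace.proj j : E n →L[ℝ] ℝ) y :=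
      fun j => (EuclideanSpace.proj j : E n →L[ℝ] ℝ).hasFDerivAt
    have hF := (((hd (k := β + 1) h.usc hφ.lap).fun_sub ((HasFDerivAt.fun_sum (u := Finset.univ) fun j _ =>
      (hy j).fun_mul (hd (k := β + 1 / 2) h.usc (hφ.pd j))).const_mul (1 / 2))).fun_sub
      ((hd (k := β) h.usc hφ).const_mul β)).fun_add (hd (k := β + 1) h.gsc hφ)
    rw [e]
    unfold pd at hF ⊢
    rw [hF.fderiv]
    simp only [add_apply, sub_apply, smul_apply,
      sum_apply, smul_eq_mul]
    have hF1 := hp (k := β + 1) h.usc hφ.lap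
    rw [pd_lap hφ] at hF1
    have hF2 := hp (k := β) h.usc hφ
    have hF3 := hp (k := β + 1) h.gsc hφ
    have hF4 : ∀ j, _ := fun j => hp (k := β + 1 / 2) h.usc (hφ.pd j)
    simp only [pd_comm hφ.c2 i] at hF4
    unfold pd at hF1 hF2 hF3 hF4
    rw [hF1, hF2, hF3]
    simp only [hF4, Finset.sum_add_distrib]
    have : ∑ j, WV (β + 1 / 2) T b (fun y => fderiv ℝ φ y (bv j)) u y s *
        (EuclideanSpace.proj j : E n →L[ℝ] ℝ) (bv i) =
        WV (β + 1 / 2) T b (fun y => fderiv ℝ φ y (bv i)) u y s := by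
      simp [PiLp.single_apply]
    rw [this, show β + 1 + 1 / 2 = β + 1 / 2 + 1 by ring]
    ring
  have hn : ∀ {ψ : E n → ℝ} {k : ℝ}, Tst ψ → 0 ≤ k → Nice J (WV k T b ψ u) := fun hψ hk =>
    WV_nice h.usc hψ hJ hsa hk
  have hng : ∀ {ψ : E n → ℝ} {k : ℝ}, Tst ψ → 0 ≤ k → Nice J (WV k T b ψ g) := fun hψ hk =>
    WV_nice h.gsc hψ hJ hsa hk
  refine ⟨hJo, fun s hs => WV_contDiff h.usc hφ (hJ s hs), fun s hs => ?_, fun y s hs => ?_,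
    fun i y s hs => ?_, hn hφ hβ, fun i => ?_, fun i j => ?_, ?_, fun i => ?_, hng hφ (by linarith)⟩
  · simp only [hwt s hs]
    have hcd : ∀ {ψ : E n → ℝ} {k : ℝ}, Tst ψ → ContDiff ℝ ∞ fun y => WV k T b ψ u y s := fun hψ =>
      WV_contDiff h.usc hψ (hJ s hs)
    refine (((hcd hφ.lap).sub (contDiff_const.mul (ContDiff.sum fun j _ => ?_))).sub
      (contDiff_const.mul (hcd hφ))).add (WV_contDiff h.gsc hφ (hJ s hs))
    exact ContDiff.mul (EuclideanSpace.proj j : E n →L[ℝ] ℝ).contDiff (hcd (hφ.pd j))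
  · rw [hwt s hs]
    exact hasDerivAt_WV h hI hφ (hJ s hs) y
  · rw [hwti i s hs]
    refine (hasDerivAt_WV h hI (hφ.pd i) (hJ s hs) (k := β + 1 / 2) y).congr_of_eventuallyEq ?_
    filter_upwards [hJo.mem_nhds hs] with s' hs'
    rw [pd_WV h.usc hφ (hJ s' hs')]
  · refine (hn (hφ.pd i) (k := β + 1 / 2) (by linarith)).congr fun y s hs => ?_
    rw [pd_WV h.usc hφ (hJ s hs)]
  · refine (hn ((hφ.pd i).pd j) (k := β + 1 / 2 + 1 / 2) (by linarith)).congr fun y s hs => ?_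
    rw [pd_WV h.usc hφ (hJ s hs), pd_WV h.usc (hφ.pd i) (hJ s hs)]
  · refine Nice.congr ?_ fun y s hs => hwt s hs y
    exact (((hn hφ.lap (by linarith)).sub ((Nice.sum _ fun j => (Nice.coord j).mul
      (hn (hφ.pd j) (by linarith))).const_mul _)).sub ((hn hφ hβ).const_mul _)).add
      (hng hφ (by linarith))
  · refine Nice.congr ?_ fun y s hs => hwti i s hs y
    exact (((hn (hφ.pd i).lap (by linarith)).sub ((Nice.sum _ fun j => (Nice.coord j).mul
      (hn ((hφ.pd i).pd j) (by linarith))).const_mul _)).sub ((hn (hφ.pd i) (by linarith)).const_mul _)).add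
      (hng (hφ.pd i) (by linarith))

end

end

section

/-- The full nonlinearity. -/
noncomputable def ff (p a μ z : ℝ) : ℝ := |z| ^ (p - 1) * z + hfun p a μ z

noncomputable def FF (p a μ z : ℝ) : ℝ := ∫ v in (0:ℝ)..z, ff p a μ v

noncomputable def NN (p a μ β s w : ℝ) : ℝ := Real.exp (-(β + 1) * s) * ff p a μ (Real.exp (β * s) * w)

noncomputable def PH (p a μ β s w : ℝ) : ℝ :=
  Real.exp (-(2 * β + 1) * s) * FF p a μ (Real.exp (β * s) * w)

noncomputable def PHs (p a μ β s w : ℝ) : ℝ :=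
  β * Real.exp (-(2 * β + 1) * s) * (Real.exp (β * s) * w * ff p a μ (Real.exp (β * s) * w) -
    (p + 1) * FF p a μ (Real.exp (β * s) * w))

lemma log2sq_pos (z : ℝ) : 0 < Real.log (2 + z ^ 2) := Real.log_pos (by nlinarith [sq_nonneg z])

lemma continuous_log2sq_rpow (a : ℝ) : Continuous fun z : ℝ => Real.log (2 + z ^ 2) ^ a := by
  refine Continuous.rpow_const (Continuous.log (by fun_prop) fun z => ?_) fun z => Or.inl (log2sq_pos z).ne'
  nlinarith [sq_nonneg z]

lemma abs_rpow_mul_abs {p z : ℝ} (hp : 1 < p) : |z| ^ (p - 1) * |z| = |z| ^ p := by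
  rcases eq_or_ne z 0 with rfl | h
  · simp [Real.zero_rpow (by linarith : p ≠ 0)]
  · have := Real.rpow_add_one (abs_ne_zero.2 h) (p - 1)
    rw [← this]; ring_nf

section
variable {p a μ β : ℝ}

lemma hfun_continuous (hp : 1 < p) : Continuous (hfun p a μ) := by
  unfold hfun
  refine Continuous.div ?_ (continuous_log2sq_rpow a) fun z => (Real.rpow_pos_of_pos (log2sq_pos z) a).ne'
  exact (continuous_const.mul (continuous_abs.rpow_const fun _ => Or.inr (by linarith))).mul continuous_id

lemma ff_continuous (hp : 1 < p) : Continuous (ff p a μ) := by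
  unfold ff
  exact ((continuous_abs.rpow_const fun _ => Or.inr (by linarith)).mul continuous_id).add (hfun_continuous hp)

lemma abs_hfun (hp : 1 < p) (z : ℝ) : |hfun p a μ z| = |μ| * (|z| ^ p / Real.log (2 + z ^ 2) ^ a) := by
  unfold hfun
  rw [abs_div, abs_mul, abs_mul, abs_of_pos (Real.rpow_pos_of_pos (log2sq_pos z) a),
    abs_of_nonneg (Real.rpow_nonneg (abs_nonneg z) _), mul_assoc, abs_rpow_mul_abs hp, mul_div_assoc]

noncomputable def Cf (a μ : ℝ) : ℝ := 1 + |μ| / Real.log 2 ^ a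

lemma Cf_pos (a μ : ℝ) : 0 < Cf a μ := by
  have : 0 < Real.log 2 := Real.log_pos (by norm_num)
  unfold Cf; positivity

lemma abs_ff_le (hp : 1 < p) (ha : 0 < a) (z : ℝ) : |ff p a μ z| ≤ Cf a μ * |z| ^ p := by
  have hl : 0 < Real.log 2 := Real.log_pos (by norm_num)
  unfold ff Cf
  refine (abs_add_le _ _).trans ?_
  rw [abs_hfun hp, abs_mul, abs_of_nonneg (Real.rpow_nonneg (abs_nonneg z) _), abs_rpow_mul_abs hp,
    add_mul, one_mul, div_mul_eq_mul_div, mul_div_assoc]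
  gcongr
  nlinarith [sq_nonneg z]

/-- Gain from the logarithm in similarity variables. -/
lemma exists_log_gain (hβ : 0 < β) {P c : ℝ} (hP : 0 < P) (hc : 0 < c) : ∃ C, 0 < C ∧ ∀ s, 1 ≤ s → ∀ w : ℝ,
    |w| ^ P / Real.log (2 + (Real.exp (β * s) * w) ^ 2) ^ c ≤ C * s ^ (-c) * (1 + |w| ^ P) := by
  have hl : 0 < Real.log 2 := Real.log_pos (by norm_num)
  obtain ⟨k, hk⟩ := exists_nat_ge c
  set d := P * β / 2 with hd
  have hd0 : 0 < d := by positivity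
  refine ⟨β ^ (-c) + (Real.log 2 ^ c)⁻¹ * (k.factorial / d ^ k), by positivity, fun s hs w => ?_⟩
  have hs0 : 0 < s := by linarith
  have hw : 0 ≤ |w| ^ P := Real.rpow_nonneg (abs_nonneg w) _
  rcases le_or_gt (Real.exp (-(β * s / 2))) |w| with h | h
  · have h1 : β * s ≤ Real.log (2 + (Real.exp (β * s) * w) ^ 2) := by
      rw [Real.le_log_iff_exp_le (by positivity)]
      have : Real.exp (β * s) = (Real.exp (β * s) * Real.exp (-(β * s / 2))) ^ 2 := by
        rw [← Real.exp_add, ← Real.exp_nat_mul]; congr 1; push_cast; ring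
      calc _ = (Real.exp (β * s) * Real.exp (-(β * s / 2))) ^ 2 := this
        _ ≤ (Real.exp (β * s) * |w|) ^ 2 := by gcongr
        _ = (Real.exp (β * s) * w) ^ 2 := by rw [mul_pow, sq_abs, mul_pow]
        _ ≤ _ := by linarith
    have h2 : (β * s) ^ c ≤ Real.log (2 + (Real.exp (β * s) * w) ^ 2) ^ c := by gcongr
    calc _ ≤ |w| ^ P / (β * s) ^ c := by gcongr
      _ = β ^ (-c) * s ^ (-c) * |w| ^ P := by
        rw [Real.mul_rpow hβ.le hs0.le, Real.rpow_neg hβ.le, Real.rpow_neg hs0.le]; field_simp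
      _ ≤ (β ^ (-c) + (Real.log 2 ^ c)⁻¹ * (k.factorial / d ^ k)) * s ^ (-c) * (1 + |w| ^ P) := by
        gcongr
        · have : 0 ≤ (Real.log 2 ^ c)⁻¹ * (k.factorial / d ^ k) := by positivity
          linarith
        · linarith
  · have h1 : |w| ^ P ≤ Real.exp (-(d * s)) := by
      calc |w| ^ P ≤ Real.exp (-(β * s / 2)) ^ P := by gcongr
        _ = _ := by rw [← Real.exp_mul]; congr 1; rw [hd]; ring
    have h2 : Real.exp (-(d * s)) ≤ (k.factorial / d ^ k) * s ^ (-c) := by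
      have e1 := Real.pow_div_factorial_le_exp (d * s) (by positivity) k
      have e2 : s ^ c ≤ s ^ k := by
        rw [← Real.rpow_natCast]; exact Real.rpow_le_rpow_of_exponent_le hs hk
      rw [Real.exp_neg, Real.rpow_neg hs0.le, ← div_eq_mul_inv, inv_eq_one_div, div_le_div_iff₀ (Real.exp_pos _) (by positivity)]
      rw [one_mul, div_mul_eq_mul_div, le_div_iff₀ (by positivity)]
      rw [div_le_iff₀ (by positivity), mul_pow] at e1
      nlinarith [pow_pos hd0 k]
    calc _ ≤ Real.exp (-(d * s)) / Real.log 2 ^ c := by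
          gcongr
          nlinarith [sq_nonneg (Real.exp (β * s) * w)]
      _ ≤ (k.factorial / d ^ k) * s ^ (-c) / Real.log 2 ^ c := by gcongr
      _ = ((Real.log 2 ^ c)⁻¹ * (k.factorial / d ^ k)) * s ^ (-c) * 1 := by rw [div_eq_mul_inv]; ring
      _ ≤ _ := by
        gcongr
        · have : 0 ≤ β ^ (-c) := by positivity
          linarith
        · linarith

lemma exp_rpow_aux (hβ : β * (p - 1) = 1) (s : ℝ) : Real.exp (β * s) ^ p = Real.exp ((β + 1) * s) := by
  rw [← Real.exp_mul]; congr 1; linear_combination s * hβ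

lemma NN_sub (hβ : β * (p - 1) = 1) (s w : ℝ) :
    NN p a μ β s w - |w| ^ (p - 1) * w =
      Real.exp (-(β + 1) * s) * hfun p a μ (Real.exp (β * s) * w) := by
  unfold NN ff
  have h1 : Real.exp (-(β + 1) * s) * (|Real.exp (β * s) * w| ^ (p - 1) * (Real.exp (β * s) * w)) =
      |w| ^ (p - 1) * w := by
    rw [abs_mul, abs_of_pos (Real.exp_pos _), Real.mul_rpow (Real.exp_pos _).le (abs_nonneg _),
      ← Real.exp_mul]
    have : Real.exp (-(β + 1) * s) * Real.exp (β * s * (p - 1)) * Real.exp (β * s) = 1 := by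
      rw [← Real.exp_add, ← Real.exp_add, Real.exp_eq_one_iff]
      linear_combination s * hβ
    linear_combination (|w| ^ (p - 1) * w) * this
  rw [mul_add, h1]; ring

lemma beta_pos (hp : 1 < p) (hβ : β * (p - 1) = 1) : 0 < β := by
  by_contra h
  nlinarith

lemma abs_exp_hfun (hp : 1 < p) (hβ : β * (p - 1) = 1) (s w : ℝ) :
    |Real.exp (-(β + 1) * s) * hfun p a μ (Real.exp (β * s) * w)| =
      |μ| * (|w| ^ p / Real.log (2 + (Real.exp (β * s) * w) ^ 2) ^ a) := by
  rw [abs_mul, abs_of_pos (Real.exp_pos _), abs_hfun hp, abs_mul, abs_of_pos (Real.exp_pos (β * s)),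
    Real.mul_rpow (Real.exp_pos _).le (abs_nonneg _), exp_rpow_aux hβ]
  have : Real.exp (-(β + 1) * s) * Real.exp ((β + 1) * s) = 1 := by
    rw [← Real.exp_add, Real.exp_eq_one_iff]; ring
  linear_combination (|μ| * (|w| ^ p / Real.log (2 + (Real.exp (β * s) * w) ^ 2) ^ a)) * this

lemma exists_NN_bound (hp : 1 < p) (ha : 0 < a) (hβ : β * (p - 1) = 1) : ∃ C, 0 < C ∧ ∀ s, 1 ≤ s → ∀ w : ℝ,
    |NN p a μ β s w - |w| ^ (p - 1) * w| ≤ C * s ^ (-a) * (1 + |w| ^ p) := by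
  obtain ⟨C, hC, h⟩ := exists_log_gain (beta_pos hp hβ) (show 0 < p by linarith) ha
  refine ⟨(|μ| + 1) * C, by positivity, fun s hs w => ?_⟩
  rw [NN_sub hβ, abs_exp_hfun hp hβ]
  have hs0 : 0 < s := by linarith
  have := h s hs w
  have h0 : 0 ≤ C * s ^ (-a) * (1 + |w| ^ p) := by positivity
  nlinarith [mul_le_mul_of_nonneg_left this (abs_nonneg μ)]

lemma abs_NN_le (hp : 1 < p) (ha : 0 < a) (hβ : β * (p - 1) = 1) (s w : ℝ) :
    |NN p a μ β s w| ≤ Cf a μ * |w| ^ p := by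
  unfold NN
  rw [abs_mul, abs_of_pos (Real.exp_pos _)]
  have h1 := abs_ff_le (μ := μ) hp ha (Real.exp (β * s) * w)
  rw [abs_mul, abs_of_pos (Real.exp_pos (β * s)), Real.mul_rpow (Real.exp_pos _).le (abs_nonneg _),
    exp_rpow_aux hβ] at h1
  have : Real.exp (-(β + 1) * s) * Real.exp ((β + 1) * s) = 1 := by
    rw [← Real.exp_add, Real.exp_eq_one_iff]; ring
  calc _ ≤ Real.exp (-(β + 1) * s) * (Cf a μ * (Real.exp ((β + 1) * s) * |w| ^ p)) := by gcongr
    _ = _ := by linear_combination (Cf a μ * |w| ^ p) * this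

lemma NN_continuous (hp : 1 < p) : Continuous fun q : ℝ × ℝ => NN p a μ β q.1 q.2 := by
  unfold NN
  exact Continuous.mul (by fun_prop) ((ff_continuous hp).comp (by fun_prop))

lemma hasDerivAt_FF (hp : 1 < p) (z : ℝ) : HasDerivAt (FF p a μ) (ff p a μ z) z :=
  intervalIntegral.integral_hasDerivAt_right ((ff_continuous hp).intervalIntegrable _ _)
    ((ff_continuous hp).stronglyMeasurableAtFilter _ _) (ff_continuous hp).continuousAt

lemma FF_continuous (hp : 1 < p) : Continuous (FF p a μ) :=
  continuous_iff_continuousAt.2 fun z => (hasDerivAt_FF hp z).continuousAt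

lemma FF_zero : FF p a μ 0 = 0 := by simp [FF]

lemma PH_zero (s : ℝ) : PH p a μ β s 0 = 0 := by simp [PH, FF_zero]

lemma hasDerivAt_PH (hp : 1 < p) (s w : ℝ) : HasDerivAt (PH p a μ β s) (NN p a μ β s w) w := by
  unfold PH NN
  have h1 : HasDerivAt (fun w : ℝ => Real.exp (β * s) * w) (Real.exp (β * s)) w := by
    simpa using (hasDerivAt_id w).const_mul (Real.exp (β * s))
  have h2 := ((hasDerivAt_FF (a := a) (μ := μ) hp _).comp w h1).const_mul (Real.exp (-(2 * β + 1) * s))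
  refine h2.congr_deriv ?_
  have : Real.exp (-(2 * β + 1) * s) * Real.exp (β * s) = Real.exp (-(β + 1) * s) := by
    rw [← Real.exp_add]; congr 1; ring
  rw [← this]; ring

lemma hasDerivAt_PH_comp (hp : 1 < p) (hβ : β * (p - 1) = 1) {w : ℝ → ℝ} {w' s : ℝ}
    (hw : HasDerivAt w w' s) :
    HasDerivAt (fun s => PH p a μ β s (w s)) (NN p a μ β s (w s) * w' + PHs p a μ β s (w s)) s := by
  unfold PH NN PHs
  have h0 : HasDerivAt (fun s : ℝ => Real.exp (β * s)) (Real.exp (β * s) * β) s := by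
    simpa using ((hasDerivAt_id s).const_mul β).exp
  have h0' : HasDerivAt (fun s : ℝ => Real.exp (-(2 * β + 1) * s))
      (Real.exp (-(2 * β + 1) * s) * (-(2 * β + 1))) s := by
    simpa using ((hasDerivAt_id s).const_mul (-(2 * β + 1))).exp
  have h2 := h0'.mul ((hasDerivAt_FF (a := a) (μ := μ) hp _).comp s (h0.mul hw))
  refine h2.congr_deriv ?_
  have : Real.exp (-(2 * β + 1) * s) * Real.exp (β * s) = Real.exp (-(β + 1) * s) := by
    rw [← Real.exp_add]; congr 1; ring
  have e : 2 * β + 1 = β * (p + 1) := by linear_combination -hβ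
  rw [← this]
  simp only [Pi.mul_apply, Function.comp]
  linear_combination (-Real.exp (-(2 * β + 1) * s) * FF p a μ (Real.exp (β * s) * w s)) * e

lemma PH_continuous (hp : 1 < p) : Continuous fun q : ℝ × ℝ => PH p a μ β q.1 q.2 := by
  unfold PH
  exact Continuous.mul (by fun_prop) ((FF_continuous hp).comp (by fun_prop))

lemma PHs_continuous (hp : 1 < p) : Continuous fun q : ℝ × ℝ => PHs p a μ β q.1 q.2 := by
  unfold PHs
  refine Continuous.mul (by fun_prop) (Continuous.sub (Continuous.mul (by fun_prop)
    ((ff_continuous hp).comp (by fun_prop))) (continuous_const.mul ((FF_continuous hp).comp (by fun_prop))))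

lemma hasDerivAt_abs_rpow_div (hp : 1 < p) (w : ℝ) :
    HasDerivAt (fun w : ℝ => |w| ^ (p + 1) / (p + 1)) (|w| ^ (p - 1) * w) w := by
  have := (hasDerivAt_abs_rpow w (show 1 < p + 1 by linarith)).div_const (p + 1)
  refine this.congr_deriv ?_
  rw [show p + 1 - 2 = p - 1 by ring]
  have : p + 1 ≠ 0 := by linarith
  field_simp

lemma abs_le_of_deriv_le {F F' : ℝ → ℝ} (hF : ∀ w, HasDerivAt F (F' w) w) (h0 : F 0 = 0) {w C : ℝ}
    (hC : ∀ v, |v| ≤ |w| → |F' v| ≤ C) : |F w| ≤ C * |w| := by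
  have := (convex_closedBall (0:ℝ) |w|).norm_image_sub_le_of_norm_hasDerivWithin_le (f := F) (f' := F')
    (fun x _ => (hF x).hasDerivWithinAt) (fun x hx => hC x (by simpa using hx))
    (show (0:ℝ) ∈ _ by simp) (show w ∈ Metric.closedBall (0:ℝ) |w| by simp)
  simpa [h0] using this

lemma one_add_rpow_mul_le (hp : 1 < p) (w : ℝ) : (1 + |w| ^ p) * |w| ≤ 2 * (1 + |w| ^ (p + 1)) := by
  have h1 : |w| ^ p * |w| = |w| ^ (p + 1) := by
    have := abs_rpow_mul_abs (z := w) (show 1 < p + 1 by linarith)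
    rwa [add_sub_cancel_right] at this
  have h2 : |w| ≤ 1 + |w| ^ (p + 1) := by
    rcases le_or_gt |w| 1 with h | h
    · have := Real.rpow_nonneg (abs_nonneg w) (p + 1); linarith
    · have := Real.self_le_rpow_of_one_le h.le (show 1 ≤ p + 1 by linarith); linarith
  have h3 := Real.rpow_nonneg (abs_nonneg w) (p + 1)
  nlinarith

lemma exists_PH_bound (hp : 1 < p) (ha : 0 < a) (hβ : β * (p - 1) = 1) : ∃ C, 0 < C ∧ ∀ s, 1 ≤ s → ∀ w : ℝ,
    |PH p a μ β s w - |w| ^ (p + 1) / (p + 1)| ≤ C * s ^ (-a) * (1 + |w| ^ (p + 1)) := by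
  obtain ⟨C, hC, h⟩ := exists_NN_bound (μ := μ) hp ha hβ
  refine ⟨2 * C, by positivity, fun s hs w => ?_⟩
  have hs0 : 0 < s := by linarith
  have h1 := abs_le_of_deriv_le (F := fun w => PH p a μ β s w - |w| ^ (p + 1) / (p + 1))
    (fun w => (hasDerivAt_PH hp s w).sub (hasDerivAt_abs_rpow_div hp w))
    (by simp [PH_zero, Real.zero_rpow (by linarith : p + 1 ≠ 0)]) (w := w)
    (C := C * s ^ (-a) * (1 + |w| ^ p)) fun v hv => (h s hs v).trans (by gcongr)
  refine h1.trans ?_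
  have := one_add_rpow_mul_le hp w
  have h0 : 0 ≤ C * s ^ (-a) := by positivity
  nlinarith

lemma exists_mulNN_bound (hp : 1 < p) (ha : 0 < a) (hβ : β * (p - 1) = 1) : ∃ C, 0 < C ∧ ∀ s, 1 ≤ s → ∀ w : ℝ,
    |w * NN p a μ β s w - |w| ^ (p + 1)| ≤ C * s ^ (-a) * (1 + |w| ^ (p + 1)) := by
  obtain ⟨C, hC, h⟩ := exists_NN_bound (μ := μ) hp ha hβ
  refine ⟨2 * C, by positivity, fun s hs w => ?_⟩
  have hs0 : 0 < s := by linarith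
  have e : w * NN p a μ β s w - |w| ^ (p + 1) = (NN p a μ β s w - |w| ^ (p - 1) * w) * w := by
    have h1 : |w| ^ p * |w| = |w| ^ (p + 1) := by
      have := abs_rpow_mul_abs (z := w) (show 1 < p + 1 by linarith)
      rwa [add_sub_cancel_right] at this
    rw [← h1, ← abs_rpow_mul_abs hp, mul_assoc (|w| ^ (p - 1)), abs_mul_abs_self]; ring
  rw [e, abs_mul]
  have := one_add_rpow_mul_le hp w
  have h0 : 0 ≤ C * s ^ (-a) := by positivity
  nlinarith [mul_le_mul_of_nonneg_right (h s hs w) (abs_nonneg w)]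

end

end

section

section
variable {p a μ β : ℝ}

lemma mul_hfun (hp : 1 < p) (z : ℝ) :
    z * hfun p a μ z = μ * (|z| ^ (p + 1) / Real.log (2 + z ^ 2) ^ a) := by
  have h1 : |z| ^ p * |z| = |z| ^ (p + 1) := by
    have := abs_rpow_mul_abs (z := z) (show 1 < p + 1 by linarith)
    rwa [add_sub_cancel_right] at this
  unfold hfun
  rw [← h1, ← abs_rpow_mul_abs hp, mul_assoc (|z| ^ (p - 1)), abs_mul_abs_self]; ring

lemma hasDerivAt_mul_hfun (hp : 1 < p) (z : ℝ) :
    HasDerivAt (fun z => z * hfun p a μ z) ((p + 1) * hfun p a μ z -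
      2 * a * μ * (|z| ^ (p + 1) * z / (2 + z ^ 2) / Real.log (2 + z ^ 2) ^ (a + 1))) z := by
  have hL := log2sq_pos z
  have e : (fun z => z * hfun p a μ z) =
      fun z => μ * (|z| ^ (p + 1) * Real.log (2 + z ^ 2) ^ (-a)) := by
    funext z
    rw [mul_hfun hp, Real.rpow_neg (log2sq_pos z).le, div_eq_mul_inv]
  rw [e]
  have hz : (2 + z ^ 2) ≠ 0 := by nlinarith [sq_nonneg z]
  have h1 := hasDerivAt_abs_rpow z (show 1 < p + 1 by linarith)
  have h2 : HasDerivAt (fun z : ℝ => 2 + z ^ 2) (2 * z) z := by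
    simpa using (hasDerivAt_pow 2 z).const_add 2
  have h3 := (h2.log hz).rpow_const (p := -a) (Or.inl hL.ne')
  have h4 := (h1.mul h3).const_mul μ
  refine h4.congr_deriv ?_
  unfold hfun
  rw [show p + 1 - 2 = p - 1 by ring, show -a - 1 = -(a + 1) by ring, Real.rpow_neg hL.le, Real.rpow_neg hL.le]
  have := (Real.rpow_pos_of_pos hL a).ne'
  have := (Real.rpow_pos_of_pos hL (a + 1)).ne'
  field_simp
  ring

lemma exists_PHs_bound (hp : 1 < p) (ha : 0 < a) (hβ : β * (p - 1) = 1) : ∃ C, 0 < C ∧ ∀ s, 1 ≤ s → ∀ w : ℝ,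
    |PHs p a μ β s w| ≤ C * s ^ (-1 - a) * (1 + |w| ^ (p + 1)) := by
  have hβ0 := beta_pos hp hβ
  obtain ⟨C, hC, h⟩ := exists_log_gain hβ0 (show 0 < p by linarith) (show 0 < a + 1 by linarith)
  refine ⟨2 * (β * (2 * a * |μ| + 1) * C), by positivity, fun s hs w => ?_⟩
  have hs0 : 0 < s := by linarith
  have hd : ∀ z, HasDerivAt (fun z => z * ff p a μ z - (p + 1) * FF p a μ z)
      (- (2 * a * μ * (|z| ^ (p + 1) * z / (2 + z ^ 2) / Real.log (2 + z ^ 2) ^ (a + 1)))) z := fun z => by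
    have h1 := hasDerivAt_mul_hfun (a := a) (μ := μ) hp z
    have h2 := hasDerivAt_abs_rpow_div (show 1 < p by linarith) z
    have h3 := ((h2.const_mul (p + 1)).add h1).sub ((hasDerivAt_FF (a := a) (μ := μ) hp z).const_mul (p + 1))
    have e : (fun z => z * ff p a μ z - (p + 1) * FF p a μ z) =
        fun z => (p + 1) * (|z| ^ (p + 1) / (p + 1)) + z * hfun p a μ z - (p + 1) * FF p a μ z := by
      funext z
      have h1 : |z| ^ p * |z| = |z| ^ (p + 1) := by
        have := abs_rpow_mul_abs (z := z) (show 1 < p + 1 by linarith)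
        rwa [add_sub_cancel_right] at this
      have h0 : p + 1 ≠ 0 := by linarith
      rw [mul_div_cancel₀ _ h0, ← h1, ← abs_rpow_mul_abs hp, mul_assoc (|z| ^ (p - 1)), abs_mul_abs_self]
      unfold ff; ring
    rw [e]
    refine h3.congr_deriv ?_
    unfold ff; ring
  have hF : ∀ v, HasDerivAt (PHs p a μ β s) (β * Real.exp (-(2 * β + 1) * s) *
      (- (2 * a * μ * (|Real.exp (β * s) * v| ^ (p + 1) * (Real.exp (β * s) * v) /
        (2 + (Real.exp (β * s) * v) ^ 2) / Real.log (2 + (Real.exp (β * s) * v) ^ 2) ^ (a + 1))) *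
        Real.exp (β * s))) v := fun v => by
    have h1 : HasDerivAt (fun w : ℝ => Real.exp (β * s) * w) (Real.exp (β * s)) v := by
      simpa using (hasDerivAt_id v).const_mul (Real.exp (β * s))
    exact ((hd _).comp v h1).const_mul (β * Real.exp (-(2 * β + 1) * s))
  have key := abs_le_of_deriv_le hF (by simp [PHs, FF_zero]) (w := w)
    (C := β * (2 * a * |μ| + 1) * C * s ^ (-1 - a) * (1 + |w| ^ p)) fun v hv => by
      set z := Real.exp (β * s) * v with hz
      have hL := log2sq_pos z
      have hB : |v| ^ p / Real.log (2 + z ^ 2) ^ (a + 1) ≤ C * s ^ (-1 - a) * (1 + |w| ^ p) := by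
        have := h s hs v
        rw [← hz, show -(a + 1) = -1 - a by ring] at this
        exact this.trans (by gcongr)
      have hB0 : 0 ≤ |v| ^ p / Real.log (2 + z ^ 2) ^ (a + 1) := by positivity
      have e1 : |z| ^ (p + 1) * |z| / (2 + z ^ 2) ≤ |z| ^ p := by
        rw [div_le_iff₀ (by positivity)]
        have : |z| ^ (p + 1) * |z| = |z| ^ p * z ^ 2 := by
          have h1 : |z| ^ p * |z| = |z| ^ (p + 1) := by
            have := abs_rpow_mul_abs (z := z) (show 1 < p + 1 by linarith)
            rwa [add_sub_cancel_right] at this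
          rw [← h1, mul_assoc, abs_mul_abs_self]; ring
        rw [this]
        have : 0 ≤ |z| ^ p := by positivity
        nlinarith
      have e2 : Real.exp (-(2 * β + 1) * s) * Real.exp (β * s) * |z| ^ p = |v| ^ p := by
        rw [hz, abs_mul, abs_of_pos (Real.exp_pos _), Real.mul_rpow (Real.exp_pos _).le (abs_nonneg _),
          exp_rpow_aux hβ, ← mul_assoc, ← Real.exp_add, ← Real.exp_add]
        have : -(2 * β + 1) * s + β * s + (β + 1) * s = 0 := by ring
        rw [this]; simp
      rw [abs_mul, abs_mul, abs_mul, abs_neg, abs_mul, abs_mul, abs_mul, abs_div, abs_div, abs_mul,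
        abs_of_pos hβ0, abs_of_pos (Real.exp_pos _), abs_of_pos (Real.exp_pos _), abs_of_pos ha,
        abs_of_pos (Real.rpow_pos_of_pos hL _), abs_of_pos (show (0:ℝ) < 2 + z ^ 2 by positivity),
        abs_of_nonneg (Real.rpow_nonneg (abs_nonneg z) _), abs_two]
      calc _ ≤ β * Real.exp (-(2 * β + 1) * s) * (2 * a * |μ| * (|z| ^ p / Real.log (2 + z ^ 2) ^ (a + 1))
            * Real.exp (β * s)) := by gcongr
        _ = β * (2 * a * |μ|) * (Real.exp (-(2 * β + 1) * s) * Real.exp (β * s) * |z| ^ p / Real.log (2 + z ^ 2) ^ (a + 1)) := by ring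
        _ = β * (2 * a * |μ|) * (|v| ^ p / Real.log (2 + z ^ 2) ^ (a + 1)) := by rw [e2]
        _ ≤ β * (2 * a * |μ| + 1) * (C * s ^ (-1 - a) * (1 + |w| ^ p)) := by
          gcongr; linarith
        _ = _ := by ring
  refine key.trans ?_
  have := one_add_rpow_mul_le hp w
  have h0 : 0 ≤ β * (2 * a * |μ| + 1) * C * s ^ (-1 - a) := by positivity
  nlinarith

lemma abs_PH_le (hp : 1 < p) (ha : 0 < a) (hβ : β * (p - 1) = 1) (s w : ℝ) :
    |PH p a μ β s w| ≤ Cf a μ * |w| ^ (p + 1) := by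
  have hC := Cf_pos a μ
  have := abs_le_of_deriv_le (hasDerivAt_PH (a := a) (μ := μ) (β := β) hp s) (PH_zero s) (w := w)
    (C := Cf a μ * |w| ^ p) fun v hv => (abs_NN_le hp ha hβ s v).trans (by gcongr)
  have h1 : |w| ^ p * |w| = |w| ^ (p + 1) := by
    have := abs_rpow_mul_abs (z := w) (show 1 < p + 1 by linarith)
    rwa [add_sub_cancel_right] at this
  rwa [mul_assoc, h1] at this

end

section
variable {n : ℕ} {J : Set ℝ} {w : E n → ℝ → ℝ}

lemma Nice.comp (hw : Nice J w) {G : ℝ → ℝ → ℝ} (hG : Continuous fun q : ℝ × ℝ => G q.1 q.2)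
    {C r : ℝ} (hr : 0 ≤ r) (hC : 0 ≤ C) (hb : ∀ s ∈ J, ∀ z, |G s z| ≤ C * (1 + |z| ^ r)) :
    Nice J fun y s => G s (w y s) where
  cy s hs := hG.comp (continuous_const.prodMk (hw.cy s hs))
  cs y := hG.comp_continuousOn (continuousOn_id.prodMk (hw.cs y))
  gr := by
    obtain ⟨k, C', hC', h⟩ := hw.gr
    obtain ⟨m, hm⟩ := exists_nat_ge r
    refine ⟨k * m, C * (1 + (1 + C') ^ m), by positivity, fun y s hs => (hb s hs _).trans ?_⟩
    have h1 := h y s hs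
    have h0 : 1 ≤ 1 + ‖y‖ := by linarith [norm_nonneg y]
    have hk : 1 ≤ (1 + ‖y‖) ^ k := one_le_pow₀ h0
    have h2 : |w y s| ≤ (1 + C') * (1 + ‖y‖) ^ k := by nlinarith
    have h3 : 1 ≤ (1 + C') * (1 + ‖y‖) ^ k := by nlinarith
    have h4 : |w y s| ^ r ≤ (1 + C') ^ m * (1 + ‖y‖) ^ (k * m) := by
      calc _ ≤ ((1 + C') * (1 + ‖y‖) ^ k) ^ r := by gcongr
        _ ≤ ((1 + C') * (1 + ‖y‖) ^ k) ^ (m : ℝ) := Real.rpow_le_rpow_of_exponent_le h3 hm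
        _ = _ := by rw [Real.rpow_natCast, mul_pow, pow_mul]
    have h5 : 1 ≤ (1 + ‖y‖) ^ (k * m) := one_le_pow₀ h0
    calc _ ≤ C * ((1 + ‖y‖) ^ (k * m) + (1 + C') ^ m * (1 + ‖y‖) ^ (k * m)) := by gcongr
      _ = _ := by ring

lemma Nice.rpow (hw : Nice J w) {r : ℝ} (hr : 0 < r) : Nice J fun y s => |w y s| ^ r :=
  hw.comp (G := fun _ z => |z| ^ r) ((continuous_abs.comp continuous_snd).rpow_const fun _ => Or.inr hr.le)
    hr.le zero_le_one fun s _ z => by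
      rw [abs_of_nonneg (Real.rpow_nonneg (abs_nonneg z) _)]; linarith

variable {p a μ β : ℝ}

lemma Nice.NN (hw : Nice J w) (hp : 1 < p) (ha : 0 < a) (hβ : β * (p - 1) = 1) :
    Nice J fun y s => NN p a μ β s (w y s) :=
  hw.comp (NN_continuous hp) (by linarith : 0 ≤ p) (Cf_pos a μ).le fun s _ z => by
    have := abs_NN_le (μ := μ) hp ha hβ s z
    have := Cf_pos a μ
    linarith

lemma Nice.PH (hw : Nice J w) (hp : 1 < p) (ha : 0 < a) (hβ : β * (p - 1) = 1) :
    Nice J fun y s => PH p a μ β s (w y s) :=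
  hw.comp (PH_continuous hp) (by linarith : 0 ≤ p + 1) (Cf_pos a μ).le fun s _ z => by
    have := abs_PH_le (μ := μ) hp ha hβ s z
    have := Cf_pos a μ
    linarith

lemma abs_PHs_le (hp : 1 < p) (ha : 0 < a) (hβ : β * (p - 1) = 1) (s w : ℝ) :
    |PHs p a μ β s w| ≤ β * (p + 2) * Cf a μ * |w| ^ (p + 1) := by
  have hβ0 := beta_pos hp hβ
  have e : PHs p a μ β s w = β * (w * GK.NN p a μ β s w - (p + 1) * GK.PH p a μ β s w) := by
    unfold PHs GK.NN GK.PH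
    have : Real.exp (-(2 * β + 1) * s) * Real.exp (β * s) = Real.exp (-(β + 1) * s) := by
      rw [← Real.exp_add]; congr 1; ring
    rw [← this]; ring
  have h1 : |w| * |w| ^ p = |w| ^ (p + 1) := by
    have := abs_rpow_mul_abs (z := w) (show 1 < p + 1 by linarith)
    rw [add_sub_cancel_right] at this
    rw [mul_comm, this]
  have h2 := abs_NN_le (μ := μ) hp ha hβ s w
  have h3 := abs_PH_le (μ := μ) hp ha hβ s w
  have hp1 : 0 ≤ p + 1 := by linarith
  rw [e, abs_mul, abs_of_pos hβ0]
  calc _ ≤ β * (|w| * |GK.NN p a μ β s w| + (p + 1) * |GK.PH p a μ β s w|) := by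
        gcongr
        refine (abs_sub _ _).trans ?_
        rw [abs_mul, abs_mul, abs_of_nonneg hp1]
    _ ≤ β * (|w| * (Cf a μ * |w| ^ p) + (p + 1) * (Cf a μ * |w| ^ (p + 1))) := by gcongr
    _ = _ := by rw [← h1]; ring

lemma Nice.PHs (hw : Nice J w) (hp : 1 < p) (ha : 0 < a) (hβ : β * (p - 1) = 1) :
    Nice J fun y s => PHs p a μ β s (w y s) := by
  have hβ0 := beta_pos hp hβ
  have := Cf_pos a μ
  refine hw.comp (C := β * (p + 2) * Cf a μ) (PHs_continuous hp) (by linarith : 0 ≤ p + 1) ?_ fun s _ z => ?_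
  · have : 0 < p + 2 := by linarith
    positivity
  · have h1 := abs_PHs_le (μ := μ) hp ha hβ s z
    have : 0 ≤ β * (p + 2) * Cf a μ := by
      have : 0 < p + 2 := by linarith
      positivity
    linarith

end

end

section

lemma antitone_of_hasDerivAt {f f' : ℝ → ℝ} {c d : ℝ} (hc : ContinuousOn f (Set.Icc c d))
    (hf : ∀ s ∈ Set.Ioo c d, HasDerivAt f (f' s) s) (h : ∀ s ∈ Set.Ioo c d, f' s ≤ 0) :
    AntitoneOn f (Set.Icc c d) := by
  refine antitoneOn_of_deriv_nonpos (convex_Icc c d) hc ?_ ?_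
  · rw [interior_Icc]; exact fun s hs => (hf s hs).differentiableAt.differentiableWithinAt
  · rw [interior_Icc]; intro s hs; rw [(hf s hs).deriv]; exact h s hs

lemma hasDerivAt_integral_of_continuousOn {f : ℝ → ℝ} {c d s : ℝ} (hf : ContinuousOn f (Set.Icc c d))
    (hs : s ∈ Set.Ioo c d) : HasDerivAt (fun s => ∫ v in c..s, f v) (f s) s := by
  have hn : Set.Icc c d ∈ 𝓝 s := Icc_mem_nhds hs.1 hs.2
  refine intervalIntegral.integral_hasDerivAt_right ?_ ?_ (hf.continuousAt hn)
  · refine (hf.mono ?_).intervalIntegrable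
    rw [Set.uIcc_of_le hs.1.le]; exact Set.Icc_subset_Icc_right hs.2.le
  · exact ⟨_, hn, hf.aestronglyMeasurable measurableSet_Icc⟩

lemma continuousOn_integral {f : ℝ → ℝ} {c d : ℝ} (hcd : c ≤ d) (hf : ContinuousOn f (Set.Icc c d)) :
    ContinuousOn (fun s => ∫ v in c..s, f v) (Set.Icc c d) := by
  have := intervalIntegral.continuousOn_primitive_interval (μ := volume) (f := f) (a := c) (b := d)
    (by rw [Set.uIcc_of_le hcd]; exact hf.integrableOn_Icc)
  rwa [Set.uIcc_of_le hcd] at this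

lemma exists_lt_of_integral_lt {f : ℝ → ℝ} {c e : ℝ} (hf : ContinuousOn f (Set.Icc c (c + 1)))
    (h : ∫ v in c..(c + 1), f v < e) : ∃ σ ∈ Set.Icc c (c + 1), f σ < e := by
  by_contra! hh
  have h1 := intervalIntegral.integral_mono_on (a := c) (b := c + 1) (μ := volume) (by linarith) intervalIntegrable_const
    (hf.mono (by rw [Set.uIcc_of_le (by linarith)])).intervalIntegrable hh
  simp at h1
  linarith

/-- Finite time blow-up for a superlinear differential inequality. -/
lemma blowup_time_le {y y' : ℝ → ℝ} {c d c0 e q : ℝ} (hcd : c ≤ d) (hq : 1 < q) (hc0 : 0 < c0) (he : 0 ≤ e)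
    (hy : ∀ s ∈ Set.Icc c d, HasDerivAt y (y' s) s) (h0 : ∀ s ∈ Set.Icc c d, 0 ≤ y s)
    (hi : ∀ s ∈ Set.Icc c d, c0 * y s ^ q - e ≤ y' s) (hc : 2 * e < c0 * y c ^ q) :
    (q - 1) * (c0 / 2) * (d - c) ≤ y c ^ (1 - q) := by
  have hyc : 0 < y c := by
    rcases (h0 c ⟨le_rfl, hcd⟩).lt_or_eq with h | h
    · exact h
    · rw [← h, Real.zero_rpow (by linarith)] at hc; linarith
  have hcont : ContinuousOn y (Set.Icc c d) := fun s hs => (hy s hs).continuousAt.continuousWithinAt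
  have hge : ∀ s ∈ Set.Icc c d, y c ≤ y s := by
    have := image_le_of_liminf_slope_right_lt_deriv_boundary' (f := fun _ => y c) (f' := fun _ => 0) (a := c) (b := d)
      continuousOn_const (fun x _ r hr => ?_) (B := y) (B' := y') le_rfl hcont
      (fun x hx => (hy x ⟨hx.1, hx.2.le⟩).hasDerivWithinAt) (fun x hx he' => ?_)
    · exact fun s hs => this hs
    · refine (eventually_of_mem self_mem_nhdsWithin fun z hz => ?_).frequently
      simpa [slope_def_field] using hr
    · have := hi x ⟨hx.1, hx.2.le⟩
      rw [← he'] at this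
      linarith
  have hpos : ∀ s ∈ Set.Icc c d, 0 < y s := fun s hs => hyc.trans_le (hge s hs)
  have hanti : AntitoneOn (fun s => y s ^ (1 - q) + (q - 1) * (c0 / 2) * (s - c)) (Set.Icc c d) := by
    have hd : ∀ s ∈ Set.Icc c d, HasDerivAt (fun s => y s ^ (1 - q) + (q - 1) * (c0 / 2) * (s - c))
        (y' s * (1 - q) * y s ^ (1 - q - 1) + (q - 1) * (c0 / 2) * 1) s := fun s hs =>
      ((hy s hs).rpow_const (Or.inl (hpos s hs).ne')).add (((hasDerivAt_id s).sub_const c).const_mul _)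
    refine antitone_of_hasDerivAt (fun s hs => (hd s hs).continuousAt.continuousWithinAt)
      (fun s hs => hd s (Set.Ioo_subset_Icc_self hs)) fun s hs => ?_
    have hs' := Set.Ioo_subset_Icc_self hs
    have hp := hpos s hs'
    have h1 : y c ^ q ≤ y s ^ q := Real.rpow_le_rpow hyc.le (hge s hs') (by linarith)
    have h2 : c0 / 2 * y s ^ q ≤ y' s := by
      have := hi s hs'
      nlinarith
    have h3 : y s ^ q * y s ^ (1 - q - 1) = 1 := by
      rw [← Real.rpow_add hp]; ring_nf; exact Real.rpow_zero _
    have h4 : 0 < y s ^ (1 - q - 1) := Real.rpow_pos_of_pos hp _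
    have h5 : c0 / 2 ≤ y' s * y s ^ (1 - q - 1) := by
      calc c0 / 2 = c0 / 2 * y s ^ q * y s ^ (1 - q - 1) := by rw [mul_assoc, h3, mul_one]
        _ ≤ _ := by gcongr
    nlinarith
  have := hanti ⟨le_rfl, hcd⟩ ⟨hcd, le_rfl⟩ hcd
  have h6 : 0 < y d ^ (1 - q) := Real.rpow_pos_of_pos (hpos d ⟨hcd, le_rfl⟩) _
  simp only [sub_self, mul_zero, add_zero] at this
  linarith

/-- The differential inequalities satisfied by the weighted energy. -/
structure En (s1 s2 a c0 A B Co e0 k0 q : ℝ) (y E D P y' E' : ℝ → ℝ) : Prop where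
  hs : 1 ≤ s1
  ha : 0 < a
  hc0 : 0 < c0
  hA : 0 < A
  hB : 0 < B
  hCo : 0 < Co
  he0 : 0 < e0
  hk0 : 0 < k0
  hq : 1 < q
  hy : ∀ s ∈ Set.Icc s1 s2, HasDerivAt y (y' s) s
  hE : ∀ s ∈ Set.Icc s1 s2, HasDerivAt E (E' s) s
  hD : ContinuousOn D (Set.Icc s1 s2)
  hP : ContinuousOn P (Set.Icc s1 s2)
  hD0 : ∀ s ∈ Set.Icc s1 s2, 0 ≤ D s
  hy0 : ∀ s ∈ Set.Icc s1 s2, 0 ≤ y s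
  hyP : ∀ s ∈ Set.Icc s1 s2, y s ^ q ≤ P s
  h1 : ∀ s ∈ Set.Icc s1 s2, -4 * E s + c0 * P s - e0 ≤ y' s
  h2 : ∀ s ∈ Set.Icc s1 s2, 1 + P s ≤ A * (E s + k0) + B * D s
  h3 : ∀ s ∈ Set.Icc s1 s2, E' s ≤ -(D s / 2) + Co * s ^ (-1 - a) * (1 + P s)
  hs1 : Co * s1 ^ (-1 - a) * B ≤ 1 / 4
  hL : A * (Co / a) * s1 ^ (-a) ≤ Real.log (1 + e0 / (e0 + k0))

namespace En
variable {s1 s2 a c0 A B Co e0 k0 q : ℝ} {y E D P y' E' : ℝ → ℝ}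

lemma Om_le (h : En s1 s2 a c0 A B Co e0 k0 q y E D P y' E') {s : ℝ} (hs : s1 ≤ s) :
    0 ≤ A * (Co / a) * (s1 ^ (-a) - s ^ (-a)) ∧
      Real.exp (A * (Co / a) * (s1 ^ (-a) - s ^ (-a))) ≤ 1 + e0 / (e0 + k0) := by
  have hs1 := h.hs; have ha := h.ha; have hA := h.hA; have hCo := h.hCo
  have he0 := h.he0; have hk0 := h.hk0
  have e1 : s ^ (-a) ≤ s1 ^ (-a) :=
    Real.rpow_le_rpow_of_nonpos (by linarith) hs (by linarith)
  have e2 : 0 ≤ s ^ (-a) := Real.rpow_nonneg (by linarith) _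
  refine ⟨mul_nonneg (by positivity) (by linarith), ?_⟩
  have e3 : A * (Co / a) * (s1 ^ (-a) - s ^ (-a)) ≤ Real.log (1 + e0 / (e0 + k0)) := by
    refine le_trans ?_ h.hL
    gcongr; linarith
  calc _ ≤ Real.exp (Real.log (1 + e0 / (e0 + k0))) := Real.exp_le_exp.2 e3
    _ = _ := Real.exp_log (by positivity)

lemma main (h : En s1 s2 a c0 A B Co e0 k0 q y E D P y' E') {σ s : ℝ} (hσ : s1 ≤ σ) (hσs : σ ≤ s) (hs : s ≤ s2) :
    (E s + k0) * Real.exp (-(A * (Co / a) * (s1 ^ (-a) - s ^ (-a)))) + 1 / 8 * ∫ v in σ..s, D v ≤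
      (E σ + k0) * Real.exp (-(A * (Co / a) * (s1 ^ (-a) - σ ^ (-a)))) := by
  have hs1 := h.hs; have ha := h.ha; have hA := h.hA; have hCo := h.hCo; have hB := h.hB
  have he0 := h.he0; have hk0 := h.hk0
  have hsub : Set.Icc σ s ⊆ Set.Icc s1 s2 := Set.Icc_subset_Icc hσ hs
  have hd : ∀ v ∈ Set.Icc σ s, HasDerivAt (fun v => (E v + k0) * Real.exp (-(A * (Co / a) * (s1 ^ (-a) - v ^ (-a)))))
      ((E' v - A * (Co * v ^ (-1 - a)) * (E v + k0)) * Real.exp (-(A * (Co / a) * (s1 ^ (-a) - v ^ (-a))))) v := by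
    intro v hv
    have hv0 : 0 < v := by linarith [hv.1]
    have d1 := (Real.hasDerivAt_rpow_const (x := v) (p := -a) (Or.inl hv0.ne'))
    have d2 := (((d1.const_sub (s1 ^ (-a))).const_mul (A * (Co / a))).fun_neg).exp
    have d3 := ((h.hE v (hsub hv)).add_const k0).mul d2
    refine d3.congr_deriv ?_
    rw [show -a - 1 = -1 - a by ring]
    field_simp
    ring
  have hanti : AntitoneOn (fun v => (E v + k0) * Real.exp (-(A * (Co / a) * (s1 ^ (-a) - v ^ (-a)))) +
      1 / 8 * ∫ x in σ..v, D x) (Set.Icc σ s) := by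
    refine antitone_of_hasDerivAt (f' := fun v => (E' v - A * (Co * v ^ (-1 - a)) * (E v + k0)) *
        Real.exp (-(A * (Co / a) * (s1 ^ (-a) - v ^ (-a)))) + 1 / 8 * D v) ?_ (fun v hv => ?_) fun v hv => ?_
    · exact ContinuousOn.add (fun v hv => (hd v hv).continuousAt.continuousWithinAt)
        (continuousOn_const.mul (continuousOn_integral hσs (h.hD.mono hsub)))
    · exact (hd v (Set.Ioo_subset_Icc_self hv)).add
        ((hasDerivAt_integral_of_continuousOn (h.hD.mono hsub) hv).const_mul _)
    · have hv' := hsub (Set.Ioo_subset_Icc_self hv)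
      have hD0 := h.hD0 v hv'
      have h2 := h.h2 v hv'
      have h3 := h.h3 v hv'
      have e1 : v ^ (-1 - a) ≤ s1 ^ (-1 - a) :=
        Real.rpow_le_rpow_of_nonpos (by linarith) hv'.1 (by linarith)
      have e2 : 0 ≤ v ^ (-1 - a) := Real.rpow_nonneg (by linarith [hv'.1]) _
      have e3 : Co * v ^ (-1 - a) * B ≤ 1 / 4 := le_trans (by gcongr) h.hs1
      have e4 : E' v - A * (Co * v ^ (-1 - a)) * (E v + k0) ≤ -(D v / 4) := by
        have : Co * v ^ (-1 - a) * (1 + P v) ≤ Co * v ^ (-1 - a) * (A * (E v + k0) + B * D v) := by gcongr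
        nlinarith
      obtain ⟨o1, o2⟩ := h.Om_le hv'.1
      set X := Real.exp (-(A * (Co / a) * (s1 ^ (-a) - v ^ (-a)))) with hX
      have e5 : 1 / 2 ≤ X := by
        have : e0 / (e0 + k0) ≤ 1 := by rw [div_le_one (by positivity)]; linarith
        rw [hX, Real.exp_neg, one_div]
        exact inv_anti₀ (Real.exp_pos _) (by linarith)
      nlinarith
  have := hanti ⟨le_rfl, hσs⟩ ⟨hσs, le_rfl⟩ hσs
  simpa using this

lemma E_le (h : En s1 s2 a c0 A B Co e0 k0 q y E D P y' E') {σ s : ℝ} (hσ : s1 ≤ σ) (hσs : σ ≤ s) (hs : s ≤ s2)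
    (hE : E σ ≤ e0) : E s ≤ 3 * e0 := by
  have hk0 := h.hk0; have he0 := h.he0
  have hD : 0 ≤ ∫ v in σ..s, D v := intervalIntegral.integral_nonneg hσs fun v hv =>
    h.hD0 v ⟨hσ.trans hv.1, hv.2.trans hs⟩
  have := h.main hσ hσs hs
  obtain ⟨o1, o2⟩ := h.Om_le (hσ.trans hσs)
  obtain ⟨o3, o4⟩ := h.Om_le hσ
  set X := Real.exp (-(A * (Co / a) * (s1 ^ (-a) - s ^ (-a)))) with hX
  have hX' : X * Real.exp (A * (Co / a) * (s1 ^ (-a) - s ^ (-a))) = 1 := by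
    rw [hX, ← Real.exp_add]; simp
  have e1 : (E σ + k0) * Real.exp (-(A * (Co / a) * (s1 ^ (-a) - σ ^ (-a)))) ≤ e0 + k0 := by
    have : Real.exp (-(A * (Co / a) * (s1 ^ (-a) - σ ^ (-a)))) ≤ 1 := Real.exp_le_one_iff.2 (by linarith)
    have p := Real.exp_pos (-(A * (Co / a) * (s1 ^ (-a) - σ ^ (-a))))
    calc _ ≤ (e0 + k0) * Real.exp (-(A * (Co / a) * (s1 ^ (-a) - σ ^ (-a)))) := by gcongr
      _ ≤ (e0 + k0) * 1 := by gcongr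
      _ = _ := by ring
  have e2 : (E s + k0) * X ≤ e0 + k0 := by linarith
  have e3 : E s + k0 ≤ (e0 + k0) * (1 + e0 / (e0 + k0)) := by
    calc E s + k0 = ((E s + k0) * X) * Real.exp (A * (Co / a) * (s1 ^ (-a) - s ^ (-a))) := by
          rw [mul_assoc, hX', mul_one]
      _ ≤ (e0 + k0) * Real.exp (A * (Co / a) * (s1 ^ (-a) - s ^ (-a))) := by gcongr
      _ ≤ _ := by gcongr
  have e4 : (e0 + k0) * (1 + e0 / (e0 + k0)) = 2 * e0 + k0 := by field_simp; ring
  linarith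

lemma y_ineq (h : En s1 s2 a c0 A B Co e0 k0 q y E D P y' E') {σ s : ℝ} (hσ : s1 ≤ σ) (hσs : σ ≤ s) (hs : s ≤ s2)
    (hE : E σ ≤ e0) : c0 * P s - 13 * e0 ≤ y' s := by
  have := h.h1 s ⟨hσ.trans hσs, hs⟩
  have := h.E_le hσ hσs hs hE
  linarith

lemma y_le (h : En s1 s2 a c0 A B Co e0 k0 q y E D P y' E') {σ s y1 : ℝ} (hσ : s1 ≤ σ) (hσs : σ ≤ s) (hs : s ≤ s2)
    (hE : E σ ≤ e0) (hy1 : 0 < y1) (h26 : 26 * e0 < c0 * y1 ^ q) (hl : y1 ^ (1 - q) < (q - 1) * (c0 / 2) * (s2 - s)) :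
    y s ≤ y1 := by
  by_contra! hlt
  have hc0 := h.hc0; have hq := h.hq
  have hsub : Set.Icc s s2 ⊆ Set.Icc s1 s2 := Set.Icc_subset_Icc_left (hσ.trans hσs)
  have := blowup_time_le (y := y) (y' := y') (e := 13 * e0) hs h.hq h.hc0 (by linarith [h.he0])
    (fun v hv => h.hy v (hsub hv)) (fun v hv => h.hy0 v (hsub hv))
    (fun v hv => by
      have e1 := h.y_ineq hσ (hσs.trans hv.1) hv.2 hE
      have e2 := h.hyP v (hsub hv)
      nlinarith) (by
      have : y1 ^ q ≤ y s ^ q := Real.rpow_le_rpow hy1.le hlt.le (by linarith)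
      nlinarith)
  have h2 : y s ^ (1 - q) ≤ y1 ^ (1 - q) := Real.rpow_le_rpow_of_nonpos hy1 hlt.le (by linarith)
  linarith

lemma int_P_le (h : En s1 s2 a c0 A B Co e0 k0 q y E D P y' E') {σ s : ℝ} (hσ : s1 ≤ σ) (hσs : σ ≤ s)
    (hs : s + 1 ≤ s2) (hE : E σ ≤ e0) : c0 * ∫ v in s..(s + 1), P v ≤ y (s + 1) + 13 * e0 := by
  have hsub : Set.Icc s (s + 1) ⊆ Set.Icc s1 s2 := Set.Icc_subset_Icc (hσ.trans hσs) hs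
  have hanti : AntitoneOn (fun v => c0 * (∫ x in s..v, P x) - 13 * e0 * (v - s) - y v) (Set.Icc s (s + 1)) := by
    refine antitone_of_hasDerivAt (f' := fun v => c0 * P v - 13 * e0 * 1 - y' v) ?_ (fun v hv => ?_) fun v hv => ?_
    · refine ((continuousOn_const.mul (continuousOn_integral (by linarith) (h.hP.mono hsub))).sub
        (by fun_prop)).sub fun v hv => (h.hy v (hsub hv)).continuousAt.continuousWithinAt
    · exact (((hasDerivAt_integral_of_continuousOn (h.hP.mono hsub) hv).const_mul _).sub
        (((hasDerivAt_id v).sub_const s).const_mul _)).sub (h.hy v (hsub (Set.Ioo_subset_Icc_self hv)))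
    · have := h.y_ineq hσ (hσs.trans hv.1.le) (hv.2.le.trans hs) hE
      linarith
  have h1 := hanti ⟨le_rfl, by linarith⟩ ⟨by linarith, le_rfl⟩ (show s ≤ s + 1 by linarith)
  have h2 := h.hy0 s ⟨hσ.trans hσs, by linarith⟩
  simp at h1
  linarith

lemma int_D_le (h : En s1 s2 a c0 A B Co e0 k0 q y E D P y' E') {σ s Y : ℝ} (hσ : s1 ≤ σ) (hσs : σ ≤ s)
    (hs : s + 1 ≤ s2) (hE : E σ ≤ e0) (hY : y (s + 1) ≤ Y) : ∫ v in σ..s, D v ≤ 8 * (2 * e0 + 2 * k0 + Y) := by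
  have hc0 := h.hc0; have he0 := h.he0; have hk0 := h.hk0
  have hsub : Set.Icc s (s + 1) ⊆ Set.Icc s1 s2 := Set.Icc_subset_Icc (hσ.trans hσs) hs
  have hP0 : ∀ v ∈ Set.Icc s1 s2, 0 ≤ P v := fun v hv =>
    (Real.rpow_nonneg (h.hy0 v hv) q).trans (h.hyP v hv)
  have hY0 : 0 ≤ Y := (h.hy0 (s + 1) (hsub ⟨by linarith, le_rfl⟩)).trans hY
  obtain ⟨τ, hτ, hlow⟩ : ∃ τ ∈ Set.Icc s (s + 1), -(Y + e0) ≤ E τ := by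
    by_contra! hh
    have hanti : AntitoneOn (fun v => (4 * Y + 3 * e0) * (v - s) - y v) (Set.Icc s (s + 1)) := by
      refine antitone_of_hasDerivAt (f' := fun v => (4 * Y + 3 * e0) * 1 - y' v) ?_ (fun v hv => ?_) fun v hv => ?_
      · refine ContinuousOn.sub (by fun_prop) fun v hv => (h.hy v (hsub hv)).continuousAt.continuousWithinAt
      · exact (((hasDerivAt_id v).sub_const s).const_mul _).sub (h.hy v (hsub (Set.Ioo_subset_Icc_self hv)))
      · have e1 := hh v (Set.Ioo_subset_Icc_self hv)
        have e2 := h.h1 v (hsub (Set.Ioo_subset_Icc_self hv))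
        have e3 := hP0 v (hsub (Set.Ioo_subset_Icc_self hv))
        nlinarith
    have h1 := hanti ⟨le_rfl, by linarith⟩ ⟨by linarith, le_rfl⟩ (show s ≤ s + 1 by linarith)
    have h2 := h.hy0 s ⟨hσ.trans hσs, by linarith⟩
    simp at h1
    linarith
  have h1 := h.main hσ (hσs.trans hτ.1) (hτ.2.trans hs)
  have hii : ∀ c ∈ Set.Icc s1 s2, ∀ d ∈ Set.Icc s1 s2, IntervalIntegrable D volume c d := fun c hc d hd =>
    (h.hD.mono (by
      rw [← Set.uIcc_of_le (hc.1.trans hc.2)]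
      exact Set.uIcc_subset_uIcc (by rwa [Set.uIcc_of_le (hc.1.trans hc.2)]) (by rwa [Set.uIcc_of_le (hc.1.trans hc.2)]))).intervalIntegrable
  have hmσ : σ ∈ Set.Icc s1 s2 := ⟨hσ, by linarith⟩
  have hms : s ∈ Set.Icc s1 s2 := hsub ⟨le_rfl, by linarith⟩
  have h2 : ∫ v in σ..s, D v ≤ ∫ v in σ..τ, D v := by
    rw [← intervalIntegral.integral_add_adjacent_intervals (hii σ hmσ s hms) (hii s hms τ (hsub hτ))]
    have : 0 ≤ ∫ v in s..τ, D v := intervalIntegral.integral_nonneg hτ.1 fun v hv =>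
      h.hD0 v ⟨hms.1.trans hv.1, hv.2.trans (hτ.2.trans hs)⟩
    linarith
  obtain ⟨o1, o2⟩ := h.Om_le (hsub hτ).1
  obtain ⟨o3, o4⟩ := h.Om_le hσ
  have x1 : Real.exp (-(A * (Co / a) * (s1 ^ (-a) - τ ^ (-a)))) ≤ 1 := Real.exp_le_one_iff.2 (by linarith)
  have x2 : Real.exp (-(A * (Co / a) * (s1 ^ (-a) - σ ^ (-a)))) ≤ 1 := Real.exp_le_one_iff.2 (by linarith)
  have p1 := Real.exp_pos (-(A * (Co / a) * (s1 ^ (-a) - τ ^ (-a))))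
  have p2 := Real.exp_pos (-(A * (Co / a) * (s1 ^ (-a) - σ ^ (-a))))
  have e1 : (E σ + k0) * Real.exp (-(A * (Co / a) * (s1 ^ (-a) - σ ^ (-a)))) ≤ e0 + k0 := by
    calc _ ≤ (e0 + k0) * Real.exp (-(A * (Co / a) * (s1 ^ (-a) - σ ^ (-a)))) := by gcongr
      _ ≤ (e0 + k0) * 1 := by gcongr
      _ = _ := by ring
  have e2 : -(Y + e0 + k0) ≤ (E τ + k0) * Real.exp (-(A * (Co / a) * (s1 ^ (-a) - τ ^ (-a)))) := by
    have : -(Y + e0 + k0) * Real.exp (-(A * (Co / a) * (s1 ^ (-a) - τ ^ (-a)))) ≤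
      (E τ + k0) * Real.exp (-(A * (Co / a) * (s1 ^ (-a) - τ ^ (-a)))) := by gcongr; linarith
    nlinarith
  linarith

end En

end

section

variable {n : ℕ} {J : Set ℝ} {β : ℝ} {w q : E n → ℝ → ℝ}

lemma pd_differentiable {f : E n → ℝ} (hf : ContDiff ℝ ∞ f) (i : Fin n) : Differentiable ℝ (pd i f) := by
  have h1 : ContDiff ℝ 1 (fderiv ℝ f) := (contDiff_infty.1 hf 2).fderiv_right (by norm_num)
  exact (h1.clm_apply contDiff_const).differentiable (by norm_num)

lemma Sim.test (h : Sim J β w q) {s : ℝ} (hs : s ∈ J) {f : E n → ℝ → ℝ} (hf : Nice J f)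
    (hfd : Differentiable ℝ fun y => f y s) (hfi : ∀ i, Nice J (fun y s => pd i (fun z => f z s) y)) :
    ∫ y, f y s * wt β w q y s ∂(gm n) =
      - (∑ i, ∫ y, pd i (fun z => f z s) y * pd i (fun z => w z s) y ∂(gm n)) - β * ∫ y, f y s * w y s ∂(gm n) +
        ∫ y, f y s * q y s ∂(gm n) := by
  have key : ∀ i, ∫ y, f y s * pd i (pd i (fun z => w z s)) y ∂(gm n) =
      - ∫ y, pd i (fun z => f z s) y * pd i (fun z => w z s) y ∂(gm n) +
        1 / 2 * ∫ y, y i * (f y s * pd i (fun z => w z s) y) ∂(gm n) := fun i =>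
    integral_mul_pd_gm hfd (pd_differentiable (h.sm s hs) i) i ((hf.mul (h.nwi i)).integrable hs)
      ((hf.mul (h.nwij i i)).integrable hs) (((hfi i).mul (h.nwi i)).integrable hs)
      (((Nice.coord i).mul (hf.mul (h.nwi i))).integrable hs)
  have e : ∀ y, f y s * wt β w q y s = ∑ i, (f y s * pd i (pd i (fun z => w z s)) y -
      1 / 2 * (y i * (f y s * pd i (fun z => w z s) y))) - β * (f y s * w y s) + f y s * q y s := fun y => by
    unfold wt
    rw [lap_eq_sum_pd, Finset.sum_sub_distrib, ← Finset.mul_sum, ← Finset.mul_sum]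
    have : ∑ i, y i * (f y s * pd i (fun z => w z s) y) = f y s * ∑ i, y i * pd i (fun z => w z s) y := by
      rw [Finset.mul_sum]; exact Finset.sum_congr rfl fun i _ => by ring
    rw [this]; ring
  have n1 : ∀ i, Nice J fun y s => f y s * pd i (pd i (fun z => w z s)) y -
      1 / 2 * (y i * (f y s * pd i (fun z => w z s) y)) := fun i =>
    (hf.mul (h.nwij i i)).sub (((Nice.coord i).mul (hf.mul (h.nwi i))).const_mul _)
  have n2 : Nice J fun y s => β * (f y s * w y s) := (hf.mul h.nw).const_mul β
  have n3 : Nice J fun y s => f y s * q y s := hf.mul h.nq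
  simp only [e]
  rw [integral_add (((Nice.sum _ n1).sub n2).integrable hs) (n3.integrable hs),
    integral_sub ((Nice.sum _ n1).integrable hs) (n2.integrable hs),
    integral_finsetSum _ fun i _ => (n1 i).integrable hs, integral_const_mul]
  congr 2
  rw [← Finset.sum_neg_distrib]
  refine Finset.sum_congr rfl fun i _ => ?_
  rw [integral_sub ((hf.mul (h.nwij i i)).integrable hs)
    ((((Nice.coord i).mul (hf.mul (h.nwi i))).const_mul _).integrable hs), integral_const_mul, key]
  ring

/-- Squared weighted norm. -/
noncomputable def yS (w : E n → ℝ → ℝ) (s : ℝ) : ℝ := ∫ y, w y s ^ 2 ∂(gm n)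

noncomputable def pS (p : ℝ) (w : E n → ℝ → ℝ) (s : ℝ) : ℝ := ∫ y, |w y s| ^ (p + 1) ∂(gm n)

noncomputable def aS (w : E n → ℝ → ℝ) (s : ℝ) : ℝ := ∑ i, ∫ y, pd i (fun z => w z s) y ^ 2 ∂(gm n)

noncomputable def dS (β : ℝ) (w q : E n → ℝ → ℝ) (s : ℝ) : ℝ := ∫ y, wt β w q y s ^ 2 ∂(gm n)

/-- Weighted energy. -/
noncomputable def eS (p a μ β : ℝ) (w : E n → ℝ → ℝ) (s : ℝ) : ℝ :=
  1 / 2 * aS w s + β / 2 * yS w s - ∫ y, PH p a μ β s (w y s) ∂(gm n)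

noncomputable def yS' (β : ℝ) (w q : E n → ℝ → ℝ) (s : ℝ) : ℝ := ∫ y, 2 * (w y s * wt β w q y s) ∂(gm n)

noncomputable def eS' (p a μ β : ℝ) (w q : E n → ℝ → ℝ) (s : ℝ) : ℝ :=
  -dS β w q s + (∫ y, (q y s - NN p a μ β s (w y s)) * wt β w q y s ∂(gm n)) -
    ∫ y, PHs p a μ β s (w y s) ∂(gm n)

variable {p a μ : ℝ}

lemma Sim.hasDerivAt_yS (h : Sim J β w q) {s : ℝ} (hs : s ∈ J) :
    HasDerivAt (yS w) (yS' β w q s) s :=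
  h.nw.sq.hasDerivAt ((h.nw.mul h.nwt).const_mul 2) h.op (fun y s hs => by
    refine ((h.dw y s hs).fun_pow 2).congr_deriv ?_
    push_cast; ring) hs

lemma Sim.yS'_eq (h : Sim J β w q) (hp : 1 < p) (ha : 0 < a) (hβ : β * (p - 1) = 1) {s : ℝ} (hs : s ∈ J) :
    yS' β w q s = -4 * eS p a μ β w s + ∫ y, (2 * (w y s * q y s) - 4 * PH p a μ β s (w y s)) ∂(gm n) := by
  have h1 := h.test hs h.nw ((h.sm s hs).differentiable (by norm_num)) h.nwi
  have n1 := h.nw.mul h.nq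
  have n2 := h.nw.PH (μ := μ) hp ha hβ
  unfold yS'
  rw [integral_const_mul, h1, integral_sub ((n1.const_mul 2).integrable hs) ((n2.const_mul 4).integrable hs),
    integral_const_mul, integral_const_mul]
  unfold eS aS yS
  simp only [pow_two]
  ring

lemma Sim.hasDerivAt_eS (h : Sim J β w q) (hp : 1 < p) (ha : 0 < a) (hβ : β * (p - 1) = 1) {s : ℝ} (hs : s ∈ J) :
    HasDerivAt (eS p a μ β w) (eS' p a μ β w q s) s := by
  have nN := h.nw.NN (μ := μ) hp ha hβ
  have nP := h.nw.PH (μ := μ) hp ha hβ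
  have nPs := h.nw.PHs (μ := μ) hp ha hβ
  have d1 : HasDerivAt (aS w) (∑ i, ∫ y, 2 * (pd i (fun z => wt β w q z s) y * pd i (fun z => w z s) y) ∂(gm n)) s := by
    unfold aS
    refine HasDerivAt.fun_sum fun i _ => ?_
    exact (h.nwi i).sq.hasDerivAt (((h.nwti i).mul (h.nwi i)).const_mul 2) h.op (fun y s hs => by
      refine ((h.dwi i y s hs).fun_pow 2).congr_deriv ?_
      push_cast; ring) hs
  have d2 := h.hasDerivAt_yS hs
  have d3 : HasDerivAt (fun s => ∫ y, PH p a μ β s (w y s) ∂(gm n))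
      (∫ y, (NN p a μ β s (w y s) * wt β w q y s + PHs p a μ β s (w y s)) ∂(gm n)) s :=
    nP.hasDerivAt ((nN.mul h.nwt).add nPs) h.op (fun y s hs => hasDerivAt_PH_comp hp hβ (h.dw y s hs)) hs
  refine (((d1.const_mul (1 / 2)).add (d2.const_mul (β / 2))).sub d3).congr_deriv ?_
  have h1 := h.test hs h.nwt ((h.ssm s hs).differentiable (by norm_num)) h.nwti
  unfold eS' dS yS'
  have e1 : ∫ y, wt β w q y s ^ 2 ∂(gm n) = ∫ y, wt β w q y s * wt β w q y s ∂(gm n) := by simp only [pow_two]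
  have e2 : ∫ y, (q y s - NN p a μ β s (w y s)) * wt β w q y s ∂(gm n) =
      ∫ y, wt β w q y s * q y s ∂(gm n) - ∫ y, NN p a μ β s (w y s) * wt β w q y s ∂(gm n) := by
    rw [← integral_sub ((h.nwt.mul h.nq).integrable hs) ((nN.mul h.nwt).integrable hs)]
    congr 1; funext y; ring
  have e3 : ∫ y, w y s * wt β w q y s ∂(gm n) = ∫ y, wt β w q y s * w y s ∂(gm n) := by
    congr 1; funext y; ring
  rw [e1, h1, e2, integral_add ((nN.mul h.nwt).integrable hs) (nPs.integrable hs), integral_const_mul, e3]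
  simp only [integral_const_mul]
  rw [← Finset.mul_sum]
  ring

lemma sq_le_one_add_rpow (hp : 1 < p) (z : ℝ) : z ^ 2 ≤ 1 + |z| ^ (p + 1) := by
  rw [← sq_abs]
  rcases le_or_gt |z| 1 with h | h
  · have := Real.rpow_nonneg (abs_nonneg z) (p + 1)
    nlinarith [abs_nonneg z]
  · have : |z| ^ (2:ℝ) ≤ |z| ^ (p + 1) := Real.rpow_le_rpow_of_exponent_le h.le (by linarith)
    rw [Real.rpow_two] at this
    linarith

lemma abs_le_one_add_rpow (hp : 1 < p) (z : ℝ) : |z| ≤ 1 + |z| ^ (p + 1) := by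
  rcases le_or_gt |z| 1 with h | h
  · have := Real.rpow_nonneg (abs_nonneg z) (p + 1)
    linarith
  · have := Real.self_le_rpow_of_one_le h.le (show 1 ≤ p + 1 by linarith); linarith

lemma integral_one_add {f : E n → ℝ} (hf : Integrable f (gm n)) (c : ℝ) :
    ∫ y, c * (1 + f y) ∂(gm n) = c * (1 + ∫ y, f y ∂(gm n)) := by
  rw [integral_const_mul, integral_add (integrable_const _) hf]
  simp

lemma Nice.yS_rpow_le (hw : Nice J w) (hp : 1 < p) {s : ℝ} (hs : s ∈ J) : yS w s ^ ((p + 1) / 2) ≤ pS p w s := by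
  have hc := convexOn_rpow (show 1 ≤ (p + 1) / 2 by linarith)
  have e : ∀ y, (w y s ^ 2) ^ ((p + 1) / 2) = |w y s| ^ (p + 1) := fun y => by
    rw [← sq_abs, ← Real.rpow_two, ← Real.rpow_mul (abs_nonneg _)]; congr 1; ring
  have := hc.map_integral_le (μ := gm n) (f := fun y => w y s ^ 2)
    (continuousOn_id.rpow_const fun x _ => Or.inr (by linarith)) isClosed_Ici
    (ae_of_all _ fun y => Set.mem_Ici.2 (sq_nonneg _)) (hw.sq.integrable hs) (by
      simp only [Function.comp_def, e]
      exact (hw.rpow (by linarith)).integrable hs)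
  simp only [e] at this
  exact this

lemma Nice.yS_le (hw : Nice J w) (hp : 1 < p) {s : ℝ} (hs : s ∈ J) : yS w s ≤ 1 + pS p w s := by
  have := integral_mono (hw.sq.integrable hs) ((integrable_const 1).add ((hw.rpow (r := p + 1) (by linarith)).integrable hs))
    fun y => sq_le_one_add_rpow hp (w y s)
  have e := integral_one_add (n := n) ((hw.rpow (r := p + 1) (by linarith)).integrable hs) 1
  simp only [one_mul] at e
  exact this.trans_eq e

lemma exists_En (hp : 1 < p) (ha : 0 < a) (hβ : β * (p - 1) = 1) {c0 : ℝ} (hc0 : c0 = (p - 1) / (p + 1)) :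
    ∃ Co, 0 < Co ∧ ∀ e1, 0 < e1 → ∃ ss, 1 ≤ ss ∧ ∀ e0, e1 ≤ e0 → ∀ (n : ℕ) (J : Set ℝ) (w q : E n → ℝ → ℝ) (s1 s2 : ℝ),
      ss ≤ s1 → Set.Icc s1 s2 ⊆ J → Sim J β w q →
      (∀ s ∈ Set.Icc s1 s2, ∀ y, |q y s - NN p a μ β s (w y s)| ≤ s ^ (-1 - a)) →
      En s1 s2 a c0 (8 / c0) (4 / c0 ^ 2) Co e0 (e0 / 4 + c0 / 4) ((p + 1) / 2) (yS w)
        (eS p a μ β w) (dS β w q) (pS p w) (yS' β w q) (eS' p a μ β w q) := by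
  obtain ⟨C1, hC1, b1⟩ := exists_mulNN_bound (μ := μ) hp ha hβ
  obtain ⟨C2, hC2, b2⟩ := exists_PH_bound (μ := μ) hp ha hβ
  obtain ⟨C3, hC3, b3⟩ := exists_PHs_bound (μ := μ) hp ha hβ
  have hc0' : 0 < c0 := by rw [hc0]; exact div_pos (by linarith) (by linarith)
  refine ⟨C3 + 1, by positivity, fun e1 he1 => ?_⟩
  have t1 : Tendsto (fun s : ℝ => (2 * C1 + 4 * C2 + 2) * s ^ (-a)) atTop (𝓝 0) := by
    simpa using (tendsto_rpow_neg_atTop ha).const_mul (2 * C1 + 4 * C2 + 2)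
  have t2 : Tendsto (fun s : ℝ => 8 / c0 * ((C3 + 1) / a) * s ^ (-a)) atTop (𝓝 0) := by
    simpa using (tendsto_rpow_neg_atTop ha).const_mul (8 / c0 * ((C3 + 1) / a))
  have t3 : Tendsto (fun s : ℝ => (C3 + 1) * s ^ (-1 - a) * (4 / c0 ^ 2)) atTop (𝓝 0) := by
    have := ((tendsto_rpow_neg_atTop (show 0 < 1 + a by linarith)).const_mul (C3 + 1)).mul_const (4 / c0 ^ 2)
    simpa [neg_add, sub_eq_add_neg, add_comm] using this
  have hlog : 0 < Real.log (1 + e1 / (e1 + (e1 / 4 + c0 / 4))) := Real.log_pos (by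
    have : 0 < e1 / (e1 + (e1 / 4 + c0 / 4)) := by positivity
    linarith)
  have ev := (((t1.eventually_lt_const (lt_min hc0' he1)).and (t2.eventually_lt_const hlog)).and
    (t3.eventually_lt_const (show (0:ℝ) < 1 / 4 by norm_num))).and (eventually_ge_atTop 1)
  obtain ⟨ss, hss'⟩ := eventually_atTop.1 ev
  refine ⟨ss, (hss' ss le_rfl).2, fun e0 he01 n J w q s1 s2 hs1 hsub h hr => ?_⟩
  have he0 : 0 < e0 := he1.trans_le he01
  have hk : 0 < e0 / 4 + c0 / 4 := by positivity
  have hmono : e1 / (e1 + (e1 / 4 + c0 / 4)) ≤ e0 / (e0 + (e0 / 4 + c0 / 4)) := by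
    rw [div_le_div_iff₀ (by positivity) (by positivity)]
    nlinarith
  have hss : ∀ s, ss ≤ s → (((2 * C1 + 4 * C2 + 2) * s ^ (-a) < min c0 e0 ∧
      8 / c0 * ((C3 + 1) / a) * s ^ (-a) < Real.log (1 + e0 / (e0 + (e0 / 4 + c0 / 4)))) ∧
      (C3 + 1) * s ^ (-1 - a) * (4 / c0 ^ 2) < 1 / 4) ∧ 1 ≤ s := fun s hs => by
    obtain ⟨⟨⟨x1, x2⟩, x3⟩, x4⟩ := hss' s hs
    refine ⟨⟨⟨x1.trans_le (min_le_min le_rfl he01), x2.trans_le ?_⟩, x3⟩, x4⟩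
    exact Real.log_le_log (by positivity) (by linarith)
  have hs11 : 1 ≤ s1 := (hss s1 hs1).2
  have nN := h.nw.NN (μ := μ) hp ha hβ
  have nP := h.nw.PH (μ := μ) hp ha hβ
  have nPs := h.nw.PHs (μ := μ) hp ha hβ
  have nW := h.nw.rpow (r := p + 1) (by linarith)
  have hy0 : ∀ s, 0 ≤ yS w s := fun s => integral_nonneg fun y => sq_nonneg _
  have hd0 : ∀ s, 0 ≤ dS β w q s := fun s => integral_nonneg fun y => sq_nonneg _
  have hp0 : ∀ s, 0 ≤ pS p w s := fun s => integral_nonneg fun y => Real.rpow_nonneg (abs_nonneg _) _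
  have H1 : ∀ s ∈ Set.Icc s1 s2, -4 * eS p a μ β w s + c0 * pS p w s - e0 ≤ yS' β w q s := by
    intro s hs
    have hsJ := hsub hs
    have hs1' : 1 ≤ s := hs11.trans hs.1
    rw [h.yS'_eq (μ := μ) hp ha hβ hsJ]
    have hsm := (hss s (hs1.trans hs.1)).1.1.1
    have m1 := min_le_left c0 e0
    have m2 := min_le_right c0 e0
    have key : ∀ y, c0 * |w y s| ^ (p + 1) - e0 ≤ 2 * (w y s * q y s) - 4 * PH p a μ β s (w y s) := fun y => by
      have x1 := (abs_le.1 (b1 s hs1' (w y s))).1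
      have x2 := (abs_le.1 (b2 s hs1' (w y s))).2
      have x3 := hr s hs y
      have hW := Real.rpow_nonneg (abs_nonneg (w y s)) (p + 1)
      have x4 : |w y s * (q y s - NN p a μ β s (w y s))| ≤ s ^ (-a) * (1 + |w y s| ^ (p + 1)) := by
        rw [abs_mul, mul_comm]
        refine mul_le_mul (x3.trans ?_) (abs_le_one_add_rpow hp _) (abs_nonneg _) (by positivity)
        exact Real.rpow_le_rpow_of_exponent_le hs1' (by linarith)
      have x5 := (abs_le.1 x4).1
      have x6 : (2 * C1 + 4 * C2 + 2) * s ^ (-a) * (1 + |w y s| ^ (p + 1)) ≤ e0 + c0 * |w y s| ^ (p + 1) := by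
        nlinarith
      have x7 : 2 * |w y s| ^ (p + 1) - 4 * (|w y s| ^ (p + 1) / (p + 1)) = 2 * c0 * |w y s| ^ (p + 1) := by
        have : p + 1 ≠ 0 := by linarith
        rw [hc0]; field_simp; ring
      nlinarith
    have hi := integral_mono (((nW.integrable hsJ).const_mul c0).sub (integrable_const e0))
      ((((h.nw.mul h.nq).const_mul 2).sub (nP.const_mul 4)).integrable hsJ) key
    have e : ∫ y, (c0 * |w y s| ^ (p + 1) - e0) ∂(gm n) = c0 * pS p w s - e0 := by
      rw [integral_sub ((nW.integrable hsJ).const_mul c0) (integrable_const e0), integral_const_mul]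
      simp [pS]
    have hi' := e.symm.le.trans hi
    linarith
  refine ⟨hs11, ha, hc0', by positivity, by positivity, by positivity, he0, hk, by linarith,
    fun s hs => h.hasDerivAt_yS (hsub hs), fun s hs => h.hasDerivAt_eS hp ha hβ (hsub hs),
    h.nwt.sq.integral_cont.mono hsub, nW.integral_cont.mono hsub, fun s _ => hd0 s, fun s _ => hy0 s,
    fun s hs => h.nw.yS_rpow_le hp (hsub hs), H1, fun s hs => ?_, fun s hs => ?_, ?_, ?_⟩
  · have hsJ := hsub hs
    have h1 := H1 s hs
    have h2 := h.nw.yS_le hp hsJ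
    have h3 : yS' β w q s ≤ c0 / 2 * yS w s + 2 / c0 * dS β w q s := by
      unfold yS' yS dS
      rw [← integral_const_mul, ← integral_const_mul, ← integral_add ((h.nw.sq.const_mul _).integrable hsJ)
        ((h.nwt.sq.const_mul _).integrable hsJ)]
      refine integral_mono (((h.nw.mul h.nwt).const_mul 2).integrable hsJ)
        (((h.nw.sq.const_mul _).add (h.nwt.sq.const_mul _)).integrable hsJ) fun y => ?_
      have : 0 ≤ c0 / 2 * (w y s - 2 / c0 * wt β w q y s) ^ 2 := by positivity
      have e : c0 / 2 * (w y s - 2 / c0 * wt β w q y s) ^ 2 = c0 / 2 * w y s ^ 2 + 2 / c0 * wt β w q y s ^ 2 -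
        2 * (w y s * wt β w q y s) := by field_simp; ring
      simp only; linarith
    have h4 : c0 / 2 * (1 + pS p w s) ≤ 4 * eS p a μ β w s + (e0 + c0) + 2 / c0 * dS β w q s := by nlinarith
    have h5 : 1 + pS p w s = 2 / c0 * (c0 / 2 * (1 + pS p w s)) := by field_simp
    rw [h5]
    calc _ ≤ 2 / c0 * (4 * eS p a μ β w s + (e0 + c0) + 2 / c0 * dS β w q s) := by gcongr
      _ = _ := by field_simp; ring
  · have hsJ := hsub hs
    have hs1' : 1 ≤ s := hs11.trans hs.1
    have hsp : 0 ≤ s ^ (-1 - a) := Real.rpow_nonneg (by linarith) _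
    have hsp1 : s ^ (-1 - a) ≤ 1 := Real.rpow_le_one_of_one_le_of_nonpos hs1' (by linarith)
    have i1 : ∫ y, (q y s - NN p a μ β s (w y s)) * wt β w q y s ∂(gm n) ≤
        1 / 2 * s ^ (-1 - a) + 1 / 2 * dS β w q s := by
      have e : 1 / 2 * s ^ (-1 - a) + 1 / 2 * dS β w q s = ∫ y, (1 / 2 * s ^ (-1 - a) + 1 / 2 * wt β w q y s ^ 2) ∂(gm n) := by
        rw [integral_add (integrable_const _) ((h.nwt.sq.const_mul _).integrable hsJ), integral_const_mul]
        simp [dS, integral_const_mul]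
      rw [e]
      refine integral_mono (((h.nq.sub nN).mul h.nwt).integrable hsJ)
        ((integrable_const _).add ((h.nwt.sq.const_mul _).integrable hsJ)) fun y => ?_
      have x := hr s hs y
      have x2 : (q y s - NN p a μ β s (w y s)) ^ 2 ≤ s ^ (-1 - a) := by
        rw [← sq_abs]; nlinarith [abs_nonneg (q y s - NN p a μ β s (w y s))]
      simp only
      nlinarith [sq_nonneg (q y s - NN p a μ β s (w y s) - wt β w q y s)]
    have i2 : |∫ y, PHs p a μ β s (w y s) ∂(gm n)| ≤ C3 * s ^ (-1 - a) * (1 + pS p w s) := by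
      have := integral_one_add (nW.integrable hsJ) (C3 * s ^ (-1 - a))
      unfold pS
      rw [← this]
      exact abs_integral_le (((integrable_const 1).add (nW.integrable hsJ)).const_mul _) fun y => b3 s hs1' _
    have i3 := (abs_le.1 i2).1
    have i4 := hp0 s
    unfold eS'
    nlinarith
  · exact ((hss s1 hs1).1.2).le
  · exact ((hss s1 hs1).1.1.2).le

end

section

/-- A fixed sequence of mollifiers. -/
noncomputable def mol (n k : ℕ) : E n → ℝ :=
  Classical.choose (exists_mol n (δ := 1 / ((k : ℝ) + 1)) (by positivity))

lemma mol_spec (n k : ℕ) : Mol (1 / ((k : ℝ) + 1)) (mol n k) :=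
  Classical.choose_spec (exists_mol n (δ := 1 / ((k : ℝ) + 1)) (by positivity))

lemma eventually_inv_le {δ : ℝ} (hδ : 0 < δ) : ∀ᶠ k : ℕ in atTop, 1 / ((k : ℝ) + 1) ≤ δ := by
  filter_upwards [(tendsto_one_div_add_atTop_nhds_zero_nat (𝕜 := ℝ)).eventually (gt_mem_nhds hδ)]
    with k hk using hk.le

lemma tendsto_V_mol {n : ℕ} {v : E n → ℝ} (hv : Continuous v) (x : E n) :
    Tendsto (fun k => V (mol n k) v x) atTop (𝓝 (v x)) := by
  rw [Metric.tendsto_atTop']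
  intro η hη
  obtain ⟨δ, hδ, h⟩ := Metric.continuous_iff.1 hv x (η / 2) (half_pos hη)
  obtain ⟨N, hN⟩ := eventually_atTop.1 (eventually_inv_le (half_pos hδ))
  refine ⟨N, fun k hk => ?_⟩
  rw [Real.dist_eq]
  refine lt_of_le_of_lt ((mol_spec n k).V_sub_le hv fun z hz => ?_) (half_lt_self hη)
  have := h (x - z) (by
    rw [dist_eq_norm, sub_sub_cancel_left, norm_neg]
    linarith [hN k hk.le])
  rw [Real.dist_eq] at this
  exact this.le

lemma abs_V_mol_sub_le {n : ℕ} {v : E n → ℝ} (hv : Continuous v) {δ η : ℝ}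
    (h : ∀ x x', ‖x - x'‖ ≤ δ → |v x - v x'| ≤ η) {k : ℕ} (hk : 1 / ((k : ℝ) + 1) ≤ δ) (x : E n) :
    |V (mol n k) v x - v x| ≤ η :=
  (mol_spec n k).V_sub_le hv fun z hz => h _ _ (by
    rw [sub_sub_cancel_left, norm_neg]; exact hz.trans hk)

lemma Sim.hasDerivAt_mean {n : ℕ} {J : Set ℝ} {β : ℝ} {w q : E n → ℝ → ℝ} (h : Sim J β w q) {s : ℝ}
    (hs : s ∈ J) : HasDerivAt (fun s => ∫ y, w y s ∂gm n)
      (-(β * ∫ y, w y s ∂gm n) + ∫ y, q y s ∂gm n) s := by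
  refine (h.nw.hasDerivAt h.nwt h.op h.dw hs).congr_deriv ?_
  have := h.test hs (f := fun _ _ => 1) (Nice.const 1) (by fun_prop) (fun i => by
    simpa [pd] using Nice.const (n := n) (J := J) 0)
  simpa [pd] using this

section
variable {n : ℕ} {T2 M T' : ℝ} {u g : E n → ℝ → ℝ}

lemma Cl.mean_sub_le (h : Cl (Set.Ioo 0 T2) M u g) {φ : E n → ℝ} {δ : ℝ} (hφ : Mol δ φ)
    (hT' : T' ∈ Set.Ioo 0 T2) (b : E n) {s s' : ℝ} (hs : Real.exp (-s) < T') (hss : s ≤ s') :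
    |∫ y, WV 0 T' b φ u y s' ∂gm n - ∫ y, WV 0 T' b φ u y s ∂gm n| ≤
      M * (Real.exp (-s) - Real.exp (-s')) := by
  have hJ : ∀ σ ∈ Set.Ioi (-Real.log T'), T' - Real.exp (-σ) ∈ Set.Ioo 0 T2 := fun σ hσ => by
    have h1 : Real.exp (-σ) < T' := by
      rw [← Real.lt_log_iff_exp_lt hT'.1]
      have := Set.mem_Ioi.1 hσ
      linarith
    exact ⟨by linarith, by linarith [Real.exp_pos (-σ), hT'.2]⟩
  have hsim := h.sim isOpen_Ioo hφ.tst (T := T') (b := b) isOpen_Ioi hJ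
    (fun σ hσ => (Set.mem_Ioi.1 hσ).le) le_rfl
  have hs0 : -Real.log T' < s := by
    rw [← Real.lt_log_iff_exp_lt hT'.1] at hs
    linarith
  have hd : ∀ σ ∈ Set.Icc s s', HasDerivAt (fun s => ∫ y, WV 0 T' b φ u y s ∂gm n)
      (∫ y, WV (0 + 1) T' b φ g y σ ∂gm n) σ := fun σ hσ =>
    (hsim.hasDerivAt_mean (Set.mem_Ioi.2 (hs0.trans_le hσ.1))).congr_deriv (by ring)
  have hq : ∀ σ ∈ Set.Icc s s', |∫ y, WV (0 + 1) T' b φ g y σ ∂gm n| ≤ Real.exp (-σ) * M :=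
    fun σ hσ => by
    have hI := hJ σ (Set.mem_Ioi.2 (hs0.trans_le hσ.1))
    refine (abs_integral_le (g := fun _ => Real.exp (-σ) * M) (integrable_const _) fun y => ?_).trans_eq
      (by simp)
    simp only [WV, W]
    rw [zero_add, neg_one_mul, abs_mul, abs_of_pos (Real.exp_pos _)]
    exact mul_le_mul_of_nonneg_left (hφ.abs_V_le (fun x => h.gsc.bd x _ hI) _) (Real.exp_pos _).le
  have he : ∀ σ : ℝ, HasDerivAt (fun s : ℝ => M * Real.exp (-s)) (-(M * Real.exp (-σ))) σ := fun σ =>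
    ((hasDerivAt_neg σ).exp.const_mul M).congr_deriv (by ring)
  have h1 : AntitoneOn (fun s => ∫ y, WV 0 T' b φ u y s ∂gm n + M * Real.exp (-s)) (Set.Icc s s') := by
    refine antitone_of_hasDerivAt (fun σ hσ => ((hd σ hσ).fun_add (he σ)).continuousAt.continuousWithinAt)
      (fun σ hσ => (hd σ (Set.Ioo_subset_Icc_self hσ)).fun_add (he σ)) fun σ hσ => ?_
    have := (abs_le.1 (hq σ (Set.Ioo_subset_Icc_self hσ))).2
    linarith
  have h2 : AntitoneOn (fun s => -∫ y, WV 0 T' b φ u y s ∂gm n + M * Real.exp (-s)) (Set.Icc s s') := by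
    refine antitone_of_hasDerivAt (fun σ hσ => ((hd σ hσ).fun_neg.fun_add (he σ)).continuousAt.continuousWithinAt)
      (fun σ hσ => (hd σ (Set.Ioo_subset_Icc_self hσ)).fun_neg.fun_add (he σ)) fun σ hσ => ?_
    have := (abs_le.1 (hq σ (Set.Ioo_subset_Icc_self hσ))).1
    linarith
  have h3 := h1 (Set.left_mem_Icc.2 hss) (Set.right_mem_Icc.2 hss) hss
  have h4 := h2 (Set.left_mem_Icc.2 hss) (Set.right_mem_Icc.2 hss) hss
  simp only at h3 h4
  rw [abs_le]
  constructor <;> linarith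

/-- Mean value of `v (·, T' - e^{-s})` against the heat kernel at scale `e^{-s}`. -/
noncomputable def mean (v : E n → ℝ → ℝ) (b : E n) (T' s : ℝ) : ℝ :=
  ∫ y, v (b + Real.exp (-s / 2) • y) (T' - Real.exp (-s)) ∂gm n

lemma tendsto_exp_neg : Tendsto (fun s : ℝ => Real.exp (-s)) atTop (𝓝 0) :=
  Real.tendsto_exp_atBot.comp tendsto_neg_atTop_atBot

lemma tendsto_exp_neg_half : Tendsto (fun s : ℝ => Real.exp (-s / 2)) atTop (𝓝 0) :=
  Real.tendsto_exp_atBot.comp (tendsto_neg_atTop_atBot.atBot_div_const (by norm_num))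

lemma tendsto_mean {v : E n → ℝ → ℝ}
    (hv : ContinuousOn (fun q : E n × ℝ => v q.1 q.2) (Set.univ ×ˢ Set.Ioo 0 T2))
    (hb : ∀ x, ∀ t ∈ Set.Ioo 0 T2, |v x t| ≤ M) (hT' : T' ∈ Set.Ioo 0 T2) (b : E n) :
    Tendsto (mean v b T') atTop (𝓝 (v b T')) := by
  have hev : ∀ᶠ s : ℝ in atTop, T' - Real.exp (-s) ∈ Set.Ioo 0 T2 := by
    filter_upwards [tendsto_exp_neg.eventually (gt_mem_nhds hT'.1)] with s hs
    exact ⟨by linarith, by linarith [Real.exp_pos (-s), hT'.2]⟩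
  have : v b T' = ∫ y : E n, v b T' ∂gm n := by simp
  rw [this]
  refine tendsto_integral_filter_of_dominated_convergence (fun _ => M) ?_ ?_ (integrable_const _) ?_
  · filter_upwards [hev] with s hs
    refine Continuous.aestronglyMeasurable ?_
    exact hv.comp_continuous (f := fun y : E n => (b + Real.exp (-s / 2) • y, T' - Real.exp (-s)))
      (by fun_prop) fun y => ⟨Set.mem_univ _, hs⟩
  · filter_upwards [hev] with s hs
    exact ae_of_all _ fun y => hb _ _ hs
  · refine ae_of_all _ fun y => ?_
    have hc : ContinuousAt (fun q : E n × ℝ => v q.1 q.2) (b, T') :=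
      hv.continuousAt ((isOpen_univ.prod isOpen_Ioo).mem_nhds ⟨Set.mem_univ _, hT'⟩)
    refine Tendsto.comp (f := fun s : ℝ => (b + Real.exp (-s / 2) • y, T' - Real.exp (-s)))
      (g := fun q : E n × ℝ => v q.1 q.2) hc ?_
    refine Tendsto.prodMk_nhds ?_ ?_
    · simpa using (tendsto_exp_neg_half.smul_const y).const_add b
    · simpa using tendsto_exp_neg.const_sub T'

lemma WV_zero {φ : E n → ℝ} (b : E n) (s : ℝ) :
    ∫ y, WV 0 T' b φ u y s ∂gm n = mean (fun x t => V φ (fun z => u z t) x) b T' s := by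
  simp [WV, W, mean]

lemma tendsto_mean_mol (hu : SC (Set.Ioo 0 T2) M u) (b : E n) {s : ℝ}
    (hs : T' - Real.exp (-s) ∈ Set.Ioo 0 T2) :
    Tendsto (fun k => mean (fun x t => V (mol n k) (fun z => u z t) x) b T' s) atTop
      (𝓝 (mean u b T' s)) := by
  refine tendsto_integral_filter_of_dominated_convergence (fun _ => M) ?_ ?_ (integrable_const _) ?_
  · refine Eventually.of_forall fun k => Continuous.aestronglyMeasurable ?_
    exact (V_contDiff (mol_spec n k).tst (hu.cx _ hs)).continuous.comp
      (f := fun y : E n => b + Real.exp (-s / 2) • y) (by fun_prop)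
  · exact Eventually.of_forall fun k => ae_of_all _ fun y =>
      (mol_spec n k).abs_V_le (fun x => hu.bd x _ hs) _
  · exact ae_of_all _ fun y => tendsto_V_mol (hu.cx _ hs) _

lemma Cl.duhamel_le (h : Cl (Set.Ioo 0 T2) M u g) (hT' : T' ∈ Set.Ioo 0 T2) (b : E n) {s : ℝ}
    (hs : Real.exp (-s) < T') : |u b T' - mean u b T' s| ≤ M * Real.exp (-s) := by
  have hsI : T' - Real.exp (-s) ∈ Set.Ioo 0 T2 :=
    ⟨by linarith, by linarith [Real.exp_pos (-s), hT'.2]⟩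
  have h1 : ∀ k, |V (mol n k) (fun z => u z T') b -
      mean (fun x t => V (mol n k) (fun z => u z t) x) b T' s| ≤ M * Real.exp (-s) := fun k => by
    have h2 := tendsto_mean (h.usc.V_cont (mol_spec n k).tst)
      (fun x t ht => (mol_spec n k).abs_V_le (fun x => h.usc.bd x _ ht) x) hT' b
    have h3 := ((h2.sub_const (mean (fun x t => V (mol n k) (fun z => u z t) x) b T' s))).abs
    have h4 : Tendsto (fun s' => M * (Real.exp (-s) - Real.exp (-s'))) atTop
        (𝓝 (M * (Real.exp (-s) - 0))) := (tendsto_exp_neg.const_sub _).const_mul _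
    rw [sub_zero] at h4
    refine le_of_tendsto_of_tendsto h3 h4 ?_
    filter_upwards [eventually_ge_atTop s] with s' hs'
    simpa only [WV_zero] using h.mean_sub_le (mol_spec n k) hT' b hs hs'
  exact le_of_tendsto ((tendsto_V_mol (h.usc.cx _ hT') b).sub (tendsto_mean_mol h.usc b hsI)).abs
    (Eventually.of_forall h1)

end

end

section

lemma rho_integrable {n : ℕ} : Integrable (rho n) := by
  have := (integrable_gm (n := n) (f := fun _ => 1)).1 (integrable_const _)
  simpa using this

lemma rho_le {n : ℕ} (y h : E n) (hh : ‖h‖ ≤ 1) : rho n (y - h) ≤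
    (4 * π) ^ (-(n : ℝ) / 2) * Real.exp (1 / 4) * Real.exp (-(1 / 8) * ‖y‖ ^ 2) := by
  rw [rho, mul_assoc, ← Real.exp_add]
  refine mul_le_mul_of_nonneg_left (Real.exp_le_exp.2 ?_) (by positivity)
  have h1 : ‖y‖ ≤ ‖y - h‖ + 1 := by
    have := norm_sub_norm_le y h
    linarith
  nlinarith [sq_nonneg (‖y - h‖ - 1), norm_nonneg y, norm_nonneg (y - h)]

lemma tendsto_rho_translate (n : ℕ) :
    Tendsto (fun h : E n => ∫ y, |rho n (y - h) - rho n y|) (𝓝 0) (𝓝 0) := by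
  have h0 : (0:ℝ) = ∫ y : E n, (0:ℝ) := by simp
  conv => rhs; rw [h0]
  refine tendsto_integral_filter_of_dominated_convergence (fun y => (4 * π) ^ (-(n : ℝ) / 2) *
    Real.exp (1 / 4) * Real.exp (-(1 / 8) * ‖y‖ ^ 2) + rho n y) ?_ ?_ ?_ ?_
  · exact Eventually.of_forall fun h => ((((rho_continuous n).comp (continuous_sub_right h)).sub
      (rho_continuous n)).abs).aestronglyMeasurable
  · filter_upwards [Metric.closedBall_mem_nhds (0 : E n) one_pos] with h hh
    refine ae_of_all _ fun y => ?_
    rw [Real.norm_eq_abs, abs_abs, abs_le]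
    have := rho_le y h (by simpa using hh)
    constructor <;> linarith [rho_pos y, rho_pos (y - h)]
  · exact ((integrable_exp_sq (by norm_num)).const_mul _).add rho_integrable
  · refine ae_of_all _ fun y => ?_
    have hc : Continuous fun h : E n => |rho n (y - h) - rho n y| := by
      have := rho_continuous n
      fun_prop
    simpa using hc.tendsto 0

section
variable {n : ℕ} {T2 M T' : ℝ} {u g : E n → ℝ → ℝ}

lemma mean_eq (u : E n → ℝ → ℝ) (b b' : E n) (T' s : ℝ) :
    mean u b' T' s = ∫ y, u (b + Real.exp (-s / 2) • y) (T' - Real.exp (-s)) *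
      rho n (y - Real.exp (s / 2) • (b' - b)) := by
  rw [mean, integral_gm, ← integral_sub_right_eq_self _ (Real.exp (s / 2) • (b' - b))]
  refine integral_congr_ae (ae_of_all _ fun y => ?_)
  simp only
  congr 2
  rw [smul_sub, smul_smul, ← Real.exp_add]
  simp only [neg_div, neg_add_cancel, Real.exp_zero, one_smul]
  abel

lemma abs_mean_sub_le (hu : SC (Set.Ioo 0 T2) M u) (b b' : E n) {s : ℝ}
    (hs : T' - Real.exp (-s) ∈ Set.Ioo 0 T2) :
    |mean u b' T' s - mean u b T' s| ≤
      M * ∫ y, |rho n (y - Real.exp (s / 2) • (b' - b)) - rho n y| := by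
  have hc : Continuous fun y : E n => u (b + Real.exp (-s / 2) • y) (T' - Real.exp (-s)) :=
    (hu.cx _ hs).comp (f := fun y : E n => b + Real.exp (-s / 2) • y) (by fun_prop)
  have hi : ∀ h : E n, Integrable fun y => u (b + Real.exp (-s / 2) • y) (T' - Real.exp (-s)) *
      rho n (y - h) := fun h =>
    (rho_integrable.comp_sub_right h).bdd_mul hc.aestronglyMeasurable
      (ae_of_all _ fun y => hu.bd _ _ hs)
  have hi0 := hi 0
  simp only [sub_zero] at hi0
  rw [mean_eq u b b', mean, integral_gm, ← integral_sub (hi _) hi0, ← integral_const_mul]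
  refine abs_integral_le ?_ fun y => ?_
  · exact (((rho_integrable.comp_sub_right _).sub rho_integrable).abs).const_mul _
  · rw [← mul_sub, abs_mul]
    exact mul_le_mul_of_nonneg_right (hu.bd _ _ hs) (abs_nonneg _)

/-- Equicontinuity in space, uniformly for times bounded away from `0`. -/
lemma Cl.exists_modulus (hM : 0 ≤ M) (h : Cl (Set.Ioo 0 T2) M u g) {t1 : ℝ} (ht1 : 0 < t1) {η : ℝ}
    (hη : 0 < η) : ∃ δ > 0, ∀ x x', ‖x - x'‖ ≤ δ → ∀ t ∈ Set.Ico t1 T2, |u x t - u x' t| ≤ η := by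
  have hM1 : 0 < M + 1 := by linarith
  obtain ⟨s, hs1, hs2⟩ : ∃ s, Real.exp (-s) < t1 ∧ M * Real.exp (-s) < η / 4 := by
    have := (tendsto_exp_neg.eventually (gt_mem_nhds ht1)).and
      (((tendsto_exp_neg.const_mul M)).eventually (gt_mem_nhds (by
        rw [mul_zero]; positivity : M * 0 < η / 4)))
    exact this.exists
  obtain ⟨δ, hδ, hd⟩ := Metric.eventually_nhds_iff_ball.1
    ((tendsto_rho_translate n).eventually (gt_mem_nhds (show 0 < η / (4 * (M + 1)) by positivity)))
  refine ⟨Real.exp (-(s / 2)) * (δ / 2), by positivity, fun x x' hx t ht => ?_⟩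
  have ht' : t ∈ Set.Ioo 0 T2 := ⟨ht1.trans_le ht.1, ht.2⟩
  have hsI : t - Real.exp (-s) ∈ Set.Ioo 0 T2 :=
    ⟨by linarith [ht.1], by linarith [Real.exp_pos (-s), ht.2]⟩
  have e1 := h.duhamel_le ht' x (s := s) (by linarith [ht.1])
  have e2 := h.duhamel_le ht' x' (s := s) (by linarith [ht.1])
  have e3 := abs_mean_sub_le h.usc x x' hsI
  have e4 := hd (Real.exp (s / 2) • (x' - x)) (by
    rw [mem_ball_zero_iff, norm_smul, Real.norm_eq_abs, abs_of_pos (Real.exp_pos _), norm_sub_rev]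
    calc _ ≤ Real.exp (s / 2) * (Real.exp (-(s / 2)) * (δ / 2)) := by gcongr
      _ = δ / 2 := by rw [← mul_assoc, ← Real.exp_add]; simp
      _ < δ := half_lt_self hδ)
  have e5 : M * ∫ y, |rho n (y - Real.exp (s / 2) • (x' - x)) - rho n y| ≤ η / 4 := by
    calc _ ≤ M * (η / (4 * (M + 1))) := by gcongr
      _ ≤ (M + 1) * (η / (4 * (M + 1))) := by gcongr; linarith
      _ = η / 4 := by field_simp
  rw [abs_le] at *
  constructor <;> linarith [e1.1, e1.2, e2.1, e2.2, e3.1, e3.2]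

lemma Cl.continuousOn (hM : 0 ≤ M) (h : Cl (Set.Ioo 0 T2) M u g) :
    ContinuousOn (fun q : E n × ℝ => u q.1 q.2) (Set.univ ×ˢ Set.Ioo 0 T2) := by
  rintro ⟨x, t⟩ ⟨-, ht⟩
  refine ContinuousAt.continuousWithinAt ?_
  simp only at ht
  rw [Metric.continuousAt_iff']
  intro η hη
  obtain ⟨δ, hδ, hd⟩ := h.exists_modulus hM (half_pos ht.1) (half_pos hη)
  have h1 : ∀ᶠ q : E n × ℝ in 𝓝 (x, t), ‖q.1 - x‖ ≤ δ := by
    have : Tendsto (fun q : E n × ℝ => ‖q.1 - x‖) (𝓝 (x, t)) (𝓝 0) := by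
      have : Continuous fun q : E n × ℝ => ‖q.1 - x‖ := by fun_prop
      simpa using this.tendsto (x, t)
    filter_upwards [this.eventually (gt_mem_nhds hδ)] with q hq using hq.le
  have h2 : ∀ᶠ q : E n × ℝ in 𝓝 (x, t), q.2 ∈ Set.Ioo (t / 2) T2 :=
    continuous_snd.continuousAt (Ioo_mem_nhds (by linarith [ht.1]) ht.2)
  have h3 : ∀ᶠ q : E n × ℝ in 𝓝 (x, t), dist (u x q.2) (u x t) < η / 2 := by
    have : ContinuousAt (u x) t := (h.dt x t ht).continuousAt
    exact (this.tendsto.comp (continuous_snd.tendsto (x, t))).eventually (Metric.ball_mem_nhds _ (half_pos hη))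
  filter_upwards [h1, h2, h3] with q h1 h2 h3
  have h4 := hd q.1 x h1 q.2 ⟨h2.1.le, h2.2⟩
  rw [← Real.dist_eq] at h4
  linarith [dist_triangle (u q.1 q.2) (u x q.2) (u x t)]

end

end

section

section
variable {n : ℕ} {T2 M T' : ℝ} {u g : E n → ℝ → ℝ}

lemma exists_modulus_comp {G : ℝ → ℝ} (hG : Continuous G) (M : ℝ) {η : ℝ} (hη : 0 < η) :
    ∃ δ > 0, ∀ z z', |z| ≤ M → |z'| ≤ M → |z - z'| ≤ δ → |G z - G z'| ≤ η := by
  have h1 : UniformContinuousOn G (Set.Icc (-M) M) := isCompact_Icc.uniformContinuousOn_of_continuous hG.continuousOn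
  obtain ⟨δ, hδ, h⟩ := Metric.uniformContinuousOn_iff_le.1 h1 η hη
  exact ⟨δ, hδ, fun z z' hz hz' hzz => h z (abs_le.1 hz) z' (abs_le.1 hz') hzz⟩

lemma Cl.eventually_V_sub (hM : 0 ≤ M) (h : Cl (Set.Ioo 0 T2) M u g) {t1 : ℝ} (ht1 : 0 < t1) {η : ℝ}
    (hη : 0 < η) : ∀ᶠ k in atTop, ∀ x, ∀ t ∈ Set.Ico t1 T2,
      |V (mol n k) (fun z => u z t) x - u x t| ≤ η := by
  obtain ⟨δ, hδ, hd⟩ := h.exists_modulus hM ht1 hη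
  filter_upwards [eventually_inv_le hδ] with k hk x t ht
  exact abs_V_mol_sub_le (h.usc.cx t ⟨ht1.trans_le ht.1, ht.2⟩) (fun x x' hx => hd x x' hx t ht) hk x

lemma Cl.eventually_V_comp_sub (hM : 0 ≤ M) (h : Cl (Set.Ioo 0 T2) M u g) {t1 : ℝ} (ht1 : 0 < t1)
    {G : ℝ → ℝ} (hG : Continuous G) {η : ℝ}
    (hη : 0 < η) : ∀ᶠ k in atTop, ∀ x, ∀ t ∈ Set.Ico t1 T2,
      |V (mol n k) (fun z => G (u z t)) x - G (V (mol n k) (fun z => u z t) x)| ≤ η := by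
  obtain ⟨δ, hδ, hd⟩ := exists_modulus_comp hG M (half_pos hη)
  obtain ⟨δ', hδ', hd'⟩ := h.exists_modulus hM ht1 hδ
  filter_upwards [eventually_inv_le hδ', h.eventually_V_sub hM ht1 hδ] with k hk hk' x t ht
  have htI : t ∈ Set.Ioo 0 T2 := ⟨ht1.trans_le ht.1, ht.2⟩
  have h1 := abs_V_mol_sub_le (v := fun z => G (u z t)) (hG.comp (h.usc.cx t htI))
    (fun x x' hx => hd _ _ (h.ub x t htI) (h.ub x' t htI) (hd' x x' hx t ht)) hk x
  have h2 := hd _ _ ((mol_spec n k).abs_V_le (fun x => h.ub x t htI) x) (h.ub x t htI) (hk' x t ht)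
  rw [abs_le] at *
  constructor <;> linarith [h1.1, h1.2, h2.1, h2.2]

end

/-- Smooth approximations `wk` of `w`, solving the similarity equation up to a uniformly small error. -/
structure Appr {n : ℕ} (p a μ β s1 s2 : ℝ) (w : E n → ℝ → ℝ) (wk qk : ℕ → E n → ℝ → ℝ) : Prop where
  sim : ∃ J, Set.Icc s1 s2 ⊆ J ∧ ∀ k, Sim J β (wk k) (qk k)
  nice : Nice (Set.Icc s1 s2) w
  bd : ∃ C, 0 ≤ C ∧ ∀ y, ∀ s ∈ Set.Icc s1 s2, |w y s| ≤ C ∧ ∀ k, |wk k y s| ≤ C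
  lim : ∀ η > 0, ∀ᶠ k in atTop, ∀ s ∈ Set.Icc s1 s2, ∀ y, |wk k y s - w y s| ≤ η
  res : ∀ η > 0, ∀ᶠ k in atTop, ∀ s ∈ Set.Icc s1 s2, ∀ y,
    |qk k y s - NN p a μ β s (wk k y s)| ≤ η

section
variable {n : ℕ} {p a μ T : ℝ} {u : E n → ℝ → ℝ}

lemma cl_of_solvesU (hp : 1 < p) (ha : 0 < a) (hu : SolvesU n p a μ T u) {T2 : ℝ} (h0 : 0 < T2)
    (hT2 : T2 < T) : ∃ M, 0 ≤ M ∧ Cl (Set.Ioo 0 T2) M u (fun x t => ff p a μ (u x t)) := by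
  obtain ⟨h1, h2, h3, h4, -⟩ := hu
  obtain ⟨M, hM⟩ := h4 T2 ⟨h0.le, hT2⟩
  have hI : ∀ t ∈ Set.Ioo 0 T2, t ∈ Set.Ico 0 T := fun t ht => ⟨ht.1.le, ht.2.trans hT2⟩
  have hM0 : 0 ≤ M := (abs_nonneg _).trans (hM 0 0 ⟨le_rfl, h0.le⟩)
  have hb : ∀ x, ∀ t ∈ Set.Ioo 0 T2, |u x t| ≤ M := fun x t ht => hM x t ⟨ht.1.le, ht.2.le⟩
  have hC : 0 ≤ Cf a μ * M ^ p := mul_nonneg (Cf_pos a μ).le (Real.rpow_nonneg hM0 _)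
  refine ⟨M + Cf a μ * M ^ p, by positivity, ⟨fun t ht => h1 t (hI t ht), fun x t ht => ?_,
    fun x t ht => (hb x t ht).trans (by linarith), ⟨fun t ht => (ff_continuous hp).comp (h1 t (hI t ht)).continuous,
    fun x t ht => ?_, fun x t ht => ?_⟩⟩⟩
  · refine (h2 x t (hI t ht)).hasDerivAt.congr_deriv ?_
    rw [h3 x t (hI t ht), ff, add_assoc]
  · exact ((ff_continuous hp).continuousAt.comp (h2 x t (hI t ht)).continuousAt).continuousWithinAt
  · refine (abs_ff_le hp ha _).trans ?_
    have : |u x t| ^ p ≤ M ^ p := Real.rpow_le_rpow (abs_nonneg _) (hb x t ht) (by linarith)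
    have := mul_le_mul_of_nonneg_left this (Cf_pos a μ).le
    linarith

lemma appr_of_solvesU (hp : 1 < p) (ha : 0 < a) (hu : SolvesU n p a μ T u) {β : ℝ} (hβ : 0 ≤ β)
    {T' : ℝ} (b : E n) {s1 s2 : ℝ} (hs : 0 ≤ s1) (hss : s1 ≤ s2) (h1 : Real.exp (-s1) < T') (hT' : T' ≤ T) :
    Appr p a μ β s1 s2 (W β T' b u) (fun k => WV β T' b (mol n k) u)
      (fun k => WV (β + 1) T' b (mol n k) (fun x t => ff p a μ (u x t))) := by
  have hT0 : 0 < T' := (Real.exp_pos _).trans h1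
  have e12 : Real.exp (-s2) ≤ Real.exp (-s1) := Real.exp_le_exp.2 (by linarith)
  obtain ⟨T2, hT2, hT2'⟩ := exists_between (show T' - Real.exp (-s2) < T by linarith [Real.exp_pos (-s2)])
  have hT20 : 0 < T2 := by linarith
  obtain ⟨M, hM, hcl⟩ := cl_of_solvesU hp ha hu hT20 hT2'
  set J : Set ℝ := {s | T' - Real.exp (-s) ∈ Set.Ioo 0 T2} with hJ
  have hJo : IsOpen J := isOpen_Ioo.preimage (by fun_prop : Continuous fun s : ℝ => T' - Real.exp (-s))
  have hJs : ∀ s ∈ J, -Real.log T' ≤ s := fun s hs => by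
    have h2 : Real.exp (-s) < T' := by linarith [hs.1]
    rw [← Real.lt_log_iff_exp_lt hT0] at h2
    linarith
  have hmem : ∀ s ∈ Set.Icc s1 s2, T' - Real.exp (-s) ∈ Set.Ico (T' - Real.exp (-s1)) T2 := fun s hs => by
    have e1 : Real.exp (-s2) ≤ Real.exp (-s) := Real.exp_le_exp.2 (by linarith [hs.2])
    have e2 : Real.exp (-s) ≤ Real.exp (-s1) := Real.exp_le_exp.2 (by linarith [hs.1])
    exact ⟨by linarith, by linarith⟩
  have ht1 : 0 < T' - Real.exp (-s1) := by linarith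
  have hmem' : ∀ s ∈ Set.Icc s1 s2, T' - Real.exp (-s) ∈ Set.Ioo 0 T2 := fun s hs =>
    ⟨ht1.trans_le (hmem s hs).1, (hmem s hs).2⟩
  have hexp : ∀ k : ℝ, 0 ≤ k → ∀ s ∈ Set.Icc s1 s2, Real.exp (-k * s) ≤ 1 := fun k hk s hs => by
    rw [Real.exp_le_one_iff]
    have := mul_nonneg hk (le_trans ‹0 ≤ s1› hs.1)
    linarith
  refine ⟨⟨J, hmem', fun k => hcl.sim isOpen_Ioo (mol_spec n k).tst hJo (fun s hs => hs) hJs hβ⟩,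
    W_nice (hcl.continuousOn hM) hcl.ub hmem' (fun s hs => hs.1) hβ, ⟨M, hM, fun y s hs => ⟨?_, fun k => ?_⟩⟩,
    fun η hη => ?_, fun η hη => ?_⟩
  · rw [W, abs_mul, abs_of_pos (Real.exp_pos _)]
    calc _ ≤ 1 * M := mul_le_mul (hexp β hβ s hs) (hcl.ub _ _ (hmem' s hs)) (abs_nonneg _) zero_le_one
      _ = M := one_mul _
  · rw [WV, W, abs_mul, abs_of_pos (Real.exp_pos _)]
    calc _ ≤ 1 * M := mul_le_mul (hexp β hβ s hs) ((mol_spec n k).abs_V_le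
          (fun x => hcl.ub x _ (hmem' s hs)) _) (abs_nonneg _) zero_le_one
      _ = M := one_mul _
  · filter_upwards [hcl.eventually_V_sub hM ht1 hη] with k hk s hs y
    rw [WV, W, W, ← mul_sub, abs_mul, abs_of_pos (Real.exp_pos _)]
    calc _ ≤ 1 * η := mul_le_mul (hexp β hβ s hs) (hk _ _ (hmem s hs)) (abs_nonneg _) zero_le_one
      _ = η := one_mul _
  · filter_upwards [hcl.eventually_V_comp_sub hM ht1 (ff_continuous (a := a) (μ := μ) hp) hη] with k hk s hs y
    have e : Real.exp (β * s) * (Real.exp (-β * s) * V (mol n k) (fun z => u z (T' - Real.exp (-s)))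
        (b + Real.exp (-s / 2) • y)) = V (mol n k) (fun z => u z (T' - Real.exp (-s)))
        (b + Real.exp (-s / 2) • y) := by
      rw [← mul_assoc, ← Real.exp_add]
      simp
    simp only [WV, W, NN]
    rw [e, ← mul_sub, abs_mul, abs_of_pos (Real.exp_pos _)]
    calc _ ≤ 1 * η := mul_le_mul (hexp (β + 1) (by linarith) s hs) (hk _ _ (hmem s hs)) (abs_nonneg _) zero_le_one
      _ = η := one_mul _

end

end

section

lemma exists_bound_comp {G : ℝ → ℝ → ℝ} (hG : Continuous fun q : ℝ × ℝ => G q.1 q.2) (s1 s2 C : ℝ) :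
    ∃ B, 0 ≤ B ∧ ∀ s ∈ Set.Icc s1 s2, ∀ z, |z| ≤ C → |G s z| ≤ B := by
  obtain ⟨B, hB⟩ := (isCompact_Icc (a := s1) (b := s2)).prod (isCompact_Icc (a := -C) (b := C))
    |>.exists_bound_of_continuousOn hG.continuousOn
  exact ⟨max B 0, le_max_right _ _, fun s hs z hz => (hB (s, z) ⟨hs, abs_le.1 hz⟩).trans (le_max_left _ _)⟩

lemma Nice.comp_bdd {n : ℕ} {s1 s2 C : ℝ} {w : E n → ℝ → ℝ} (hw : Nice (Set.Icc s1 s2) w)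
    (hC : ∀ y, ∀ s ∈ Set.Icc s1 s2, |w y s| ≤ C) {G : ℝ → ℝ → ℝ}
    (hG : Continuous fun q : ℝ × ℝ => G q.1 q.2) : Nice (Set.Icc s1 s2) fun y s => G s (w y s) where
  cy s hs := hG.comp (continuous_const.prodMk (hw.cy s hs))
  cs y := hG.comp_continuousOn (continuousOn_id.prodMk (hw.cs y))
  gr := by
    obtain ⟨B, hB, h⟩ := exists_bound_comp hG s1 s2 C
    exact ⟨0, B, hB, fun y s hs => by simpa using h s hs _ (hC y s hs)⟩

lemma abs_integral_gm_le {n : ℕ} {f : E n → ℝ} {B : ℝ} (h : ∀ y, |f y| ≤ B) : |∫ y, f y ∂gm n| ≤ B := by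
  simpa using abs_integral_le (integrable_const (μ := gm n) B) h

namespace Appr
variable {n : ℕ} {p a μ β s1 s2 : ℝ} {w : E n → ℝ → ℝ} {wk qk : ℕ → E n → ℝ → ℝ}

lemma nice_k (h : Appr p a μ β s1 s2 w wk qk) (k : ℕ) : Nice (Set.Icc s1 s2) (wk k) := by
  obtain ⟨J, hJ, hs⟩ := h.sim
  exact (hs k).nw.mono hJ

lemma nice_comp (h : Appr p a μ β s1 s2 w wk qk) {G : ℝ → ℝ → ℝ}
    (hG : Continuous fun q : ℝ × ℝ => G q.1 q.2) : Nice (Set.Icc s1 s2) fun y s => G s (w y s) := by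
  obtain ⟨C, hC, hb⟩ := h.bd
  exact h.nice.comp_bdd (fun y s hs => (hb y s hs).1) hG

lemma nice_k_comp (h : Appr p a μ β s1 s2 w wk qk) (k : ℕ) {G : ℝ → ℝ → ℝ}
    (hG : Continuous fun q : ℝ × ℝ => G q.1 q.2) : Nice (Set.Icc s1 s2) fun y s => G s (wk k y s) := by
  obtain ⟨C, hC, hb⟩ := h.bd
  exact (h.nice_k k).comp_bdd (fun y s hs => (hb y s hs).2 k) hG

lemma tendsto (h : Appr p a μ β s1 s2 w wk qk) {s : ℝ} (hs : s ∈ Set.Icc s1 s2) (y : E n) :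
    Tendsto (fun k => wk k y s) atTop (𝓝 (w y s)) := by
  refine Metric.tendsto_nhds.2 fun η hη => ?_
  filter_upwards [h.lim (η / 2) (half_pos hη)] with k hk
  exact (hk s hs y).trans_lt (half_lt_self hη)

lemma tendsto_comp (h : Appr p a μ β s1 s2 w wk qk) {G : ℝ → ℝ → ℝ}
    (hG : Continuous fun q : ℝ × ℝ => G q.1 q.2) {s : ℝ} (hs : s ∈ Set.Icc s1 s2) :
    Tendsto (fun k => ∫ y, G s (wk k y s) ∂gm n) atTop (𝓝 (∫ y, G s (w y s) ∂gm n)) := by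
  obtain ⟨C, hC, hb⟩ := h.bd
  obtain ⟨B, hB, hGB⟩ := exists_bound_comp hG s1 s2 C
  refine tendsto_integral_of_dominated_convergence (fun _ => B)
    (fun k => ((h.nice_k_comp k hG).cy s hs).aestronglyMeasurable) (integrable_const _)
    (fun k => ae_of_all _ fun y => hGB s hs _ ((hb y s hs).2 k)) (ae_of_all _ fun y => ?_)
  exact (hG.tendsto (s, w y s)).comp (tendsto_const_nhds.prodMk_nhds (h.tendsto hs y))

lemma tendsto_int_comp (h : Appr p a μ β s1 s2 w wk qk) {G : ℝ → ℝ → ℝ}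
    (hG : Continuous fun q : ℝ × ℝ => G q.1 q.2) {c d : ℝ} (hc : s1 ≤ c) (hcd : c ≤ d) (hd : d ≤ s2) :
    Tendsto (fun k => ∫ s in c..d, ∫ y, G s (wk k y s) ∂gm n) atTop
      (𝓝 (∫ s in c..d, ∫ y, G s (w y s) ∂gm n)) := by
  obtain ⟨C, hC, hb⟩ := h.bd
  obtain ⟨B, hB, hGB⟩ := exists_bound_comp hG s1 s2 C
  have hsub : Set.uIoc c d ⊆ Set.Icc s1 s2 := by
    rw [Set.uIoc_of_le hcd]
    exact fun s hs => ⟨hc.trans hs.1.le, hs.2.trans hd⟩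
  refine intervalIntegral.tendsto_integral_filter_of_dominated_convergence (fun _ => B) ?_ ?_
    intervalIntegrable_const ?_
  · exact Eventually.of_forall fun k =>
      ((h.nice_k_comp k hG).integral_cont.mono hsub).aestronglyMeasurable measurableSet_uIoc
  · exact Eventually.of_forall fun k => ae_of_all _ fun s hs =>
      abs_integral_gm_le fun y => hGB s (hsub hs) _ ((hb y s (hsub hs)).2 k)
  · exact ae_of_all _ fun s hs => h.tendsto_comp hG (hsub hs)

lemma mono (h : Appr p a μ β s1 s2 w wk qk) {s1' s2' : ℝ} (h1 : s1 ≤ s1') (h2 : s2' ≤ s2) :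
    Appr p a μ β s1' s2' w wk qk := by
  have hs : Set.Icc s1' s2' ⊆ Set.Icc s1 s2 := Set.Icc_subset_Icc h1 h2
  obtain ⟨J, hJ, hs'⟩ := h.sim
  obtain ⟨C, hC, hb⟩ := h.bd
  refine ⟨⟨J, hs.trans hJ, hs'⟩, h.nice.mono hs, ⟨C, hC, fun y s hss => hb y s (hs hss)⟩,
    fun η hη => ?_, fun η hη => ?_⟩
  · filter_upwards [h.lim η hη] with k hk s hss using hk s (hs hss)
  · filter_upwards [h.res η hη] with k hk s hss using hk s (hs hss)

end Appr

lemma Sim.nice_wt_sq {n : ℕ} {J : Set ℝ} {β : ℝ} {w q : E n → ℝ → ℝ} (h : Sim J β w q) :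
    ContinuousOn (dS β w q) J := h.nwt.sq.integral_cont

/-- The displacement in `L²(γ)` is controlled by the dissipation. -/
lemma Sim.dist_sq_le {n : ℕ} {J : Set ℝ} {β : ℝ} {w q : E n → ℝ → ℝ} (h : Sim J β w q) {s s' : ℝ}
    (hss : s ≤ s') (hJ : Set.Icc s s' ⊆ J) :
    ∫ y, (w y s' - w y s) ^ 2 ∂gm n ≤ Real.exp 1 * (s' - s) * ∫ σ in s..s', dS β w q σ := by
  rcases hss.eq_or_lt with rfl | hlt
  · simp
  set τ := s' - s with hτ
  have hτ0 : 0 < τ := by simp [hτ, hlt]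
  have hsJ : s ∈ J := hJ (Set.left_mem_Icc.2 hss)
  have hN0 : Nice J fun y (_ : ℝ) => w y s := by
    obtain ⟨k, C, hC, hb⟩ := h.nw.gr
    exact ⟨fun _ _ => h.nw.cy s hsJ, fun y => continuousOn_const, ⟨k, C, hC, fun y _ _ => hb y s hsJ⟩⟩
  have hN : Nice J fun y σ => w y σ - w y s := h.nw.sub hN0
  have hN2 : Nice J fun y σ => 2 * ((w y σ - w y s) * wt β w q y σ) := (hN.mul h.nwt).const_mul 2
  set G : ℝ → ℝ := fun σ => ∫ y, (w y σ - w y s) ^ 2 ∂gm n with hG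
  set G' : ℝ → ℝ := fun σ => ∫ y, 2 * ((w y σ - w y s) * wt β w q y σ) ∂gm n with hG'
  have hd : ∀ σ ∈ J, HasDerivAt G (G' σ) σ := fun σ hσ =>
    hN.sq.hasDerivAt hN2 h.op (fun y σ hσ => (((h.dw y σ hσ).sub_const (w y s)).fun_pow 2).congr_deriv (by
      simp; ring)) hσ
  have hG'le : ∀ σ ∈ J, G' σ ≤ G σ / τ + τ * dS β w q σ := fun σ hσ => by
    have : G σ / τ + τ * dS β w q σ = ∫ y, (w y σ - w y s) ^ 2 / τ + τ * wt β w q y σ ^ 2 ∂gm n := by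
      rw [integral_add ((hN.sq.integrable hσ).div_const τ) ((h.nwt.sq.integrable hσ).const_mul τ),
        integral_div, integral_const_mul]
      rfl
    rw [this]
    refine integral_mono (hN2.integrable hσ) (((hN.sq.integrable hσ).div_const τ).add
      ((h.nwt.sq.integrable hσ).const_mul τ)) fun y => ?_
    have h0 : (w y σ - w y s) ^ 2 / τ + τ * wt β w q y σ ^ 2 -
        2 * ((w y σ - w y s) * wt β w q y σ) = ((w y σ - w y s) - τ * wt β w q y σ) ^ 2 / τ := by
      field_simp; ring
    have h1 : 0 ≤ ((w y σ - w y s) - τ * wt β w q y σ) ^ 2 / τ := by positivity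
    simp only
    linarith
  have hDc : ContinuousOn (dS β w q) (Set.Icc s s') := h.nice_wt_sq.mono hJ
  have hD0 : ∀ σ, 0 ≤ dS β w q σ := fun σ => integral_nonneg fun y => sq_nonneg _
  have he : ∀ σ : ℝ, HasDerivAt (fun σ => Real.exp (-(σ - s) / τ))
      (Real.exp (-(σ - s) / τ) * (-1 / τ)) σ := fun σ =>
    ((((hasDerivAt_id σ).sub_const s).fun_neg).div_const τ).exp
  have hanti : AntitoneOn (fun σ => Real.exp (-(σ - s) / τ) * G σ - τ * ∫ v in s..σ, dS β w q v)
      (Set.Icc s s') := by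
    refine antitone_of_hasDerivAt (f' := fun σ => Real.exp (-(σ - s) / τ) * (-1 / τ) * G σ +
      Real.exp (-(σ - s) / τ) * G' σ - τ * dS β w q σ) ?_ (fun σ hσ => ?_) fun σ hσ => ?_
    · refine ContinuousOn.sub (fun σ hσ => ?_) (continuousOn_const.mul (continuousOn_integral hss hDc))
      exact ((he σ).fun_mul (hd σ (hJ hσ))).continuousAt.continuousWithinAt
    · exact ((he σ).fun_mul (hd σ (hJ (Set.Ioo_subset_Icc_self hσ)))).fun_sub
        ((hasDerivAt_integral_of_continuousOn hDc hσ).const_mul τ)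
    · have h1 := hG'le σ (hJ (Set.Ioo_subset_Icc_self hσ))
      have h2 : Real.exp (-(σ - s) / τ) ≤ 1 := by
        rw [Real.exp_le_one_iff, neg_div]
        have : 0 ≤ (σ - s) / τ := div_nonneg (by linarith [hσ.1]) hτ0.le
        linarith
      have h3 := mul_le_mul_of_nonneg_left h1 (Real.exp_pos (-(σ - s) / τ)).le
      have h4 := mul_le_mul_of_nonneg_right h2 (mul_nonneg hτ0.le (hD0 σ))
      have h5 : Real.exp (-(σ - s) / τ) * (-1 / τ) * G σ = -(Real.exp (-(σ - s) / τ) * (G σ / τ)) := by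
        ring
      rw [h5]
      linarith
  have hfin := hanti (Set.left_mem_Icc.2 hss) (Set.right_mem_Icc.2 hss) hss
  have hGs : G s = 0 := by simp [hG]
  simp only [hGs, mul_zero, intervalIntegral.integral_same, sub_zero] at hfin
  have e1 : Real.exp (-(s' - s) / τ) = (Real.exp 1)⁻¹ := by
    rw [← Real.exp_neg, ← hτ, neg_div, div_self hτ0.ne']
  rw [e1, sub_nonpos, inv_mul_le_iff₀ (Real.exp_pos _)] at hfin
  change G s' ≤ _
  linarith

end

section

noncomputable def Kf (p a μ β s z : ℝ) : ℝ := 2 * (z * NN p a μ β s z) - 4 * PH p a μ β s z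

/-- The energy averaged over `[s, s+1]`, in a form that makes sense without derivatives of `w`. -/
noncomputable def Qf {n : ℕ} (p a μ β : ℝ) (w : E n → ℝ → ℝ) (s : ℝ) : ℝ :=
  -(1 / 4) * (yS w (s + 1) - yS w s) + 1 / 4 * ∫ v in s..s + 1, ∫ y, Kf p a μ β v (w y v) ∂gm n

lemma Kf_continuous {p a μ β : ℝ} (hp : 1 < p) :
    Continuous fun q : ℝ × ℝ => Kf p a μ β q.1 q.2 := by
  unfold Kf
  exact (continuous_const.mul (continuous_snd.mul (NN_continuous hp))).sub
    (continuous_const.mul (PH_continuous hp))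

namespace Appr
variable {n : ℕ} {p a μ β s1 s2 : ℝ} {w : E n → ℝ → ℝ} {wk qk : ℕ → E n → ℝ → ℝ}

lemma nice_q (h : Appr p a μ β s1 s2 w wk qk) (k : ℕ) : Nice (Set.Icc s1 s2) (qk k) := by
  obtain ⟨J, hJ, hs⟩ := h.sim
  exact (hs k).nq.mono hJ

lemma nice_res (h : Appr p a μ β s1 s2 w wk qk) (hp : 1 < p) (k : ℕ) {H : ℝ → ℝ → ℝ}
    (hH : Continuous fun q : ℝ × ℝ => H q.1 q.2) :
    Nice (Set.Icc s1 s2) fun y s => H s (wk k y s) * (qk k y s - NN p a μ β s (wk k y s)) :=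
  (h.nice_k_comp k hH).mul ((h.nice_q k).sub (h.nice_k_comp k (NN_continuous hp)))

lemma tendsto_int_res (h : Appr p a μ β s1 s2 w wk qk) {H : ℝ → ℝ → ℝ}
    (hH : Continuous fun q : ℝ × ℝ => H q.1 q.2) {c d : ℝ} (hc : s1 ≤ c) (hcd : c ≤ d) (hd : d ≤ s2) :
    Tendsto (fun k => ∫ s in c..d, ∫ y, H s (wk k y s) * (qk k y s - NN p a μ β s (wk k y s)) ∂gm n) atTop
      (𝓝 0) := by
  obtain ⟨C, hC, hb⟩ := h.bd
  obtain ⟨B, hB, hHB⟩ := exists_bound_comp hH s1 s2 C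
  refine Metric.tendsto_nhds.2 fun η hη => ?_
  have hpos : 0 < (B + 1) * (|d - c| + 1) := by positivity
  filter_upwards [h.res (η / (2 * ((B + 1) * (|d - c| + 1)))) (by positivity)] with k hk
  rw [Real.dist_eq, sub_zero, ← Real.norm_eq_abs]
  have h1 : ‖∫ s in c..d, ∫ y, H s (wk k y s) * (qk k y s - NN p a μ β s (wk k y s)) ∂gm n‖ ≤
      (B * (η / (2 * ((B + 1) * (|d - c| + 1))))) * |d - c| := by
    refine intervalIntegral.norm_integral_le_of_norm_le_const fun s hs => ?_
    rw [Set.uIoc_of_le hcd] at hs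
    have hs' : s ∈ Set.Icc s1 s2 := ⟨hc.trans hs.1.le, hs.2.trans hd⟩
    refine abs_integral_gm_le fun y => ?_
    rw [abs_mul]
    exact mul_le_mul (hHB s hs' _ ((hb y s hs').2 k)) (hk s hs' y) (abs_nonneg _) hB
  refine h1.trans_lt ?_
  calc _ ≤ ((B + 1) * (η / (2 * ((B + 1) * (|d - c| + 1))))) * (|d - c| + 1) := by
        gcongr <;> linarith
    _ = η / 2 := by field_simp
    _ < η := half_lt_self hη

lemma tendsto_yS (h : Appr p a μ β s1 s2 w wk qk) {s : ℝ} (hs : s ∈ Set.Icc s1 s2) :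
    Tendsto (fun k => yS (wk k) s) atTop (𝓝 (yS w s)) :=
  h.tendsto_comp (G := fun _ z => z ^ 2) (by fun_prop) hs

lemma mean_sub (h : Appr p a μ β s1 s2 w wk qk) (hp : 1 < p) {c d : ℝ} (hc : s1 ≤ c) (hcd : c ≤ d)
    (hd : d ≤ s2) : ∫ y, w y d ∂gm n - ∫ y, w y c ∂gm n =
      ∫ s in c..d, (∫ y, (-(β * w y s) + NN p a μ β s (w y s)) ∂gm n) := by
  have hG : Continuous fun q : ℝ × ℝ => -(β * q.2) + NN p a μ β q.1 q.2 :=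
    (by fun_prop : Continuous fun q : ℝ × ℝ => -(β * q.2)).add (NN_continuous hp)
  have hcI : c ∈ Set.Icc s1 s2 := ⟨hc, hcd.trans hd⟩
  have hdI : d ∈ Set.Icc s1 s2 := ⟨hc.trans hcd, hd⟩
  have hsub : Set.Icc c d ⊆ Set.Icc s1 s2 := Set.Icc_subset_Icc hc hd
  have t1 := h.tendsto_int_comp (G := fun s z => -(β * z) + NN p a μ β s z) hG hc hcd hd
  have t2 := h.tendsto_int_res (H := fun _ _ => 1) (by fun_prop) hc hcd hd
  have t3 := (h.tendsto_comp (G := fun _ z => z) (by fun_prop) hdI).sub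
    (h.tendsto_comp (G := fun _ z => z) (by fun_prop) hcI)
  have t4 := t1.add t2
  rw [add_zero] at t4
  refine tendsto_nhds_unique t3 (t4.congr fun k => ?_)
  obtain ⟨J, hJ, hsim⟩ := h.sim
  have n1 := h.nice_k_comp k (G := fun s z => -(β * z) + NN p a μ β s z) hG
  have n2 := h.nice_res hp k (H := fun _ _ => 1) (by fun_prop)
  rw [← intervalIntegral.integral_add]
  · symm
    rw [← intervalIntegral.integral_eq_sub_of_hasDerivAt
      (f := fun s => ∫ y, wk k y s ∂gm n) (f' := fun s => -(β * ∫ y, wk k y s ∂gm n) +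
      ∫ y, qk k y s ∂gm n)]
    · refine intervalIntegral.integral_congr fun s hs => ?_
      rw [Set.uIcc_of_le hcd] at hs
      have hs' := hsub hs
      rw [← integral_add (n1.integrable hs') (n2.integrable hs'), ← integral_const_mul, ← integral_neg,
        ← integral_add (((h.nice_k k).const_mul β).neg.integrable hs') ((h.nice_q k).integrable hs')]
      refine integral_congr_ae (ae_of_all _ fun y => ?_)
      simp only
      ring
    · intro s hs
      rw [Set.uIcc_of_le hcd] at hs
      exact (hsim k).hasDerivAt_mean (hJ (hsub hs))
    · refine ContinuousOn.intervalIntegrable ?_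
      rw [Set.uIcc_of_le hcd]
      exact ((((h.nice_k k).integral_cont.const_mul β).neg).add (h.nice_q k).integral_cont).mono hsub
  · refine ContinuousOn.intervalIntegrable ?_
    rw [Set.uIcc_of_le hcd]
    exact n1.integral_cont.mono hsub
  · refine ContinuousOn.intervalIntegrable ?_
    rw [Set.uIcc_of_le hcd]
    exact n2.integral_cont.mono hsub

lemma tendsto_int_eS (h : Appr p a μ β s1 s2 w wk qk) (hp : 1 < p) (ha : 0 < a) (hβ : β * (p - 1) = 1)
    {c : ℝ} (hc : s1 ≤ c) (hd : c + 1 ≤ s2) :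
    Tendsto (fun k => ∫ s in c..c + 1, eS p a μ β (wk k) s) atTop (𝓝 (Qf p a μ β w c)) := by
  have hcd : c ≤ c + 1 := by linarith
  have hcI : c ∈ Set.Icc s1 s2 := ⟨hc, hcd.trans hd⟩
  have hdI : c + 1 ∈ Set.Icc s1 s2 := ⟨hc.trans hcd, hd⟩
  have hsub : Set.Icc c (c + 1) ⊆ Set.Icc s1 s2 := Set.Icc_subset_Icc hc hd
  have t1 := h.tendsto_int_comp (Kf_continuous (a := a) (μ := μ) (β := β) hp) hc hcd hd
  have t2 := h.tendsto_int_res (H := fun _ z => 2 * z) (by fun_prop) hc hcd hd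
  have t3 := (h.tendsto_yS hdI).sub (h.tendsto_yS hcI)
  have t4 := (t3.const_mul (-(1 / 4))).add ((t1.add t2).const_mul (1 / 4))
  rw [add_zero] at t4
  refine t4.congr fun k => ?_
  obtain ⟨J, hJ, hsim⟩ := h.sim
  have n1 := h.nice_k_comp k (Kf_continuous (a := a) (μ := μ) (β := β) hp)
  have n2 := h.nice_res hp k (H := fun _ z => 2 * z) (by fun_prop)
  have ce : ContinuousOn (eS p a μ β (wk k)) (Set.Icc c (c + 1)) := fun s hs =>
    ((hsim k).hasDerivAt_eS hp ha hβ (hJ (hsub hs))).continuousAt.continuousWithinAt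
  have ii : ∀ {f : ℝ → ℝ}, ContinuousOn f (Set.Icc c (c + 1)) → IntervalIntegrable f volume c (c + 1) :=
    fun hf => ContinuousOn.intervalIntegrable (by rwa [Set.uIcc_of_le hcd])
  have e1 : yS (wk k) (c + 1) - yS (wk k) c = ∫ s in c..c + 1,
      (-4 * eS p a μ β (wk k) s + ((∫ y, Kf p a μ β s (wk k y s) ∂gm n) +
      ∫ y, 2 * wk k y s * (qk k y s - NN p a μ β s (wk k y s)) ∂gm n)) := by
    refine (intervalIntegral.integral_eq_sub_of_hasDerivAt (fun s hs => ?_) (ii ?_)).symm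
    · rw [Set.uIcc_of_le hcd] at hs
      have hs' := hsub hs
      refine ((hsim k).hasDerivAt_yS (hJ hs')).congr_deriv ?_
      rw [(hsim k).yS'_eq hp ha hβ (hJ hs'), ← integral_add (n1.integrable hs') (n2.integrable hs')]
      congr 1
      refine integral_congr_ae (ae_of_all _ fun y => ?_)
      simp only [Kf]
      ring
    · exact (ce.const_mul _).add ((n1.integral_cont.mono hsub).add (n2.integral_cont.mono hsub))
  have i12 : IntervalIntegrable (fun s => (∫ y, Kf p a μ β s (wk k y s) ∂gm n) +
      ∫ y, 2 * wk k y s * (qk k y s - NN p a μ β s (wk k y s)) ∂gm n) volume c (c + 1) :=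
    ii ((n1.integral_cont.mono hsub).add (n2.integral_cont.mono hsub))
  rw [e1, intervalIntegral.integral_add (ii (ce.const_mul _)) i12, intervalIntegral.integral_add (ii (n1.integral_cont.mono hsub))
    (ii (n2.integral_cont.mono hsub)), intervalIntegral.integral_const_mul]
  ring

end Appr

end

section

theorem exists_energy_core {β p a μ : ℝ} (hp : 1 < p) (ha : 0 < a) (hβ : β * (p - 1) = 1) {c0 : ℝ}
    (hc0 : c0 = (p - 1) / (p + 1)) {e1 : ℝ} (he1 : 0 < e1) : ∃ ss, 1 ≤ ss ∧
    ∀ e0, e1 ≤ e0 → ∀ (n : ℕ) (w : E n → ℝ → ℝ) (wk qk : ℕ → E n → ℝ → ℝ) (s1 : ℝ), ss ≤ s1 →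
      (∀ s2, Appr p a μ β s1 s2 w wk qk) → Qf p a μ β w s1 < e0 → ∀ y1, 0 < y1 →
      26 * e0 < c0 * y1 ^ ((p + 1) / 2) → ∀ s, s1 + 1 ≤ s → ∀ᶠ k in atTop,
        yS (wk k) s ≤ y1 ∧ c0 * ∫ v in s..s + 1, pS p (wk k) v ≤ y1 + 13 * e0 ∧
        ∫ v in s1 + 1..s, dS β (wk k) (qk k) v ≤ 8 * (2 * e0 + 2 * (e0 / 4 + c0 / 4) + y1) := by
  obtain ⟨Co, hCo, h⟩ := exists_En (μ := μ) hp ha hβ hc0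
  obtain ⟨ss, hss, hEn⟩ := h e1 he1
  refine ⟨ss, hss, fun e0 he n w wk qk s1 hs1 hA hQ y1 hy1 hy s hs => ?_⟩
  have hc0p : 0 < c0 := by rw [hc0]; exact div_pos (by linarith) (by linarith)
  set q := (p + 1) / 2 with hq
  have hq1 : 0 < (q - 1) * (c0 / 2) := mul_pos (by rw [hq]; linarith) (by linarith)
  set L := y1 ^ (1 - q) / ((q - 1) * (c0 / 2)) with hL
  have hL0 : 0 ≤ L := div_nonneg (Real.rpow_nonneg hy1.le _) hq1.le
  set s2 := s + 2 + L with hs2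
  have hL1 : y1 ^ (1 - q) = (q - 1) * (c0 / 2) * L := by rw [hL, mul_div_cancel₀ _ hq1.ne']
  have hA2 := hA s2
  obtain ⟨J, hJ, hsim⟩ := hA2.sim
  have hη : 0 < s2 ^ (-1 - a) := Real.rpow_pos_of_pos (by linarith) _
  filter_upwards [hA2.res _ hη, (hA2.tendsto_int_eS hp ha hβ le_rfl (by linarith)).eventually (gt_mem_nhds hQ)]
    with k hk hek
  have hen := hEn e0 he n J (wk k) (qk k) s1 s2 hs1 hJ (hsim k) (fun v hv y => (hk v hv y).trans
    (Real.rpow_le_rpow_of_nonpos (by linarith [hv.1]) hv.2 (by linarith)))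
  have hsub : Set.Icc s1 (s1 + 1) ⊆ Set.Icc s1 s2 := Set.Icc_subset_Icc le_rfl (by linarith)
  obtain ⟨σ, hσ, hσe⟩ := exists_lt_of_integral_lt (fun v hv =>
    (hen.hE v (hsub hv)).continuousAt.continuousWithinAt) hek
  have y_s := hen.y_le hσ.1 (hσ.2.trans hs) (by linarith) hσe.le hy1 hy (by
    rw [hL1]; exact mul_lt_mul_of_pos_left (by linarith) hq1)
  have y_s1 := hen.y_le hσ.1 (show σ ≤ s + 1 by linarith [hσ.2]) (by linarith) hσe.le hy1 hy (by
    rw [hL1]; exact mul_lt_mul_of_pos_left (by linarith) hq1)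
  have P_s := hen.int_P_le hσ.1 (hσ.2.trans hs) (by linarith) hσe.le
  have D_s := hen.int_D_le hσ.1 (hσ.2.trans hs) (by linarith) hσe.le y_s1
  refine ⟨y_s, by linarith, le_trans ?_ D_s⟩
  have i1 : IntervalIntegrable (dS β (wk k) (qk k)) volume σ (s1 + 1) := by
    refine (hen.hD.mono ?_).intervalIntegrable
    rw [Set.uIcc_of_le hσ.2]
    exact Set.Icc_subset_Icc hσ.1 (by linarith)
  have i2 : IntervalIntegrable (dS β (wk k) (qk k)) volume (s1 + 1) s := by
    refine (hen.hD.mono ?_).intervalIntegrable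
    rw [Set.uIcc_of_le hs]
    exact Set.Icc_subset_Icc (by linarith) (by linarith)
  rw [← intervalIntegral.integral_add_adjacent_intervals i1 i2]
  have : 0 ≤ ∫ v in σ..s1 + 1, dS β (wk k) (qk k) v :=
    intervalIntegral.integral_nonneg hσ.2 fun v hv => integral_nonneg fun y => sq_nonneg _
  linarith

/-- Uniform bounds after the averaged energy has become small. -/
structure Ub {n : ℕ} (p β c0 e0 s0 y1 CD : ℝ) (w : E n → ℝ → ℝ) (wk qk : ℕ → E n → ℝ → ℝ) : Prop where
  y : ∀ s, s0 ≤ s → yS w s ≤ y1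
  P : ∀ s, s0 ≤ s → c0 * ∫ v in s..s + 1, pS p w v ≤ y1 + 13 * e0
  D : ∀ s, s0 ≤ s → ∀ᶠ k in atTop, ∫ v in s0..s, dS β (wk k) (qk k) v ≤ CD
  dist : ∀ s s', s0 ≤ s → s ≤ s' → ∫ y, (w y s' - w y s) ^ 2 ∂gm n ≤ Real.exp 1 * (s' - s) * CD

lemma Appr.dist_sq_le {n : ℕ} {p a μ β s1 s2 C s s' : ℝ} {w : E n → ℝ → ℝ} {wk qk : ℕ → E n → ℝ → ℝ}
    (h : Appr p a μ β s1 s2 w wk qk) (hs : s1 ≤ s) (hss : s ≤ s') (hs2 : s' ≤ s2)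
    (hD : ∃ᶠ k in atTop, ∫ v in s..s', dS β (wk k) (qk k) v ≤ C) :
    ∫ y, (w y s' - w y s) ^ 2 ∂gm n ≤ Real.exp 1 * (s' - s) * C := by
  obtain ⟨J, hJ, hsim⟩ := h.sim
  obtain ⟨B, hB, hb⟩ := h.bd
  have hs1 : s ∈ Set.Icc s1 s2 := ⟨hs, hss.trans hs2⟩
  have hs2 : s' ∈ Set.Icc s1 s2 := ⟨hs.trans hss, hs2⟩
  have t : Tendsto (fun k => ∫ y, (wk k y s' - wk k y s) ^ 2 ∂gm n) atTop
      (𝓝 (∫ y, (w y s' - w y s) ^ 2 ∂gm n)) := by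
    refine tendsto_integral_of_dominated_convergence (fun _ => (2 * B) ^ 2)
      (fun k => ((((h.nice_k k).cy s' hs2).sub ((h.nice_k k).cy s hs1)).pow 2).aestronglyMeasurable)
      (integrable_const _) (fun k => ae_of_all _ fun y => ?_) (ae_of_all _ fun y => ?_)
    · rw [Real.norm_eq_abs, abs_pow]
      have h1 := abs_le.1 ((hb y s' hs2).2 k)
      have h2 := abs_le.1 ((hb y s hs1).2 k)
      refine pow_le_pow_left₀ (abs_nonneg _) (abs_le.2 ⟨?_, ?_⟩) 2 <;> linarith [h1.1, h1.2, h2.1, h2.2]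
    · exact ((h.tendsto hs2 y).sub (h.tendsto hs1 y)).pow 2
  refine le_of_tendsto_of_frequently t (hD.mono fun k hk => ?_)
  refine ((hsim k).dist_sq_le hss ((Set.Icc_subset_Icc hs hs2.2).trans hJ)).trans ?_
  exact mul_le_mul_of_nonneg_left hk (mul_nonneg (Real.exp_pos _).le (by linarith))

theorem exists_energy {β p a μ : ℝ} (hp : 1 < p) (ha : 0 < a) (hβ : β * (p - 1) = 1) {c0 : ℝ}
    (hc0 : c0 = (p - 1) / (p + 1)) {e1 : ℝ} (he1 : 0 < e1) : ∃ ss, 1 ≤ ss ∧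
    ∀ e0, e1 ≤ e0 → ∀ (n : ℕ) (w : E n → ℝ → ℝ) (wk qk : ℕ → E n → ℝ → ℝ) (s1 : ℝ), ss ≤ s1 →
      (∀ s2, Appr p a μ β s1 s2 w wk qk) → Qf p a μ β w s1 < e0 → ∀ y1, 0 < y1 →
      26 * e0 < c0 * y1 ^ ((p + 1) / 2) →
      Ub p β c0 e0 (s1 + 1) y1 (8 * (2 * e0 + 2 * (e0 / 4 + c0 / 4) + y1)) w wk qk := by
  obtain ⟨ss, hss, h⟩ := exists_energy_core (μ := μ) hp ha hβ hc0 he1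
  refine ⟨ss, hss, fun e0 he n w wk qk s1 hs1 hA hQ y1 hy1 hy => ?_⟩
  have hcore := h e0 he n w wk qk s1 hs1 hA hQ y1 hy1 hy
  have hc0p : 0 < c0 := by rw [hc0]; exact div_pos (by linarith) (by linarith)
  have hpc : Continuous fun q : ℝ × ℝ => |q.2| ^ (p + 1) :=
    (continuous_abs.comp continuous_snd).rpow_const fun _ => Or.inr (by linarith)
  refine ⟨fun s hs => ?_, fun s hs => ?_, fun s hs => ?_, fun s s' hs hss => ?_⟩
  · exact le_of_tendsto ((hA s).tendsto_yS ⟨by linarith, le_rfl⟩) ((hcore s hs).mono fun k hk => hk.1)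
  · exact le_of_tendsto (((hA (s + 1)).tendsto_int_comp (G := fun _ z => |z| ^ (p + 1)) hpc
      (by linarith) (by linarith) le_rfl).const_mul c0) ((hcore s hs).mono fun k hk => hk.2.1)
  · exact (hcore s hs).mono fun k hk => hk.2.2
  · refine (hA s').dist_sq_le (by linarith) hss le_rfl (Eventually.frequently ?_)
    filter_upwards [hcore s' (hs.trans hss)] with k hk
    refine le_trans ?_ hk.2.2
    obtain ⟨J, hJ, hsim⟩ := (hA s').sim
    have hc : ∀ c d, s1 ≤ c → c ≤ d → d ≤ s' → IntervalIntegrable (dS β (wk k) (qk k)) volume c d :=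
      fun c d h1 h2 h3 => by
        refine ((hsim k).nice_wt_sq.mono ?_).intervalIntegrable
        rw [Set.uIcc_of_le h2]
        exact (Set.Icc_subset_Icc h1 h3).trans hJ
    rw [← intervalIntegral.integral_add_adjacent_intervals (hc (s1 + 1) s (by linarith) hs hss)
      (hc s s' (by linarith) hss le_rfl)]
    have : 0 ≤ ∫ v in s1 + 1..s, dS β (wk k) (qk k) v :=
      intervalIntegral.integral_nonneg hs fun v hv => integral_nonneg fun y => sq_nonneg _
    linarith

end

section

variable {n : ℕ} {p a μ T : ℝ} {u : E n → ℝ → ℝ}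

lemma W_zero_eq (T' : ℝ) (b : E n) (v : E n → ℝ → ℝ) (y : E n) (s : ℝ) :
    W 0 T' b v y s = v (b + Real.exp (-s / 2) • y) (T' - Real.exp (-s)) := by
  simp [W]

lemma NN_zero_exp (s w : ℝ) : NN p a μ 0 s w = Real.exp (-s) * ff p a μ w := by
  simp [NN]

lemma continuousOn_of_solvesU (hp : 1 < p) (ha : 0 < a) (hu : SolvesU n p a μ T u) :
    ContinuousOn (fun q : E n × ℝ => u q.1 q.2) (Set.univ ×ˢ Set.Ioo 0 T) := by
  rintro ⟨x, t⟩ ⟨-, ht⟩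
  obtain ⟨T2, h1, h2⟩ := exists_between ht.2
  have h0 : 0 < T2 := ht.1.trans h1
  obtain ⟨M, hM, hc⟩ := cl_of_solvesU hp ha hu h0 h2
  have := (hc.continuousOn hM).continuousAt (x := (x, t))
    ((isOpen_univ.prod isOpen_Ioo).mem_nhds ⟨Set.mem_univ _, ht.1, h1⟩)
  exact this.continuousWithinAt

lemma exists_bound_of_solvesU (hu : SolvesU n p a μ T u) {t : ℝ} (ht : t < T) :
    ∃ M, 0 ≤ M ∧ ∀ x, ∀ t' ∈ Set.Icc 0 t, |u x t'| ≤ M := by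
  rcases lt_or_ge t 0 with h | h
  · exact ⟨0, le_rfl, fun x t' ht' => absurd (ht'.1.trans ht'.2) (by linarith)⟩
  · obtain ⟨M, hM⟩ := hu.2.2.2.1 t ⟨h, ht⟩
    exact ⟨M, (abs_nonneg _).trans (hM 0 0 ⟨le_rfl, h⟩), hM⟩

lemma appr_max (hp : 1 < p) (ha : 0 < a) (hu : SolvesU n p a μ T u) {β : ℝ} (hβ : 0 ≤ β)
    {T' : ℝ} (b : E n) {s1 : ℝ} (hs : 0 ≤ s1) (h1 : Real.exp (-s1) < T') (hT' : T' ≤ T) (s2 : ℝ) :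
    Appr p a μ β s1 s2 (W β T' b u) (fun k => WV β T' b (mol n k) u)
      (fun k => WV (β + 1) T' b (mol n k) (fun x t => ff p a μ (u x t))) :=
  (appr_of_solvesU hp ha hu hβ b hs (le_max_left s1 s2) h1 hT').mono le_rfl (le_max_right _ _)

lemma mean_sub_eq (hp : 1 < p) (ha : 0 < a) (hu : SolvesU n p a μ T u) {T' : ℝ} (b : E n) {c d : ℝ}
    (hc : 0 ≤ c) (h1 : Real.exp (-c) < T') (hT' : T' ≤ T) (hcd : c ≤ d) :
    mean u b T' d - mean u b T' c =
      ∫ s in c..d, ∫ y, NN p a μ 0 s (W 0 T' b u y s) ∂gm n := by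
  have := (appr_max hp ha hu le_rfl b hc h1 hT' d).mean_sub hp le_rfl hcd le_rfl
  simpa [mean, W_zero_eq] using this

lemma abs_sub_mean_le (hp : 1 < p) (ha : 0 < a) (hu : SolvesU n p a μ T u) {T' : ℝ} (b : E n) {c C : ℝ}
    (hc : 0 ≤ c) (h1 : Real.exp (-c) < T') (hT' : T' < T)
    (h : ∀ d, c ≤ d → ∫ s in c..d, ∫ y, |NN p a μ 0 s (W 0 T' b u y s)| ∂gm n ≤ C) :
    |u b T' - mean u b T' c| ≤ C := by
  have h0 : 0 < T' := (Real.exp_pos _).trans h1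
  obtain ⟨T2, h2, h3⟩ := exists_between hT'
  obtain ⟨M, hM, hcl⟩ := cl_of_solvesU hp ha hu (h0.trans h2) h3
  have t : Tendsto (fun d => |mean u b T' d - mean u b T' c|) atTop (𝓝 |u b T' - mean u b T' c|) :=
    ((tendsto_mean (hcl.continuousOn hM) hcl.usc.bd ⟨h0, h2⟩ b).sub_const _).abs
  refine le_of_tendsto t ((eventually_ge_atTop c).mono fun d hd => ?_)
  rw [mean_sub_eq hp ha hu b hc h1 hT'.le hd]
  refine le_trans ?_ (h d hd)
  have hN := (appr_max hp ha hu le_rfl b hc h1 hT'.le d).nice_comp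
    (NN_continuous (a := a) (μ := μ) (β := 0) hp)
  have hA := (appr_max hp ha hu le_rfl b hc h1 hT'.le d).nice_comp
    (G := fun s z => |NN p a μ 0 s z|) (NN_continuous (a := a) (μ := μ) (β := 0) hp).abs
  refine (intervalIntegral.abs_integral_le_integral_abs hd).trans ?_
  refine intervalIntegral.integral_mono_on hd ?_ ?_ fun s hs => ?_
  · refine ContinuousOn.intervalIntegrable ?_
    rw [Set.uIcc_of_le hd]; exact hN.integral_cont.abs
  · refine ContinuousOn.intervalIntegrable ?_
    rw [Set.uIcc_of_le hd]; exact hA.integral_cont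
  · exact abs_integral_le (hA.integrable hs) fun y => le_rfl

/-- Uniform bounds for solutions in similarity variables. -/
structure Ubd {n : ℕ} (p β s0 C : ℝ) (w : E n → ℝ → ℝ) (wk qk : ℕ → E n → ℝ → ℝ) : Prop where
  y : ∀ s, s0 ≤ s → yS w s ≤ C
  P : ∀ s, s0 ≤ s → ∫ v in s..s + 1, pS p w v ≤ C
  D : ∀ s, s0 ≤ s → ∀ᶠ k in atTop, ∫ v in s0..s, dS β (wk k) (qk k) v ≤ C
  dist : ∀ s s', s0 ≤ s → s ≤ s' → ∫ y, (w y s' - w y s) ^ 2 ∂gm n ≤ C * (s' - s)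

theorem exists_unif (hp : 1 < p) (ha : 0 < a) {β : ℝ} (hβ : β * (p - 1) = 1) (hT : 0 < T)
    (hu : SolvesU n p a μ T u) : ∃ s0 C, 0 ≤ s0 ∧ 0 < C ∧ Real.exp (-s0) ≤ T / 4 ∧
      ∀ b : E n, ∀ T' ∈ Set.Icc (T / 2) T, Ubd p β s0 C (W β T' b u) (fun k => WV β T' b (mol n k) u)
        (fun k => WV (β + 1) T' b (mol n k) (fun x t => ff p a μ (u x t))) := by
  have hβ0 := beta_pos hp hβ
  set c0 := (p - 1) / (p + 1) with hc0
  have hc0p : 0 < c0 := div_pos (by linarith) (by linarith)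
  obtain ⟨ss, hss, H⟩ := exists_energy (μ := μ) hp ha hβ hc0 one_pos
  obtain ⟨s1, h4, hs1⟩ := ((tendsto_exp_neg.eventually_le_const (show 0 < T / 4 by linarith)).and
    (eventually_ge_atTop ss)).exists
  obtain ⟨M, hM, hb⟩ := exists_bound_of_solvesU hu (t := T - Real.exp (-(s1 + 1)))
    (by linarith [Real.exp_pos (-(s1 + 1))])
  obtain ⟨B, hB, hK⟩ := exists_bound_comp (Kf_continuous (a := a) (μ := μ) (β := β) hp) s1 (s1 + 1) M
  set e0 := 1 + M ^ 2 + B with he0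
  have he1 : 1 ≤ e0 := by rw [he0]; nlinarith [sq_nonneg M]
  have hq : 0 < (p + 1) / 2 := by linarith
  obtain ⟨y1, hy, hy1⟩ := (((tendsto_rpow_atTop hq).const_mul_atTop hc0p).eventually_gt_atTop
    (26 * e0) |>.and (eventually_gt_atTop 0)).exists
  set CD := 8 * (2 * e0 + 2 * (e0 / 4 + c0 / 4) + y1)
  have hCD : 0 < CD := by positivity
  refine ⟨s1 + 1, y1 + (y1 + 13 * e0) / c0 + CD + Real.exp 1 * CD, by linarith, by positivity, ?_,
    fun b T' hT' => ?_⟩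
  · exact le_trans (Real.exp_le_exp.2 (by linarith)) h4
  · have hT1 : Real.exp (-s1) < T' := by linarith [hT'.1]
    have hA := appr_max hp ha hu hβ0.le b (show 0 ≤ s1 by linarith) hT1 hT'.2
    have hw : ∀ y, ∀ s ∈ Set.Icc s1 (s1 + 1), |W β T' b u y s| ≤ M := fun y s hs => by
      have e1 : Real.exp (-β * s) ≤ 1 := Real.exp_le_one_iff.2 (by nlinarith [hs.1])
      have e2 : Real.exp (-s) ≤ Real.exp (-s1) := Real.exp_le_exp.2 (by linarith [hs.1])
      have e3 : Real.exp (-(s1 + 1)) ≤ Real.exp (-s) := Real.exp_le_exp.2 (by linarith [hs.2])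
      have h := hb (b + Real.exp (-s / 2) • y) (T' - Real.exp (-s))
        ⟨by linarith, by linarith [hT'.2]⟩
      rw [W, abs_mul, abs_of_pos (Real.exp_pos _)]
      nlinarith [abs_nonneg (u (b + Real.exp (-s / 2) • y) (T' - Real.exp (-s))), Real.exp_pos (-β * s)]
    have hQ : Qf p a μ β (W β T' b u) s1 < e0 := by
      have k1 : |yS (W β T' b u) (s1 + 1)| ≤ M ^ 2 := abs_integral_gm_le fun y => by
        rw [abs_pow]; exact pow_le_pow_left₀ (abs_nonneg _) (hw y _ ⟨by linarith, le_rfl⟩) 2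
      have k2 : |yS (W β T' b u) s1| ≤ M ^ 2 := abs_integral_gm_le fun y => by
        rw [abs_pow]; exact pow_le_pow_left₀ (abs_nonneg _) (hw y _ ⟨le_rfl, by linarith⟩) 2
      have k3 : ‖∫ v in s1..s1 + 1, ∫ y, Kf p a μ β v (W β T' b u y v) ∂gm n‖ ≤ B * |s1 + 1 - s1| := by
        refine intervalIntegral.norm_integral_le_of_norm_le_const fun v hv => ?_
        rw [Set.uIoc_of_le (by linarith)] at hv
        exact abs_integral_gm_le fun y => hK v ⟨hv.1.le, hv.2⟩ _ (hw y v ⟨hv.1.le, hv.2⟩)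
      rw [Real.norm_eq_abs] at k3
      have k1' := abs_le.1 k1
      have k2' := abs_le.1 k2
      have k3' := abs_le.1 k3
      have : |s1 + 1 - s1| = 1 := by norm_num
      rw [this, mul_one] at k3'
      unfold Qf
      linarith [k1'.1, k2'.2, k3'.2]
    have U : Ub p β c0 e0 (s1 + 1) y1 CD (W β T' b u) (fun k => WV β T' b (mol n k) u)
        (fun k => WV (β + 1) T' b (mol n k) (fun x t => ff p a μ (u x t))) := H e0 he1 n _ _ _ s1 hs1 hA hQ y1 hy1 hy
    have q1 : 0 < (y1 + 13 * e0) / c0 := by positivity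
    have q2 : 0 < Real.exp 1 * CD := by positivity
    refine ⟨fun s hs => (U.y s hs).trans (by linarith), fun s hs => ?_, fun s hs => ?_, fun s s' hs hss' => ?_⟩
    · have := U.P s hs
      rw [mul_comm, ← le_div_iff₀ hc0p] at this
      linarith
    · exact (U.D s hs).mono fun k hk => hk.trans (by linarith)
    · have h1 := U.dist s s' hs hss'
      have h2 : 0 ≤ s' - s := by linarith
      nlinarith

end

section

variable {n : ℕ}

noncomputable def Cr (n : ℕ) : ℝ := ((4 * π) ^ (-(n : ℝ) / 2))⁻¹ * Real.exp (1 / 4)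

lemma Cr_pos (n : ℕ) : 0 < Cr n := by unfold Cr; positivity

lemma Cr_mul_rho {y : E n} (hy : ‖y‖ ≤ 1) : 1 ≤ Cr n * rho n y := by
  have h0 : 0 < (4 * π) ^ (-(n : ℝ) / 2) := by positivity
  have : Cr n * rho n y = Real.exp (1 / 4 + -‖y‖ ^ 2 / 4) := by
    unfold Cr rho
    rw [Real.exp_add]
    field_simp
  rw [this]
  exact Real.one_le_exp (by nlinarith [norm_nonneg y])

lemma rho_le_const (y : E n) : rho n y ≤ (4 * π) ^ (-(n : ℝ) / 2) := by
  unfold rho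
  refine mul_le_of_le_one_right (by positivity) (Real.exp_le_one_iff.2 ?_)
  nlinarith [sq_nonneg ‖y‖]

lemma integrableOn_ball {f : E n → ℝ} (hf : Continuous f) (r : ℝ) :
    IntegrableOn f (Metric.closedBall 0 r) :=
  hf.continuousOn.integrableOn_compact (isCompact_closedBall 0 r)

lemma setInt_le_gm {f : E n → ℝ} (hf : Continuous f) (h0 : ∀ y, 0 ≤ f y) (hi : Integrable f (gm n))
    {r : ℝ} (hr : r ≤ 1) : ∫ y in Metric.closedBall 0 r, f y ≤ Cr n * ∫ y, f y ∂gm n := by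
  rw [integral_gm, ← integral_const_mul]
  have hi' := (integrable_gm.1 hi).const_mul (Cr n)
  refine (setIntegral_mono_on (integrableOn_ball hf r) hi'.integrableOn
    Metric.isClosed_closedBall.measurableSet fun y hy => ?_).trans
    (setIntegral_le_integral hi' (ae_of_all _ fun y =>
      mul_nonneg (Cr_pos n).le (mul_nonneg (h0 y) (rho_pos y).le)))
  have := Cr_mul_rho ((mem_closedBall_zero_iff.1 hy).trans hr)
  nlinarith [h0 y]

open Pointwise in
lemma setInt_scale (F : E n → ℝ) {l r : ℝ} (hl : 0 < l) (hr : 0 ≤ r) :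
    ∫ y in Metric.closedBall 0 (r * l), F (l⁻¹ • y) = l ^ n * ∫ z in Metric.closedBall 0 r, F z := by
  rw [Measure.setIntegral_comp_smul_of_pos _ _ _ (inv_pos.2 hl)]
  have : l⁻¹ • Metric.closedBall (0 : E n) (r * l) = Metric.closedBall 0 r := by
    rw [smul_closedBall _ _ (by positivity), smul_zero, norm_inv, Real.norm_of_nonneg hl.le]
    congr 1; field_simp
  rw [this]
  simp

lemma setInt_mono_ball {f : E n → ℝ} (hf : Continuous f) (h0 : ∀ y, 0 ≤ f y) {r r' : ℝ} (hr : r ≤ r') :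
    ∫ y in Metric.closedBall 0 r, f y ≤ ∫ y in Metric.closedBall 0 r', f y :=
  setIntegral_mono_set (integrableOn_ball hf r') (ae_of_all _ h0)
    (Metric.closedBall_subset_closedBall hr).eventuallyLE

lemma exists_ball_lower (n : ℕ) : ∃ R0 c : ℝ, 0 < R0 ∧ 0 < c ∧ ∀ (v : E n → ℝ) (M : ℝ), Continuous v → 0 < M →
    (∀ y, |v y| ≤ M) → M / 4 ≤ |∫ y, v y ∂gm n| → c * M ^ 2 ≤ ∫ y in Metric.closedBall 0 R0, v y ^ 2 := by
  set m1 : ℝ := ∫ y : E n, (1 + ‖y‖) ^ 1 ∂gm n with hm1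
  have hm10 : 0 ≤ m1 := integral_nonneg fun y => by positivity
  have hD : 0 < (4 * π) ^ (-(n : ℝ) / 2) := by positivity
  refine ⟨16 * m1 + 1, 1 / 32 / (4 * π) ^ (-(n : ℝ) / 2), by positivity, by positivity,
    fun v M hv hM hb hl => ?_⟩
  set R0 := 16 * m1 + 1
  have hR0 : 0 < R0 := by positivity
  set B := Metric.closedBall (0 : E n) R0
  have hB : MeasurableSet B := Metric.isClosed_closedBall.measurableSet
  have hiv : Integrable (fun y => v y ^ 2) (gm n) :=
    (integrable_const (M ^ 2)).mono' (hv.pow 2).aestronglyMeasurable (ae_of_all _ fun y => by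
      rw [Real.norm_eq_abs, abs_pow]; exact pow_le_pow_left₀ (abs_nonneg _) (hb y) 2)
  have hind : Integrable (B.indicator fun y => v y ^ 2) (gm n) := hiv.indicator hB
  have hi1 := (integrable_pow_gm (n := n) 1)
  have hp : ∀ y, |v y| ≤ M / R0 * (1 + ‖y‖) ^ 1 + (M / 16 + 4 / M * B.indicator (fun y => v y ^ 2) y) := by
    intro y
    by_cases hy : y ∈ B
    · rw [Set.indicator_of_mem hy]
      have h1 : 0 ≤ M / R0 * (1 + ‖y‖) ^ 1 := by positivity
      have h2 : M / 16 + 4 / M * v y ^ 2 - |v y| = 4 / M * (|v y| - M / 8) ^ 2 := by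
        rw [← sq_abs (v y)]; field_simp; ring
      have h3 : 0 ≤ 4 / M * (|v y| - M / 8) ^ 2 := by positivity
      linarith
    · rw [Set.indicator_of_notMem hy]
      have h1 : R0 < ‖y‖ := by simpa [B] using hy
      have h2 : M ≤ M / R0 * (1 + ‖y‖) ^ 1 := by
        rw [div_mul_eq_mul_div, le_div_iff₀ hR0, pow_one]; nlinarith
      have := hb y
      linarith
  have hInt := abs_integral_le (m := gm n) ((hi1.const_mul (M / R0)).add ((integrable_const (M / 16)).add
    (hind.const_mul (4 / M)))) hp
  have e : ∫ y, (M / R0 * (1 + ‖y‖) ^ 1 + (M / 16 + 4 / M * B.indicator (fun y => v y ^ 2) y)) ∂gm n =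
      M / R0 * m1 + (M / 16 + 4 / M * ∫ y in B, v y ^ 2 ∂gm n) := by
    have j1 : Integrable (fun y => M / R0 * (1 + ‖y‖) ^ 1) (gm n) := hi1.const_mul _
    have j2 : Integrable (fun y => 4 / M * B.indicator (fun y => v y ^ 2) y) (gm n) := hind.const_mul _
    have j3 : Integrable (fun y => M / 16 + 4 / M * B.indicator (fun y => v y ^ 2) y) (gm n) :=
      (integrable_const _).add j2
    rw [integral_add j1 j3, integral_add (integrable_const _) j2, integral_const_mul, integral_const_mul,
      integral_indicator hB]
    simp [hm1]
  have e' := hInt.trans e.le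
  have h1 : M / R0 * m1 ≤ M / 16 := by
    rw [div_mul_eq_mul_div, div_le_div_iff₀ hR0 (by norm_num)]
    nlinarith
  have h2 : M ^ 2 / 32 ≤ ∫ y in B, v y ^ 2 ∂gm n := by
    have : M / 8 ≤ 4 / M * ∫ y in B, v y ^ 2 ∂gm n := by linarith
    rw [div_mul_eq_mul_div, le_div_iff₀ hM] at this
    nlinarith
  have h3 : ∫ y in B, v y ^ 2 ∂gm n ≤ (4 * π) ^ (-(n : ℝ) / 2) * ∫ y in B, v y ^ 2 := by
    rw [← integral_indicator hB, integral_gm, ← integral_const_mul, ← integral_indicator hB]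
    refine integral_mono (integrable_gm.1 hind) ?_ fun y => ?_
    · exact (integrable_indicator_iff hB).2 ((integrableOn_ball (f := fun y => v y ^ 2) (hv.pow 2) R0).const_mul _)
    · by_cases hy : y ∈ B
      · simp only [Set.indicator_of_mem hy]
        nlinarith [rho_le_const y, sq_nonneg (v y)]
      · simp [Set.indicator_of_notMem hy]
  rw [div_mul_eq_mul_div, div_le_iff₀ hD]
  linarith

/-- A lower bound on the `L²` mass gives a lower bound on the `L^{p+1}` mass. -/
lemma rpow_mass_lower {p : ℝ} (hp : 1 < p) {v : E n → ℝ} (hv : Continuous v) {r A V0 c : ℝ} (hA : 0 < A)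
    (hV : volume.real (Metric.closedBall (0 : E n) r) ≤ V0)
    (hc : c ≤ ∫ y in Metric.closedBall 0 r, v y ^ 2) :
    A ^ (p - 1) * (c - A ^ 2 * V0) ≤ ∫ y in Metric.closedBall 0 r, |v y| ^ (p + 1) := by
  have hcp : Continuous fun y => |v y| ^ (p + 1) := hv.abs.rpow_const fun _ => Or.inr (by linarith)
  have hAp : 0 < A ^ (p - 1) := Real.rpow_pos_of_pos hA _
  have key : ∀ y, A ^ (p - 1) * v y ^ 2 ≤ |v y| ^ (p + 1) + A ^ (p - 1) * A ^ 2 := fun y => by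
    rw [← sq_abs (v y)]
    rcases le_total |v y| A with h | h
    · have : |v y| ^ 2 ≤ A ^ 2 := pow_le_pow_left₀ (abs_nonneg _) h 2
      have := Real.rpow_nonneg (abs_nonneg (v y)) (p + 1)
      nlinarith
    · have h1 : A ^ (p - 1) ≤ |v y| ^ (p - 1) := Real.rpow_le_rpow hA.le h (by linarith)
      have h2 : |v y| ^ (p + 1) = |v y| ^ (p - 1) * |v y| ^ 2 := by
        rw [← Real.rpow_natCast, ← Real.rpow_add (hA.trans_le h)]; congr 1; norm_num; ring
      rw [h2]
      have := mul_le_mul_of_nonneg_right h1 (sq_nonneg |v y|)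
      nlinarith [mul_pos hAp (pow_pos hA 2)]
  have i1 := integrableOn_ball hcp r
  have hfin : volume (Metric.closedBall (0 : E n) r) ≠ ⊤ := (isCompact_closedBall 0 r).measure_lt_top.ne
  have hm := setIntegral_mono_on ((integrableOn_ball (f := fun y => v y ^ 2) (hv.pow 2) r).const_mul (A ^ (p - 1)))
    (i1.add (integrableOn_const (μ := volume) (C := A ^ (p - 1) * A ^ 2) hfin))
    Metric.isClosed_closedBall.measurableSet fun y _ => key y
  have e : ∫ y in Metric.closedBall 0 r, (|v y| ^ (p + 1) + A ^ (p - 1) * A ^ 2) =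
      (∫ y in Metric.closedBall 0 r, |v y| ^ (p + 1)) +
      volume.real (Metric.closedBall (0 : E n) r) * (A ^ (p - 1) * A ^ 2) := by
    rw [integral_add i1 (integrableOn_const hfin)]
    simp
  rw [integral_const_mul] at hm
  have hm' := hm.trans e.le
  have : volume.real (Metric.closedBall (0 : E n) r) * (A ^ (p - 1) * A ^ 2) ≤ V0 * (A ^ (p - 1) * A ^ 2) :=
    mul_le_mul_of_nonneg_right hV (by positivity)
  have h2 := mul_le_mul_of_nonneg_left hc hAp.le
  have h3 : A ^ (p - 1) * (c - A ^ 2 * V0) = A ^ (p - 1) * c - V0 * (A ^ (p - 1) * A ^ 2) := by ring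
  rw [h3]
  linarith

end

section

variable {n : ℕ} {p a μ β T : ℝ} {u : E n → ℝ → ℝ}

lemma duhamel_const (hp : 1 < p) (ha : 0 < a) (hu : SolvesU n p a μ T u) {T' M : ℝ} (b : E n) {c : ℝ}
    (hc : 0 ≤ c) (h1 : Real.exp (-c) < T') (hT' : T' < T) (hM : ∀ x, ∀ t ∈ Set.Ico (T' - Real.exp (-c)) T', |u x t| ≤ M) :
    |u b T' - mean u b T' c| ≤ Cf a μ * M ^ p * Real.exp (-c) := by
  have hM0 : 0 ≤ M := (abs_nonneg _).trans (hM 0 _ ⟨le_rfl, by linarith [Real.exp_pos (-c)]⟩)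
  have hC : 0 ≤ Cf a μ * M ^ p := mul_nonneg (Cf_pos a μ).le (Real.rpow_nonneg hM0 _)
  refine abs_sub_mean_le hp ha hu b hc h1 hT' fun d hd => ?_
  have hI : ∫ s in c..d, Cf a μ * M ^ p * Real.exp (-s) = Cf a μ * M ^ p * (Real.exp (-c) - Real.exp (-d)) := by
    rw [intervalIntegral.integral_const_mul, intervalIntegral.integral_eq_sub_of_hasDerivAt
      (f := fun s => -Real.exp (-s)) (fun s _ => ?_) ((by fun_prop : Continuous fun s : ℝ => Real.exp (-s)).intervalIntegrable _ _)]
    · ring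
    · exact ((Real.hasDerivAt_exp (-s)).comp s (hasDerivAt_neg s)).fun_neg.congr_deriv (by ring)
  have hA := (appr_max hp ha hu le_rfl b hc h1 hT'.le d).nice_comp
    (G := fun s z => |NN p a μ 0 s z|) (NN_continuous (a := a) (μ := μ) (β := 0) hp).abs
  calc _ ≤ ∫ s in c..d, Cf a μ * M ^ p * Real.exp (-s) := by
        refine intervalIntegral.integral_mono_on hd ?_ ((by fun_prop : Continuous fun s : ℝ => Cf a μ * M ^ p * Real.exp (-s)).intervalIntegrable _ _) fun s hs => ?_
        · refine ContinuousOn.intervalIntegrable ?_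
          rw [Set.uIcc_of_le hd]; exact hA.integral_cont
        · refine (le_abs_self _).trans (abs_integral_gm_le fun y => ?_)
          rw [abs_abs, NN_zero_exp, W_zero_eq, abs_mul, abs_of_pos (Real.exp_pos _), mul_comm]
          refine mul_le_mul_of_nonneg_right ?_ (Real.exp_pos _).le
          have : Real.exp (-s) ≤ Real.exp (-c) := Real.exp_le_exp.2 (by linarith [hs.1])
          exact (abs_ff_le hp ha _).trans (mul_le_mul_of_nonneg_left (Real.rpow_le_rpow (abs_nonneg _)
            (hM _ _ ⟨by linarith, by linarith [Real.exp_pos (-s)]⟩) (by linarith)) (Cf_pos a μ).le)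
    _ ≤ _ := by
      rw [hI]
      exact mul_le_mul_of_nonneg_left (by linarith [Real.exp_pos (-d)]) hC

lemma exists_bad_point (hβ : 0 < β) (hT : 0 < T) (hu : SolvesU n p a μ T u)
    (hneg : ∀ K, ∃ x, ∃ t ∈ Set.Ico 0 T, K < |u x t| * (T - t) ^ β) (K : ℝ) {δ : ℝ} (hδ : 0 < δ) :
    ∃ x1 t1 M, t1 ∈ Set.Ico 0 T ∧ T - δ < t1 ∧ 0 < M ∧ K ≤ M * (T - t1) ^ β ∧
      (∀ x, ∀ t ∈ Set.Icc 0 t1, |u x t| ≤ M) ∧ M / 2 ≤ |u x1 t1| := by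
  obtain ⟨M0, hM0, hb0⟩ := exists_bound_of_solvesU hu (t := T - δ) (by linarith)
  obtain ⟨x, t, ht, hK⟩ := hneg (max K (2 * (M0 + 1) * T ^ β))
  obtain ⟨M1, hM1, hb1⟩ := exists_bound_of_solvesU hu ht.2
  have hTp : 0 < T ^ β := Real.rpow_pos_of_pos hT _
  have htp : 0 < (T - t) ^ β := Real.rpow_pos_of_pos (by linarith [ht.2]) _
  have htT : (T - t) ^ β ≤ T ^ β := Real.rpow_le_rpow (by linarith [ht.2]) (by linarith [ht.1]) hβ.le
  set S : Set ℝ := {m | ∃ z, ∃ τ ∈ Set.Icc 0 t, m = |u z τ|}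
  have hbdd : BddAbove S := ⟨M1, by rintro _ ⟨z, τ, hτ, rfl⟩; exact hb1 z τ hτ⟩
  have hmem : |u x t| ∈ S := ⟨x, t, ⟨ht.1, le_rfl⟩, rfl⟩
  have hle : |u x t| ≤ sSup S := le_csSup hbdd hmem
  have hlow : 2 * (M0 + 1) < |u x t| := by
    have h1 := (le_max_right K (2 * (M0 + 1) * T ^ β)).trans_lt hK
    by_contra! h
    nlinarith [abs_nonneg (u x t)]
  have hMpos : 0 < sSup S := by linarith
  obtain ⟨_, ⟨z, τ, hτ, rfl⟩, hlt⟩ := exists_lt_of_lt_csSup ⟨_, hmem⟩ (show sSup S / 2 < sSup S by linarith)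
  refine ⟨z, τ, sSup S, ⟨hτ.1, hτ.2.trans_lt ht.2⟩, ?_, hMpos, ?_, fun z' t' ht' =>
    le_csSup hbdd ⟨z', t', ⟨ht'.1, ht'.2.trans hτ.2⟩, rfl⟩, hlt.le⟩
  · by_contra! h
    have := hb0 z τ ⟨hτ.1, h⟩
    linarith
  · have h1 : (T - t) ^ β ≤ (T - τ) ^ β := Real.rpow_le_rpow (by linarith [ht.2]) (by linarith [hτ.2]) hβ.le
    have h2 := (le_max_left K (2 * (M0 + 1) * T ^ β)).trans_lt hK
    have := mul_le_mul hle h1 htp.le hMpos.le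
    linarith

lemma W_scaled (T' : ℝ) (x1 y : E n) (s : ℝ) {l lam : ℝ} (hl : l * Real.exp (-s / 2) = lam) (hl0 : 0 < l) :
    W β T' x1 u y s = Real.exp (-β * s) * u (x1 + lam • l⁻¹ • y) (T' - Real.exp (-s)) := by
  rw [W, smul_smul, ← hl]
  congr 4
  field_simp

lemma setInt_W (φ : ℝ → ℝ) (T' : ℝ) (x1 : E n) (s : ℝ) {l lam r : ℝ} (hl : l * Real.exp (-s / 2) = lam)
    (hl0 : 0 < l) (hr : 0 ≤ r) : ∫ y in Metric.closedBall 0 (r * l), φ (W β T' x1 u y s) =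
      l ^ n * ∫ z in Metric.closedBall 0 r, φ (Real.exp (-β * s) * u (x1 + lam • z) (T' - Real.exp (-s))) := by
  rw [← setInt_scale _ hl0 hr]
  simp only [W_scaled T' x1 _ s hl hl0]

lemma persist (hp : 1 < p) (ha : 0 < a) (hu : SolvesU n p a μ T u) (hβ : 0 < β) {x1 : E n}
    {s sb C lam lb r m : ℝ} (hs : 0 ≤ s) (hsT : Real.exp (-s) < T) (hssb : s ≤ sb)
    (hdist : ∫ y, (W β T x1 u y sb - W β T x1 u y s) ^ 2 ∂gm n ≤ C * (sb - s))
    (h4 : Real.exp (-s) ≤ 4 * Real.exp (-sb)) (hlb : lb * Real.exp (-sb / 2) = lam) (hlb0 : 0 < lb)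
    (hr : 0 ≤ r) (hrl : r * lb ≤ 1)
    (hm : m ≤ ∫ z in Metric.closedBall 0 r, u (x1 + lam • z) (T - Real.exp (-sb)) ^ 2) :
    lb ^ n * Real.exp (-β * sb) ^ 2 * m ≤
      2 * (lb ^ n * (4 ^ β * Real.exp (-β * sb)) ^ 2 *
        ∫ z in Metric.closedBall 0 (2 * r), u (x1 + lam • z) (T - Real.exp (-s)) ^ 2) +
      2 * (Cr n * (C * (sb - s))) := by
  have hA := appr_max hp ha hu hβ.le x1 hs hsT le_rfl sb
  have hsI : s ∈ Set.Icc s sb := ⟨le_rfl, hssb⟩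
  have hsbI : sb ∈ Set.Icc s sb := ⟨hssb, le_rfl⟩
  have c1 := hA.nice.cy s hsI
  have c2 := hA.nice.cy sb hsbI
  set g := fun y => W β T x1 u y sb with hg
  set h := fun y => W β T x1 u y s with hh
  have hd : Integrable (fun y => (g y - h y) ^ 2) (gm n) := by
    have hgi : Integrable (fun y => g y ^ 2) (gm n) := hA.nice.sq.integrable hsbI
    have hhi : Integrable (fun y => h y ^ 2) (gm n) := hA.nice.sq.integrable hsI
    refine ((hgi.const_mul 2).add (hhi.const_mul 2)).mono' ((c2.sub c1).pow 2).aestronglyMeasurable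
      (ae_of_all _ fun y => ?_)
    rw [Real.norm_of_nonneg (sq_nonneg _), Pi.add_apply]
    nlinarith [sq_nonneg (g y + h y)]
  have e1 := setInt_W (β := β) (u := u) (fun z => z ^ 2) T x1 sb hlb hlb0 hr
  have e2 : ∫ y in Metric.closedBall 0 (r * lb), (g y - h y) ^ 2 ≤ Cr n * ∫ y, (g y - h y) ^ 2 ∂gm n :=
    setInt_le_gm ((c2.sub c1).pow 2) (fun y => sq_nonneg _) hd hrl
  have hl : lb * Real.exp ((s - sb) / 2) * Real.exp (-s / 2) = lam := by
    rw [mul_assoc, ← Real.exp_add, ← hlb]; congr 2; ring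
  have hl0 : 0 < lb * Real.exp ((s - sb) / 2) := by positivity
  have hball : r * lb ≤ 2 * r * (lb * Real.exp ((s - sb) / 2)) := by
    have h1 : 1 ≤ 2 * Real.exp ((s - sb) / 2) := by
      have h2 : Real.exp ((s - sb) / 2) ^ 2 = Real.exp (-sb) / Real.exp (-s) := by
        rw [← Real.exp_nat_mul, ← Real.exp_sub]; congr 1; push_cast; ring
      have h3 : 1 / 4 ≤ Real.exp ((s - sb) / 2) ^ 2 := by
        rw [h2, div_le_div_iff₀ (by norm_num) (Real.exp_pos _)]; linarith
      nlinarith [Real.exp_pos ((s - sb) / 2)]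
    nlinarith [mul_nonneg hr hlb0.le]
  have e3 := setInt_W (β := β) (u := u) (fun z => z ^ 2) T x1 s hl hl0 (show 0 ≤ 2 * r by linarith)
  have e4 := setInt_mono_ball (f := fun y => h y ^ 2) (c1.pow 2) (fun y => sq_nonneg _) hball
  have e5 : ∫ y in Metric.closedBall 0 (r * lb), g y ^ 2 ≤
      2 * (∫ y in Metric.closedBall 0 (r * lb), h y ^ 2) +
      2 * ∫ y in Metric.closedBall 0 (r * lb), (g y - h y) ^ 2 := by
    have i1 : IntegrableOn (fun y => 2 * h y ^ 2) (Metric.closedBall 0 (r * lb)) :=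
      integrableOn_ball (by fun_prop) _
    have i2 : IntegrableOn (fun y => 2 * (g y - h y) ^ 2) (Metric.closedBall 0 (r * lb)) :=
      integrableOn_ball (by fun_prop) _
    rw [← integral_const_mul, ← integral_const_mul, ← integral_add i1 i2]
    refine setIntegral_mono_on (integrableOn_ball (by fun_prop) _) (i1.add i2)
      Metric.isClosed_closedBall.measurableSet fun y _ => ?_
    nlinarith [sq_nonneg (g y - 2 * h y)]
  simp only [mul_pow] at e1 e3
  rw [integral_const_mul] at e1 e3
  have e6 : (lb * Real.exp ((s - sb) / 2)) ^ n ≤ lb ^ n :=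
    pow_le_pow_left₀ hl0.le (mul_le_of_le_one_right hlb0.le (Real.exp_le_one_iff.2 (by linarith))) n
  have e7 : Real.exp (-β * s) ≤ 4 ^ β * Real.exp (-β * sb) := by
    have : (Real.exp (-s)) ^ β ≤ (4 * Real.exp (-sb)) ^ β := Real.rpow_le_rpow (Real.exp_pos _).le h4 hβ.le
    rw [Real.mul_rpow (by norm_num) (Real.exp_pos _).le, ← Real.exp_mul, ← Real.exp_mul] at this
    rwa [show -s * β = -β * s by ring, show -sb * β = -β * sb by ring] at this
  set I2 := ∫ z in Metric.closedBall 0 (2 * r), u (x1 + lam • z) (T - Real.exp (-s)) ^ 2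
  have hI2 : 0 ≤ I2 := integral_nonneg fun y => sq_nonneg _
  have e8 : ∫ y in Metric.closedBall 0 (r * lb), h y ^ 2 ≤ lb ^ n * (4 ^ β * Real.exp (-β * sb)) ^ 2 * I2 := by
    refine e4.trans (e3.le.trans ?_)
    rw [mul_pow] at e6
    rw [mul_assoc (lb ^ n) (_ ^ 2) I2]
    refine mul_le_mul e6 (mul_le_mul_of_nonneg_right (pow_le_pow_left₀ (Real.exp_pos _).le e7 2) hI2)
      (by positivity) (by positivity)
  have e9 : lb ^ n * Real.exp (-β * sb) ^ 2 * m ≤ ∫ y in Metric.closedBall 0 (r * lb), g y ^ 2 := by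
    refine le_trans ?_ e1.symm.le
    rw [mul_assoc]
    gcongr
  have e10 := mul_le_mul_of_nonneg_left hdist (Cr_pos n).le
  linarith

end

section

variable {n : ℕ} {p a μ β T : ℝ} {u : E n → ℝ → ℝ}

lemma slice_continuous (hu : SolvesU n p a μ T u) {t : ℝ} (ht : t ∈ Set.Ico 0 T) : Continuous fun x => u x t :=
  (hu.1 t ht).continuous

lemma exists_mass (hp : 1 < p) (ha : 0 < a) (hu : SolvesU n p a μ T u) :
    ∃ τ r c, 0 < τ ∧ 0 < r ∧ 0 < c ∧ ∀ x1 t1 M L, 0 < M → 0 < L → M ^ (p - 1) * L = 1 → τ * L ≤ 1 →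
      τ * L < t1 → t1 < T → (∀ x, ∀ t ∈ Set.Icc 0 t1, |u x t| ≤ M) → M / 2 ≤ |u x1 t1| →
      c * M ^ 2 ≤ ∫ z in Metric.closedBall 0 r, u (x1 + √L • z) (t1 - τ * L) ^ 2 := by
  obtain ⟨R0, c, hR0, hc, H⟩ := exists_ball_lower n
  have hCF := Cf_pos a μ
  set τ := 1 / (4 * Cf a μ) with hτ
  have hτ0 : 0 < τ := by positivity
  have hsτ : 0 < √τ := Real.sqrt_pos.2 hτ0
  refine ⟨τ, R0 * √τ, c * √τ ^ n, hτ0, by positivity, by positivity, fun x1 t1 M L hM hL hML h1 h2 h3 hb hx => ?_⟩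
  have hτL : 0 < τ * L := by positivity
  have hec : Real.exp (- -Real.log (τ * L)) = τ * L := by rw [neg_neg, Real.exp_log hτL]
  have hec2 : Real.exp (- -Real.log (τ * L) / 2) = √(τ * L) := by
    rw [neg_neg, Real.sqrt_eq_rpow, Real.rpow_def_of_pos hτL]; congr 1; ring
  have hD := duhamel_const hp ha hu x1 (T' := t1) (M := M) (c := -Real.log (τ * L))
    (by have := Real.log_nonpos hτL.le h1; linarith) (by rw [hec]; exact h2) h3
    (fun x t ht => hb x t ⟨by have := ht.1; rw [hec] at this; linarith, ht.2.le⟩)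
  have hMp : M ^ p = M ^ (p - 1) * M := by
    rw [← Real.rpow_add_one hM.ne']; congr 1; ring
  rw [hec, show Cf a μ * M ^ p * (τ * L) = M / 4 by
    rw [hMp, hτ, show Cf a μ * (M ^ (p - 1) * M) * (1 / (4 * Cf a μ) * L) = Cf a μ / (4 * Cf a μ) * (M ^ (p - 1) * L) * M by ring,
      hML]; field_simp] at hD
  have hmean : M / 4 ≤ |∫ y, u (x1 + √(τ * L) • y) (t1 - τ * L) ∂gm n| := by
    rw [mean, hec, hec2] at hD
    have := abs_sub_abs_le_abs_sub (u x1 t1) (∫ y, u (x1 + √(τ * L) • y) (t1 - τ * L) ∂gm n)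
    linarith
  have hcont := slice_continuous hu (t := t1 - τ * L) ⟨by linarith, by linarith⟩
  have h4 := H _ M (by fun_prop) hM (fun y => hb _ _ ⟨by linarith, by linarith⟩) hmean
  have h5 := setInt_scale (n := n) (fun z => u (x1 + √L • z) (t1 - τ * L) ^ 2) (inv_pos.2 hsτ)
    (show 0 ≤ R0 * √τ by positivity)
  rw [mul_assoc, mul_inv_cancel₀ hsτ.ne', mul_one, inv_inv] at h5
  simp only [smul_smul, ← Real.sqrt_mul hL.le, mul_comm L τ] at h5
  rw [h5, inv_pow] at h4
  rw [mul_right_comm]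
  have h6 := mul_le_mul_of_nonneg_left h4 (pow_pos hsτ n).le
  rw [← mul_assoc, ← mul_assoc, mul_inv_cancel₀ (pow_pos hsτ n).ne', one_mul] at h6
  linarith

lemma pS_lower (hp : 1 < p) (ha : 0 < a) (hβ : β * (p - 1) = 1) (hu : SolvesU n p a μ T u) {x1 : E n}
    {t1 s L M r c A V0 : ℝ} (hL : 0 < L) (hML : M = L ^ (-β)) (hs0 : 0 ≤ s) (hst : Real.exp (-s) < t1) (ht1 : t1 ≤ T)
    (hr : 0 ≤ r) (hrl : r * √(L * Real.exp s) ≤ 1) (hA : 0 < A)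
    (hV : volume.real (Metric.closedBall (0 : E n) r) ≤ V0)
    (hc : c * M ^ 2 ≤ ∫ z in Metric.closedBall 0 r, u (x1 + √L • z) (t1 - Real.exp (-s)) ^ 2) :
    A ^ (p - 1) * (c - A ^ 2 * V0) * (L * Real.exp s) ^ ((n : ℝ) / 2 - 1 - 2 * β) ≤
      Cr n * pS p (W β t1 x1 u) s := by
  have hβ0 := beta_pos hp hβ
  set Q := L * Real.exp s with hQ
  have hQ0 : 0 < Q := by positivity
  have hl : √Q * Real.exp (-s / 2) = √L := by
    rw [hQ, Real.sqrt_mul hL.le, mul_assoc, ← Real.exp_half, ← Real.exp_add]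
    rw [show s / 2 + -s / 2 = 0 by ring, Real.exp_zero, mul_one]
  have hl0 : 0 < √Q := Real.sqrt_pos.2 hQ0
  have hT : 0 < t1 := (Real.exp_pos _).trans hst
  have hAp := appr_max hp ha hu hβ0.le x1 hs0 hst ht1 s
  have hsI : s ∈ Set.Icc s s := ⟨le_rfl, le_rfl⟩
  have hN := hAp.nice.rpow (r := p + 1) (by linarith)
  have h1 := setInt_le_gm (hN.cy s hsI) (fun y => by positivity) (hN.integrable hsI) hrl
  have h2 := setInt_W (β := β) (u := u) (fun z => |z| ^ (p + 1)) t1 x1 s hl hl0 hr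
  have hcont := slice_continuous hu (t := t1 - Real.exp (-s)) ⟨by linarith, by linarith [Real.exp_pos (-s)]⟩
  set B := Real.exp (-β * s) * M with hB
  have hBQ : B = Q ^ (-β) := by
    rw [hB, hML, hQ, Real.mul_rpow hL.le (Real.exp_pos _).le, ← Real.exp_mul, mul_comm, show s * -β = -β * s by ring]
  have hB0 : 0 < B := by rw [hBQ]; positivity
  have hc' : c * B ^ 2 ≤ ∫ z in Metric.closedBall 0 r,
      (Real.exp (-β * s) * u (x1 + √L • z) (t1 - Real.exp (-s))) ^ 2 := by
    simp only [mul_pow]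
    rw [integral_const_mul, hB, mul_pow]
    have := mul_le_mul_of_nonneg_left hc (sq_nonneg (Real.exp (-β * s)))
    linarith
  have h3 := rpow_mass_lower hp (by fun_prop) (mul_pos hA hB0) hV hc'
  have h4 : (A * B) ^ (p - 1) * (c * B ^ 2 - (A * B) ^ 2 * V0) =
      A ^ (p - 1) * (c - A ^ 2 * V0) * Q ^ (-1 - 2 * β) := by
    rw [Real.mul_rpow hA.le hB0.le]
    have : B ^ (p - 1) * B ^ 2 = Q ^ (-1 - 2 * β) := by
      rw [hBQ, ← Real.rpow_mul hQ0.le, ← Real.rpow_natCast, ← Real.rpow_mul hQ0.le, ← Real.rpow_add hQ0]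
      congr 1; push_cast; linarith
    rw [← this]; ring
  rw [h4] at h3
  have h5 : Q ^ ((n : ℝ) / 2 - 1 - 2 * β) = √Q ^ n * Q ^ (-1 - 2 * β) := by
    rw [Real.sqrt_eq_rpow, ← Real.rpow_natCast, ← Real.rpow_mul hQ0.le, ← Real.rpow_add hQ0]
    congr 1; ring
  rw [h5]
  refine le_trans ?_ (h2.symm.le.trans h1)
  have := mul_le_mul_of_nonneg_left h3 (pow_pos hl0 n).le
  linarith

end

section

variable {n : ℕ} {p a μ β T : ℝ} {u : E n → ℝ → ℝ}

lemma exists_radius {γ τ r A C : ℝ} (hγ : 0 < γ) (hA : 0 < A) :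
    ∃ R, 0 < R ∧ Real.exp 1 * τ ≤ R ∧ (2 * r) ^ 2 * Real.exp 1 ≤ R ∧ C < A * (R / Real.exp 1) ^ γ := by
  have h1 : Tendsto (fun R : ℝ => A * (R / Real.exp 1) ^ γ) atTop atTop :=
    ((tendsto_rpow_atTop hγ).comp (tendsto_id.atTop_div_const (Real.exp_pos 1))).const_mul_atTop hA
  obtain ⟨R, h1, h2, h3, h4⟩ := ((eventually_gt_atTop 0).and ((eventually_ge_atTop (Real.exp 1 * τ)).and
    ((eventually_ge_atTop ((2 * r) ^ 2 * Real.exp 1)).and (h1.eventually_gt_atTop C)))).exists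
  exact ⟨R, h1, h2, h3, h4⟩

lemma exists_small {γ r R A c : ℝ} (hγ : 0 < γ) (hc : 0 < c) :
    ∃ q : ℝ, 0 < q ∧ r ^ 2 * q ≤ 1 ∧ R * q ≤ 1 ∧ A * q ^ γ ≤ c := by
  have t0 : Tendsto (fun q : ℝ => q) (𝓝[>] 0) (𝓝 0) := tendsto_nhdsWithin_of_tendsto_nhds tendsto_id
  have t1 : Tendsto (fun q : ℝ => r ^ 2 * q) (𝓝[>] 0) (𝓝 0) := by simpa using t0.const_mul (r ^ 2)
  have t2 : Tendsto (fun q : ℝ => R * q) (𝓝[>] 0) (𝓝 0) := by simpa using t0.const_mul R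
  have t3 : Tendsto (fun q : ℝ => A * q ^ γ) (𝓝[>] 0) (𝓝 0) := by
    have := (Real.continuousAt_rpow_const 0 γ (Or.inr hγ.le)).tendsto
    rw [Real.zero_rpow hγ.ne'] at this
    simpa using (tendsto_nhdsWithin_of_tendsto_nhds this).const_mul A
  obtain ⟨q, h1, h2, h3, h4⟩ := ((eventually_mem_nhdsWithin (a := (0 : ℝ)) (s := Set.Ioi 0)).and ((t1.eventually_le_const one_pos).and
    ((t2.eventually_le_const one_pos).and (t3.eventually_le_const hc)))).exists
  exact ⟨q, h1, h2, h3, h4⟩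

theorem exists_typeI (hp : 1 < p) (ha : 0 < a) (hβ : β * (p - 1) = 1) (hsub : (n : ℝ) < 2 + 4 * β) (hT : 0 < T)
    (hu : SolvesU n p a μ T u) : ∃ K, ∀ x, ∀ t ∈ Set.Ico 0 T, |u x t| * (T - t) ^ β ≤ K := by
  have hβ0 := beta_pos hp hβ
  by_contra! hneg
  obtain ⟨s0, C, hs0, hC, hs0T, HU⟩ := exists_unif hp ha hβ hT hu
  obtain ⟨τ, r, c1, hτ, hr, hc1, HM⟩ := exists_mass hp ha hu
  set c2 := c1 / (4 * (4 ^ β) ^ 2) with hc2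
  have h4β : (0 : ℝ) < 4 ^ β := by positivity
  have hc20 : 0 < c2 := by positivity
  set V0 := volume.real (Metric.closedBall (0 : E n) (2 * r)) + 1 with hV0
  have hV00 : 0 < V0 := by positivity
  set A := √(c2 / (2 * V0)) with hA
  have hA0 : 0 < A := Real.sqrt_pos.2 (by positivity)
  have hA2 : c2 - A ^ 2 * V0 = c2 / 2 := by
    rw [hA, Real.sq_sqrt (by positivity)]; field_simp; ring
  set γ := 1 + 2 * β - n / 2 with hγ
  have hγ0 : 0 < γ := by rw [hγ]; linarith
  have hCr := Cr_pos n
  obtain ⟨R, hR0, hRτ, hRr, hRC⟩ := exists_radius (τ := τ) (r := r) (A := A ^ (p - 1) * (c2 / 2))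
    (C := Cr n * (C + 1)) hγ0 (by positivity)
  obtain ⟨q, hq0, hrq, hRq, hqc⟩ := exists_small (r := r) (R := R) (A := 2 * Cr n * C * R) (c := c1 / 2) hγ0 (by positivity)
  have he1 : (1 : ℝ) ≤ Real.exp 1 := by have := Real.add_one_le_exp (1 : ℝ); linarith
  have hτR : τ ≤ R := by nlinarith
  obtain ⟨x1, t1, M, ht1, hδ, hM, hK, hb, hx⟩ := exists_bad_point hβ0 hT hu hneg (q ^ (-β)) (half_pos (Real.exp_pos (-s0)))
  set L := M ^ (-(p - 1)) with hLdef
  have hL : 0 < L := by positivity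
  have hML1 : M ^ (p - 1) * L = 1 := by
    rw [hLdef, ← Real.rpow_add hM]; simp
  have hML : M = L ^ (-β) := by
    rw [hLdef, ← Real.rpow_mul hM.le, show -(p - 1) * -β = 1 by linarith, Real.rpow_one]
  have hd1 : 0 < T - t1 := by linarith [ht1.2]
  have hLq : L ≤ (T - t1) * q := by
    by_contra! h
    have h1 : ((T - t1) * q) ^ β < L ^ β := Real.rpow_lt_rpow (by positivity) h hβ0
    rw [Real.mul_rpow hd1.le hq0.le] at h1
    rw [hML, Real.rpow_neg hq0.le, Real.rpow_neg hL.le] at hK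
    have h2 : 0 < q ^ β := by positivity
    have h3 : 0 < L ^ β := by positivity
    rw [← one_div, ← div_eq_inv_mul, div_le_div_iff₀ h2 h3] at hK
    linarith
  have hRL : R * L ≤ T - t1 := by
    calc R * L ≤ R * ((T - t1) * q) := by gcongr
      _ = (R * q) * (T - t1) := by ring
      _ ≤ 1 * (T - t1) := by gcongr
      _ = _ := one_mul _
  have hτL : τ * L ≤ R * L := by gcongr
  have hes0 : Real.exp (-s0) ≤ 1 := Real.exp_le_one_iff.2 (by linarith)
  have hb0 := HM x1 t1 M L hM hL hML1 (by linarith) (by linarith) ht1.2 hb hx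
  set θb := T - (t1 - τ * L) with hθb
  have hθb0 : 0 < θb := by have := mul_pos hτ hL; linarith
  set sb := -Real.log θb with hsb
  have hesb : Real.exp (-sb) = θb := by rw [hsb, neg_neg, Real.exp_log hθb0]
  set lb := √(L / θb) with hlb
  have hLθ : L / θb ≤ q := by
    rw [div_le_iff₀ hθb0]
    have : (T - t1) * q ≤ θb * q := mul_le_mul_of_nonneg_right (by have := mul_pos hτ hL; linarith) hq0.le
    linarith
  have hlb0 : 0 < lb := Real.sqrt_pos.2 (by positivity)
  have hlb2 : lb ^ 2 = L / θb := Real.sq_sqrt (by positivity)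
  have hlbs : lb * Real.exp (-sb / 2) = √L := by
    rw [show Real.exp (-sb / 2) = √θb by rw [Real.exp_half, hesb], hlb, ← Real.sqrt_mul (by positivity), div_mul_cancel₀ _ hθb0.ne']
  have hrl : r * lb ≤ 1 := by
    rw [← abs_of_nonneg (show 0 ≤ r * lb by positivity), abs_le_one_iff_mul_self_le_one, ← sq, mul_pow, hlb2]
    exact (mul_le_mul_of_nonneg_left hLθ (by positivity)).trans hrq
  have hmass : ∀ t ∈ Set.Icc (t1 - R * L) (t1 - τ * L), c2 * M ^ 2 ≤
      ∫ z in Metric.closedBall 0 (2 * r), u (x1 + √L • z) t ^ 2 := by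
    intro t ht
    have hθ0 : 0 < T - t := by have := mul_pos hτ hL; linarith [ht.2]
    set s := -Real.log (T - t) with hs
    have hes : Real.exp (-s) = T - t := by rw [hs, neg_neg, Real.exp_log hθ0]
    have hs0s : s0 ≤ s := by
      have : Real.exp (-s) ≤ Real.exp (-s0) := by rw [hes]; linarith [ht.1]
      linarith [Real.exp_le_exp.1 this]
    have hssb : s ≤ sb := by
      have := Real.log_le_log hθb0 (show θb ≤ T - t by linarith [ht.2])
      linarith
    have hdiff : sb - s ≤ R * lb ^ 2 := by
      have h1 := Real.log_le_sub_one_of_pos (div_pos hθ0 hθb0)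
      rw [Real.log_div hθ0.ne' hθb0.ne'] at h1
      have h2 : (T - t) / θb - 1 ≤ R * (L / θb) := by
        rw [← mul_div_assoc, div_sub_one hθb0.ne']
        gcongr
        have := mul_pos hτ hL
        linarith [ht.1]
      rw [hlb2]; linarith
    have hP := persist hp ha hu hβ0 (hs0.trans hs0s) (by rw [hes]; linarith [ht.1]) hssb
      ((HU x1 T ⟨by linarith, le_rfl⟩).dist s sb hs0s hssb)
      (by rw [hes, hesb]; have := mul_pos hτ hL; linarith [ht.1]) hlbs hlb0 hr.le hrl (m := c1 * M ^ 2)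
      (by rw [hesb, hθb, sub_sub_cancel]; exact hb0)
    rw [hes, sub_sub_cancel] at hP
    set I2 := ∫ z in Metric.closedBall 0 (2 * r), u (x1 + √L • z) t ^ 2
    set G := lb ^ n * Real.exp (-β * sb) ^ 2 with hG
    have hG0 : 0 < G := by positivity
    have hGM : G * M ^ 2 * (L / θb) ^ γ = L / θb := by
      have hQ0 : 0 < L / θb := by positivity
      have h1 : Real.exp (-β * sb) * M = (L / θb) ^ (-β) := by
        rw [hML, Real.div_rpow hL.le hθb0.le, Real.rpow_neg hθb0.le, ← hesb, ← Real.exp_mul,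
          div_inv_eq_mul, show -sb * β = -β * sb by ring, mul_comm]
      have h2 : lb ^ n = (L / θb) ^ ((n : ℝ) / 2) := by
        rw [hlb, Real.sqrt_eq_rpow, ← Real.rpow_natCast, ← Real.rpow_mul hQ0.le]; congr 1; ring
      have h3 : ((L / θb) ^ (-β)) ^ 2 = (L / θb) ^ (-β * 2) := by
        rw [← Real.rpow_natCast, ← Real.rpow_mul hQ0.le]; norm_num
      rw [hG, mul_assoc (lb ^ n), ← mul_pow, h1, h2, h3, ← Real.rpow_add hQ0, ← Real.rpow_add hQ0, hγ]
      conv_rhs => rw [← Real.rpow_one (L / θb)]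
      congr 1; ring
    have hsmall : 2 * (Cr n * (C * (sb - s))) ≤ G * (c1 / 2) * M ^ 2 := by
      have h1 : (L / θb) ^ γ ≤ q ^ γ := Real.rpow_le_rpow (by positivity) hLθ hγ0.le
      calc _ ≤ 2 * (Cr n * (C * (R * lb ^ 2))) := by gcongr
        _ = (2 * Cr n * C * R * (L / θb) ^ γ) * (G * M ^ 2) := by
          rw [hlb2]; conv_lhs => rw [← hGM]
          ring
        _ ≤ (c1 / 2) * (G * M ^ 2) := by
          gcongr
          exact (mul_le_mul_of_nonneg_left h1 (by positivity)).trans hqc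
        _ = _ := by ring
    have h5 : G * (c1 / 2 * M ^ 2) ≤ G * (2 * (4 ^ β) ^ 2 * I2) := by
      have : 2 * (lb ^ n * (4 ^ β * Real.exp (-β * sb)) ^ 2 * I2) = G * (2 * (4 ^ β) ^ 2 * I2) := by rw [hG]; ring
      rw [this] at hP; linarith
    have h6 := le_of_mul_le_mul_left h5 hG0
    rw [hc2, div_mul_eq_mul_div, div_le_iff₀ (by positivity)]
    linarith
  set σ := -Real.log (R * L) with hσ
  have hRL0 : 0 < R * L := by positivity
  have heσ : Real.exp (-σ) = R * L := by rw [hσ, neg_neg, Real.exp_log hRL0]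
  have hσ0 : s0 ≤ σ := by
    have : Real.exp (-σ) ≤ Real.exp (-s0) := by rw [heσ]; linarith
    linarith [Real.exp_le_exp.1 this]
  have hlow : ∀ s ∈ Set.Icc σ (σ + 1), C + 1 ≤ pS p (W β t1 x1 u) s := by
    intro s hs
    have h1 : Real.exp (-s) ≤ R * L := by rw [← heσ]; exact Real.exp_le_exp.2 (by linarith [hs.1])
    have h2 : R * L ≤ Real.exp 1 * Real.exp (-s) := by
      rw [← heσ, ← Real.exp_add]; exact Real.exp_le_exp.2 (by linarith [hs.2])
    have h3 : τ * L ≤ Real.exp (-s) := by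
      have : Real.exp 1 * (τ * L) ≤ Real.exp 1 * Real.exp (-s) := by
        refine le_trans ?_ h2; rw [← mul_assoc]; gcongr
      exact le_of_mul_le_mul_left this (Real.exp_pos 1)
    have hQ0 : 0 < L * Real.exp s := by positivity
    have hQ : R * (L * Real.exp s) ≤ Real.exp 1 := by
      have := mul_le_mul_of_nonneg_right h2 (Real.exp_pos s).le
      rwa [mul_assoc, mul_assoc, ← Real.exp_add, neg_add_cancel, Real.exp_zero, mul_one] at this
    have hrl2 : 2 * r * √(L * Real.exp s) ≤ 1 := by
      rw [← abs_of_nonneg (show 0 ≤ 2 * r * √(L * Real.exp s) by positivity), abs_le_one_iff_mul_self_le_one, ← sq, mul_pow,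
        Real.sq_sqrt hQ0.le]
      have h5 := mul_le_mul_of_nonneg_right hRr hQ0.le
      have h6 : Real.exp 1 * ((2 * r) ^ 2 * (L * Real.exp s)) ≤ Real.exp 1 * 1 := by linarith
      exact le_of_mul_le_mul_left h6 (Real.exp_pos 1)
    have h4 := pS_lower hp ha hβ hu hL hML (s := s) (by linarith [hs.1]) (by linarith [ht1.1]) ht1.2.le
      (show 0 ≤ 2 * r by linarith) hrl2 hA0 (V0 := V0) (by linarith) (hmass (t1 - Real.exp (-s)) ⟨by linarith, by linarith⟩)
    rw [hA2] at h4
    have h7 : (R / Real.exp 1) ^ γ ≤ (L * Real.exp s) ^ ((n : ℝ) / 2 - 1 - 2 * β) := by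
      rw [show (n : ℝ) / 2 - 1 - 2 * β = -γ by rw [hγ]; ring, Real.rpow_neg hQ0.le, ← Real.inv_rpow hQ0.le]
      refine Real.rpow_le_rpow (by positivity) ?_ hγ0.le
      rw [← one_div, div_le_div_iff₀ (Real.exp_pos 1) hQ0]; linarith
    have h8 := mul_le_mul_of_nonneg_left h7 (show 0 ≤ A ^ (p - 1) * (c2 / 2) by positivity)
    have h9 : Cr n * (C + 1) ≤ Cr n * pS p (W β t1 x1 u) s := by linarith
    exact le_of_mul_le_mul_left h9 hCr
  have hP := (HU x1 t1 ⟨by linarith, ht1.2.le⟩).P σ hσ0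
  have hcont : ContinuousOn (fun v => pS p (W β t1 x1 u) v) (Set.Icc σ (σ + 1)) :=
    ((appr_max hp ha hu hβ0.le x1 (hs0.trans hσ0) (by rw [heσ]; linarith) ht1.2.le (σ + 1)).nice.rpow
      (r := p + 1) (by linarith)).integral_cont
  have h10 : ∫ _ in σ..σ + 1, (C + 1) ≤ ∫ v in σ..σ + 1, pS p (W β t1 x1 u) v :=
    intervalIntegral.integral_mono_on (by linarith) intervalIntegrable_const
      (ContinuousOn.intervalIntegrable (by rwa [Set.uIcc_of_le (by linarith)])) hlow
  simp at h10
  linarith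

end

section

variable {n : ℕ}

/-- The orthogonal reflection `(x, y) ↦ (s x + c y, c x - s y)`. -/
def rot (n : ℕ) (c s : ℝ) (z : E n × E n) : E n × E n := (s • z.1 + c • z.2, c • z.1 - s • z.2)

lemma rot_norm {c s : ℝ} (h : c ^ 2 + s ^ 2 = 1) (z : E n × E n) :
    ‖(rot n c s z).1‖ ^ 2 + ‖(rot n c s z).2‖ ^ 2 = ‖z.1‖ ^ 2 + ‖z.2‖ ^ 2 := by
  simp only [rot]
  rw [norm_add_sq_real, norm_sub_sq_real]
  simp only [norm_smul, inner_smul_left, inner_smul_right, mul_pow, Real.norm_eq_abs, sq_abs, RCLike.conj_to_real]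
  linear_combination (‖z.1‖ ^ 2 + ‖z.2‖ ^ 2) * h

lemma rot_rot {c s : ℝ} (h : c ^ 2 + s ^ 2 = 1) (z : E n × E n) : rot n c s (rot n c s z) = z := by
  ext i
  · simp only [rot, PiLp.add_apply, PiLp.sub_apply, PiLp.smul_apply, smul_eq_mul]
    linear_combination (z.1 i) * h
  · simp only [rot, PiLp.add_apply, PiLp.sub_apply, PiLp.smul_apply, smul_eq_mul]
    linear_combination (z.2 i) * h

lemma rot_measurePreserving {c s : ℝ} (h : c ^ 2 + s ^ 2 = 1) :
    MeasurePreserving (rot n c s) volume volume := by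
  let R : WithLp 2 (E n × E n) ≃ₗ[ℝ] WithLp 2 (E n × E n) :=
    { toFun := fun z => WithLp.toLp 2 (rot n c s (WithLp.ofLp z))
      invFun := fun z => WithLp.toLp 2 (rot n c s (WithLp.ofLp z))
      left_inv := fun z => by simp [rot_rot h]
      right_inv := fun z => by simp [rot_rot h]
      map_add' := fun x y => by
        simp only [rot, ← WithLp.toLp_add]; congr 1; ext i <;> simp <;> ring
      map_smul' := fun k y => by
        simp only [rot, ← WithLp.toLp_smul]; congr 1; ext i <;> simp <;> ring }
  have hR : ∀ z, ‖R z‖ = ‖z‖ := fun z => by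
    have := rot_norm h (WithLp.ofLp z)
    rw [← sq_eq_sq₀ (norm_nonneg _) (norm_nonneg _), WithLp.prod_norm_sq_eq_of_L2, WithLp.prod_norm_sq_eq_of_L2]
    exact this
  have h1 := (LinearIsometryEquiv.mk R hR).measurePreserving
  exact ((WithLp.volume_preserving_ofLp (E n) (E n)).comp h1).comp (WithLp.volume_preserving_toLp (E n) (E n))

lemma integral_gm_prod (F : E n × E n → ℝ) :
    ∫ z, F z ∂(gm n).prod (gm n) = ∫ z, F z * (rho n z.1 * rho n z.2) := by
  have hm : Measurable fun y => ENNReal.ofReal (rho n y) := (rho_continuous n).measurable.ennreal_ofReal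
  rw [show (gm n).prod (gm n) = (volume.prod volume).withDensity
      fun z => ENNReal.ofReal (rho n z.1) * ENNReal.ofReal (rho n z.2) from prod_withDensity hm hm,
    ← Measure.volume_eq_prod]
  have : (fun z : E n × E n => ENNReal.ofReal (rho n z.1) * ENNReal.ofReal (rho n z.2)) =
      fun z => (((rho n z.1).toNNReal * (rho n z.2).toNNReal : NNReal) : ENNReal) := by
    ext z; rw [ENNReal.coe_mul]; rfl
  have hm' : Measurable fun y => (rho n y).toNNReal := (rho_continuous n).measurable.real_toNNReal
  have hmm : Measurable fun z : E n × E n => (rho n z.1).toNNReal * (rho n z.2).toNNReal :=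
    (hm'.comp measurable_fst).mul (hm'.comp measurable_snd)
  rw [this, integral_withDensity_eq_integral_smul hmm]
  refine integral_congr_ae (ae_of_all _ fun z => ?_)
  simp only [NNReal.smul_def, NNReal.coe_mul, Real.coe_toNNReal _ (rho_pos _).le, smul_eq_mul]
  ring

lemma integral_rot {c s : ℝ} (h : c ^ 2 + s ^ 2 = 1) (F : E n × E n → ℝ) :
    ∫ z, F (rot n c s z) ∂(gm n).prod (gm n) = ∫ z, F z ∂(gm n).prod (gm n) := by
  have hc : Continuous (rot n c s) := by unfold rot; fun_prop
  have he : MeasurableEmbedding (rot n c s) :=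
    (Homeomorph.mk ⟨rot n c s, rot n c s, rot_rot h, rot_rot h⟩ hc hc).measurableEmbedding
  rw [integral_gm_prod, integral_gm_prod, ← (rot_measurePreserving h).integral_comp he]
  refine integral_congr_ae (ae_of_all _ fun z => ?_)
  have := rot_norm h z
  simp only [rho, mul_mul_mul_comm ((4 * π) ^ (-(n : ℝ) / 2)), ← Real.exp_add]
  rw [show -‖z.1‖ ^ 2 / 4 + -‖z.2‖ ^ 2 / 4 = -‖(rot n c s z).1‖ ^ 2 / 4 + -‖(rot n c s z).2‖ ^ 2 / 4 by linarith, rot_rot h]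

lemma fderiv_apply_sq_le (f : E n → ℝ) (z v : E n) :
    fderiv ℝ f z v ^ 2 ≤ (∑ i, pd i f z ^ 2) * ‖v‖ ^ 2 := by
  have h1 : fderiv ℝ f z v = ∑ i, pd i f z * v i := by
    conv_lhs => rw [← (EuclideanSpace.basisFun (Fin n) ℝ).sum_repr v]
    rw [map_sum]
    refine Finset.sum_congr rfl fun i _ => ?_
    rw [map_smul, smul_eq_mul, mul_comm]
    simp [pd, bv]
  rw [h1, EuclideanSpace.norm_sq_eq]
  simp only [Real.norm_eq_abs, sq_abs]
  exact Finset.sum_mul_sq_le_sq_mul_sq _ _ _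

theorem poincare {f : E n → ℝ} (hf : ContDiff ℝ 1 f) (h1 : Integrable f (gm n))
    (h2 : Integrable (fun y => f y ^ 2) (gm n))
    (hS : ∃ k : ℕ, ∃ C : ℝ, ∀ y, ∑ i, pd i f y ^ 2 ≤ C * (1 + ‖y‖) ^ k) :
    ∫ y, (f y - ∫ x, f x ∂gm n) ^ 2 ∂gm n ≤ 2 * (∫ y, ‖y‖ ^ 2 ∂gm n) * ∫ y, ∑ i, pd i f y ^ 2 ∂gm n := by
  set m := ∫ x, f x ∂gm n with hm
  set S := fun y => ∑ i, pd i f y ^ 2 with hSdef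
  set P := (gm n).prod (gm n) with hP
  obtain ⟨k, C, hS⟩ := hS
  have hSc : Continuous S := continuous_finsetSum _ fun i _ =>
    ((hf.continuous_fderiv one_ne_zero).clm_apply continuous_const).pow 2
  have hS0 : ∀ y, 0 ≤ S y := fun y => Finset.sum_nonneg fun i _ => sq_nonneg _
  have hC : 0 ≤ C := by have := (hS0 0).trans (hS 0); simpa using this
  set G := fun (t : ℝ) (z : E n × E n) => S (rot n (cos (π / 2 * t)) (sin (π / 2 * t)) z).1 *
    ‖(rot n (cos (π / 2 * t)) (sin (π / 2 * t)) z).2‖ ^ 2 with hG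
  have hGc : Continuous fun q : ℝ × (E n × E n) => G q.1 q.2 := by
    simp only [hG, rot]; fun_prop
  have hGb : ∀ t z, ‖G t z‖ ≤ C * ((1 + ‖z.1‖) ^ (k + 2) * (1 + ‖z.2‖) ^ (k + 2)) := by
    intro t z
    have hb : ∀ (c s : ℝ) (x y : E n), |c| ≤ 1 → |s| ≤ 1 → ‖c • x + s • y‖ ≤ ‖x‖ + ‖y‖ := by
      intro c s x y hc hs
      refine (norm_add_le _ _).trans ?_
      rw [norm_smul, norm_smul, Real.norm_eq_abs, Real.norm_eq_abs]
      exact add_le_add (mul_le_of_le_one_left (norm_nonneg _) hc) (mul_le_of_le_one_left (norm_nonneg _) hs)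
    have e1 := hb _ _ z.1 z.2 (abs_sin_le_one (π / 2 * t)) (abs_cos_le_one (π / 2 * t))
    have e2 := hb _ (-sin (π / 2 * t)) z.1 z.2 (abs_cos_le_one (π / 2 * t)) (by rw [abs_neg]; exact abs_sin_le_one _)
    rw [neg_smul, ← sub_eq_add_neg] at e2
    have hx := norm_nonneg z.1
    have hy := norm_nonneg z.2
    rw [Real.norm_of_nonneg (mul_nonneg (hS0 _) (sq_nonneg _)), ← mul_pow, pow_add, ← mul_assoc]
    have e3 : 1 + (‖z.1‖ + ‖z.2‖) ≤ (1 + ‖z.1‖) * (1 + ‖z.2‖) := by nlinarith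
    refine mul_le_mul ((hS _).trans ?_) ?_ (by positivity) (by positivity)
    · gcongr
      exact (add_le_add_right e1 1).trans e3
    · exact pow_le_pow_left₀ (norm_nonneg _) (e2.trans (by linarith)) 2
  have hdom : Integrable (fun z : E n × E n => C * ((1 + ‖z.1‖) ^ (k + 2) * (1 + ‖z.2‖) ^ (k + 2))) P :=
    ((integrable_pow_gm (k + 2)).mul_prod (integrable_pow_gm (k + 2))).const_mul C
  have hGP : ∀ t, Integrable (G t) P := fun t =>
    hdom.mono' (by fun_prop) (ae_of_all _ fun z => hGb t z)
  have hGI : ∀ t, ∫ z, G t z ∂P = (∫ y, S y ∂gm n) * ∫ y, ‖y‖ ^ 2 ∂gm n := fun t => by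
    rw [← integral_prod_mul]
    exact integral_rot (by rw [add_comm]; exact sin_sq_add_cos_sq _) (fun z => S z.1 * ‖z.2‖ ^ 2)
  have hpt : ∀ z : E n × E n, (f z.1 - f z.2) ^ 2 ≤ (π / 2) ^ 2 * ∫ t in (0 : ℝ)..1, G t z := by
    intro z
    set X := fun t : ℝ => sin (π / 2 * t) • z.1 + cos (π / 2 * t) • z.2
    set X' := fun t : ℝ => cos (π / 2 * t) • z.1 - sin (π / 2 * t) • z.2
    have hX : ∀ t, HasDerivAt X ((π / 2) • X' t) t := fun t => by
      have a0 : HasDerivAt (fun t : ℝ => π / 2 * t) (π / 2) t := by simpa using (hasDerivAt_id t).const_mul (π / 2)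
      refine ((a0.sin.smul_const z.1).fun_add (a0.cos.smul_const z.2)).congr_deriv ?_
      ext i
      simp only [X', PiLp.add_apply, PiLp.sub_apply, PiLp.smul_apply, smul_eq_mul]
      ring
    set g := fun t => fderiv ℝ f (X t) (X' t)
    have hgc : Continuous g := by
      have := hf.continuous_fderiv one_ne_zero
      have hXc : Continuous X := by fun_prop
      have hXc' : Continuous X' := by fun_prop
      exact (this.comp hXc).clm_apply hXc'
    have hFTC : ∫ t in (0 : ℝ)..1, π / 2 * g t = f z.1 - f z.2 := by
      rw [intervalIntegral.integral_eq_sub_of_hasDerivAt (f := fun t => f (X t)) (fun t _ => ?_)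
        ((by fun_prop : Continuous fun t => π / 2 * g t).intervalIntegrable _ _)]
      · simp [X]
      · have := ((hf.differentiable one_ne_zero (X t)).hasFDerivAt.comp_hasDerivAt t (hX t))
        refine this.congr_deriv ?_
        simp [g]
    rw [intervalIntegral.integral_const_mul] at hFTC
    set c := ∫ t in (0 : ℝ)..1, g t with hc
    have h0 : 0 ≤ ∫ t in (0 : ℝ)..1, (g t - c) ^ 2 :=
      intervalIntegral.integral_nonneg zero_le_one fun t _ => sq_nonneg _
    have h3 : ∫ t in (0 : ℝ)..1, (g t - c) ^ 2 = (∫ t in (0 : ℝ)..1, g t ^ 2) - c ^ 2 := by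
      have : ∀ t, (g t - c) ^ 2 = g t ^ 2 - (2 * c * g t - c ^ 2) := fun t => by ring
      simp only [this]
      rw [intervalIntegral.integral_sub
        ((by fun_prop : Continuous fun t => g t ^ 2).intervalIntegrable _ _)
        ((by fun_prop : Continuous fun t => 2 * c * g t - c ^ 2).intervalIntegrable _ _), intervalIntegral.integral_sub
        ((by fun_prop : Continuous fun t => 2 * c * g t).intervalIntegrable _ _) (by simp),
        intervalIntegral.integral_const_mul, ← hc]
      simp; ring
    have h4 : ∫ t in (0 : ℝ)..1, g t ^ 2 ≤ ∫ t in (0 : ℝ)..1, G t z :=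
      intervalIntegral.integral_mono_on zero_le_one ((hgc.pow 2).intervalIntegrable _ _)
        ((hGc.comp (by fun_prop : Continuous fun t : ℝ => (t, z))).intervalIntegrable _ _) fun t _ =>
          fderiv_apply_sq_le f (X t) (X' t)
    rw [← hFTC, mul_pow]
    gcongr
    linarith
  have hfi : Integrable (fun z : E n × E n => (f z.1 - f z.2) ^ 2) P := by
    have i1 := h2.comp_fst (gm n)
    have i2 := h2.comp_snd (gm n)
    have i3 := (h1.mul_prod h1).const_mul 2
    exact ((i1.add i2).sub i3).congr (ae_of_all _ fun z => by simp only [Pi.sub_apply, Pi.add_apply]; ring)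
  have hI : Integrable (Function.uncurry fun (z : E n × E n) (t : ℝ) => G t z)
      (P.prod (volume.restrict (Set.Ioc (0 : ℝ) 1))) := by
    refine (hdom.comp_fst _).mono' ?_ (ae_of_all _ fun q => hGb q.2 q.1)
    exact (hGc.comp continuous_swap).aestronglyMeasurable
  have hsw : ∫ z, (∫ t in (0 : ℝ)..1, G t z) ∂P = (∫ y, S y ∂gm n) * ∫ y, ‖y‖ ^ 2 ∂gm n := by
    simp only [intervalIntegral.integral_of_le (zero_le_one (α := ℝ))]
    rw [integral_integral_swap hI]
    simp [hGI]
  have hIi : Integrable (fun z => ∫ t in (0 : ℝ)..1, G t z) P := by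
    simp only [intervalIntegral.integral_of_le (zero_le_one (α := ℝ))]
    exact hI.integral_prod_left
  have hup : ∫ z, (f z.1 - f z.2) ^ 2 ∂P ≤ (π / 2) ^ 2 * ((∫ y, S y ∂gm n) * ∫ y, ‖y‖ ^ 2 ∂gm n) := by
    rw [← hsw, ← integral_const_mul]
    exact integral_mono hfi (hIi.const_mul _) hpt
  have hexp : ∫ z, (f z.1 - f z.2) ^ 2 ∂P = 2 * ∫ y, (f y - m) ^ 2 ∂gm n := by
    have hg1 : Integrable (fun y => f y - m) (gm n) := h1.sub (integrable_const m)
    have hg0 : ∫ y, (f y - m) ∂gm n = 0 := by rw [integral_sub h1 (integrable_const m)]; simp [hm]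
    have hg2 : Integrable (fun y => (f y - m) ^ 2) (gm n) :=
      ((h2.sub (h1.const_mul (2 * m))).add (integrable_const (m ^ 2))).congr
        (ae_of_all _ fun y => by simp only [Pi.sub_apply, Pi.add_apply]; ring)
    have i1 := hg2.comp_fst (gm n)
    have i2 := hg2.comp_snd (gm n)
    have i3 := (hg1.mul_prod hg1).const_mul 2
    have e3 : ∫ z : E n × E n, (f z.1 - m) * (f z.2 - m) ∂P = 0 := by
      rw [hP, integral_prod_mul (fun y => f y - m) (fun y => f y - m), hg0, zero_mul]
    calc _ = ∫ z : E n × E n, ((f z.1 - m) ^ 2 + (f z.2 - m) ^ 2 - 2 * ((f z.1 - m) * (f z.2 - m))) ∂P :=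
          integral_congr_ae (ae_of_all _ fun z => by ring)
      _ = _ := by
        have i12 : Integrable (fun z : E n × E n => (f z.1 - m) ^ 2 + (f z.2 - m) ^ 2) P := i1.add i2
        rw [integral_sub i12 i3, integral_add i1 i2, integral_const_mul, e3,
          integral_fun_fst (fun y => (f y - m) ^ 2), integral_fun_snd (fun y => (f y - m) ^ 2)]
        simp; ring
  have hpi : (π / 2) ^ 2 ≤ 4 := by nlinarith [Real.pi_le_four, Real.pi_pos]
  have hnn : 0 ≤ (∫ y, S y ∂gm n) * ∫ y, ‖y‖ ^ 2 ∂gm n :=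
    mul_nonneg (integral_nonneg hS0) (integral_nonneg fun y => sq_nonneg _)
  rw [hexp] at hup
  have := mul_le_mul_of_nonneg_right hpi hnn
  linarith

end

section

variable {n : ℕ} {J : Set ℝ} {β : ℝ} {w q : E n → ℝ → ℝ}

lemma pd_mul {f g : E n → ℝ} (hf : Differentiable ℝ f) (hg : Differentiable ℝ g) (i : Fin n) (y : E n) :
    pd i (fun z => f z * g z) y = f y * pd i g y + pd i f y * g y := by
  unfold pd
  rw [((hf y).hasFDerivAt.fun_mul (hg y).hasFDerivAt).fderiv]
  simp; ring

lemma pd_sum {ι : Type*} (t : Finset ι) {f : ι → E n → ℝ} (hf : ∀ j, Differentiable ℝ (f j))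
    (i : Fin n) (y : E n) : pd i (fun z => ∑ j ∈ t, f j z) y = ∑ j ∈ t, pd i (f j) y := by
  unfold pd
  rw [(HasFDerivAt.fun_sum fun j (_ : j ∈ t) => (hf j y).hasFDerivAt).fderiv]
  simp

lemma differentiable_coord (j : Fin n) : Differentiable ℝ fun y : E n => y j := by fun_prop

/-- `(‖y‖² / 2 - n)`, minus the adjoint of the Euler field in the Gaussian space. -/
noncomputable def Hn (n : ℕ) (y : E n) : ℝ := 1 / 2 * ∑ j, y j * y j - n

lemma differentiable_Hn : Differentiable ℝ (Hn n) := by unfold Hn; fun_prop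

lemma pd_Hn (i : Fin n) (y : E n) : pd i (Hn n) y = y i := by
  have h1 : pd i (fun y : E n => ∑ j, y j * y j) y = 2 * y i := by
    rw [pd_sum (f := fun j y => y j * y j) _ fun j => (differentiable_coord j).mul (differentiable_coord j)]
    simp only [pd_mul (differentiable_coord _) (differentiable_coord _), pd_coord]
    simp [Finset.sum_add_distrib]; ring
  unfold pd at h1 ⊢
  unfold Hn
  rw [fderiv_sub_const, fderiv_const_mul (by fun_prop)]
  simp [h1]

lemma nice_Hn : Nice J fun y _ => Hn n y :=
  (((Nice.sum _ fun j => (Nice.coord j).mul (Nice.coord j)).const_mul _).sub (Nice.const _))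

lemma Nice.euler {g : E n → ℝ → ℝ} (hg : Nice J g) {s : ℝ} (hs : s ∈ J)
    (hd : Differentiable ℝ fun y => g y s) (hi : ∀ i, Nice J fun y s => pd i (fun z => g z s) y) :
    ∫ y, ∑ i, y i * pd i (fun z => g z s) y ∂(gm n) = ∫ y, Hn n y * g y s ∂(gm n) := by
  have n1 : ∀ i, Nice J fun y s => y i * pd i (fun z => g z s) y := fun i => (Nice.coord i).mul (hi i)
  have n2 : ∀ i : Fin n, Nice J fun y s => y i * (y i * g y s) := fun i =>
    (Nice.coord i).mul ((Nice.coord i).mul hg)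
  have n3 : ∀ i : Fin n, Nice J fun y s => pd i (fun z : E n => z i) y * g y s := fun i =>
    hg.congr fun y s _ => by simp [pd_coord]
  have key : ∀ i, ∫ y, y i * pd i (fun z => g z s) y ∂(gm n) =
      ∫ y, (1 / 2 * (y i * (y i * g y s)) - g y s) ∂(gm n) := fun i => by
    rw [integral_mul_pd_gm (differentiable_coord i) hd i (((Nice.coord i).mul hg).integrable hs)
      ((n1 i).integrable hs) ((n3 i).integrable hs) ((n2 i).integrable hs),
      integral_sub (((n2 i).const_mul _).integrable hs) (hg.integrable hs), integral_const_mul]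
    simp [pd_coord]; ring
  rw [integral_finsetSum _ fun i _ => (n1 i).integrable hs, Finset.sum_congr rfl fun i _ => key i,
    ← integral_finsetSum _ fun i _ => (((n2 i).const_mul (1 / 2)).sub hg).integrable hs]
  congr 1; ext y
  rw [Finset.sum_sub_distrib, ← Finset.mul_sum, Hn]
  simp only [Finset.sum_const, Finset.card_univ, Fintype.card_fin, nsmul_eq_mul, sub_mul, mul_assoc,
    Finset.sum_mul]

/-- The Pohozaev multiplier. -/
noncomputable def psi (c : ℝ) (w : E n → ℝ → ℝ) (y : E n) (s : ℝ) : ℝ :=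
  ∑ j, y j * pd j (fun z => w z s) y - c * (Hn n y * w y s)

noncomputable def gradSq (w : E n → ℝ → ℝ) (y : E n) (s : ℝ) : ℝ := ∑ i, pd i (fun z => w z s) y ^ 2

lemma Sim.pohozaev (h : Sim J β w q) {p : ℝ} (hp : 1 < p) (hβ : β * (p - 1) = 1) {s : ℝ} (hs : s ∈ J) :
    ∫ y, psi (1 / (p + 1)) w y s * (wt β w q y s - q y s + |w y s| ^ (p - 1) * w y s) ∂(gm n) =
      - aS w s - (1 / 2 - 1 / (p + 1)) * ∫ y, Hn n y * gradSq w y s ∂(gm n) := by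
  set c : ℝ := 1 / (p + 1) with hc
  have hc' : c / 2 = β * (1 / 2 - c) := by
    rw [hc]; field_simp; linarith
  have dw : ∀ s ∈ J, Differentiable ℝ fun y => w y s := fun s hs => (h.sm s hs).differentiable (by simp)
  have dwi : ∀ s ∈ J, ∀ i, Differentiable ℝ (pd i fun y => w y s) := fun s hs i =>
    pd_differentiable (h.sm s hs) i
  have hpsi : ∀ s ∈ J, ∀ i y, pd i (fun z => psi c w z s) y = pd i (fun z => w z s) y +
      ∑ j, y j * pd j (pd i fun z => w z s) y - c * (Hn n y * pd i (fun z => w z s) y + y i * w y s) := by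
    intro s hs i y
    have d1 : ∀ j, Differentiable ℝ fun y : E n => y j * pd j (fun z => w z s) y := fun j =>
      (differentiable_coord j).mul (dwi s hs j)
    have d2 : Differentiable ℝ fun y : E n => Hn n y * w y s := differentiable_Hn.mul (dw s hs)
    have e1 := pd_sum Finset.univ d1 i y
    have e2 := pd_mul differentiable_Hn (dw s hs) i y
    have e3 : pd i (fun z => psi c w z s) y = pd i (fun z => ∑ j, z j * pd j (fun z => w z s) z) y -
        c * pd i (fun z => Hn n z * w z s) y := by
      unfold pd psi
      rw [fderiv_fun_sub ((Differentiable.fun_sum fun j _ => d1 j) y) ((d2.const_mul c) y), fderiv_const_mul (d2 y)]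
      simp [pd]
    rw [e3, e1, e2, pd_Hn]
    congr 1
    have e4 : ∀ j, pd i (fun z : E n => z j * pd j (fun z => w z s) z) y =
        y j * pd j (pd i fun z => w z s) y + (if i = j then 1 else 0) * pd j (fun z => w z s) y := fun j => by
      rw [pd_mul (differentiable_coord j) (dwi s hs j), pd_coord,
        pd_comm (contDiff_infty.1 (h.sm s hs) 2)]
    rw [Finset.sum_congr rfl fun j _ => e4 j, Finset.sum_add_distrib]
    simp [add_comm]
  have nDw : Nice J fun y s => ∑ j, y j * pd j (fun z => w z s) y := Nice.sum _ fun j => (Nice.coord j).mul (h.nwi j)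
  have npsi : Nice J (psi c w) := nDw.sub ((nice_Hn.mul h.nw).const_mul c)
  have npsii : ∀ i, Nice J fun y s => pd i (fun z => psi c w z s) y := fun i =>
    (((h.nwi i).add (Nice.sum _ fun j => (Nice.coord j).mul (h.nwij i j))).sub
      (((nice_Hn.mul (h.nwi i)).add ((Nice.coord i).mul h.nw)).const_mul c)).congr fun y s hs => hpsi s hs i y
  have dpsi : Differentiable ℝ fun y => psi c w y s :=
    (Differentiable.fun_sum fun j _ => (differentiable_coord j).mul (dwi s hs j)).sub
      ((differentiable_Hn.mul (dw s hs)).const_mul c)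
  have t := h.test hs npsi dpsi npsii
  have nG : Nice J (gradSq w) := Nice.sum _ fun i => (h.nwi i).sq
  have dG : ∀ s ∈ J, Differentiable ℝ fun y => gradSq w y s := fun s hs =>
    Differentiable.fun_sum fun i _ => (dwi s hs i).pow 2
  have hGi : ∀ s ∈ J, ∀ j y, pd j (fun z => gradSq w z s) y =
      2 * ∑ i, pd i (fun z => w z s) y * pd j (pd i fun z => w z s) y := fun s hs j y => by
    unfold gradSq
    rw [pd_sum (f := fun i z => pd i (fun z => w z s) z ^ 2) _ fun i => (dwi s hs i).pow 2, Finset.mul_sum]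
    refine Finset.sum_congr rfl fun i _ => ?_
    simp only [pow_two]
    rw [pd_mul (dwi s hs i) (dwi s hs i)]; ring
  have nGi : ∀ j, Nice J fun y s => pd j (fun z => gradSq w z s) y := fun j =>
    ((Nice.sum _ fun i => (h.nwi i).mul (h.nwij i j)).const_mul 2).congr fun y s hs => hGi s hs j y
  have hw2i : ∀ s ∈ J, ∀ j y, pd j (fun z => w z s ^ 2) y = 2 * (w y s * pd j (fun z => w z s) y) :=
    fun s hs j y => by
      simp only [pow_two]
      rw [pd_mul (dw s hs) (dw s hs)]; ring
  have nw2i : ∀ j, Nice J fun y s => pd j (fun z => w z s ^ 2) y := fun j =>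
    ((h.nw.mul (h.nwi j)).const_mul 2).congr fun y s hs => hw2i s hs j y
  have nP : Nice J fun y s => |w y s| ^ (p + 1) / (p + 1) :=
    ((h.nw.rpow (r := p + 1) (by linarith)).const_mul (1 / (p + 1))).congr fun y s _ => by ring
  have hdP : ∀ s ∈ J, ∀ y, HasFDerivAt (fun y => |w y s| ^ (p + 1) / (p + 1))
      ((|w y s| ^ (p - 1) * w y s) • fderiv ℝ (fun y => w y s) y) y := fun s hs y =>
    HasDerivAt.comp_hasFDerivAt (f := fun y => w y s) (h₂ := fun w => |w| ^ (p + 1) / (p + 1)) y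
      (hasDerivAt_abs_rpow_div hp (w y s)) (dw s hs y).hasFDerivAt
  have hPi : ∀ s ∈ J, ∀ j y, pd j (fun z => |w z s| ^ (p + 1) / (p + 1)) y =
      |w y s| ^ (p - 1) * w y s * pd j (fun z => w z s) y := fun s hs j y => by
    unfold pd
    rw [(hdP s hs y).fderiv]; simp
  have nF : Nice J fun y s => |w y s| ^ (p - 1) * w y s := (h.nw.rpow (r := p - 1) (by linarith)).mul h.nw
  have nPi : ∀ j, Nice J fun y s => pd j (fun z => |w z s| ^ (p + 1) / (p + 1)) y := fun j =>
    (nF.mul (h.nwi j)).congr fun y s hs => hPi s hs j y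
  have eG := nG.euler hs (dG s hs) nGi
  have ew := h.nw.sq.euler hs ((dw s hs).pow 2) nw2i
  have eP := nP.euler hs (fun y => (hdP s hs y).differentiableAt) nPi
  have nEG : Nice J fun y s => ∑ i, y i * pd i (fun z => gradSq w z s) y := Nice.sum _ fun j => (Nice.coord j).mul (nGi j)
  have nEw : Nice J fun y s => ∑ i, y i * pd i (fun z => w z s ^ 2) y := Nice.sum _ fun j => (Nice.coord j).mul (nw2i j)
  have nEP : Nice J fun y s => ∑ i, y i * pd i (fun z => |w z s| ^ (p + 1) / (p + 1)) y :=
    Nice.sum _ fun j => (Nice.coord j).mul (nPi j)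
  have nHG := (nice_Hn (J := J)).mul nG
  have nHw := (nice_Hn (J := J)).mul h.nw.sq
  have nHP := (nice_Hn (J := J)).mul nP
  have eDw : ∀ y, ∑ j, y j * pd j (fun z => w z s) y * w y s = 1 / 2 * ∑ i, y i * pd i (fun z => w z s ^ 2) y :=
    fun y => by
      rw [Finset.mul_sum]
      refine Finset.sum_congr rfl fun j _ => ?_
      rw [hw2i s hs]; ring
  have h1 : ∑ i, ∫ y, pd i (fun z => psi c w z s) y * pd i (fun z => w z s) y ∂(gm n) =
      aS w s + (1 / 2 - c) * ∫ y, Hn n y * gradSq w y s ∂(gm n) - c / 2 * ∫ y, Hn n y * w y s ^ 2 ∂(gm n) := by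
    have e0 : aS w s = ∫ y, gradSq w y s ∂(gm n) := by
      unfold aS gradSq
      first
        | rfl
        | rw [integral_finsetSum _ fun i _ => (h.nwi i).sq.integrable hs]
    rw [e0, ← integral_finsetSum _ fun i _ => ((npsii i).mul (h.nwi i)).integrable hs]
    rw [← ew, sub_mul, ← integral_const_mul c, show (1 / 2 : ℝ) * ∫ y, Hn n y * gradSq w y s ∂(gm n) =
      ∫ y, 1 / 2 * ∑ i, y i * pd i (fun z => gradSq w z s) y ∂(gm n) by rw [integral_const_mul, eG],
      ← integral_const_mul (c / 2), ← integral_sub ((nEG.const_mul _).integrable hs) ((nHG.const_mul _).integrable hs),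
      ← integral_add (nG.integrable hs) (((nEG.const_mul _).sub (nHG.const_mul _)).integrable hs),
      ← integral_sub ((nG.add ((nEG.const_mul _).sub (nHG.const_mul _))).integrable hs) ((nEw.const_mul _).integrable hs)]
    congr 1; ext y
    have e1 : ∑ i, (∑ j, y j * pd j (pd i fun z => w z s) y) * pd i (fun z => w z s) y =
        1 / 2 * ∑ j, y j * pd j (fun z => gradSq w z s) y := by
      simp only [hGi s hs, Finset.sum_mul, Finset.mul_sum]
      rw [Finset.sum_comm]
      exact Finset.sum_congr rfl fun i _ => Finset.sum_congr rfl fun j _ => by ring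
    have e2 := eDw y
    rw [← Finset.sum_mul] at e2
    have e3 : c / 2 * ∑ i, y i * pd i (fun z => w z s ^ 2) y =
      ∑ i, c * (y i * w y s) * pd i (fun z => w z s) y := by
      rw [Finset.mul_sum]
      refine Finset.sum_congr rfl fun j _ => ?_
      rw [hw2i s hs]; ring
    rw [← e1, e3, gradSq, Finset.mul_sum, Finset.mul_sum, ← Finset.sum_sub_distrib, ← Finset.sum_add_distrib,
      ← Finset.sum_sub_distrib]
    refine Finset.sum_congr rfl fun i _ => ?_
    rw [hpsi s hs]; ring
  have h2 : ∫ y, psi c w y s * w y s ∂(gm n) = (1 / 2 - c) * ∫ y, Hn n y * w y s ^ 2 ∂(gm n) := by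
    rw [sub_mul, ← ew, ← integral_const_mul, ew, ← integral_const_mul c,
      ← integral_sub ((nEw.const_mul _).integrable hs) ((nHw.const_mul _).integrable hs)]
    congr 1; ext y
    rw [← eDw y, psi, sub_mul, Finset.sum_mul]; ring
  have h3 : ∫ y, psi c w y s * (|w y s| ^ (p - 1) * w y s) ∂(gm n) = 0 := by
    refine Eq.trans ?_ (sub_eq_zero.2 eP)
    rw [← integral_sub (nEP.integrable hs) (nHP.integrable hs)]
    congr 1; ext y
    have e1 : |w y s| ^ (p + 1) = |w y s| ^ (p - 1) * w y s * w y s := by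
      rw [mul_assoc, ← pow_two, ← sq_abs (w y s), ← Real.rpow_natCast,
        ← Real.rpow_add' (abs_nonneg _) (by push_cast; linarith)]
      push_cast; ring_nf
    rw [e1, psi, sub_mul, Finset.sum_mul, hc]
    congr 1
    · exact Finset.sum_congr rfl fun j _ => by rw [hPi s hs]; ring
    · ring
  have h4 : ∀ y, psi c w y s * (wt β w q y s - q y s + |w y s| ^ (p - 1) * w y s) =
      psi c w y s * wt β w q y s - psi c w y s * q y s + psi c w y s * (|w y s| ^ (p - 1) * w y s) := fun y => by ring
  simp only [h4]
  rw [integral_add (((npsi.mul h.nwt).sub (npsi.mul h.nq)).integrable hs) ((npsi.mul nF).integrable hs),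
    integral_sub ((npsi.mul h.nwt).integrable hs) ((npsi.mul h.nq).integrable hs), h3, t, h1, h2]
  linear_combination (∫ y, Hn n y * w y s ^ 2 ∂(gm n)) * hc'

end

section

variable {n : ℕ} {J : Set ℝ} {β : ℝ} {w q : E n → ℝ → ℝ}

/-- The residual of the stationary equation, up to lower order terms of `q`. -/
noncomputable def rsd (p β : ℝ) (w q : E n → ℝ → ℝ) (y : E n) (s : ℝ) : ℝ :=
  wt β w q y s - q y s + |w y s| ^ (p - 1) * w y s

lemma Sim.nice_rsd (h : Sim J β w q) {p : ℝ} (hp : 1 < p) : Nice J (rsd p β w q) :=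
  (h.nwt.sub h.nq).add ((h.nw.rpow (r := p - 1) (by linarith)).mul h.nw)

/-- Bounded solutions with small residual have small Dirichlet energy. -/
lemma exists_aS_le {p : ℝ} (hp : 1 < p) (hβ : β * (p - 1) = 1) (hsub : (n : ℝ) < 2 + 4 * β) {C0 : ℝ}
    {δ : ℝ} (hδ : 0 < δ) : ∃ L, 0 ≤ L ∧ ∀ (J : Set ℝ) (w q : E n → ℝ → ℝ) (s : ℝ), Sim J β w q → s ∈ J →
      (∀ y, |w y s| ≤ C0) → aS w s ≤ δ + L * ∫ y, rsd p β w q y s ^ 2 ∂(gm n) := by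
  set c : ℝ := 1 / (p + 1) with hc
  have hb := beta_pos hp hβ
  have e1 : (1 / 2 - c) * (2 * (1 + 2 * β)) = 1 := by
    rw [hc]; field_simp; linear_combination 2 * hβ
  have c2 : 0 < (1 / 2 - c) / 2 := by
    by_contra! h0; nlinarith
  have hc1 : 0 < 1 - n * (1 / 2 - c) := by
    have : 0 < (1 - n * (1 / 2 - c)) * (2 * (1 + 2 * β)) := by linear_combination hsub + n * e1
    exact (pos_iff_pos_of_mul_pos this).2 (by positivity)
  obtain ⟨c1, hc1e⟩ : ∃ x, x = 1 - n * (1 / 2 - c) := ⟨_, rfl⟩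
  obtain ⟨c2', hc2⟩ : ∃ x, x = (1 / 2 - c) / 2 := ⟨_, rfl⟩
  obtain ⟨K, hKe⟩ : ∃ x, x = ∫ y, Hn n y ^ 2 ∂(gm n) := ⟨_, rfl⟩
  rw [← hc1e] at hc1
  rw [← hc2] at c2
  have hK : 0 ≤ K := hKe ▸ integral_nonneg fun y => sq_nonneg _
  obtain ⟨d, hd⟩ : ∃ x, x = δ * c1 / (K + 1) := ⟨_, rfl⟩
  have hdp : 0 < d := by rw [hd]; positivity
  obtain ⟨L, hL⟩ : ∃ x, x = 1 / (4 * c2') + c ^ 2 * C0 ^ 2 / (4 * d) := ⟨_, rfl⟩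
  have hLp : 0 ≤ L := by rw [hL]; positivity
  refine ⟨L / c1, by positivity, fun J w q s h hs hw => ?_⟩
  have P := h.pohozaev hp hβ hs
  rw [← hc] at P
  have nDw : Nice J fun y s => ∑ j, y j * pd j (fun z => w z s) y := Nice.sum _ fun j => (Nice.coord j).mul (h.nwi j)
  have npsi : Nice J (psi c w) := nDw.sub ((nice_Hn.mul h.nw).const_mul c)
  have nG : Nice J (gradSq w) := Nice.sum _ fun i => (h.nwi i).sq
  have nr := h.nice_rsd hp
  have nyG : Nice J fun y s => ‖y‖ ^ 2 * gradSq w y s := Nice.norm.sq.mul nG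
  have eA : aS w s = ∫ y, gradSq w y s ∂(gm n) := by
    unfold aS gradSq
    first
      | rfl
      | rw [integral_finsetSum _ fun i _ => (h.nwi i).sq.integrable hs]
  have eH : ∫ y, Hn n y * gradSq w y s ∂(gm n) =
      1 / 2 * ∫ y, ‖y‖ ^ 2 * gradSq w y s ∂(gm n) - n * aS w s := by
    rw [eA, ← integral_const_mul, ← integral_const_mul,
      ← integral_sub ((nyG.const_mul _).integrable hs) ((nG.const_mul _).integrable hs)]
    congr 1; ext y
    rw [Hn, EuclideanSpace.real_norm_sq_eq]
    simp only [pow_two]; ring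
  have key : ∀ y, -(psi c w y s * rsd p β w q y s) - c2' * (‖y‖ ^ 2 * gradSq w y s) ≤
      d * Hn n y ^ 2 + L * rsd p β w q y s ^ 2 := fun y => by
    obtain ⟨D, hD⟩ : ∃ x, x = ∑ j, y j * pd j (fun z => w z s) y := ⟨_, rfl⟩
    have hCS : D ^ 2 ≤ ‖y‖ ^ 2 * gradSq w y s := by
      rw [EuclideanSpace.real_norm_sq_eq, hD]
      exact Finset.sum_mul_sq_le_sq_mul_sq _ _ _
    have hps : psi c w y s = D - c * (Hn n y * w y s) := by rw [hD]; rfl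
    obtain ⟨e, he⟩ : ∃ x, x = rsd p β w q y s := ⟨_, rfl⟩
    rw [← he]
    have i1 : - (D * e) ≤ c2' * D ^ 2 + 1 / (4 * c2') * e ^ 2 := by
      have : c2' * D ^ 2 + 1 / (4 * c2') * e ^ 2 + D * e = c2' * (D + e / (2 * c2')) ^ 2 := by
        field_simp; ring
      nlinarith [mul_nonneg c2.le (sq_nonneg (D + e / (2 * c2')))]
    have i2 : c * w y s * e * Hn n y ≤ d * Hn n y ^ 2 + (c * w y s * e) ^ 2 / (4 * d) := by
      have : d * Hn n y ^ 2 + (c * w y s * e) ^ 2 / (4 * d) - c * w y s * e * Hn n y =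
          d * (Hn n y - c * w y s * e / (2 * d)) ^ 2 := by
        field_simp; ring
      nlinarith [mul_nonneg hdp.le (sq_nonneg (Hn n y - c * w y s * e / (2 * d)))]
    have i3 : (c * w y s * e) ^ 2 / (4 * d) ≤ c ^ 2 * C0 ^ 2 / (4 * d) * e ^ 2 := by
      have h0 : w y s ^ 2 ≤ C0 ^ 2 := sq_le_sq' (abs_le.1 (hw y)).1 (abs_le.1 (hw y)).2
      have h5 := mul_le_mul_of_nonneg_right h0 (by positivity : 0 ≤ c ^ 2 / (4 * d) * e ^ 2)
      calc _ = w y s ^ 2 * (c ^ 2 / (4 * d) * e ^ 2) := by ring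
        _ ≤ _ := h5
        _ = _ := by ring
    have i4 := mul_le_mul_of_nonneg_left hCS c2.le
    rw [hps, hL]
    linarith [i1, i2, i3, i4]
  have hInt := integral_mono (((npsi.mul nr).neg.sub (nyG.const_mul c2')).integrable hs)
    ((((nice_Hn (J := J)).sq.const_mul d).add (nr.sq.const_mul L)).integrable hs) key
  rw [integral_sub ((npsi.mul nr).neg.integrable hs) ((nyG.const_mul c2').integrable hs),
    integral_add (((nice_Hn (J := J)).sq.const_mul d).integrable hs) ((nr.sq.const_mul L).integrable hs),
    integral_neg, integral_const_mul, integral_const_mul, integral_const_mul] at hInt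
  have P' : ∫ y, psi c w y s * rsd p β w q y s ∂(gm n) =
    - aS w s - (1 / 2 - c) * ∫ y, Hn n y * gradSq w y s ∂(gm n) := P
  rw [P', eH, ← hKe] at hInt
  have hdK : d * K ≤ δ * c1 := by
    rw [hd, div_mul_eq_mul_div, div_le_iff₀ (by positivity)]
    nlinarith [mul_pos hδ hc1]
  have : c1 * aS w s ≤ δ * c1 + L * ∫ y, rsd p β w q y s ^ 2 ∂(gm n) := by
    have : c1 * aS w s = - (- aS w s - (1 / 2 - c) * (1 / 2 * ∫ y, ‖y‖ ^ 2 * gradSq w y s ∂(gm n) - n * aS w s)) -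
        c2' * ∫ y, ‖y‖ ^ 2 * gradSq w y s ∂(gm n) := by
      rw [hc1e, hc2]; ring
    rw [this]; exact hInt.trans (by gcongr)
  rw [← mul_le_mul_iff_right₀ hc1]
  refine this.trans (le_of_eq ?_)
  field_simp

end

section

variable {n : ℕ} {p a μ β s0 C C0 : ℝ} {w : E n → ℝ → ℝ} {wk qk : ℕ → E n → ℝ → ℝ}

lemma dS_nonneg (w q : E n → ℝ → ℝ) (s : ℝ) : 0 ≤ dS β w q s := integral_nonneg fun _ => sq_nonneg _

lemma Appr.dS_intervalIntegrable {s2 : ℝ} (h : Appr p a μ β s0 s2 w wk qk) (k : ℕ) {c d : ℝ} (hc : s0 ≤ c)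
    (hcd : c ≤ d) (hd : d ≤ s2) : IntervalIntegrable (dS β (wk k) (qk k)) volume c d := by
  obtain ⟨J, hJ, hs⟩ := h.sim
  exact ((hs k).nice_wt_sq.mono fun x hx => by
    rw [Set.uIcc_of_le hcd] at hx
    exact hJ ⟨hc.trans hx.1, hx.2.trans hd⟩).intervalIntegrable

lemma exists_quiet (hA : ∀ s2, Appr p a μ β s0 s2 w wk qk)
    (hD : ∀ s, s0 ≤ s → ∀ᶠ k in atTop, ∫ v in s0..s, dS β (wk k) (qk k) v ≤ C) {δ : ℝ} (hδ : 0 < δ) :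
    ∃ S, s0 ≤ S ∧ ∀ s, S ≤ s → ∃ᶠ k in atTop, ∫ v in s..s + 1, dS β (wk k) (qk k) v ≤ δ := by
  by_contra! hneg
  have key : ∀ N : ℕ, ∃ s, s0 ≤ s ∧ ∀ᶠ k in atTop, N * δ ≤ ∫ v in s0..s, dS β (wk k) (qk k) v := by
    intro N
    induction N with
    | zero => exact ⟨s0, le_rfl, by simp⟩
    | succ N ih =>
      obtain ⟨s, hs, ih⟩ := ih
      obtain ⟨s', hs', h'⟩ := hneg s hs
      refine ⟨s' + 1, by linarith, ?_⟩
      filter_upwards [ih, h'] with k h1 h2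
      have i1 := (hA (s' + 1)).dS_intervalIntegrable k le_rfl hs (by linarith)
      have i2 := (hA (s' + 1)).dS_intervalIntegrable k hs hs' (by linarith)
      have i3 := (hA (s' + 1)).dS_intervalIntegrable k (hs.trans hs') (by linarith) le_rfl
      rw [← intervalIntegral.integral_add_adjacent_intervals (i1.trans i2) i3,
        ← intervalIntegral.integral_add_adjacent_intervals i1 i2]
      have := intervalIntegral.integral_nonneg (μ := volume) hs' fun v _ => dS_nonneg (β := β) (wk k) (qk k) v
      push_cast
      linarith
  obtain ⟨N, hN⟩ := exists_nat_gt (C / δ)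
  obtain ⟨s, hs, h⟩ := key N
  obtain ⟨k, h1, h2⟩ := (h.and (hD s hs)).exists
  rw [div_lt_iff₀ hδ] at hN
  linarith

set_option maxHeartbeats 1000000 in
lemma exists_const_close (hp : 1 < p) (ha : 0 < a) (hβ : β * (p - 1) = 1) (hsub : (n : ℝ) < 2 + 4 * β)
    (hA : ∀ s2, Appr p a μ β s0 s2 w wk qk)
    (hD : ∀ s, s0 ≤ s → ∀ᶠ k in atTop, ∫ v in s0..s, dS β (wk k) (qk k) v ≤ C)
    (hb : ∀ y s, s0 ≤ s → |w y s| ≤ C0) {ε : ℝ} (hε : 0 < ε) :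
    ∃ S, s0 ≤ S ∧ ∀ s, S ≤ s → (∃ c, ∫ y, (w y s - c) ^ 2 ∂gm n ≤ ε) ∧
      ∀ s' ∈ Set.Icc s (s + 1), ∫ y, (w y s' - w y s) ^ 2 ∂gm n ≤ ε := by
  obtain ⟨M2, hM2e⟩ : ∃ x, x = ∫ y : E n, ‖y‖ ^ 2 ∂gm n := ⟨_, rfl⟩
  have hM2 : 0 ≤ M2 := hM2e ▸ integral_nonneg fun _ => by positivity
  obtain ⟨δ1, hδ1⟩ : ∃ x, x = ε / (24 * (M2 + 1)) := ⟨_, rfl⟩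
  obtain ⟨L, hL, HL⟩ := exists_aS_le (n := n) hp hβ hsub (C0 := C0 + 1) (δ := δ1) (by rw [hδ1]; positivity)
  obtain ⟨x, hx⟩ : ∃ x, x = ε / (12 * (Real.exp 1 + 1 + 12 * M2 * L)) := ⟨_, rfl⟩
  have hx0 : 0 < x := by rw [hx]; positivity
  have hxe : 12 * (Real.exp 1 + 1 + 12 * M2 * L) * x = ε := by rw [hx]; field_simp
  have hδe : M2 * δ1 ≤ ε / 24 := by
    rw [hδ1, mul_div_assoc', div_le_div_iff₀ (by positivity) (by norm_num)]
    nlinarith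
  obtain ⟨η, hη⟩ : ∃ η, η = min 1 (√x) := ⟨_, rfl⟩
  have hη0 : 0 < η := by rw [hη]; exact lt_min one_pos (Real.sqrt_pos.2 hx0)
  have hη1 : η ≤ 1 := hη ▸ min_le_left _ _
  have hηx : η ^ 2 ≤ x := by
    rw [← Real.sq_sqrt hx0.le]
    exact pow_le_pow_left₀ hη0.le (hη ▸ min_le_right _ _) 2
  obtain ⟨S1, hS1, HQ⟩ := exists_quiet hA hD hx0
  obtain ⟨Cn, hCn, HN⟩ := exists_NN_bound (μ := μ) hp ha hβ
  have htend : Tendsto (fun s : ℝ => Cn * s ^ (-a) * (1 + (C0 + 1) ^ p)) atTop (𝓝 0) := by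
    simpa using ((tendsto_rpow_neg_atTop ha).const_mul Cn).mul_const (1 + (C0 + 1) ^ p)
  obtain ⟨S2, hS2⟩ := eventually_atTop.1 (htend.eventually_le_const (half_pos hη0))
  refine ⟨max S1 (max S2 1), hS1.trans (le_max_left _ _), fun s hs => ?_⟩
  have hsS1 : S1 ≤ s := (le_max_left _ _).trans hs
  have hsS2 : S2 ≤ s := (le_max_left _ _).trans ((le_max_right _ _).trans hs)
  have hs1 : 1 ≤ s := (le_max_right _ _).trans ((le_max_right _ _).trans hs)
  have hs0 : s0 ≤ s := hS1.trans hsS1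
  have hdist : ∀ s' ∈ Set.Icc s (s + 1), ∫ y, (w y s' - w y s) ^ 2 ∂gm n ≤ Real.exp 1 * x := fun s' hs' => by
    refine ((hA (s + 1)).dist_sq_le (C := x) hs0 hs'.1 hs'.2 ((HQ s hsS1).mono fun k hk => ?_)).trans ?_
    · refine le_trans ?_ hk
      refine intervalIntegral.integral_mono_interval le_rfl hs'.1 hs'.2
        (Eventually.of_forall fun v => dS_nonneg _ _ v)
        ((hA (s + 1)).dS_intervalIntegrable k hs0 (by linarith) le_rfl)
    · have := hs'.2
      have h1 : s' - s ≤ 1 := by linarith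
      calc _ ≤ Real.exp 1 * 1 * x := by gcongr
        _ = _ := by ring
  have hdε : Real.exp 1 * x ≤ ε := by
    have h1 : 0 ≤ M2 * L * x := by positivity
    nlinarith [Real.exp_pos 1]
  refine ⟨?_, fun s' hs' => (hdist s' hs').trans hdε⟩
  have A := hA (s + 1)
  obtain ⟨J, hJ, hsim⟩ := A.sim
  obtain ⟨k, ⟨hk1, hk2⟩, hk3⟩ := (((HQ s hsS1).and_eventually (A.lim η hη0)).and_eventually
    (A.res (η / 2) (half_pos hη0))).exists
  have hcont : ContinuousOn (dS β (wk k) (qk k)) (Set.Icc s (s + 1)) :=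
    (hsim k).nice_wt_sq.mono fun v hv => hJ ⟨hs0.trans hv.1, hv.2⟩
  obtain ⟨σ, hσ, hdσ⟩ := exists_lt_of_integral_lt hcont (hk1.trans_lt (by linarith : x < 2 * x))
  have hσA : σ ∈ Set.Icc s0 (s + 1) := ⟨hs0.trans hσ.1, hσ.2⟩
  have hσJ := hJ hσA
  have hwk : ∀ y, |wk k y σ| ≤ C0 + 1 := fun y => by
    have h1 := hk2 σ hσA y
    have h2 := hb y σ hσA.1
    calc |wk k y σ| = |(wk k y σ - w y σ) + w y σ| := by ring_nf
      _ ≤ _ := abs_add_le _ _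
      _ ≤ _ := by linarith
  have hr : ∫ y, rsd p β (wk k) (qk k) y σ ^ 2 ∂gm n ≤ 2 * dS β (wk k) (qk k) σ + 2 * x := by
    have hpt : ∀ y, rsd p β (wk k) (qk k) y σ ^ 2 ≤ 2 * wt β (wk k) (qk k) y σ ^ 2 + 2 * x := fun y => by
      have h1 := hk3 σ hσA y
      have h2 := (HN σ (hs1.trans hσ.1) (wk k y σ)).trans
        ((show _ ≤ Cn * σ ^ (-a) * (1 + (C0 + 1) ^ p) by
          have := Real.rpow_nonneg (zero_le_one.trans (hs1.trans hσ.1)) (-a)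
          gcongr
          exact hwk y).trans (hS2 σ (hsS2.trans hσ.1)))
      have h3 : |qk k y σ - |wk k y σ| ^ (p - 1) * wk k y σ| ≤ η := by
        have := abs_add_le (qk k y σ - NN p a μ β σ (wk k y σ)) (NN p a μ β σ (wk k y σ) - |wk k y σ| ^ (p - 1) * wk k y σ)
        rw [sub_add_sub_cancel] at this
        linarith
      have h4 := (sq_le_sq' (abs_le.1 h3).1 (abs_le.1 h3).2).trans hηx
      have e : rsd p β (wk k) (qk k) y σ = wt β (wk k) (qk k) y σ - (qk k y σ - |wk k y σ| ^ (p - 1) * wk k y σ) := by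
        unfold rsd; ring
      rw [e]
      nlinarith [sq_nonneg (wt β (wk k) (qk k) y σ + (qk k y σ - |wk k y σ| ^ (p - 1) * wk k y σ))]
    have i1 := (((hsim k).nwt.sq.const_mul 2).integrable hσJ)
    have := integral_mono (((hsim k).nice_rsd hp).sq.integrable hσJ) (i1.add (integrable_const (2 * x))) hpt
    refine this.trans (le_of_eq ?_)
    rw [integral_add' i1 (integrable_const _), integral_const_mul]
    simp [dS]
  have hAS := HL J (wk k) (qk k) σ (hsim k) hσJ hwk
  have nG : Nice J (gradSq (wk k)) := Nice.sum _ fun i => ((hsim k).nwi i).sq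
  have hP := poincare (((hsim k).sm σ hσJ).of_le (by exact_mod_cast le_top)) ((hsim k).nw.integrable hσJ)
    ((hsim k).nw.sq.integrable hσJ) (by
      obtain ⟨K, C', -, h⟩ := nG.gr
      exact ⟨K, C', fun y => (le_abs_self _).trans (h y σ hσJ)⟩)
  rw [← hM2e, show (∫ y, ∑ i, pd i (fun y => wk k y σ) y ^ 2 ∂gm n) = aS (wk k) σ from by
    unfold aS
    first
      | rfl
      | rw [integral_finsetSum _ fun i _ => ((hsim k).nwi i).sq.integrable hσJ]] at hP
  obtain ⟨c, hc⟩ : ∃ c, c = ∫ y, wk k y σ ∂gm n := ⟨_, rfl⟩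
  rw [← hc] at hP
  refine ⟨c, ?_⟩
  have hsA : s ∈ Set.Icc s0 (s + 1) := ⟨hs0, by linarith⟩
  have j1 : Integrable (fun y => 3 * (w y σ - w y s) ^ 2) (gm n) :=
    (((((A.nice.cy σ hσA).sub (A.nice.cy s hsA)).pow 2)).const_mul 3 |> fun hcont =>
      Integrable.of_bound (C := 3 * (2 * C0) ^ 2) hcont.aestronglyMeasurable (Eventually.of_forall fun y => by
        have h1 := abs_le.1 (hb y σ hσA.1)
        have h2 := abs_le.1 (hb y s hs0)
        rw [Real.norm_of_nonneg (by positivity)]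
        have : (w y σ - w y s) ^ 2 ≤ (2 * C0) ^ 2 := sq_le_sq' (by linarith) (by linarith)
        linarith))
  have j2 : Integrable (fun y => 3 * (wk k y σ - c) ^ 2) (gm n) :=
    (((hsim k).nw.sub (Nice.const c)).sq.const_mul 3).integrable hσJ
  have hfin := integral_mono ((A.nice.sub (Nice.const c)).sq.integrable hsA)
    ((j1.add j2).add (integrable_const (3 * η ^ 2))) (fun y => show (w y s - c) ^ 2 ≤
      3 * (w y σ - w y s) ^ 2 + 3 * (wk k y σ - c) ^ 2 + 3 * η ^ 2 by
        have h1 := abs_le.1 (hk2 σ hσA y)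
        have h2 := sq_le_sq' h1.1 h1.2
        nlinarith [sq_nonneg ((w y σ - w y s) + (wk k y σ - c)), sq_nonneg ((w y σ - w y s) - (wk k y σ - w y σ)),
          sq_nonneg ((wk k y σ - c) + (wk k y σ - w y σ))])
  refine hfin.trans ?_
  rw [integral_add' (j1.add j2) (integrable_const _), integral_add' j1 j2, integral_const_mul, integral_const_mul]
  have hd := hdist σ hσ
  have h5 : 2 * M2 * aS (wk k) σ ≤ 2 * M2 * (δ1 + L * (6 * x)) := by
    gcongr
    refine hAS.trans ?_
    gcongr
    linarith
  simp only [integral_const, probReal_univ, one_smul]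
  nlinarith

end

section

lemma exists_modulus_sq {G : ℝ → ℝ} (hG : Continuous G) (C0 : ℝ) {ε : ℝ} (hε : 0 < ε) :
    ∃ K, 0 ≤ K ∧ ∀ x y, |x| ≤ C0 → |y| ≤ C0 → |G x - G y| ≤ ε + K * (x - y) ^ 2 := by
  have hc : IsCompact (Set.Icc (-C0) C0) := isCompact_Icc
  obtain ⟨δ, hδ, h1⟩ := Metric.uniformContinuousOn_iff.1 (hc.uniformContinuousOn_of_continuous hG.continuousOn) ε hε
  obtain ⟨B, hB⟩ := hc.exists_bound_of_continuousOn hG.continuousOn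
  refine ⟨2 * |B| / δ ^ 2, by positivity, fun x y hx hy => ?_⟩
  by_cases hd : |x - y| < δ
  · have := h1 x (abs_le.1 hx) y (abs_le.1 hy) hd
    rw [Real.dist_eq] at this
    have : 0 ≤ 2 * |B| / δ ^ 2 * (x - y) ^ 2 := by positivity
    linarith
  · have h2 := hB x (abs_le.1 hx)
    have h3 := hB y (abs_le.1 hy)
    have h4 : δ ^ 2 ≤ (x - y) ^ 2 := by
      rw [← sq_abs (x - y)]; exact pow_le_pow_left₀ hδ.le (not_lt.1 hd) 2
    have h5 : 2 * |B| ≤ 2 * |B| / δ ^ 2 * (x - y) ^ 2 := by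
      rw [div_mul_eq_mul_div, le_div_iff₀ (by positivity)]; gcongr
    have h6 := abs_sub (G x) (G y)
    rw [Real.norm_eq_abs] at h2 h3
    linarith [le_abs_self B]

lemma integral_sub_sq {n : ℕ} {f : E n → ℝ} (h1 : Integrable f (gm n))
    (h2 : Integrable (fun y => f y ^ 2) (gm n)) (c : ℝ) :
    ∫ y, (f y - c) ^ 2 ∂gm n = ∫ y, (f y - ∫ x, f x ∂gm n) ^ 2 ∂gm n + ((∫ x, f x ∂gm n) - c) ^ 2 := by
  have key : ∀ c, ∫ y, (f y - c) ^ 2 ∂gm n = ∫ y, f y ^ 2 ∂gm n - 2 * c * (∫ x, f x ∂gm n) + c ^ 2 := fun c => by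
    have e : ∀ y, (f y - c) ^ 2 = f y ^ 2 - 2 * c * f y + c ^ 2 := fun y => by ring
    simp only [e]
    have h3 := h1.const_mul (2 * c)
    have h4 : Integrable (fun y => f y ^ 2 - 2 * c * f y) (gm n) := h2.sub h3
    rw [integral_add h4 (integrable_const _), integral_sub h2 h3, integral_const_mul]
    simp
  rw [key, key (∫ x, f x ∂gm n)]; ring

/-- The nonlinearity of the limiting ordinary differential equation. -/
noncomputable def gz (p β z : ℝ) : ℝ := -(β * z) + |z| ^ (p - 1) * z

lemma gz_continuous {p : ℝ} (hp : 1 < p) (β : ℝ) : Continuous (gz p β) := by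
  unfold gz
  exact (by fun_prop : Continuous fun z : ℝ => -(β * z)).add
    ((continuous_abs.rpow_const fun _ => Or.inr (by linarith)).mul continuous_id)

section
variable {p β κ : ℝ}

lemma kappa_facts (hp : 1 < p) (hβ : β * (p - 1) = 1) (hκ : κ = (p - 1) ^ (-(1 / (p - 1)))) :
    0 < κ ∧ κ ^ (p - 1) = β := by
  have h0 : 0 < p - 1 := by linarith
  refine ⟨hκ ▸ Real.rpow_pos_of_pos h0 _, ?_⟩
  rw [hκ, ← Real.rpow_mul h0.le, show -(1 / (p - 1)) * (p - 1) = -1 by field_simp, Real.rpow_neg_one]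
  exact (eq_inv_of_mul_eq_one_left hβ).symm

lemma gz_eq_zero (hp : 1 < p) (hβ : β * (p - 1) = 1) (hκ : κ = (p - 1) ^ (-(1 / (p - 1)))) {z : ℝ}
    (h : gz p β z = 0) : z = 0 ∨ |z| = κ := by
  obtain ⟨h1, h2⟩ := kappa_facts hp hβ hκ
  unfold gz at h
  have : z * (|z| ^ (p - 1) - β) = 0 := by linarith
  rcases mul_eq_zero.1 this with h3 | h3
  · exact Or.inl h3
  · right
    rw [sub_eq_zero, ← h2] at h3
    exact (Real.rpow_left_inj (abs_nonneg z) h1.le (by linarith)).1 h3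

lemma tendsto_of_gz (hp : 1 < p) (hβ : β * (p - 1) = 1) (hκ : κ = (p - 1) ^ (-(1 / (p - 1)))) {m : ℝ → ℝ}
    {s0 C0 : ℝ} (hm : ∀ s2, ContinuousOn m (Set.Icc s0 s2)) (hC : ∀ s, s0 ≤ s → |m s| ≤ C0)
    (hg : Tendsto (fun s => gz p β (m s)) atTop (𝓝 0)) :
    ∃ z, (z = 0 ∨ z = κ ∨ z = -κ) ∧ Tendsto m atTop (𝓝 z) := by
  obtain ⟨h1, h2⟩ := kappa_facts hp hβ hκ
  have avoid : ∀ v, gz p β v ≠ 0 → (∀ᶠ s in atTop, m s ≤ v) ∨ ∀ᶠ s in atTop, v ≤ m s := fun v hv => by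
    obtain ⟨S, hS⟩ := eventually_atTop.1 ((hg.abs).eventually_lt_const (by simpa using hv : |(0 : ℝ)| < |gz p β v|))
    have hne : ∀ s, max s0 S ≤ s → m s ≠ v := fun s hs he => by
      have := hS s ((le_max_right _ _).trans hs)
      rw [he] at this; exact lt_irrefl _ this
    have hco : ∀ s, ContinuousOn m (Set.Icc (max s0 S) s) := fun s =>
      (hm s).mono (Set.Icc_subset_Icc_left (le_max_left _ _))
    rcases le_total (m (max s0 S)) v with h | h
    · left
      filter_upwards [eventually_ge_atTop (max s0 S)] with s hs
      by_contra! h'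
      obtain ⟨x, hx, hx'⟩ := intermediate_value_Icc hs (hco s) ⟨h, h'.le⟩
      exact hne x hx.1 hx'
    · right
      filter_upwards [eventually_ge_atTop (max s0 S)] with s hs
      by_contra! h'
      obtain ⟨x, hx, hx'⟩ := intermediate_value_Icc' hs (hco s) ⟨h'.le, h⟩
      exact hne x hx.1 hx'
  have hbd : ∀ᶠ s in atTop, m s ∈ Set.Icc (-C0) C0 := by
    filter_upwards [eventually_ge_atTop s0] with s hs
    exact abs_le.1 (hC s hs)
  have lim : ∀ c d z, (∀ᶠ s in atTop, c ≤ m s) → (∀ᶠ s in atTop, m s ≤ d) →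
      (∀ y ∈ Set.Icc c d, gz p β y = 0 → y = z) → Tendsto m atTop (𝓝 z) := fun c d z hc hd hu => by
    refine (isCompact_Icc (a := c) (b := d)).tendsto_nhds_of_unique_mapClusterPt (hc.and hd) fun y hy hcl => hu y hy ?_
    have hcl' := hcl.continuousAt_comp (gz_continuous hp β).continuousAt
    have : (𝓝 (gz p β y) ⊓ map (gz p β ∘ m) atTop).NeBot := hcl'
    by_contra hne
    have hd := (disjoint_nhds_nhds.2 hne).mono_right hg
    exact this.ne hd.eq_bot
  have hv : ∀ v, |v| = κ / 2 → gz p β v ≠ 0 := fun v hv h => by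
    rcases gz_eq_zero hp hβ hκ h with h3 | h3
    · rw [h3, abs_zero] at hv; linarith
    · linarith
  have hk2 := hv (κ / 2) (abs_of_pos (by linarith))
  have hk3 := hv (-(κ / 2)) (by rw [abs_neg, abs_of_pos (by linarith)])
  have zr : ∀ y, gz p β y = 0 → y = 0 ∨ y = κ ∨ y = -κ := fun y hy =>
    (gz_eq_zero hp hβ hκ hy).imp_right fun h => (abs_eq h1.le).1 h
  rcases avoid _ hk2 with ha | ha
  · rcases avoid _ hk3 with hb | hb
    · refine ⟨-κ, by simp, lim (-C0) (-(κ / 2)) _ (hbd.mono fun s h => h.1) hb fun y hy h => ?_⟩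
      rcases zr y h with h' | h' | h' <;> [skip; skip; exact h'] <;> exfalso <;> linarith [hy.2]
    · refine ⟨0, by simp, lim (-(κ / 2)) (κ / 2) _ hb ha fun y hy h => ?_⟩
      rcases zr y h with h' | h' | h' <;> [exact h'; skip; skip] <;> exfalso <;> linarith [hy.1, hy.2]
  · refine ⟨κ, by simp, lim (κ / 2) C0 _ ha (hbd.mono fun s h => h.2) fun y hy h => ?_⟩
    rcases zr y h with h' | h' | h' <;> [skip; exact h'; skip] <;> exfalso <;> linarith [hy.1]

end

variable {n : ℕ} {p a μ β κ s0 C C0 : ℝ} {w : E n → ℝ → ℝ} {wk qk : ℕ → E n → ℝ → ℝ}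

lemma abs_le_add_sq {e : ℝ} (he : 0 < e) (z : ℝ) : |z| ≤ e + e⁻¹ * z ^ 2 := by
  have : e + e⁻¹ * z ^ 2 - |z| = e⁻¹ * ((e - |z| / 2) ^ 2 + 3 / 4 * |z| ^ 2) := by
    rw [← sq_abs z]; field_simp; ring
  have : 0 ≤ e⁻¹ * ((e - |z| / 2) ^ 2 + 3 / 4 * |z| ^ 2) := by positivity
  linarith

theorem exists_limit (hp : 1 < p) (ha : 0 < a) (hβ : β * (p - 1) = 1) (hsub : (n : ℝ) < 2 + 4 * β)
    (hκ : κ = (p - 1) ^ (-(1 / (p - 1))))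
    (hA : ∀ s2, Appr p a μ β s0 s2 w wk qk)
    (hD : ∀ s, s0 ≤ s → ∀ᶠ k in atTop, ∫ v in s0..s, dS β (wk k) (qk k) v ≤ C)
    (hb : ∀ y s, s0 ≤ s → |w y s| ≤ C0) :
    ∃ z, (z = 0 ∨ z = κ ∨ z = -κ) ∧ Tendsto (fun s => ∫ y, w y s ∂gm n) atTop (𝓝 z) ∧
      Tendsto (fun s => ∫ y, (w y s - z) ^ 2 ∂gm n) atTop (𝓝 0) := by
  have hmem : ∀ s, s0 ≤ s → ∀ s' ∈ Set.Icc s (s + 1), s' ∈ Set.Icc s0 (s + 1) := fun s hs s' hs' =>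
    ⟨hs.trans hs'.1, hs'.2⟩
  obtain ⟨m, hm⟩ : ∃ m : ℝ → ℝ, ∀ s, m s = ∫ y, w y s ∂gm n := ⟨_, fun _ => rfl⟩
  have hmb : ∀ s, s0 ≤ s → |m s| ≤ C0 := fun s hs => by
    rw [hm]; exact abs_integral_gm_le fun y => hb y s hs
  have hi : ∀ s, s0 ≤ s → Integrable (fun y => w y s) (gm n) := fun s hs => (hA s).nice.integrable ⟨hs, le_rfl⟩
  have hi2 : ∀ s, s0 ≤ s → Integrable (fun y => w y s ^ 2) (gm n) := fun s hs => (hA s).nice.sq.integrable ⟨hs, le_rfl⟩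
  have hid : ∀ s s', s0 ≤ s → s0 ≤ s' → Integrable (fun y => (w y s' - w y s) ^ 2) (gm n) := fun s s' h1 h2 => by
    have c1 := (hA s).nice.cy s ⟨h1, le_rfl⟩
    have c2 := (hA s').nice.cy s' ⟨h2, le_rfl⟩
    refine Integrable.of_bound (C := (2 * C0) ^ 2) ((c2.sub c1).pow 2).aestronglyMeasurable (Eventually.of_forall fun y => ?_)
    have h1 := abs_le.1 (hb y s h1)
    have h2 := abs_le.1 (hb y s' h2)
    rw [Real.norm_of_nonneg (sq_nonneg _)]
    exact sq_le_sq' (by linarith) (by linarith)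
  have hV : ∀ ε > 0, ∃ S, s0 ≤ S ∧ ∀ s, S ≤ s → ∫ y, (w y s - m s) ^ 2 ∂gm n ≤ ε ∧
      ∀ s' ∈ Set.Icc s (s + 1), ∫ y, (w y s' - w y s) ^ 2 ∂gm n ≤ ε := fun ε hε => by
    obtain ⟨S, hS, h⟩ := exists_const_close hp ha hβ hsub hA hD hb hε
    refine ⟨S, hS, fun s hs => ⟨?_, (h s hs).2⟩⟩
    obtain ⟨c, hc⟩ := (h s hs).1
    rw [integral_sub_sq (hi s (hS.trans hs)) (hi2 s (hS.trans hs)) c] at hc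
    rw [hm]
    linarith [sq_nonneg (∫ x, w x s ∂gm n - c)]
  have hg : Tendsto (fun s => gz p β (m s)) atTop (𝓝 0) := by
    rw [Metric.tendsto_atTop]
    intro ε hε
    obtain ⟨e, he⟩ : ∃ e, e = ε / 8 := ⟨_, rfl⟩
    have he0 : 0 < e := by linarith
    obtain ⟨K, hK, HK⟩ := exists_modulus_sq (gz_continuous hp β) C0 he0
    obtain ⟨x, hx⟩ : ∃ x, x = e / (4 * K + e⁻¹) := ⟨_, rfl⟩
    have hx0 : 0 < x := by rw [hx]; positivity
    have hxe : 4 * K * x + e⁻¹ * x = e := by rw [hx]; field_simp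
    have hx1 : 0 ≤ e⁻¹ * x := by positivity
    have hx2 : 0 ≤ K * x := by positivity
    obtain ⟨S1, hS1, HS⟩ := hV x hx0
    obtain ⟨Cn, hCn, HN⟩ := exists_NN_bound (μ := μ) hp ha hβ
    have htend : Tendsto (fun s : ℝ => Cn * s ^ (-a) * (1 + C0 ^ p)) atTop (𝓝 0) := by
      simpa using ((tendsto_rpow_neg_atTop ha).const_mul Cn).mul_const (1 + C0 ^ p)
    obtain ⟨S2, hS2⟩ := eventually_atTop.1 (htend.eventually_le_const he0)
    refine ⟨max S1 (max S2 1), fun s hs => ?_⟩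
    have hsS1 : S1 ≤ s := (le_max_left _ _).trans hs
    have hsS2 : S2 ≤ s := (le_max_left _ _).trans ((le_max_right _ _).trans hs)
    have hs1 : 1 ≤ s := (le_max_right _ _).trans ((le_max_right _ _).trans hs)
    have hs0 : s0 ≤ s := hS1.trans hsS1
    obtain ⟨hv, hd⟩ := HS s hsS1
    have A := hA (s + 1)
    have hms := A.mean_sub hp hs0 (by linarith : s ≤ s + 1) le_rfl
    have hGc : Continuous fun q : ℝ × ℝ => -(β * q.2) + NN p a μ β q.1 q.2 :=
      (by fun_prop : Continuous fun q : ℝ × ℝ => -(β * q.2)).add (NN_continuous hp)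
    have nF := A.nice_comp (G := fun s z => -(β * z) + NN p a μ β s z) hGc
    have hF : ∀ σ ∈ Set.Icc s (s + 1),
        |(∫ y, (-(β * w y σ) + NN p a μ β σ (w y σ)) ∂gm n) - gz p β (m s)| ≤ 3 * e := fun σ hσ => by
      have hσA := hmem s hs0 σ hσ
      have e1 : (∫ y, (-(β * w y σ) + NN p a μ β σ (w y σ)) ∂gm n) - gz p β (m s) =
          ∫ y, (-(β * w y σ) + NN p a μ β σ (w y σ) - gz p β (m s)) ∂gm n := by
        rw [integral_sub (nF.integrable hσA) (integrable_const _)]; simp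
      have j1 := (hid s σ hs0 hσA.1).const_mul (2 * K)
      have j2 : Integrable (fun y => 2 * K * (w y s - m s) ^ 2) (gm n) :=
        ((A.nice.sub (Nice.const (m s))).sq.const_mul (2 * K)).integrable (hmem s hs0 s ⟨le_rfl, by linarith⟩)
      rw [e1]
      refine (abs_integral_le ((j1.add j2).add (integrable_const (2 * e))) fun y => ?_).trans ?_
      · have h1 := (HN σ (hs1.trans hσ.1) (w y σ)).trans
          ((show _ ≤ Cn * σ ^ (-a) * (1 + C0 ^ p) by
            have := Real.rpow_nonneg (zero_le_one.trans (hs1.trans hσ.1)) (-a)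
            gcongr
            exact hb y σ hσA.1).trans (hS2 σ (hsS2.trans hσ.1)))
        have h2 := HK (w y σ) (m s) (hb y σ hσA.1) (hmb s hs0)
        have h3 : K * (w y σ - m s) ^ 2 ≤ 2 * K * (w y σ - w y s) ^ 2 + 2 * K * (w y s - m s) ^ 2 := by
          nlinarith [mul_nonneg hK (sq_nonneg ((w y σ - w y s) - (w y s - m s)))]
        have e2 : -(β * w y σ) + NN p a μ β σ (w y σ) - gz p β (m s) =
          (NN p a μ β σ (w y σ) - |w y σ| ^ (p - 1) * w y σ) + (gz p β (w y σ) - gz p β (m s)) := by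
          unfold gz; ring
        rw [e2]
        refine (abs_add_le _ _).trans ?_
        simp only [Pi.add_apply]
        linarith
      · rw [integral_add' (j1.add j2) (integrable_const _), integral_add' j1 j2, integral_const_mul, integral_const_mul]
        simp only [integral_const, probReal_univ, one_smul]
        have h1 := mul_le_mul_of_nonneg_left (hd σ hσ) (by positivity : 0 ≤ 2 * K)
        have h2 := mul_le_mul_of_nonneg_left hv (by positivity : 0 ≤ 2 * K)
        linarith
    have hInt : IntervalIntegrable (fun σ => ∫ y, (-(β * w y σ) + NN p a μ β σ (w y σ)) ∂gm n) volume s (s + 1) :=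
      (nF.integral_cont.mono fun x hx => by
        rw [Set.uIcc_of_le (by linarith)] at hx; exact hmem s hs0 x hx).intervalIntegrable
    have h4 := intervalIntegral.norm_integral_le_of_norm_le_const (a := s) (b := s + 1) (C := 3 * e)
      (f := fun σ => (∫ y, (-(β * w y σ) + NN p a μ β σ (w y σ)) ∂gm n) - gz p β (m s)) fun σ hσ => by
        rw [Set.uIoc_of_le (by linarith)] at hσ
        exact hF σ ⟨hσ.1.le, hσ.2⟩
    rw [intervalIntegral.integral_sub hInt intervalIntegrable_const, ← hms, intervalIntegral.integral_const,
      Real.norm_eq_abs] at h4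
    simp only [add_sub_cancel_left, one_smul, abs_one, mul_one] at h4
    have h5 : |∫ y, w y (s + 1) ∂gm n - ∫ y, w y s ∂gm n| ≤ 2 * e := by
      rw [← integral_sub (hi _ (by linarith)) (hi s hs0)]
      have j1 := (hid s (s + 1) hs0 (by linarith)).const_mul e⁻¹
      refine (abs_integral_le ((integrable_const e).add j1) fun y => abs_le_add_sq he0 _).trans ?_
      rw [integral_add' (integrable_const _) j1, integral_const_mul]
      have h1 := mul_le_mul_of_nonneg_left (hd (s + 1) ⟨by linarith, le_rfl⟩) (by positivity : 0 ≤ e⁻¹)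
      simp only [integral_const, probReal_univ, one_smul]
      linarith
    rw [Real.dist_eq, sub_zero]
    have h6 := abs_le.1 h4
    have h7 := abs_le.1 h5
    exact (abs_le.2 ⟨by linarith, by linarith⟩ : |gz p β (m s)| ≤ 5 * e).trans_lt (by linarith)
  obtain ⟨z, hz, hz'⟩ := tendsto_of_gz hp hβ hκ (fun s2 => ((hA s2).nice.integral_cont).congr fun s _ => hm s) hmb hg
  refine ⟨z, hz, hz'.congr hm, ?_⟩
  have hV0 : Tendsto (fun s => ∫ y, (w y s - m s) ^ 2 ∂gm n) atTop (𝓝 0) := by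
    rw [Metric.tendsto_atTop]
    intro ε hε
    obtain ⟨S, hS, h⟩ := hV (ε / 2) (half_pos hε)
    refine ⟨S, fun s hs => ?_⟩
    rw [Real.dist_eq, sub_zero, abs_of_nonneg (integral_nonneg fun _ => sq_nonneg _)]
    linarith [(h s hs).1]
  have : Tendsto (fun s => ∫ y, (w y s - m s) ^ 2 ∂gm n + (m s - z) ^ 2) atTop (𝓝 0) := by
    simpa using hV0.add ((hz'.sub_const z).pow 2)
  refine this.congr' ?_
  filter_upwards [eventually_ge_atTop s0] with s hs
  rw [integral_sub_sq (hi s hs) (hi2 s hs) z, hm]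

end

section

variable {n : ℕ} {p a μ β T : ℝ} {u : E n → ℝ → ℝ}

lemma integral_gm_shift_le {f : E n → ℝ} (h0 : ∀ y, 0 ≤ f y) (hf : Integrable f (gm n)) {l : ℝ} (hl : 0 < l)
    (hl2 : 2 ≤ l ^ 2) (h : E n) :
    ∫ y, f (l⁻¹ • (y + h)) ∂gm n ≤ l ^ n * (Real.exp (‖h‖ ^ 2 / 4) * ∫ y, f y ∂gm n) := by
  have e1 : ∫ y, f (l⁻¹ • (y + h)) ∂gm n = l ^ n * ∫ y, f y * rho n (l • y - h) := by
    have := Measure.integral_comp_smul (volume : Measure (E n)) (fun y => f y * rho n (l • y - h)) l⁻¹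
    rw [finrank_euclideanSpace_fin, inv_pow, inv_inv, abs_of_pos (pow_pos hl n), smul_eq_mul] at this
    rw [integral_gm, ← integral_sub_right_eq_self _ h, ← this]
    simp only [sub_add_cancel, smul_inv_smul₀ hl.ne']
  rw [e1, integral_gm, ← integral_const_mul (Real.exp (‖h‖ ^ 2 / 4))]
  refine mul_le_mul_of_nonneg_left ?_ (by positivity)
  refine integral_mono_of_nonneg (ae_of_all _ fun y => mul_nonneg (h0 y) (rho_pos _).le)
    ((integrable_gm.1 hf).const_mul _) (ae_of_all _ fun y => ?_)
  have e2 : rho n (l • y - h) ≤ Real.exp (‖h‖ ^ 2 / 4) * rho n y := by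
    have h1 : ‖l • y‖ ≤ ‖l • y - h‖ + ‖h‖ := by simpa using norm_add_le (l • y - h) h
    rw [norm_smul, Real.norm_of_nonneg hl.le] at h1
    have h2 : ‖y‖ ^ 2 ≤ ‖l • y - h‖ ^ 2 + ‖h‖ ^ 2 := by
      have h3 := pow_le_pow_left₀ (by positivity) h1 2
      nlinarith [sq_nonneg (‖l • y - h‖ - ‖h‖), mul_le_mul_of_nonneg_right hl2 (sq_nonneg ‖y‖)]
    unfold rho
    rw [mul_left_comm, ← Real.exp_add]
    gcongr
    linarith
  simp only
  rw [mul_left_comm]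
  exact mul_le_mul_of_nonneg_left e2 (h0 y)

lemma exists_pointwise (hp : 1 < p) (ha : 0 < a) (hβ : β * (p - 1) = 1)
    (hu : SolvesU n p a μ T u) {K : ℝ} (hK0 : 0 ≤ K)
    (hK : ∀ x, ∀ t ∈ Set.Ico 0 T, |u x t| * (T - t) ^ β ≤ K) (z R : ℝ) {e : ℝ} (he : 0 < e) :
    ∃ δ L, 0 < δ ∧ δ ≤ 1 ∧ 0 ≤ L ∧ ∀ b y0 t, ‖y0‖ ≤ R → t < T → T - t ≤ 1 / 2 → 2 * (T - t) < T →
      |(T - t) ^ β * u (b + √(T - t) • y0) t - z| ≤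
        e + L * ∫ y, (W β T b u y (-Real.log ((1 + δ) * (T - t))) - z) ^ 2 ∂gm n := by
  have hβ0 := beta_pos hp hβ
  obtain ⟨δ, hδ, hδ1, hδe⟩ : ∃ δ : ℝ, 0 < δ ∧ δ ≤ 1 ∧ Cf a μ * K ^ p * δ + |z| * (1 - (1 + δ) ^ (-β)) ≤ e / 2 := by
    have t1 : Tendsto (fun δ : ℝ => Cf a μ * K ^ p * δ + |z| * (1 - (1 + δ) ^ (-β))) (𝓝 0) (𝓝 0) := by
      have : ContinuousAt (fun δ : ℝ => Cf a μ * K ^ p * δ + |z| * (1 - (1 + δ) ^ (-β))) 0 := by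
        have : ContinuousAt (fun δ : ℝ => (1 + δ) ^ (-β)) 0 :=
          ContinuousAt.rpow_const (by fun_prop) (Or.inl (by norm_num))
        fun_prop
      simpa [ContinuousAt] using this
    have t2 := (t1.eventually_le_const (half_pos he)).filter_mono (nhdsWithin_le_nhds (s := Set.Ioi 0))
    obtain ⟨δ, h1, h2⟩ := (t2.and (Ioo_mem_nhdsGT (zero_lt_one' ℝ))).exists
    exact ⟨δ, h2.1, h2.2.le, h1⟩
  obtain ⟨l, hl⟩ : ∃ l, l = √((1 + δ) / δ) := ⟨_, rfl⟩
  have hl0 : 0 < l := by rw [hl]; positivity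
  have hl2 : l ^ 2 = (1 + δ) / δ := by rw [hl]; exact Real.sq_sqrt (by positivity)
  obtain ⟨L, hL⟩ : ∃ L, L = l ^ n * Real.exp ((R / √δ) ^ 2 / 4) := ⟨_, rfl⟩
  have hL0 : 0 < L := by rw [hL]; positivity
  obtain ⟨e', he'⟩ : ∃ e', e' = e / (2 * L) := ⟨_, rfl⟩
  have he'0 : 0 < e' := by rw [he']; positivity
  refine ⟨δ, L * e'⁻¹, hδ, hδ1, by positivity, fun b y0 t hy0 ht ht2 hT2 => ?_⟩
  obtain ⟨θ, hθ⟩ : ∃ θ, θ = T - t := ⟨_, rfl⟩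
  have hθ0 : 0 < θ := by linarith
  rw [← hθ] at ht2 hT2 ⊢
  obtain ⟨s, hs⟩ : ∃ s, s = -Real.log ((1 + δ) * θ) := ⟨_, rfl⟩
  obtain ⟨c, hc⟩ : ∃ c, c = -Real.log (δ * θ) := ⟨_, rfl⟩
  have es : Real.exp (-s) = (1 + δ) * θ := by rw [hs, neg_neg, Real.exp_log (by positivity)]
  have ec : Real.exp (-c) = δ * θ := by rw [hc, neg_neg, Real.exp_log (by positivity)]
  have h1θ : (1 + δ) * θ ≤ 2 * θ := by gcongr; linarith
  have hδθ : δ * θ ≤ θ := by nlinarith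
  have es2 : Real.exp (-s / 2) = √((1 + δ) * θ) := by rw [Real.exp_half, es]
  have ec2 : Real.exp (-c / 2) = √(δ * θ) := by rw [Real.exp_half, ec]
  have hs0 : 0 ≤ s := by
    rw [hs, neg_nonneg]; exact Real.log_nonpos (by positivity) (by linarith)
  have hc0 : 0 ≤ c := by
    rw [hc, neg_nonneg]; exact Real.log_nonpos (by positivity) (by linarith)
  have hsT : Real.exp (-s) < T := by rw [es]; linarith
  have hN := (appr_max hp ha hu hβ0.le b hs0 hsT le_rfl s).nice
  have hsm : s ∈ Set.Icc s s := ⟨le_rfl, le_rfl⟩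
  have hi2 : Integrable (fun y => (W β T b u y s - z) ^ 2) (gm n) := (hN.sub (Nice.const z)).sq.integrable hsm
  have hi1 : Integrable (fun y => W β T b u y s - z) (gm n) := (hN.sub (Nice.const z)).integrable hsm
  rw [← hs]
  obtain ⟨x, hx⟩ : ∃ x, x = b + √θ • y0 := ⟨_, rfl⟩
  rw [← hx]
  -- the Duhamel term
  have d1 : |u x t - mean u x t c| ≤ Cf a μ * (K * θ ^ (-β)) ^ p * Real.exp (-c) := by
    refine duhamel_const hp ha hu x hc0 (by rw [ec]; linarith) ht fun x' t' ht' => ?_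
    rw [ec] at ht'
    have h2 := hK x' t' ⟨by linarith [ht'.1], ht'.2.trans ht⟩
    have h3 : 0 < T - t' := by linarith [ht'.2]
    rw [← le_div_iff₀ (Real.rpow_pos_of_pos h3 _), div_eq_mul_inv, ← Real.rpow_neg h3.le] at h2
    refine h2.trans (mul_le_mul_of_nonneg_left ?_ hK0)
    exact Real.rpow_le_rpow_of_nonpos hθ0 (by linarith [ht'.2]) (by linarith)
  have d2 : θ ^ β * |u x t - mean u x t c| ≤ Cf a μ * K ^ p * δ := by
    refine (mul_le_mul_of_nonneg_left d1 (by positivity)).trans_eq ?_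
    rw [ec, Real.mul_rpow hK0 (by positivity), ← Real.rpow_mul hθ0.le]
    have : θ ^ β * (θ ^ (-β * p) * θ) = 1 := by
      rw [← Real.rpow_add_one hθ0.ne', ← Real.rpow_add hθ0, show β + (-β * p + 1) = 0 by linarith, Real.rpow_zero]
    linear_combination Cf a μ * K ^ p * δ * this
  -- the mean
  have m1 : |Real.exp (-β * s) * mean u x t c - z| ≤ L * ∫ y, |W β T b u y s - z| ∂gm n := by
    obtain ⟨h, hh⟩ : ∃ h : E n, h = (√δ)⁻¹ • y0 := ⟨_, rfl⟩
    have e1 : ∀ y, Real.exp (-β * s) * u (x + Real.exp (-c / 2) • y) (t - Real.exp (-c)) - z =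
        W β T b u (l⁻¹ • (y + h)) s - z := fun y => by
      have q1 : √((1 + δ) * θ) * l⁻¹ = √(δ * θ) := by
        rw [mul_inv_eq_iff_eq_mul₀ hl0.ne', hl, ← Real.sqrt_mul (by positivity)]
        congr 1; field_simp
      have q2 : √(δ * θ) * (√δ)⁻¹ = √θ := by
        rw [Real.sqrt_mul hδ.le]; field_simp
      unfold W
      rw [es, ec, es2, ec2, smul_smul, q1, hh, smul_add, smul_smul, q2, hx, show t - δ * θ = T - (1 + δ) * θ by
        rw [hθ]; ring]
      congr 3; abel
    have e2 : Integrable (fun y => u (x + Real.exp (-c / 2) • y) (t - Real.exp (-c))) (gm n) := by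
      have hct : Real.exp (-c) < t := by rw [ec]; linarith
      have := ((appr_max hp ha hu le_rfl x hc0 hct ht.le c).nice).integrable (s := c) ⟨le_rfl, le_rfl⟩
      simpa only [W_zero_eq] using this
    have e3 : Real.exp (-β * s) * mean u x t c - z = ∫ y, (W β T b u (l⁻¹ • (y + h)) s - z) ∂gm n := by
      rw [mean, ← integral_const_mul]
      simp only [← e1]
      rw [integral_sub (e2.const_mul _) (integrable_const _)]; simp
    rw [e3]
    refine (abs_integral_le_integral_abs).trans ((integral_gm_shift_le (f := fun y => |W β T b u y s - z|)
      (fun y => abs_nonneg _) hi1.abs hl0 ?_ h).trans ?_)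
    · rw [hl2, le_div_iff₀ hδ]; linarith
    · rw [hL, mul_assoc]
      have : ‖h‖ ≤ R / √δ := by
        rw [hh, norm_smul, norm_inv, Real.norm_of_nonneg (by positivity), inv_mul_eq_div]; gcongr
      have := integral_nonneg (μ := gm n) (f := fun y => |W β T b u y s - z|) fun y => abs_nonneg _
      gcongr
  have m2 : ∫ y, |W β T b u y s - z| ∂gm n ≤ e' + e'⁻¹ * ∫ y, (W β T b u y s - z) ^ 2 ∂gm n := by
    refine (integral_mono hi1.abs ((integrable_const e').add (hi2.const_mul e'⁻¹)) fun y => abs_le_add_sq he'0 _).trans_eq ?_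
    rw [integral_add' (integrable_const _) (hi2.const_mul _), integral_const_mul]; simp
  have r1 : Real.exp (-β * s) = (1 + δ) ^ β * θ ^ β := by
    rw [show -β * s = -s * β by ring, Real.exp_mul, es, Real.mul_rpow (by linarith) hθ0.le]
  have r2 : (1 + δ) ^ (-β) * (1 + δ) ^ β = 1 := by
    rw [← Real.rpow_add (by linarith), neg_add_cancel, Real.rpow_zero]
  have r3 : (1 + δ) ^ (-β) ≤ 1 := Real.rpow_le_one_of_one_le_of_nonpos (by linarith) (by linarith)
  have r4 : 0 < (1 + δ) ^ (-β) := by positivity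
  have dec : θ ^ β * u x t - z = θ ^ β * (u x t - mean u x t c) +
      (1 + δ) ^ (-β) * (Real.exp (-β * s) * mean u x t c - z) - z * (1 - (1 + δ) ^ (-β)) := by
    rw [r1]; linear_combination (-(θ ^ β) * mean u x t c) * r2
  have m3 := m1.trans (mul_le_mul_of_nonneg_left m2 hL0.le)
  have m4 : L * e' = e / 2 := by rw [he']; field_simp
  have m5 : (1 + δ) ^ (-β) * |Real.exp (-β * s) * mean u x t c - z| ≤ |Real.exp (-β * s) * mean u x t c - z| :=
    mul_le_of_le_one_left (abs_nonneg _) r3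
  rw [dec]
  refine (abs_sub _ _).trans ((add_le_add_left (abs_add_le _ _) _).trans ?_)
  rw [abs_mul, abs_mul, abs_mul, abs_of_pos r4, abs_of_nonneg (by linarith : 0 ≤ 1 - (1 + δ) ^ (-β)),
    abs_of_pos (by positivity : 0 < θ ^ β)]
  linarith

end

section

variable {n : ℕ} {p a μ β T s C0 : ℝ} {u : E n → ℝ → ℝ}

lemma Qf_le (hp : 1 < p) (ha : 0 < a) (hβ : β * (p - 1) = 1) {w : E n → ℝ → ℝ} {η : ℝ}
    (hN : Nice (Set.Icc s (s + 1)) w) (hC : ∀ y, ∀ v ∈ Set.Icc s (s + 1), |w y v| ≤ C0)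
    (hy : ∀ v ∈ Set.Icc s (s + 1), yS w v ≤ η) :
    Qf p a μ β w s ≤ (1 / 4 + 2 * (Cf a μ * C0 ^ (p - 1))) * η := by
  have hCf := Cf_pos (a := a) (μ := μ)
  have hs : s ∈ Set.Icc s (s + 1) := ⟨le_rfl, by linarith⟩
  have hC0 : 0 ≤ C0 := (abs_nonneg _).trans (hC 0 s hs)
  have y0 : 0 ≤ yS w (s + 1) := integral_nonneg fun _ => sq_nonneg _
  have y1 : 0 ≤ yS w s := integral_nonneg fun _ => sq_nonneg _
  have k : ‖∫ v in s..s + 1, ∫ y, Kf p a μ β v (w y v) ∂gm n‖ ≤ 8 * (Cf a μ * C0 ^ (p - 1)) * η * |s + 1 - s| := by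
    refine intervalIntegral.norm_integral_le_of_norm_le_const fun v hv => ?_
    rw [Set.uIoc_of_le (by linarith)] at hv
    have hv' : v ∈ Set.Icc s (s + 1) := ⟨hv.1.le, hv.2⟩
    have hi : Integrable (fun y => w y v ^ 2) (gm n) := hN.sq.integrable hv'
    refine (abs_integral_le (hi.const_mul (8 * (Cf a μ * C0 ^ (p - 1)))) fun y => ?_).trans ?_
    · have h1 := abs_NN_le (μ := μ) hp ha hβ v (w y v)
      have h2 := abs_PH_le (μ := μ) hp ha hβ v (w y v)
      have e1 : |w y v| ^ (p + 1) = |w y v| * |w y v| ^ p := by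
        rw [Real.rpow_add_one' (abs_nonneg _) (by linarith), mul_comm]
      have e2 : |w y v| ^ (p + 1) ≤ C0 ^ (p - 1) * w y v ^ 2 := by
        rw [show p + 1 = (p - 1) + (2 : ℕ) by push_cast; ring, Real.rpow_add_natCast' (abs_nonneg _) (by push_cast; linarith),
          sq_abs]
        gcongr
        exact hC y v hv'
      have h3 : |w y v * NN p a μ β v (w y v)| ≤ Cf a μ * |w y v| ^ (p + 1) := by
        rw [abs_mul, e1, mul_left_comm]
        exact mul_le_mul_of_nonneg_left h1 (abs_nonneg _)
      have h4 := mul_le_mul_of_nonneg_left e2 hCf.le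
      have h5 : 0 ≤ Cf a μ * |w y v| ^ (p + 1) := by positivity
      have h3' := abs_le.1 h3
      have h2' := abs_le.1 h2
      unfold Kf
      exact abs_le.2 ⟨by linarith, by linarith⟩
    · rw [integral_const_mul]
      exact mul_le_mul_of_nonneg_left (hy v hv') (by positivity)
  rw [Real.norm_eq_abs] at k
  have : |s + 1 - s| = 1 := by norm_num
  rw [this, mul_one] at k
  have k' := abs_le.1 k
  have := hy s hs
  unfold Qf
  linarith [k'.2]

lemma continuous_Qf (hp : 1 < p) (hN : ∀ b : E n, Nice (Set.Icc s (s + 1)) (W β T b u))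
    (hC : ∀ b y, ∀ v ∈ Set.Icc s (s + 1), |W β T b u y v| ≤ C0)
    (hc : ∀ y, ∀ v ∈ Set.Icc s (s + 1), Continuous fun b => W β T b u y v) :
    Continuous fun b => Qf p a μ β (W β T b u) s := by
  have key : ∀ G : ℝ → ℝ → ℝ, (Continuous fun q : ℝ × ℝ => G q.1 q.2) → ∀ v ∈ Set.Icc s (s + 1),
      Continuous fun b => ∫ y, G v (W β T b u y v) ∂gm n := fun G hG v hv => by
    obtain ⟨B, hB, hGB⟩ := exists_bound_comp hG s (s + 1) C0
    have hGv : Continuous (G v) := hG.comp (Continuous.prodMk_right v)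
    exact continuous_of_dominated (bound := fun _ => B) (fun b => (hGv.comp ((hN b).cy v hv)).aestronglyMeasurable)
      (fun b => ae_of_all _ fun y => hGB v hv _ (hC b y v hv)) (integrable_const _)
      (ae_of_all _ fun y => hGv.comp (hc y v hv))
  have hG := Kf_continuous (a := a) (μ := μ) (β := β) hp
  obtain ⟨B, hB, hGB⟩ := exists_bound_comp hG s (s + 1) C0
  have k3 : Continuous fun b => ∫ v in s..s + 1, ∫ y, Kf p a μ β v (W β T b u y v) ∂gm n := by
    refine intervalIntegral.continuous_of_dominated_interval (bound := fun _ => B) (fun b => ?_) (fun b => ae_of_all _ fun v hv => ?_)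
      intervalIntegrable_const (ae_of_all _ fun v hv => ?_)
    · rw [Set.uIoc_of_le (by linarith)]
      exact (((hN b).comp_bdd (hC b) hG).integral_cont.mono Set.Ioc_subset_Icc_self).aestronglyMeasurable measurableSet_Ioc
    all_goals rw [Set.uIoc_of_le (by linarith)] at hv
    · exact abs_integral_gm_le fun y => hGB v ⟨hv.1.le, hv.2⟩ _ (hC b y v ⟨hv.1.le, hv.2⟩)
    · exact key _ hG v ⟨hv.1.le, hv.2⟩
  have k1 := key (fun _ z => z ^ 2) (by fun_prop) (s + 1) ⟨by linarith, le_rfl⟩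
  have k2 := key (fun _ z => z ^ 2) (by fun_prop) s ⟨le_rfl, by linarith⟩
  unfold Qf yS
  exact ((k1.sub k2).const_mul _).add (k3.const_mul _)

lemma abs_W_le (hu : ∀ x, ∀ t ∈ Set.Ico 0 T, |u x t| * (T - t) ^ β ≤ C0) (b y : E n) (hs : Real.exp (-s) ≤ T) :
    |W β T b u y s| ≤ C0 := by
  have := hu (b + Real.exp (-s / 2) • y) (T - Real.exp (-s)) ⟨by linarith, by linarith [Real.exp_pos (-s)]⟩
  rw [sub_sub_cancel, ← Real.exp_mul] at this
  rwa [W, abs_mul, abs_of_pos (Real.exp_pos _), mul_comm, show -β * s = -s * β by ring]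

lemma exists_yS_le (hp : 1 < p) (ha : 0 < a) (hβ : β * (p - 1) = 1) (hT : 0 < T) (hu : SolvesU n p a μ T u)
    (hK : ∀ x, ∀ t ∈ Set.Ico 0 T, |u x t| * (T - t) ^ β ≤ C0) {b : E n}
    (hz : Tendsto (yS (W β T b u)) atTop (𝓝 0)) {η : ℝ} (hη : 0 < η) :
    ∃ r S, 0 < r ∧ ∀ b' ∈ Metric.ball b r, ∀ s, S ≤ s → yS (W β T b' u) s ≤ η := by
  have hβ0 := beta_pos hp hβ
  have hCf := Cf_pos (a := a) (μ := μ)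
  have hC0 : 0 ≤ C0 := (by positivity : 0 ≤ |u 0 0| * (T - 0) ^ β).trans' le_rfl |>.trans (hK 0 0 ⟨le_rfl, hT⟩)
  have hc0 : 0 < (p - 1) / (p + 1) := div_pos (by linarith) (by linarith)
  obtain ⟨e0, he0⟩ : ∃ e0, e0 = (p - 1) / (p + 1) * η ^ ((p + 1) / 2) / 27 := ⟨_, rfl⟩
  have he : 0 < e0 := by rw [he0]; positivity
  obtain ⟨ss, hss, H⟩ := exists_energy (μ := μ) hp ha hβ rfl he
  obtain ⟨A, hA⟩ : ∃ A, A = 1 / 4 + 2 * (Cf a μ * C0 ^ (p - 1)) := ⟨_, rfl⟩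
  have hA0 : 0 < A := by rw [hA]; positivity
  obtain ⟨S, hS⟩ := eventually_atTop.1 (hz.eventually_le_const (show 0 < e0 / (2 * A) by positivity))
  obtain ⟨s1, h4, hs1⟩ := ((tendsto_exp_neg.eventually_lt_const hT).and (eventually_ge_atTop (max ss S))).exists
  have hap := fun b => appr_max hp ha hu hβ0.le b (show 0 ≤ s1 by linarith [(le_max_left _ _).trans hs1]) h4 le_rfl
  have hex : ∀ v, s1 ≤ v → Real.exp (-v) < T := fun v hv => (Real.exp_le_exp.2 (neg_le_neg hv)).trans_lt h4
  have hCb : ∀ b y, ∀ v ∈ Set.Icc s1 (s1 + 1), |W β T b u y v| ≤ C0 := fun b y v hv =>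
    abs_W_le hK b y (hex v hv.1).le
  have hcont : Continuous fun b => Qf p a μ β (W β T b u) s1 := by
    refine continuous_Qf hp (fun b => (hap b _).nice) hCb fun y v hv => ?_
    have h1 : Continuous fun x => u x (T - Real.exp (-v)) :=
      (hu.1 _ ⟨by linarith [hex v hv.1], by linarith [Real.exp_pos (-v)]⟩).continuous
    unfold W
    exact (h1.comp (continuous_id.add continuous_const)).const_mul _
  have hQ : Qf p a μ β (W β T b u) s1 < e0 := by
    refine (Qf_le hp ha hβ (hap b _).nice (hCb b) fun v hv => hS v (((le_max_right _ _).trans hs1).trans hv.1)).trans_lt ?_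
    rw [← hA]
    have : A * (e0 / (2 * A)) = e0 / 2 := by field_simp
    linarith
  obtain ⟨r, hr, hball⟩ := Metric.eventually_nhds_iff_ball.1 (hcont.continuousAt.eventually_lt_const hQ)
  refine ⟨r, s1 + 1, hr, fun b' hb' => ?_⟩
  exact (H e0 le_rfl n _ _ _ s1 ((le_max_left _ _).trans hs1) (hap b') (hball b' hb') η hη (by linarith)).y

lemma exists_small_near (hp : 1 < p) (ha : 0 < a) (hβ : β * (p - 1) = 1) (hT : 0 < T) (hu : SolvesU n p a μ T u)
    (hC0 : 0 ≤ C0) (hK : ∀ x, ∀ t ∈ Set.Ico 0 T, |u x t| * (T - t) ^ β ≤ C0) {b : E n}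
    (hz : Tendsto (yS (W β T b u)) atTop (𝓝 0)) {ε : ℝ} (hε : 0 < ε) :
    ∃ r t0, 0 < r ∧ t0 < T ∧ ∀ x ∈ Metric.ball b r, ∀ t, t0 ≤ t → t < T → (T - t) ^ β * |u x t| ≤ ε := by
  obtain ⟨δ, L, hδ, hδ1, hL, H⟩ := exists_pointwise hp ha hβ hu hC0 hK 0 0 (half_pos hε)
  obtain ⟨r, S, hr, hy⟩ := exists_yS_le hp ha hβ hT hu hK hz (show 0 < ε / (2 * (L + 1)) by positivity)
  obtain ⟨q, hq⟩ : ∃ q, q = min (min (1 / 2) (T / 4)) (Real.exp (-S) / 2) := ⟨_, rfl⟩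
  have hq0 : 0 < q := by rw [hq]; have := Real.exp_pos (-S); positivity
  have q1 : q ≤ 1 / 2 := by rw [hq]; exact (min_le_left _ _).trans (min_le_left _ _)
  have q2 : q ≤ T / 4 := by rw [hq]; exact (min_le_left _ _).trans (min_le_right _ _)
  have q3 : q ≤ Real.exp (-S) / 2 := by rw [hq]; exact min_le_right _ _
  refine ⟨r, T - q, hr, by linarith, fun x hx t ht htT => ?_⟩
  have h1 := H x 0 t (by simp) htT (by linarith) (by linarith)
  have h2 : S ≤ -Real.log ((1 + δ) * (T - t)) := by
    have h4 : 0 < T - t := by linarith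
    rw [le_neg, Real.log_le_iff_le_exp (by positivity)]
    nlinarith
  have h3 := hy x hx _ h2
  simp only [smul_zero, add_zero, sub_zero] at h1
  rw [abs_mul, abs_of_pos (Real.rpow_pos_of_pos (by linarith) _)] at h1
  refine h1.trans ?_
  have h4 := mul_le_mul_of_nonneg_left h3 hL
  have h5 : L * (ε / (2 * (L + 1))) ≤ ε / 2 := by
    rw [mul_div_assoc', div_le_div_iff₀ (by positivity) two_pos]; nlinarith
  unfold yS at h4
  linarith

end

section

variable {n : ℕ} {p a μ β T C0 : ℝ} {u : E n → ℝ → ℝ}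

lemma pd_pd_le_of_line {φ : E n → ℝ} (hφ : ContDiff ℝ 2 φ) {h : E n} {i : Fin n} {g g' : ℝ → ℝ} {g'' : ℝ}
    (hg : ∀ τ, HasDerivAt g (g' τ) τ) (hg' : HasDerivAt g' g'' 0)
    (hm : IsLocalMax (fun τ : ℝ => φ (h + τ • bv i) - g τ) 0) : pd i (pd i φ) h ≤ g'' := by
  have hd1 := fun τ => (hasDerivAt_line (hφ.differentiable (by norm_num)) i h τ).fun_sub (hg τ)
  have hd2 := (hasDerivAt_line (differentiable_pd hφ i) i h 0).fun_sub hg'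
  have := deriv_deriv_nonpos_of_isLocalMax (hd1 0).continuousAt hm
  rw [funext fun τ => (hd1 τ).deriv, hd2.deriv] at this
  simp only [zero_smul, add_zero] at this
  linarith

lemma barrier_lt (hp : 1 < p) (hβ : β * (p - 1) = 1) {U : E n → ℝ → ℝ} {C M c r t0 : ℝ}
    (hM : 0 < M) (hc : 0 < c) (hMC : C * M ^ (p - 1) < 3 / 4 * β)
    (hcn : n * (c * (16 * β + 20) * r ^ 2) ≤ 1 / 4)
    (hU : ContinuousOn (fun q : E n × ℝ => U q.1 q.2) (Set.univ ×ˢ Set.Ico t0 T))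
    (hx : ∀ t ∈ Set.Ico t0 T, ContDiff ℝ 2 fun h => U h t)
    (hd : ∀ h, ∀ t ∈ Set.Ico t0 T, ∃ d, HasDerivAt (U h) d t ∧ d ≤ lap n (fun h => U h t) h + C * |U h t| ^ p)
    (h0 : ∀ h, ‖h‖ ≤ r → U h t0 < M * (T - t0 + c * (r ^ 2 - ‖h‖ ^ 2) ^ 2) ^ (-β))
    (hb : ∀ h, ‖h‖ = r → ∀ t ∈ Set.Ico t0 T, U h t < M * (T - t) ^ (-β)) :
    ∀ h, ‖h‖ ≤ r → ∀ t ∈ Set.Ico t0 T, U h t < M * (T - t + c * (r ^ 2 - ‖h‖ ^ 2) ^ 2) ^ (-β) := by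
  have hβ0 := beta_pos hp hβ
  intro h1 hh1 t1 ht1
  by_contra! hge
  obtain ⟨Z, hZ⟩ : ∃ Z : E n × ℝ → ℝ, Z = fun q => U q.1 q.2 - M * (T - q.2 + c * (r ^ 2 - ‖q.1‖ ^ 2) ^ 2) ^ (-β) := ⟨_, rfl⟩
  have hpos : ∀ (h : E n) t, t < T → 0 < T - t + c * (r ^ 2 - ‖h‖ ^ 2) ^ 2 := fun h t ht => by
    have : 0 ≤ c * (r ^ 2 - ‖h‖ ^ 2) ^ 2 := by positivity
    linarith
  have hKc : IsCompact (Metric.closedBall (0 : E n) r ×ˢ Set.Icc t0 t1) := (isCompact_closedBall _ _).prod isCompact_Icc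
  have hZc : ContinuousOn Z (Metric.closedBall (0 : E n) r ×ˢ Set.Icc t0 t1) := by
    rw [hZ]
    refine (hU.mono fun q hq => ⟨trivial, hq.2.1, hq.2.2.trans_lt ht1.2⟩).sub (continuousOn_const.mul ?_)
    refine ContinuousOn.rpow_const (by fun_prop) fun q hq => Or.inl (hpos _ _ (hq.2.2.trans_lt ht1.2)).ne'
  have hS : IsCompact ((Metric.closedBall (0 : E n) r ×ˢ Set.Icc t0 t1) ∩ Z ⁻¹' Set.Ici 0) :=
    hKc.of_isClosed_subset (hZc.preimage_isClosed_of_isClosed hKc.isClosed isClosed_Ici) Set.inter_subset_left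
  obtain ⟨⟨h, t⟩, ⟨⟨hh, htt⟩, hz⟩, hmin⟩ := hS.exists_isMinOn ⟨(h1, t1), ⟨by simpa using hh1, ht1.1, le_rfl⟩, by
    rw [hZ]; simpa using hge⟩ continuous_snd.continuousOn
  simp only at hh htt
  have hlt : ∀ x, ‖x‖ ≤ r → ∀ s, t0 ≤ s → s < t → Z (x, s) < 0 := fun x hx s hs hst => by
    by_contra! h'
    have := hmin (show (x, s) ∈ _ from ⟨⟨by simpa using hx, hs, hst.le.trans htt.2⟩, h'⟩)
    simp only [Set.mem_ofPred_eq] at this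
    linarith
  rw [mem_closedBall_zero_iff] at hh
  have hz' : 0 ≤ Z (h, t) := hz
  have htI : t ∈ Set.Ico t0 T := ⟨htt.1, htt.2.trans_lt ht1.2⟩
  have hT : 0 < T - t := by linarith [htI.2]
  have ht0 : t0 < t := by
    refine htt.1.lt_of_ne fun he => ?_
    have := h0 h hh
    rw [he] at this
    rw [hZ] at hz'
    simp only at hz'; linarith
  have hhr : ‖h‖ < r := by
    refine hh.lt_of_ne fun he => ?_
    have := hb h he t htI
    rw [hZ] at hz'
    simp only [he, sub_self] at hz'
    norm_num at hz'
    linarith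
  have hle : ∀ x, ‖x‖ ≤ r → Z (x, t) ≤ 0 := fun x hx => by
    have hcs : ContinuousOn (fun s => Z (x, s)) (Set.Icc t0 t) :=
      hZc.comp (by fun_prop) fun s hs => ⟨by simpa using hx, hs.1, hs.2.trans htt.2⟩
    have h2 : Tendsto (fun s => Z (x, s)) (𝓝[Set.Ioo t0 t] t) (𝓝 (Z (x, t))) :=
      ((hcs t ⟨htt.1, le_rfl⟩).mono Set.Ioo_subset_Icc_self)
    have : (𝓝[Set.Ioo t0 t] t).NeBot := by rw [nhdsWithin_Ioo_eq_nhdsLT ht0]; infer_instance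
    refine le_of_tendsto h2 ?_
    filter_upwards [self_mem_nhdsWithin] with s hs using (hlt x hx s hs.1.le hs.2).le
  have hz0 : Z (h, t) = 0 := le_antisymm (hle h hh) hz'
  obtain ⟨P0, hP0⟩ : ∃ P0, P0 = T - t + c * (r ^ 2 - ‖h‖ ^ 2) ^ 2 := ⟨_, rfl⟩
  have hP : 0 < P0 := hP0 ▸ hpos h t htI.2
  have hUv : U h t = M * P0 ^ (-β) := by rw [hZ] at hz0; simp only [← hP0] at hz0; linarith
  obtain ⟨d, hd1, hd2⟩ := hd h t htI
  -- time derivative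
  have hvt : HasDerivAt (fun s => M * (T - s + c * (r ^ 2 - ‖h‖ ^ 2) ^ 2) ^ (-β)) (M * (-1 * (-β) * P0 ^ (-β - 1))) t := by
    have := (((hasDerivAt_id t).const_sub T).add_const (c * (r ^ 2 - ‖h‖ ^ 2) ^ 2)).rpow_const (p := -β) (Or.inl (by
      simpa using (hpos h t htI.2).ne'))
    rw [hP0]
    exact this.const_mul M
  have k1 : 0 ≤ d - M * (-1 * (-β) * P0 ^ (-β - 1)) := by
    refine deriv_nonneg_of_max_left ht0 (hd1.fun_sub hvt) fun s hs => ?_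
    have e1 : U h t - M * (T - t + c * (r ^ 2 - ‖h‖ ^ 2) ^ 2) ^ (-β) = 0 := by rw [hZ] at hz0; exact hz0
    rw [e1]
    rcases hs.2.lt_or_eq with h' | h'
    · have := hlt h hh s hs.1 h'
      rw [hZ] at this; exact this.le
    · rw [h', e1]
  -- space derivatives
  have k2 : ∀ i, pd i (pd i fun x => U x t) h ≤ M * (β * P0 ^ (-β - 1) * (c * (16 * β + 20) * r ^ 2)) := fun i => by
    obtain ⟨q, hq⟩ : ∃ q : ℝ → ℝ, q = fun τ => r ^ 2 - (‖h‖ ^ 2 + 2 * τ * h i + τ ^ 2) := ⟨_, rfl⟩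
    have hq1 : ∀ τ, HasDerivAt q (-(2 * h i + 2 * τ)) τ := fun τ => by
      have h1 : HasDerivAt (fun τ : ℝ => 2 * τ * h i) (2 * 1 * h i) τ := ((hasDerivAt_id τ).const_mul 2).mul_const (h i)
      have := ((h1.const_add (‖h‖ ^ 2)).fun_add (hasDerivAt_pow 2 τ)).const_sub (r ^ 2)
      rw [hq]
      simpa using this
    have hq2 : HasDerivAt (fun τ : ℝ => -(2 * h i + 2 * τ)) (-(2 * 1)) 0 :=
      (((hasDerivAt_id (0 : ℝ)).const_mul 2).const_add _).fun_neg
    have hPp : ∀ τ, 0 < T - t + c * q τ ^ 2 := fun τ => by positivity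
    have hP1 : ∀ τ, HasDerivAt (fun τ => T - t + c * q τ ^ 2) (c * (2 * q τ * -(2 * h i + 2 * τ))) τ := fun τ =>
      ((((hq1 τ).fun_pow 2).const_mul c).const_add (T - t)).congr_deriv (by simp)
    have hg : ∀ τ, HasDerivAt (fun τ => M * (T - t + c * q τ ^ 2) ^ (-β))
        (M * (c * (2 * q τ * -(2 * h i + 2 * τ)) * -β * (T - t + c * q τ ^ 2) ^ (-β - 1))) τ := fun τ =>
      ((hP1 τ).rpow_const (Or.inl (hPp τ).ne')).const_mul M
    have hg' := (((((hq1 0).const_mul 2).fun_mul hq2).const_mul c).mul_const (-β)).fun_mul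
      ((hP1 0).rpow_const (p := -β - 1) (Or.inl (hPp 0).ne')) |>.const_mul M
    have hq0 : q 0 = r ^ 2 - ‖h‖ ^ 2 := by rw [hq]; simp
    refine (pd_pd_le_of_line (hx t htI) hg hg' ?_).trans ?_
    · have hct : ContinuousAt (fun τ : ℝ => ‖h + τ • bv i‖) 0 := by fun_prop
      filter_upwards [hct.eventually_lt_const (by simpa using hhr)] with τ hτ
      have e1 := hle _ hτ.le
      rw [hZ] at e1 hz0
      simp only [norm_add_smul_bv_sq] at e1
      have e2 : U h t - M * (T - t + c * q 0 ^ 2) ^ (-β) = 0 := by rw [hq0]; exact hz0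
      simp only [zero_smul, add_zero]
      rw [e2, hq]
      exact e1
    · rw [hq0, ← hP0]
      have hi : h i ^ 2 ≤ r ^ 2 := by
        have := PiLp.norm_apply_le h i
        rw [← sq_abs]
        exact pow_le_pow_left₀ (abs_nonneg _) (this.trans hh) 2
      obtain ⟨Q, hQ⟩ : ∃ Q, Q = r ^ 2 - ‖h‖ ^ 2 := ⟨_, rfl⟩
      rw [← hQ] at hP0 ⊢
      have hQr : Q ≤ r ^ 2 := by rw [hQ]; linarith [sq_nonneg ‖h‖]
      have hcQ : c * Q ^ 2 ≤ P0 := by linarith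
      obtain ⟨X, hX⟩ : ∃ X, X = P0 ^ (-β - 1 - 1) := ⟨_, rfl⟩
      have hX0 : 0 < X := by rw [hX]; positivity
      have eX : P0 ^ (-β - 1) = X * P0 := by
        rw [hX, ← Real.rpow_add_one hP.ne']; congr 1; ring
      rw [eX, ← hX]
      refine mul_le_mul_of_nonneg_left ?_ hM.le
      have f1 : c * Q ^ 2 * (h i ^ 2) ≤ P0 * r ^ 2 := by gcongr
      have f2 := mul_le_mul_of_nonneg_left f1 (by positivity : 0 ≤ 16 * (β * (β + 1)) * c * X)
      have f3 := mul_le_mul_of_nonneg_left hQr (by positivity : 0 ≤ 4 * β * c * X * P0)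
      have f4 : 0 ≤ 8 * β * c * X * P0 * h i ^ 2 := by positivity
      linarith
  have k3 : lap n (fun x => U x t) h ≤ ∑ _i : Fin n, M * (β * P0 ^ (-β - 1) * (c * (16 * β + 20) * r ^ 2)) :=
    Finset.sum_le_sum fun i _ => k2 i
  rw [Finset.sum_const, Finset.card_univ, Fintype.card_fin, nsmul_eq_mul] at k3
  have hPP : 0 < P0 ^ (-β - 1) := by positivity
  have k4 : C * |U h t| ^ p < M * (3 / 4 * β * P0 ^ (-β - 1)) := by
    rw [hUv, abs_of_pos (by positivity), Real.mul_rpow hM.le (by positivity), ← Real.rpow_mul hP.le,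
      show -β * p = -β - 1 by linarith]
    have : M ^ p = M ^ (p - 1) * M := by rw [← Real.rpow_add_one hM.ne']; congr 1; ring
    rw [this]
    have := mul_lt_mul_of_pos_right hMC (mul_pos hM hPP)
    linarith
  have k5 := mul_le_mul_of_nonneg_left hcn (by positivity : 0 ≤ M * (β * P0 ^ (-β - 1)))
  linarith

theorem not_blowupPt_of_tendsto (hp : 1 < p) (ha : 0 < a) (hβ : β * (p - 1) = 1) (hT : 0 < T) (hu : SolvesU n p a μ T u)
    (hC0 : 0 ≤ C0) (hK : ∀ x, ∀ t ∈ Set.Ico 0 T, |u x t| * (T - t) ^ β ≤ C0) {b : E n}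
    (hz : Tendsto (yS (W β T b u)) atTop (𝓝 0)) : ¬ BlowupPt n T u b := by
  have hβ0 := beta_pos hp hβ
  have hCf := Cf_pos (a := a) (μ := μ)
  obtain ⟨M, hM, hMC⟩ : ∃ M, 0 < M ∧ Cf a μ * M ^ (p - 1) < 3 / 4 * β := by
    have t1 : Tendsto (fun M : ℝ => Cf a μ * M ^ (p - 1)) (𝓝 0) (𝓝 (Cf a μ * 0 ^ (p - 1))) :=
      ((Real.continuousAt_rpow_const 0 (p - 1) (Or.inr (by linarith))).tendsto).const_mul _
    rw [Real.zero_rpow (by linarith), mul_zero] at t1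
    have t2 := (t1.eventually_lt_const (show 0 < 3 / 4 * β by positivity)).filter_mono
      (nhdsWithin_le_nhds (s := Set.Ioi 0))
    obtain ⟨M, h1, h2⟩ := (t2.and self_mem_nhdsWithin).exists
    exact ⟨M, h2, h1⟩
  obtain ⟨ε, hε⟩ : ∃ ε, ε = M * 2 ^ (-β) / 2 := ⟨_, rfl⟩
  have h2β : (0 : ℝ) < 2 ^ (-β) := by positivity
  have h2β1 : (2 : ℝ) ^ (-β) ≤ 1 := Real.rpow_le_one_of_one_le_of_nonpos (by norm_num) (by linarith)
  have hε0 : 0 < ε := by rw [hε]; positivity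
  obtain ⟨r0, t', hr0, ht', hs'⟩ := exists_small_near hp ha hβ hT hu hC0 hK hz hε0
  obtain ⟨r, hr⟩ : ∃ r, r = r0 / 2 := ⟨_, rfl⟩
  obtain ⟨t0, ht0⟩ : ∃ t0, t0 = max t' (T / 2) := ⟨_, rfl⟩
  have hr1 : 0 < r := by linarith
  have h0T : t0 < T := by rw [ht0]; exact max_lt ht' (by linarith)
  have h00 : 0 < t0 := by rw [ht0]; exact (half_pos hT).trans_le (le_max_right _ _)
  have hs : ∀ h : E n, ‖h‖ ≤ r → ∀ t ∈ Set.Ico t0 T, |u (b + h) t| ≤ ε * (T - t) ^ (-β) := fun h hh t ht => by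
    have h3 : 0 < T - t := by linarith [ht.2]
    have := hs' (b + h) (by simp only [mem_ball_iff_norm, add_sub_cancel_left]; linarith) t
      ((le_max_left _ _).trans (ht0 ▸ ht.1)) ht.2
    rwa [mul_comm, ← le_div_iff₀ (by positivity), div_eq_mul_inv, ← Real.rpow_neg h3.le] at this
  obtain ⟨c, hc⟩ : ∃ c, c = min ((T - t0) / r ^ 4) (1 / (4 * ((n + 1) * ((16 * β + 20) * r ^ 2)))) := ⟨_, rfl⟩
  have hT0 : 0 < T - t0 := by linarith
  have hc0 : 0 < c := by rw [hc]; positivity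
  have hc1 : c * r ^ 4 ≤ T - t0 := by
    rw [← le_div_iff₀ (by positivity), hc]; exact min_le_left _ _
  have hc2 : n * (c * (16 * β + 20) * r ^ 2) ≤ 1 / 4 := by
    have : c ≤ 1 / (4 * ((n + 1) * ((16 * β + 20) * r ^ 2))) := by rw [hc]; exact min_le_right _ _
    rw [le_div_iff₀ (by positivity)] at this
    have : 0 ≤ c * ((16 * β + 20) * r ^ 2) := by positivity
    linarith
  have main : ∀ σ : ℝ, |σ| = 1 → ∀ h : E n, ‖h‖ ≤ r → ∀ t ∈ Set.Ico t0 T,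
      σ * u (b + h) t < M * (T - t + c * (r ^ 2 - ‖h‖ ^ 2) ^ 2) ^ (-β) := fun σ hσ => by
    have hle : ∀ h : E n, ‖h‖ ≤ r → ∀ t ∈ Set.Ico t0 T, σ * u (b + h) t ≤ ε * (T - t) ^ (-β) := fun h hh t ht =>
      (le_abs_self _).trans (by rw [abs_mul, hσ, one_mul]; exact hs h hh t ht)
    have hmem : ∀ t ∈ Set.Ico t0 T, t ∈ Set.Ico 0 T := fun t ht => ⟨h00.le.trans ht.1, ht.2⟩
    have hcd : ∀ t ∈ Set.Ico t0 T, ContDiff ℝ 2 fun h : E n => u (b + h) t := fun t ht =>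
      (hu.1 t (hmem t ht)).comp (contDiff_const.add contDiff_id)
    refine barrier_lt (U := fun h t => σ * u (b + h) t) (C := Cf a μ) hp hβ hM hc0 hMC hc2 ?_ (fun t ht => ?_)
      (fun h t ht => ?_) (fun h hh => ?_) (fun h hh t ht => ?_)
    · refine ((continuousOn_of_solvesU hp ha hu).comp (f := fun q : E n × ℝ => (b + q.1, q.2)) (by fun_prop)
        fun q hq => ⟨trivial, h00.trans_le hq.2.1, hq.2.2⟩).const_mul σ
    · exact contDiff_const.mul (hcd t ht)
    · refine ⟨_, ((hu.2.1 (b + h) t (hmem t ht)).hasDerivAt).const_mul σ, ?_⟩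
      rw [hu.2.2.1 _ _ (hmem t ht), lap_const_mul (hcd t ht), lap_comp_add (fun x => u x t), abs_mul, hσ, one_mul]
      have h1 := abs_ff_le (μ := μ) hp ha (u (b + h) t)
      have h2 : σ * ff p a μ (u (b + h) t) ≤ Cf a μ * |u (b + h) t| ^ p :=
        (le_abs_self _).trans (by rw [abs_mul, hσ, one_mul]; exact h1)
      unfold ff at h2
      linarith
    · refine (hle h hh t0 ⟨le_rfl, h0T⟩).trans_lt ?_
      have h3 : c * (r ^ 2 - ‖h‖ ^ 2) ^ 2 ≤ c * r ^ 4 := by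
        rw [show r ^ 4 = (r ^ 2) ^ 2 by ring]
        have := pow_le_pow_left₀ (norm_nonneg h) hh 2
        gcongr
        linarith [sq_nonneg ‖h‖]
      have h4 : (2 * (T - t0)) ^ (-β) ≤ (T - t0 + c * (r ^ 2 - ‖h‖ ^ 2) ^ 2) ^ (-β) :=
        Real.rpow_le_rpow_of_nonpos (by positivity) (by linarith) (by linarith)
      rw [Real.mul_rpow two_pos.le hT0.le] at h4
      have h5 := mul_le_mul_of_nonneg_left h4 hM.le
      have h6 : 0 < ε * (T - t0) ^ (-β) := by positivity
      have h7 : M * (2 ^ (-β) * (T - t0) ^ (-β)) = 2 * (ε * (T - t0) ^ (-β)) := by rw [hε]; ring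
      linarith
    · refine (hle h hh.le t ht).trans_lt ?_
      have h3 : 0 < T - t := by linarith [ht.2]
      have h4 : ε < M := by rw [hε]; nlinarith
      exact mul_lt_mul_of_pos_right h4 (by positivity)
  rintro ⟨x, t, hmem, hxb, htT, hinf⟩
  obtain ⟨B, hB⟩ : ∃ B, B = M * (c * (r ^ 2 / 2) ^ 2) ^ (-β) := ⟨_, rfl⟩
  obtain ⟨k, h1, h2, h3⟩ := ((hinf.eventually_gt_atTop B).and ((htT.eventually_const_lt h0T).and
    (hxb.eventually (Metric.ball_mem_nhds b (half_pos hr1))))).exists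
  have h4 : ‖x k - b‖ ≤ r / 2 := (mem_ball_iff_norm.1 h3).le
  have m := fun σ hσ => main σ hσ (x k - b) (by linarith) (t k) ⟨h2.le, (hmem k).2⟩
  simp only [add_sub_cancel] at m
  have h5 : M * (T - t k + c * (r ^ 2 - ‖x k - b‖ ^ 2) ^ 2) ^ (-β) ≤ B := by
    rw [hB]
    refine mul_le_mul_of_nonneg_left (Real.rpow_le_rpow_of_nonpos (by positivity) ?_ (by linarith)) hM.le
    have h6 := pow_le_pow_left₀ (norm_nonneg _) h4 2
    have h7 : c * (r ^ 2 / 2) ^ 2 ≤ c * (r ^ 2 - ‖x k - b‖ ^ 2) ^ 2 := by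
      gcongr
      nlinarith
    linarith [(hmem k).2]
  have m1 := m 1 (by simp)
  have m2 := m (-1) (by simp)
  have : |u (x k) (t k)| ≤ B := abs_le.2 ⟨by linarith, by linarith⟩
  linarith

end

end GK

/-- Blow-up limit at a blow-up point. -/
theorem stmt2 (n : ℕ) (hn : 1 ≤ n) (p : ℝ) (hp : 1 < p)
    (hpS : 3 ≤ n → p < ((n : ℝ) + 2) / ((n : ℝ) - 2)) (a : ℝ) (ha : 0 < a) (μ : ℝ)
    (κ : ℝ) (hκ : κ = (p - 1) ^ (-(1 / (p - 1))))
    (T : ℝ) (hT : 0 < T) (u : EuclideanSpace ℝ (Fin n) → ℝ → ℝ)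
    (hu : SolvesU n p a μ T u)
    (b : EuclideanSpace ℝ (Fin n)) (hb : BlowupPt n T u b) :
    ∃ ε : ℝ, (ε = 1 ∨ ε = -1) ∧
      Tendsto (fun s => ∫ y, (wSelf n p T u b y s - ε * κ) ^ 2 * rho n y)
        atTop (nhds 0) ∧
      ∀ K : Set (EuclideanSpace ℝ (Fin n)), IsCompact K →
        TendstoUniformlyOn
          (fun t y => (T - t) ^ (1 / (p - 1)) * u (b + Real.sqrt (T - t) • y) t)
          (fun _ => ε * κ) (nhdsWithin T (Set.Iio T)) K := by
  have hp1 : p - 1 ≠ 0 := by linarith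
  obtain ⟨β, hβd⟩ : ∃ β, β = 1 / (p - 1) := ⟨_, rfl⟩
  have hβ : β * (p - 1) = 1 := by rw [hβd]; field_simp
  have hβ0 := GK.beta_pos hp hβ
  have hsub : (n : ℝ) < 2 + 4 * β := by
    rcases le_or_gt 3 n with h3 | h3
    · have h3' : (3 : ℝ) ≤ n := by exact_mod_cast h3
      have h4 := (lt_div_iff₀ (by linarith)).1 (hpS h3)
      nlinarith
    · have : (n : ℝ) ≤ 2 := by exact_mod_cast Nat.le_of_lt_succ h3
      linarith
  have hκ0 := (GK.kappa_facts hp hβ hκ).1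
  obtain ⟨K0, hK⟩ := GK.exists_typeI hp ha hβ hsub hT hu
  have hK0 : 0 ≤ K0 := le_trans (mul_nonneg (abs_nonneg _) (Real.rpow_nonneg (by linarith) _)) (hK 0 0 ⟨le_rfl, hT⟩)
  obtain ⟨s0, C, hs0, -, hs0T, H⟩ := GK.exists_unif hp ha hβ hT hu
  obtain ⟨z, hz, -, hz2⟩ := GK.exists_limit hp ha hβ hsub hκ
    (GK.appr_max hp ha hu hβ0.le b hs0 (by linarith) le_rfl) (H b T ⟨by linarith, le_rfl⟩).D
    fun y s hs => GK.abs_W_le hK b y ((Real.exp_le_exp.2 (neg_le_neg hs)).trans (by linarith))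
  have hz0 : z ≠ 0 := fun h0 => GK.not_blowupPt_of_tendsto hp ha hβ hT hu hK0 hK
    (by simp only [h0, sub_zero] at hz2; exact hz2) hb
  obtain ⟨ε, hε, rfl⟩ : ∃ ε : ℝ, (ε = 1 ∨ ε = -1) ∧ z = ε * κ := by
    rcases hz with h | h | h
    · exact absurd h hz0
    · exact ⟨1, .inl rfl, by rw [h, one_mul]⟩
    · exact ⟨-1, .inr rfl, by rw [h, neg_one_mul]⟩
  refine ⟨ε, hε, hz2.congr fun s => ?_, fun K hKc => ?_⟩
  · rw [GK.integral_gm]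
    refine integral_congr_ae (.of_forall fun y => ?_)
    simp only [GK.W, wSelf, hβd]
    rw [show -(1 / (p - 1)) * s = -s / (p - 1) by ring]
  · obtain ⟨R, hR⟩ := hKc.isBounded.exists_norm_le
    rw [Metric.tendstoUniformlyOn_iff]
    intro e he
    obtain ⟨δ, L, hδ, -, -, hL⟩ := GK.exists_pointwise hp ha hβ hu hK0 hK (ε * κ) R (half_pos he)
    have hT0 : Tendsto (fun t => T - t) (𝓝[<] T) (𝓝[>] 0) := by
      refine tendsto_nhdsWithin_iff.2 ⟨?_, ?_⟩
      · have : Tendsto (fun t => T - t) (𝓝 T) (𝓝 (T - T)) := tendsto_const_nhds.sub tendsto_id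
        rw [sub_self] at this
        exact this.mono_left nhdsWithin_le_nhds
      · filter_upwards [self_mem_nhdsWithin] with t ht using sub_pos.2 (Set.mem_Iio.1 ht)
    have hs : Tendsto (fun t => -Real.log ((1 + δ) * (T - t))) (𝓝[<] T) atTop := by
      refine tendsto_neg_atBot_atTop.comp (Real.tendsto_log_nhdsGT_zero.comp ?_)
      simpa using TendstoNhdsWithinIoi.const_mul (c := (0 : ℝ)) (show 0 < 1 + δ by linarith) hT0
    have h0 := (hz2.comp hs).const_mul L
    rw [mul_zero] at h0
    have hT1 := hT0.mono_right nhdsWithin_le_nhds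
    filter_upwards [self_mem_nhdsWithin, h0.eventually_lt_const (half_pos he),
      hT1.eventually_lt_const (show (0 : ℝ) < 1 / 2 by norm_num), hT1.eventually_lt_const (half_pos hT)]
      with t ht h1 h2 h3 y hy
    have := hL b y t (hR y hy) ht h2.le (by linarith)
    rw [dist_comm, Real.dist_eq, ← hβd]
    simp only [Function.comp_apply] at h1
    linarith
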